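/- Let d ≥ 3 be an integer and let u be a classical finite-energy free Coulomb wave on ℝ^d with energy E. Let ℓ : (0,∞) → (0,∞) satisfy lim_{t→+∞} ℓ(t)/ln t = 0. Then lim_{t→+∞} ( sup_{r ≥ 0} ∫_{r < |x| < r+ℓ(t)} e(x,t) dx ) = 0, where e(x,t) := ½|∇ₓu(x,t)|² + ½|∂ₜu(x,t)|² + |u(x,t)|²/(2|x|) is the energy density. -/

import Mathlib

open MeasureTheory Filter

/-- The Laplacian of `u : ℝ^d → ℝ`, as the sum of second derivatives in the
coordinate directions. -/
noncomputable def lap {d : ℕ} (u : EuclideanSpace ℝ (Fin d) → ℝ)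
    (x : EuclideanSpace ℝ (Fin d)) : ℝ :=
  ∑ i : Fin d, iteratedFDeriv ℝ 2 u x ![EuclideanSpace.single i 1, EuclideanSpace.single i 1]

/-- The energy density `e(x,t) = ½|∇ₓu|² + ½|∂ₜu|² + |u|²/(2|x|)` of the free
Coulomb wave equation. -/
noncomputable def eDenFree {d : ℕ} (u : EuclideanSpace ℝ (Fin d) → ℝ → ℝ)
    (x : EuclideanSpace ℝ (Fin d)) (t : ℝ) : ℝ :=
  (1 / 2) * ‖gradient (fun y => u y t) x‖ ^ 2
    + (1 / 2) * (deriv (u x) t) ^ 2 + (u x t) ^ 2 / (2 * ‖x‖)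

/-- `u` is a classical finite-energy free Coulomb wave with (conserved)
energy `E`: it is continuous on `ℝ^d × ℝ`, `C²` on `(ℝ^d∖{0}) × ℝ`, solves
`∂ₜ²u - Δu + u/|x| = 0` away from `x = 0`, and its total energy equals `E`
at every time. -/
def IsFreeCoulombWave {d : ℕ} (u : EuclideanSpace ℝ (Fin d) → ℝ → ℝ) (E : ℝ) : Prop :=
  Continuous (fun q : EuclideanSpace ℝ (Fin d) × ℝ => u q.1 q.2) ∧
  ContDiffOn ℝ 2 (fun q : EuclideanSpace ℝ (Fin d) × ℝ => u q.1 q.2)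
    ({(0 : EuclideanSpace ℝ (Fin d))}ᶜ ×ˢ Set.univ) ∧
  (∀ x : EuclideanSpace ℝ (Fin d), x ≠ 0 → ∀ t : ℝ,
    deriv (deriv (u x)) t - lap (fun y => u y t) x + u x t / ‖x‖ = 0) ∧
  (∀ t : ℝ, Integrable (fun x => eDenFree u x t)) ∧
  (∀ t : ℝ, ∫ x, eDenFree u x t = E)

namespace CoulombWave

open Set
open scoped Topology RealInnerProductSpace
set_option linter.unusedSectionVars false

/-- Physical space. -/
abbrev V (d : ℕ) := EuclideanSpace ℝ (Fin d)

/-- The punctured space-time `(ℝ^d ∖ {0}) × ℝ`. -/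
def Om (d : ℕ) : Set (V d × ℝ) := {(0 : V d)}ᶜ ×ˢ univ

/-- The time derivative of a function on space-time. -/
noncomputable def D {d : ℕ} (u : V d → ℝ → ℝ) : V d → ℝ → ℝ := fun x t => deriv (u x) t

/-- The spatial gradient of a function on space-time. -/
noncomputable def gr {d : ℕ} (u : V d → ℝ → ℝ) (x : V d) (t : ℝ) : V d :=
  gradient (fun y => u y t) x

/-- The spatial Hessian of a function on space-time. -/
noncomputable def hs {d : ℕ} (u : V d → ℝ → ℝ) (x : V d) (t : ℝ) : V d →L[ℝ] V d :=
  fderiv ℝ (fun y => gr u y t) x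

/-- The divergence of a vector field. -/
noncomputable def dvg {d : ℕ} (f : V d → V d) (x : V d) : ℝ :=
  ∑ i : Fin d, (fderiv ℝ f x (EuclideanSpace.single i 1)) i

/-- Joint `C^n` regularity on the punctured space-time. -/
def CD {d : ℕ} {F : Type*} [NormedAddCommGroup F] [NormedSpace ℝ F] (n : ℕ) (u : V d → ℝ → F) :
    Prop :=
  ContDiffOn ℝ n (fun q : V d × ℝ => u q.1 q.2) (Om d)

section calculus

variable {d : ℕ} {u : V d → ℝ → ℝ} {x : V d} {t : ℝ}

lemma isOpen_Om : IsOpen (Om d) := isOpen_compl_singleton.prod isOpen_univ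

lemma mem_Om (hx : x ≠ 0) : (x, t) ∈ Om d := ⟨hx, mem_univ _⟩

lemma Om_mem_nhds (hx : x ≠ 0) : Om d ∈ 𝓝 (x, t) := isOpen_Om.mem_nhds (mem_Om hx)

lemma CD.at {F : Type*} [NormedAddCommGroup F] [NormedSpace ℝ F] {n : ℕ} {u : V d → ℝ → F}
    (h : CD n u) (hx : x ≠ 0) :
    ContDiffAt ℝ n (fun q : V d × ℝ => u q.1 q.2) (x, t) :=
  h.contDiffAt (Om_mem_nhds hx)

lemma CD.mono {F : Type*} [NormedAddCommGroup F] [NormedSpace ℝ F] {n m : ℕ} {u : V d → ℝ → F}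
    (h : CD n u) (hm : m ≤ n) : CD m u :=
  ContDiffOn.of_le h (by exact_mod_cast hm)

lemma CD.congr {F : Type*} [NormedAddCommGroup F] [NormedSpace ℝ F] {n : ℕ} {u v : V d → ℝ → F}
    (h : CD n u) (huv : ∀ x t, x ≠ 0 → v x t = u x t) : CD n v :=
  ContDiffOn.congr h fun q hq => huv q.1 q.2 hq.1

lemma CD.contOn {F : Type*} [NormedAddCommGroup F] [NormedSpace ℝ F] {n : ℕ} {u : V d → ℝ → F}
    (h : CD n u) : ContinuousOn (fun q : V d × ℝ => u q.1 q.2) (Om d) :=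
  ContDiffOn.continuousOn h

lemma CD.hasFDerivAt {F : Type*} [NormedAddCommGroup F] [NormedSpace ℝ F] {n : ℕ}
    {u : V d → ℝ → F} (h : CD n u) (hn : 1 ≤ n) (hx : x ≠ 0) :
    HasFDerivAt (fun q : V d × ℝ => u q.1 q.2)
      (fderiv ℝ (fun q : V d × ℝ => u q.1 q.2) (x, t)) (x, t) :=
  ((h.at hx).differentiableAt (by exact_mod_cast (by omega : n ≠ 0))).hasFDerivAt

lemma CD.hasFDerivAt_space {F : Type*} [NormedAddCommGroup F] [NormedSpace ℝ F] {n : ℕ}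
    {u : V d → ℝ → F} (h : CD n u) (hn : 1 ≤ n) (hx : x ≠ 0) :
    HasFDerivAt (fun y => u y t)
      ((fderiv ℝ (fun q : V d × ℝ => u q.1 q.2) (x, t)).comp (.inl ℝ (V d) ℝ)) x :=
  (h.hasFDerivAt (t := t) hn hx).comp (f := fun y : V d => (y, t)) x (hasFDerivAt_prodMk_left x t)

lemma CD.hasDerivAt_time {F : Type*} [NormedAddCommGroup F] [NormedSpace ℝ F] {n : ℕ}
    {u : V d → ℝ → F} (h : CD n u) (hn : 1 ≤ n) (hx : x ≠ 0) :
    HasDerivAt (fun s => u x s) (fderiv ℝ (fun q : V d × ℝ => u q.1 q.2) (x, t) (0, 1)) t := by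
  have := (h.hasFDerivAt (t := t) hn hx).comp (f := fun s : ℝ => (x, s)) t
    (hasFDerivAt_prodMk_right x t)
  exact this.hasDerivAt.congr_deriv (by simp)

lemma CD.hasDerivAt (h : CD 1 u) (hx : x ≠ 0) : HasDerivAt (u x) (D u x t) t :=
  (h.hasDerivAt_time le_rfl hx).differentiableAt.hasDerivAt

lemma CD.inner_gr (h : CD 1 u) (hx : x ≠ 0) (v : V d) :
    ⟪gr u x t, v⟫ = fderiv ℝ (fun q : V d × ℝ => u q.1 q.2) (x, t) (v, 0) := by
  rw [gr, inner_gradient_left, (h.hasFDerivAt_space le_rfl hx).fderiv]; rfl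

lemma CD.hasFDerivAt_gr (h : CD 1 u) (hx : x ≠ 0) :
    HasFDerivAt (fun y => u y t) (innerSL ℝ (gr u x t)) x := by
  have := h.hasFDerivAt_space (t := t) le_rfl hx
  refine this.congr_fderiv ?_
  ext v
  simpa using (h.inner_gr hx v).symm

lemma CD.D_eq (h : CD 1 u) (hx : x ≠ 0) :
    D u x t = fderiv ℝ (fun q : V d × ℝ => u q.1 q.2) (x, t) (0, 1) :=
  (h.hasDerivAt_time le_rfl hx).deriv

lemma gr_eq_toDual (h : CD 1 u) (hx : x ≠ 0) : gr u x t = (InnerProductSpace.toDual ℝ (V d)).symm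
    ((fderiv ℝ (fun q : V d × ℝ => u q.1 q.2) (x, t)).comp (.inl ℝ (V d) ℝ)) := by
  rw [gr, gradient, (h.hasFDerivAt_space le_rfl hx).fderiv]

lemma CD.cfderiv {F : Type*} [NormedAddCommGroup F] [NormedSpace ℝ F] {n : ℕ} {u : V d → ℝ → F}
    (h : CD (n + 1) u) :
    CD n (fun x t => fderiv ℝ (fun q : V d × ℝ => u q.1 q.2) (x, t)) :=
  ContDiffOn.fderiv_of_isOpen h isOpen_Om (by norm_cast)

lemma CD.cD {n : ℕ} (h : CD (n + 1) u) : CD n (D u) := by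
  refine CD.congr (u := fun x t => fderiv ℝ (fun q : V d × ℝ => u q.1 q.2) (x, t) (0, 1))
    ?_ fun x t hx => (h.mono (by omega)).D_eq hx
  exact ContDiffOn.clm_apply h.cfderiv contDiffOn_const

lemma CD.cgr {n : ℕ} (h : CD (n + 1) u) : CD n (gr u) := by
  refine CD.congr (u := fun x t => (InnerProductSpace.toDual ℝ (V d)).symm
    ((fderiv ℝ (fun q : V d × ℝ => u q.1 q.2) (x, t)).comp (.inl ℝ (V d) ℝ)))
    ?_ fun x t hx => gr_eq_toDual (h.mono (by omega)) hx
  have := ContDiffOn.clm_comp h.cfderiv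
    (contDiffOn_const (c := ContinuousLinearMap.inl ℝ (V d) ℝ))
  exact ((InnerProductSpace.toDual ℝ (V d)).symm.contDiff.comp_contDiffOn this :)

lemma CD.hasFDerivAt_hs (h : CD 2 u) (hx : x ≠ 0) :
    HasFDerivAt (fun y => gr u y t) (hs u x t) x :=
  (h.cgr.hasFDerivAt_space (t := t) le_rfl hx).differentiableAt.hasFDerivAt

lemma CD.symm2 (h : CD 2 u) (hx : x ≠ 0) (v w : V d × ℝ) :
    fderiv ℝ (fderiv ℝ (fun q : V d × ℝ => u q.1 q.2)) (x, t) v w =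
    fderiv ℝ (fderiv ℝ (fun q : V d × ℝ => u q.1 q.2)) (x, t) w v :=
  ((h.at hx).isSymmSndFDerivAt (by simp)) v w

lemma CD.inner_hs (h : CD 2 u) (hx : x ≠ 0) (v w : V d) :
    ⟪hs u x t v, w⟫ =
      fderiv ℝ (fderiv ℝ (fun q : V d × ℝ => u q.1 q.2)) (x, t) (v, 0) (w, 0) := by
  have h1 : HasFDerivAt (fun y => ⟪gr u y t, w⟫)
      ((innerSL ℝ w).comp (hs u x t)) x := by
    refine ((h.hasFDerivAt_hs (t := t) hx).inner ℝ (hasFDerivAt_const w x)).congr_fderiv ?_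
    ext v; simp [fderivInnerCLM_apply, real_inner_comm]
  have h2 := (h.cfderiv.hasFDerivAt_space (t := t) le_rfl hx).clm_apply
    (hasFDerivAt_const ((w, 0) : V d × ℝ) x)
  have h3 : (fun y => ⟪gr u y t, w⟫) =ᶠ[𝓝 x]
      fun y => fderiv ℝ (fun q : V d × ℝ => u q.1 q.2) (y, t) (w, 0) := by
    filter_upwards [isOpen_compl_singleton.mem_nhds hx] with y hy
    exact (h.mono one_le_two).inner_gr hy w
  have h4 := h1.unique (h2.congr_of_eventuallyEq h3)
  have := congrArg (fun L => L v) h4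
  simp only [ContinuousLinearMap.comp_apply, innerSL_apply_apply] at this
  rw [real_inner_comm, this]
  simp

lemma CD.hs_symm (h : CD 2 u) (hx : x ≠ 0) (v w : V d) : ⟪hs u x t v, w⟫ = ⟪hs u x t w, v⟫ := by
  rw [h.inner_hs hx, h.inner_hs hx, h.symm2 hx]

lemma CD.inner_gr_D (h : CD 2 u) (hx : x ≠ 0) (w : V d) :
    ⟪gr (D u) x t, w⟫ =
     fderiv ℝ (fderiv ℝ (fun q : V d × ℝ => u q.1 q.2)) (x, t) (0, 1) (w, 0) := by
    rw [gr, inner_gradient_left, h.symm2 hx]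
    have h2 := (h.cfderiv.hasFDerivAt_space (t := t) le_rfl hx).clm_apply
      (hasFDerivAt_const ((0, 1) : V d × ℝ) x)
    have h3 : (fun y => D u y t) =ᶠ[𝓝 x]
        fun y => fderiv ℝ (fun q : V d × ℝ => u q.1 q.2) (y, t) (0, 1) := by
      filter_upwards [isOpen_compl_singleton.mem_nhds hx] with y hy
      exact (h.mono one_le_two).D_eq hy
    rw [(h2.congr_of_eventuallyEq h3).fderiv]
    simp

lemma CD.hasDerivAt_gr (h : CD 2 u) (hx : x ≠ 0) :
    HasDerivAt (fun s => gr u x s) (gr (D u) x t) t := by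
  have hg := (h.cgr.hasDerivAt_time (t := t) le_rfl hx).differentiableAt.hasDerivAt
  refine hg.congr_deriv ?_
  refine ext_inner_right ℝ fun w => ?_
  have h1 : HasDerivAt (fun s => ⟪gr u x s, w⟫)
      ⟪deriv (fun s => gr u x s) t, w⟫ t := by
    simpa using hg.inner ℝ (hasDerivAt_const t w)
  have h2 := (h.cfderiv.hasDerivAt_time (t := t) le_rfl hx).clm_apply
    (hasDerivAt_const t ((w, 0) : V d × ℝ))
  have h3 : (fun s => ⟪gr u x s, w⟫) =
      fun s => fderiv ℝ (fun q : V d × ℝ => u q.1 q.2) (x, s) (w, 0) := by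
    ext s
    exact (h.mono one_le_two).inner_gr hx w
  rw [h3] at h1
  have h4 := h1.unique h2
  rw [h4, h.inner_gr_D hx]
  simp
lemma CD.lap_eq (h : CD 2 u) (hx : x ≠ 0) :
    lap (fun y => u y t) x = ∑ i : Fin d, (hs u x t (EuclideanSpace.single i 1)) i := by
  unfold lap
  refine Finset.sum_congr rfl fun i _ => ?_
  have e1 : (hs u x t (EuclideanSpace.single i 1)) i =
      ⟪hs u x t (EuclideanSpace.single i 1), EuclideanSpace.single i 1⟫ := by
    simp [EuclideanSpace.inner_single_right]
  rw [e1, iteratedFDeriv_two_apply]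
  have h1 : HasFDerivAt (fun y => ⟪gr u y t, EuclideanSpace.single i (1 : ℝ)⟫)
      ((innerSL ℝ (EuclideanSpace.single i (1 : ℝ))).comp (hs u x t)) x := by
    refine ((h.hasFDerivAt_hs (t := t) hx).inner ℝ (hasFDerivAt_const (EuclideanSpace.single i (1 : ℝ)) x)).congr_fderiv ?_
    ext v; simp [fderivInnerCLM_apply, real_inner_comm]
  have h2 : (fun y => fderiv ℝ (fun y => u y t) y) =ᶠ[𝓝 x]
      fun y => innerSL ℝ (gr u y t) := by
    filter_upwards [isOpen_compl_singleton.mem_nhds hx] with y hy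
    exact ((h.mono one_le_two).hasFDerivAt_gr hy).fderiv
  have h3 : HasFDerivAt (fun y => innerSL ℝ (gr u y t))
      ((innerSL ℝ (E := V d)).comp (hs u x t)) x :=
    (innerSL ℝ (E := V d)).hasFDerivAt.comp x (h.hasFDerivAt_hs (t := t) hx)
  rw [h2.fderiv_eq, h3.fderiv]
  simp

/-- Divergence of `g₁ ∇u + g₂ x`. -/
lemma dvg_add_smul {f₁ f₂ : V d → ℝ} {X₁ X₂ : V d → V d} {g₁ g₂ : V d} {L₁ L₂ : V d →L[ℝ] V d}
    (hf₁ : HasFDerivAt f₁ (innerSL ℝ g₁) x) (hX₁ : HasFDerivAt X₁ L₁ x)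
    (hf₂ : HasFDerivAt f₂ (innerSL ℝ g₂) x) (hX₂ : HasFDerivAt X₂ L₂ x) :
    dvg (fun y => f₁ y • X₁ y + f₂ y • X₂ y) x =
      (⟪g₁, X₁ x⟫ + f₁ x * ∑ i : Fin d, (L₁ (EuclideanSpace.single i 1)) i) +
      (⟪g₂, X₂ x⟫ + f₂ x * ∑ i : Fin d, (L₂ (EuclideanSpace.single i 1)) i) := by
  rw [dvg, ((hf₁.fun_smul hX₁).fun_add (hf₂.fun_smul hX₂)).fderiv]
  simp only [Finset.mul_sum, PiLp.inner_apply, ← Finset.sum_add_distrib]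
  refine Finset.sum_congr rfl fun i _ => ?_
  simp [EuclideanSpace.inner_single_right]
  ring

lemma sum_single_id : ∑ i : Fin d,
    ((ContinuousLinearMap.id ℝ (V d)) (EuclideanSpace.single i (1 : ℝ)) : V d) i = d := by
  simp

end calculus

section spacetime

variable {d : ℕ}

instance [Fact (3 ≤ d)] : NeZero d := ⟨by have := Fact.out (p := 3 ≤ d); omega⟩

/-- The measure on space-time restricted to the time slab `(T₀, T]`. -/
noncomputable def Qm (d : ℕ) (T₀ T : ℝ) : Measure (V d × ℝ) :=
  (volume : Measure (V d)).prod (volume.restrict (Ioc T₀ T))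

lemma Qm_eq (T₀ T : ℝ) : Qm d T₀ T =
    ((volume : Measure (V d)).prod (volume : Measure ℝ)).restrict (univ ×ˢ Ioc T₀ T) := by
  rw [← Measure.prod_restrict, Measure.restrict_univ, Qm]

variable [Fact (3 ≤ d)]

lemma ae_ne_zero : ∀ᵐ x : V d, x ≠ 0 := by
  simp [ae_iff, measure_singleton]

lemma ae_Q_ne_zero (T₀ T : ℝ) : ∀ᵐ z ∂(Qm d T₀ T), z.1 ≠ 0 :=
  Measure.quasiMeasurePreserving_fst.ae ae_ne_zero

lemma ae_Q_mem (T₀ T : ℝ) : ∀ᵐ z ∂(Qm d T₀ T), z.1 ≠ 0 ∧ z.2 ∈ Ioc T₀ T :=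
  (ae_Q_ne_zero T₀ T).and (Measure.quasiMeasurePreserving_snd.ae
    (ae_restrict_mem measurableSet_Ioc))

lemma aesm_Q {F : Type*} [NormedAddCommGroup F] {f : V d × ℝ → F} (h : ContinuousOn f (Om d))
    (T₀ T : ℝ) : AEStronglyMeasurable f (Qm d T₀ T) := by
  have h1 : AEStronglyMeasurable f ((Qm d T₀ T).restrict (Om d)) :=
    h.aestronglyMeasurable isOpen_Om.measurableSet
  rwa [Measure.restrict_eq_self_of_ae_mem] at h1
  filter_upwards [ae_Q_ne_zero T₀ T] with z hz using ⟨hz, mem_univ _⟩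

lemma aesm_slice {F : Type*} [NormedAddCommGroup F] {f : V d × ℝ → F}
    (h : ContinuousOn f (Om d)) (t : ℝ) : AEStronglyMeasurable (fun x => f (x, t)) volume := by
  have h0 : ContinuousOn (fun x => f (x, t)) {(0 : V d)}ᶜ :=
    h.comp (by fun_prop) fun x hx => ⟨hx, mem_univ _⟩
  have h1 := h0.aestronglyMeasurable (μ := volume) isOpen_compl_singleton.measurableSet
  rwa [Measure.restrict_eq_self_of_ae_mem] at h1
  exact ae_ne_zero

/-- A family of smooth cutoffs on `ℝ^d` exhausting the complement of the origin. -/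
lemma exists_cutoff : ∃ (χ : ℕ → V d → ℝ) (C : ℝ), ∀ n, ContDiff ℝ 1 (χ n) ∧
    HasCompactSupport (χ n) ∧ (∀ᶠ x in 𝓝 0, χ n x = 0) ∧ (∀ x, |χ n x| ≤ 1) ∧
    (∀ x, ‖fderiv ℝ (χ n) x‖ * ‖x‖ ≤ C) ∧
    (∀ x, x ≠ 0 → ∀ᶠ n in atTop, χ n x = 1 ∧ fderiv ℝ (χ n) x = 0) := by
  let θ : ContDiffBump (0 : V d) := ⟨1, 2, one_pos, one_lt_two⟩
  have hθ : ContDiff ℝ 1 (θ : V d → ℝ) := θ.contDiff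
  obtain ⟨K, hK⟩ := (θ.hasCompactSupport.fderiv (𝕜 := ℝ)).exists_bound_of_continuous
    (hθ.continuous_fderiv one_ne_zero)
  have hK0 : 0 ≤ K := (norm_nonneg _).trans (hK 0)
  have hd0 : ∀ x : V d, ‖x‖ ≠ 0 → (1 > ‖x‖ ∨ ‖x‖ > 2) → fderiv ℝ θ x = 0 := by
    intro x _ hx
    rcases hx with hx | hx
    · have : (θ : V d → ℝ) =ᶠ[𝓝 x] fun _ => 1 := by
        filter_upwards [Metric.isOpen_ball.mem_nhds
          (show x ∈ Metric.ball (0 : V d) 1 by simpa using hx)] with y hy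
        exact θ.one_of_mem_closedBall (Metric.ball_subset_closedBall hy)
      rw [this.fderiv_eq]; simp
    · have : (θ : V d → ℝ) =ᶠ[𝓝 x] fun _ => 0 := by
        have : {y : V d | 2 < ‖y‖} ∈ 𝓝 x := (isOpen_lt continuous_const continuous_norm).mem_nhds hx
        filter_upwards [this] with y hy
        exact θ.zero_of_le_dist (by simpa [θ] using le_of_lt hy)
      rw [this.fderiv_eq]; simp
  have hdr : ∀ x : V d, ‖fderiv ℝ θ x‖ * ‖x‖ ≤ 2 * K := by
    intro x
    by_cases h : ‖x‖ ≤ 2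
    · nlinarith [hK x, norm_nonneg x, norm_nonneg (fderiv ℝ θ x)]
    · rw [hd0 x (by linarith) (Or.inr (by linarith))]; simpa using hK0
  have hsc : ∀ (c : ℝ) (x : V d),
      HasFDerivAt (fun y => θ (c • y)) (c • fderiv ℝ θ (c • x)) x := by
    intro c x
    have h1 : HasFDerivAt (θ : V d → ℝ) (fderiv ℝ θ (c • x)) (c • x) :=
      (hθ.differentiable one_ne_zero _).hasFDerivAt
    have := h1.comp x ((hasFDerivAt_id x).const_smul c)
    refine this.congr_fderiv ?_
    ext v; simp
  have hfd : ∀ (n : ℕ) (x : V d), fderiv ℝ (fun y => θ (((n : ℝ) + 1)⁻¹ • y) -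
      θ (((n : ℝ) + 1) • y)) x = ((n : ℝ) + 1)⁻¹ • fderiv ℝ θ (((n : ℝ) + 1)⁻¹ • x) -
        ((n : ℝ) + 1) • fderiv ℝ θ (((n : ℝ) + 1) • x) := fun n x =>
    ((hsc _ x).fun_sub (hsc _ x)).fderiv
  have hn1 : ∀ n : ℕ, (0 : ℝ) < (n : ℝ) + 1 := fun n => by positivity
  refine ⟨fun n x => θ (((n : ℝ) + 1)⁻¹ • x) - θ (((n : ℝ) + 1) • x), 4 * K,
    fun n => ⟨?_, ?_, ?_, ?_, ?_, ?_⟩⟩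
  · exact (hθ.comp (contDiff_const_smul _)).sub (hθ.comp (contDiff_const_smul _))
  · exact (θ.hasCompactSupport.comp_smul (inv_ne_zero (hn1 n).ne')).sub
      (θ.hasCompactSupport.comp_smul (hn1 n).ne')
  · have : Metric.ball (0 : V d) ((n : ℝ) + 1)⁻¹ ∈ 𝓝 (0 : V d) :=
      Metric.ball_mem_nhds _ (inv_pos.2 (hn1 n))
    filter_upwards [this] with x hx
    have hx' : ‖x‖ < ((n : ℝ) + 1)⁻¹ := by simpa using hx
    have h2 : ((n : ℝ) + 1) * ‖x‖ ≤ 1 := by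
      have := mul_le_mul_of_nonneg_left hx'.le (hn1 n).le
      rwa [mul_inv_cancel₀ (hn1 n).ne'] at this
    have h3 : ((n : ℝ) + 1)⁻¹ ≤ 1 := inv_le_one_of_one_le₀ (by simp)
    rw [θ.one_of_mem_closedBall, θ.one_of_mem_closedBall, sub_self]
    · simpa [norm_smul, abs_of_pos (hn1 n)] using h2
    · simp only [mem_closedBall_zero_iff, norm_smul, norm_inv, Real.norm_eq_abs, abs_of_pos (hn1 n)]
      show _ ≤ (1 : ℝ)
      nlinarith [norm_nonneg x, inv_pos.2 (hn1 n)]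
  · intro x
    rw [abs_le]
    constructor <;> linarith [θ.nonneg (x := ((n : ℝ) + 1)⁻¹ • x), θ.nonneg (x := ((n : ℝ) + 1) • x),
      θ.le_one (x := ((n : ℝ) + 1)⁻¹ • x), θ.le_one (x := ((n : ℝ) + 1) • x)]
  · intro x
    rw [hfd]
    have e1 := hdr (((n : ℝ) + 1)⁻¹ • x)
    have e2 := hdr (((n : ℝ) + 1) • x)
    rw [norm_smul, Real.norm_of_nonneg (inv_pos.2 (hn1 n)).le] at e1
    rw [norm_smul, Real.norm_of_nonneg (hn1 n).le] at e2
    have := norm_sub_le (((n : ℝ) + 1)⁻¹ • fderiv ℝ θ (((n : ℝ) + 1)⁻¹ • x))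
      (((n : ℝ) + 1) • fderiv ℝ θ (((n : ℝ) + 1) • x))
    rw [norm_smul, norm_smul, Real.norm_of_nonneg (inv_pos.2 (hn1 n)).le,
      Real.norm_of_nonneg (hn1 n).le] at this
    nlinarith [mul_le_mul_of_nonneg_right this (norm_nonneg x)]
  · intro x hx
    have hx0 : 0 < ‖x‖ := norm_pos_iff.2 hx
    have t1 : Tendsto (fun n : ℕ => (n : ℝ) + 1) atTop atTop :=
      tendsto_atTop_add_const_right _ _ tendsto_natCast_atTop_atTop
    filter_upwards [t1.eventually_gt_atTop ‖x‖, t1.eventually_gt_atTop (2 / ‖x‖)] with m h1 h2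
    have a1 : ‖((m : ℝ) + 1)⁻¹ • x‖ < 1 := by
      rw [norm_smul, Real.norm_of_nonneg (inv_pos.2 (hn1 m)).le, inv_mul_lt_iff₀ (hn1 m)]
      simpa using h1
    have a2 : 2 < ‖((m : ℝ) + 1) • x‖ := by
      rw [norm_smul, Real.norm_of_nonneg (hn1 m).le]
      rwa [div_lt_iff₀ hx0] at h2
    constructor
    · rw [θ.one_of_mem_closedBall (by simpa using a1.le),
        θ.zero_of_le_dist (by simpa [θ] using a2.le), sub_zero]
    · rw [hfd, hd0 _ _ (Or.inl a1), hd0 _ _ (Or.inr a2)]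
      · simp
      · linarith
      · simpa [(hn1 m).ne'] using hx

lemma integral_dvg_eq_zero {G : V d → V d} (h : ContDiff ℝ 1 G) (hc : HasCompactSupport G) :
    ∫ x, dvg G x = 0 := by
  have hcont : Continuous (fderiv ℝ G) := h.continuous_fderiv one_ne_zero
  have hInt : ∀ i : Fin d,
      Integrable (fun x => (fderiv ℝ G x (EuclideanSpace.single i 1)) i) := by
    intro i
    have hcs : HasCompactSupport (fun x => (fderiv ℝ G x (EuclideanSpace.single i 1)) i) := by
      exact (hc.fderiv (𝕜 := ℝ)).comp_left
        (g := fun L : V d →L[ℝ] V d => (L (EuclideanSpace.single i 1)) i) (by simp)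
    exact Continuous.integrable_of_hasCompactSupport
      ((EuclideanSpace.proj (𝕜 := ℝ) i).continuous.comp (hcont.clm_apply continuous_const)) hcs
  unfold dvg
  rw [integral_finsetSum _ fun i _ => hInt i]
  refine Finset.sum_eq_zero fun i _ => ?_
  have hdi : ∀ x, HasFDerivAt (fun x => G x i)
      ((EuclideanSpace.proj (𝕜 := ℝ) i).comp (fderiv ℝ G x)) x := fun x =>
    (EuclideanSpace.proj (𝕜 := ℝ) i).hasFDerivAt.comp x
      ((h.differentiable one_ne_zero x).hasFDerivAt)
  have := integral_mul_fderiv_eq_neg_fderiv_mul_of_integrable (μ := (volume : Measure (V d)))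
    (f := fun _ => (1 : ℝ)) (g := fun x => G x i) (v := EuclideanSpace.single i 1)
    (by simp) ?_ ?_ (by fun_prop) (fun x _ => (hdi x).differentiableAt)
  · simpa [fun x => (hdi x).fderiv] using this
  · simpa [fun x => (hdi x).fderiv] using hInt i
  · simp only [one_mul]
    exact ((EuclideanSpace.proj (𝕜 := ℝ) i).continuous.comp
      h.continuous).integrable_of_hasCompactSupport
        (hc.comp_left (g := fun v : V d => v i) (by simp))

lemma dvg_smul {f : V d → ℝ} {X : V d → V d} {x : V d} (hf : DifferentiableAt ℝ f x)
    (hX : DifferentiableAt ℝ X x) :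
    dvg (fun y => f y • X y) x = f x * dvg X x + fderiv ℝ f x (X x) := by
  have := dvg_add_smul (f₂ := fun _ => 0) (g₂ := 0) (X₂ := fun _ => (0 : V d)) (L₂ := 0)
    (g₁ := gradient f x)
    (hf.hasFDerivAt.congr_fderiv (by ext v; simp [inner_gradient_left])) hX.hasFDerivAt
    (by simpa using hasFDerivAt_const (0 : ℝ) x) (hasFDerivAt_const _ _)
  simp only [zero_smul, add_zero, inner_gradient_left] at this
  rw [this, dvg]; simp; ring

/-- Integrated form of a local conservation law `∂ₜ F = div H + k` off the origin. -/
theorem spacetime_identity {F k : V d → ℝ → ℝ} {H : V d → ℝ → V d} (hF : CD 1 F) (hH : CD 1 H)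
    {T₀ T : ℝ} (hT : T₀ ≤ T)
    (heq : ∀ x t, x ≠ 0 → D F x t = dvg (fun y => H y t) x + k x t)
    (hF0 : Integrable fun x => F x T₀) (hF1 : Integrable fun x => F x T)
    (hk : Integrable (fun z => k z.1 z.2) (Qm d T₀ T))
    (hHi : Integrable (fun z => ‖H z.1 z.2‖ / ‖z.1‖) (Qm d T₀ T)) :
    (∫ x, F x T) - ∫ x, F x T₀ = ∫ z, k z.1 z.2 ∂(Qm d T₀ T) := by
  obtain ⟨χ, C, hχ⟩ := exists_cutoff (d := d)
  have hχc : ∀ n, Continuous (χ n) := fun n => (hχ n).1.continuous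
  have hχd : ∀ n x, DifferentiableAt ℝ (χ n) x := fun n x =>
    (hχ n).1.differentiable one_ne_zero x
  have hχint : ∀ n, ∀ g : V d × ℝ → ℝ, ContinuousOn g (Om d) →
      Integrable (fun z => χ n z.1 * g z) (Qm d T₀ T) := by
    intro n g hg
    have hcont : Continuous (fun z : V d × ℝ => χ n z.1 * g z) := by
      rw [continuous_iff_continuousAt]
      rintro ⟨x, t⟩
      by_cases hx : x = 0
      · have h1 : ∀ᶠ z : V d × ℝ in 𝓝 (x, t), χ n z.1 = 0 := by
          subst hx
          exact (continuous_fst.tendsto ((0 : V d), t)).eventually (hχ n).2.2.1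
        refine ContinuousAt.congr (f := fun _ => (0 : ℝ)) continuousAt_const ?_
        filter_upwards [h1] with z hz
        simp [hz]
      · exact ((hχc n).comp continuous_fst).continuousAt.mul (hg.continuousAt (Om_mem_nhds hx))
    rw [Qm_eq]
    have hK : IsCompact (tsupport (χ n) ×ˢ Icc T₀ T) := (hχ n).2.1.isCompact.prod isCompact_Icc
    refine IntegrableOn.of_forall_sdiff_eq_zero
      (hcont.continuousOn.integrableOn_compact hK) (by measurability) ?_
    rintro z ⟨hz1, hz2⟩
    have : z.1 ∉ tsupport (χ n) := fun h => hz2 ⟨h, Ioc_subset_Icc_self hz1.2⟩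
    simp [image_eq_zero_of_notMem_tsupport this]
  have hDF : ContinuousOn (fun z : V d × ℝ => D F z.1 z.2) (Om d) := by
    have h1 := (hF.cfderiv (n := 0)).contOn
    exact (h1.clm_apply (continuousOn_const (c := ((0 : V d), (1 : ℝ))))).congr
      fun z hz => hF.D_eq hz.1
  have hdH : ContinuousOn (fun z : V d × ℝ => dvg (fun y => H y z.2) z.1) (Om d) := by
    have h1 := (hH.cfderiv (n := 0)).contOn
    have h2 : ContinuousOn (fun z : V d × ℝ => ∑ i : Fin d, (fderiv ℝ
        (fun q : V d × ℝ => H q.1 q.2) z (EuclideanSpace.single i 1, 0)) i) (Om d) := by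
      refine continuousOn_finsetSum _ fun i _ => ?_
      exact (EuclideanSpace.proj (𝕜 := ℝ) i).continuous.comp_continuousOn
        (h1.clm_apply continuousOn_const)
    refine h2.congr fun z hz => ?_
    simp only [dvg, (hH.hasFDerivAt_space (t := z.2) le_rfl hz.1).fderiv]
    rfl
  have hkc : ContinuousOn (fun z : V d × ℝ => k z.1 z.2) (Om d) :=
    (hDF.sub hdH).congr fun z hz => by
      simp only [Pi.sub_apply]; rw [heq _ _ hz.1]; ring
  have hχk : ∀ n, Integrable (fun z => χ n z.1 * k z.1 z.2) (Qm d T₀ T) := fun n =>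
    hχint n _ hkc
  have hχdH : ∀ n, Integrable (fun z => χ n z.1 * dvg (fun y => H y z.2) z.1) (Qm d T₀ T) :=
    fun n => hχint n _ hdH
  have hgr : ∀ n, ∀ z : V d × ℝ, z.1 ≠ 0 →
      ‖fderiv ℝ (χ n) z.1 (H z.1 z.2)‖ ≤ C * (‖H z.1 z.2‖ / ‖z.1‖) := by
    intro n z hz
    have h1 := (fderiv ℝ (χ n) z.1).le_opNorm (H z.1 z.2)
    have h2 := (hχ n).2.2.2.2.1 z.1
    have hz0 : 0 < ‖z.1‖ := norm_pos_iff.2 hz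
    refine h1.trans ?_
    rw [mul_div_assoc', le_div_iff₀ hz0]
    nlinarith [norm_nonneg (H z.1 z.2)]
  have hgm : ∀ n, AEStronglyMeasurable (fun z : V d × ℝ => fderiv ℝ (χ n) z.1 (H z.1 z.2))
      (Qm d T₀ T) := fun n => aesm_Q (((((hχ n).1.continuous_fderiv one_ne_zero).comp
        continuous_fst).continuousOn).clm_apply hH.contOn) _ _
  have hdiv : ∀ n t, ∫ x, (χ n x * dvg (fun y => H y t) x + fderiv ℝ (χ n) x (H x t)) = 0 := by
    intro n t
    have hG : ContDiff ℝ 1 (fun x => χ n x • H x t) := by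
      rw [contDiff_iff_contDiffAt]
      intro x
      by_cases hx : x = 0
      · subst hx
        refine ContDiffAt.congr_of_eventuallyEq (f := fun _ => (0 : V d)) contDiffAt_const ?_
        filter_upwards [(hχ n).2.2.1] with z hz
        simp [hz]
      · exact (hχ n).1.contDiffAt.smul ((hH.at (t := t) hx).comp (f := fun y => (y, t)) x
          (by fun_prop))
    rw [← integral_dvg_eq_zero hG ((hχ n).2.1.smul_right (f' := fun x => H x t))]
    refine integral_congr_ae ?_
    filter_upwards [ae_ne_zero] with x hx
    rw [dvg_smul (hχd n x) (hH.hasFDerivAt_space le_rfl hx).differentiableAt]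
  have hmain : ∀ n, (∫ x, χ n x * F x T) - ∫ x, χ n x * F x T₀ =
      (∫ z, χ n z.1 * k z.1 z.2 ∂(Qm d T₀ T)) - ∫ z, fderiv ℝ (χ n) z.1 (H z.1 z.2) ∂(Qm d T₀ T) := by
    intro n
    have hi1 : ∀ t, Integrable (fun x => F x t) → Integrable (fun x => χ n x * F x t) := by
      intro t ht
      exact ht.bdd_mul (c := 1) (hχc n).aestronglyMeasurable
        (Eventually.of_forall fun x => (hχ n).2.2.2.1 x)
    rw [← integral_sub (hi1 _ hF1) (hi1 _ hF0)]
    have e1 : ∀ᵐ x : V d, χ n x * F x T - χ n x * F x T₀ =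
        ∫ t in Ioc T₀ T, χ n x * D F x t := by
      filter_upwards [ae_ne_zero] with x hx
      rw [integral_const_mul, ← mul_sub, ← intervalIntegral.integral_of_le hT]
      congr 1
      rw [intervalIntegral.integral_eq_sub_of_hasDerivAt (fun t _ => hF.hasDerivAt hx)]
      have : Continuous (D F x) := by
        have := hDF.comp_continuous (f := fun t : ℝ => (x, t)) (by fun_prop) fun t => mem_Om hx
        exact this
      exact this.intervalIntegrable _ _
    have hg : Integrable (fun z => fderiv ℝ (χ n) z.1 (H z.1 z.2)) (Qm d T₀ T) := by
      refine (hHi.const_mul C).mono' (hgm n) ?_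
      filter_upwards [ae_Q_ne_zero T₀ T] with z hz using hgr n z hz
    have e2 : ∫ z, χ n z.1 * D F z.1 z.2 ∂(Qm d T₀ T) =
        ∫ x, ∫ t in Ioc T₀ T, χ n x * D F x t := by
      rw [Qm, integral_prod _ (hχint n _ hDF)]
    have e3 : ∫ z, (χ n z.1 * dvg (fun y => H y z.2) z.1 + fderiv ℝ (χ n) z.1 (H z.1 z.2))
        ∂(Qm d T₀ T) = 0 := by
      have : Integrable (fun z => χ n z.1 * dvg (fun y => H y z.2) z.1 +
        fderiv ℝ (χ n) z.1 (H z.1 z.2)) (Qm d T₀ T) := (hχdH n).add hg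
      rw [Qm] at this ⊢
      rw [integral_prod_symm _ this]
      simp only [hdiv, integral_zero]
    rw [integral_add (hχdH n) hg] at e3
    rw [integral_congr_ae e1, ← e2]
    have e4 : ∫ z, χ n z.1 * D F z.1 z.2 ∂(Qm d T₀ T) =
        ∫ z, (χ n z.1 * dvg (fun y => H y z.2) z.1 + χ n z.1 * k z.1 z.2) ∂(Qm d T₀ T) := by
      refine integral_congr_ae ?_
      filter_upwards [ae_Q_ne_zero T₀ T] with z hz
      rw [heq _ _ hz]; ring
    rw [e4, integral_add (hχdH n) (hχk n)]
    linarith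
  have l1 : ∀ t, Integrable (fun x => F x t) →
      Tendsto (fun n => ∫ x, χ n x * F x t) atTop (𝓝 (∫ x, F x t)) := by
    intro t ht
    refine tendsto_integral_of_dominated_convergence (fun x => ‖F x t‖)
      (fun n => (hχc n).aestronglyMeasurable.mul ht.1) ht.norm (fun n => ?_) ?_
    · refine Eventually.of_forall fun x => ?_
      rw [norm_mul]
      exact mul_le_of_le_one_left (norm_nonneg _) ((hχ n).2.2.2.1 x)
    · filter_upwards [ae_ne_zero] with x hx
      refine tendsto_const_nhds.congr' ?_
      filter_upwards [(hχ 0).2.2.2.2.2 x hx] with n hn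
      simp [hn.1]
  have l2 : Tendsto (fun n => ∫ z, χ n z.1 * k z.1 z.2 ∂(Qm d T₀ T)) atTop
      (𝓝 (∫ z, k z.1 z.2 ∂(Qm d T₀ T))) := by
    refine tendsto_integral_of_dominated_convergence (fun z => ‖k z.1 z.2‖)
      (fun n => (hχk n).1) hk.norm (fun n => ?_) ?_
    · refine Eventually.of_forall fun z => ?_
      rw [norm_mul]
      exact mul_le_of_le_one_left (norm_nonneg _) ((hχ n).2.2.2.1 z.1)
    · filter_upwards [ae_Q_ne_zero T₀ T] with z hz
      refine tendsto_const_nhds.congr' ?_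
      filter_upwards [(hχ 0).2.2.2.2.2 z.1 hz] with n hn
      simp [hn.1]
  have l3 : Tendsto (fun n => ∫ z, fderiv ℝ (χ n) z.1 (H z.1 z.2) ∂(Qm d T₀ T)) atTop
      (𝓝 (∫ z, (0 : ℝ) ∂(Qm d T₀ T))) := by
    refine tendsto_integral_of_dominated_convergence (fun z => C * (‖H z.1 z.2‖ / ‖z.1‖))
      hgm (hHi.const_mul C) (fun n => ?_) ?_
    · filter_upwards [ae_Q_ne_zero T₀ T] with z hz using hgr n z hz
    · filter_upwards [ae_Q_ne_zero T₀ T] with z hz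
      refine tendsto_const_nhds.congr' ?_
      filter_upwards [(hχ 0).2.2.2.2.2 z.1 hz] with n hn
      simp [hn.2]
  have := tendsto_nhds_unique (((l1 T hF1).sub (l1 T₀ hF0)).congr hmain) (l2.sub l3)
  simpa using this

end spacetime

section waves

variable {d : ℕ} {u v : V d → ℝ → ℝ} {x : V d} {t : ℝ}

/-- The radial derivative. -/
noncomputable def rd (u : V d → ℝ → ℝ) (x : V d) (t : ℝ) : ℝ := ⟪gr u x t, x⟫ / ‖x‖

/-- The squared length of the angular part of the gradient. -/
noncomputable def an (u : V d → ℝ → ℝ) (x : V d) (t : ℝ) : ℝ := ‖gr u x t‖ ^ 2 - rd u x t ^ 2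

/-- The energy flux density through outgoing light cones. -/
noncomputable def nd (u : V d → ℝ → ℝ) (x : V d) (t : ℝ) : ℝ :=
  eDenFree u x t + D u x t * rd u x t

/-- A finite energy wave: like `IsFreeCoulombWave`, with energy only assumed bounded. -/
structure Wave (u : V d → ℝ → ℝ) : Prop where
  cont : Continuous (fun q : V d × ℝ => u q.1 q.2)
  cd : CD 2 u
  pde : ∀ x t, x ≠ 0 → D (D u) x t = lap (fun y => u y t) x - u x t / ‖x‖
  int : ∀ t, Integrable (fun x => eDenFree u x t)
  bdd : ∃ B, ∀ t, ∫ x, eDenFree u x t ≤ B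

lemma Wave.of_isFree {E : ℝ} (h : IsFreeCoulombWave u E) : Wave u :=
  ⟨h.1, h.2.1, fun x t hx => by 
    have := h.2.2.1 x hx t
    change deriv (deriv (u x)) t = _
    linarith,
    h.2.2.2.1, ⟨E, fun t => (h.2.2.2.2 t).le⟩⟩

lemma eDen_def : eDenFree u x t = (1 / 2) * ‖gr u x t‖ ^ 2 + (1 / 2) * D u x t ^ 2 +
    u x t ^ 2 / (2 * ‖x‖) := rfl

lemma eDen_eq : eDenFree u x t = (1 / 2) * (rd u x t ^ 2 + an u x t) + (1 / 2) * D u x t ^ 2 +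
    u x t ^ 2 / (2 * ‖x‖) := by rw [eDen_def, an]; ring

lemma nd_eq : nd u x t = (1 / 2) * (D u x t + rd u x t) ^ 2 + (1 / 2) * an u x t +
    u x t ^ 2 / (2 * ‖x‖) := by rw [nd, eDen_eq]; ring

lemma rd_abs_le : |rd u x t| ≤ ‖gr u x t‖ := by
  rw [rd, abs_div, abs_norm]
  exact div_le_of_le_mul₀ (norm_nonneg _) (norm_nonneg _) (abs_real_inner_le_norm _ _)

lemma an_nonneg : 0 ≤ an u x t := by
  have h := rd_abs_le (u := u) (x := x) (t := t)
  have := sq_le_sq' (by linarith [abs_nonneg (rd u x t), norm_nonneg (gr u x t)]) h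
  rw [sq_abs] at this
  rw [an]; linarith

lemma pot_nonneg : 0 ≤ u x t ^ 2 / (2 * ‖x‖) := by positivity

lemma eDen_nonneg : 0 ≤ eDenFree u x t := by rw [eDen_def]; positivity

lemma nd_nonneg : 0 ≤ nd u x t := by
  rw [nd_eq]; linarith [sq_nonneg (D u x t + rd u x t), an_nonneg (u := u) (x := x) (t := t),
    pot_nonneg (u := u) (x := x) (t := t)]

lemma nd_le : nd u x t ≤ 2 * eDenFree u x t := by
  rw [nd_eq, eDen_eq]; linarith [sq_nonneg (D u x t - rd u x t),
    an_nonneg (u := u) (x := x) (t := t), pot_nonneg (u := u) (x := x) (t := t)]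

lemma D_sq_le : D u x t ^ 2 ≤ 2 * eDenFree u x t := by
  rw [eDen_def]; linarith [sq_nonneg ‖gr u x t‖, pot_nonneg (u := u) (x := x) (t := t)]

lemma gr_sq_le : ‖gr u x t‖ ^ 2 ≤ 2 * eDenFree u x t := by
  rw [eDen_def]; linarith [sq_nonneg (D u x t), pot_nonneg (u := u) (x := x) (t := t)]

lemma pot_le : u x t ^ 2 / ‖x‖ ≤ 2 * eDenFree u x t := by
  rw [eDen_def]
  have : u x t ^ 2 / (2 * ‖x‖) = u x t ^ 2 / ‖x‖ / 2 := by rw [mul_comm, div_mul_eq_div_div]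
  rw [this]
  linarith [sq_nonneg (D u x t), sq_nonneg ‖gr u x t‖]

lemma Om_ne {q : V d × ℝ} (hq : q ∈ Om d) : ‖q.1‖ ≠ 0 := norm_ne_zero_iff.2 hq.1

lemma cd_norm : ContDiffOn ℝ 1 (fun q : V d × ℝ => ‖q.1‖) (Om d) :=
  contDiffOn_fst.norm ℝ fun _ hq => hq.1

lemma CD.crd (h : CD 2 u) : CD 1 (rd u) :=
  ContDiffOn.div (h.cgr.inner ℝ contDiffOn_fst) cd_norm fun _ hq => Om_ne hq

lemma CD.can (h : CD 2 u) : CD 1 (an u) := (ContDiffOn.norm_sq ℝ h.cgr).sub (h.crd.pow 2)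

/-- The first order quantities attached to a wave are `C¹` off the origin. -/
lemma CD.bundle (h : CD 2 u) :
    ContDiffOn ℝ 1 (fun q : V d × ℝ => u q.1 q.2) (Om d) ∧
    ContDiffOn ℝ 1 (fun q : V d × ℝ => D u q.1 q.2) (Om d) ∧
    ContDiffOn ℝ 1 (fun q : V d × ℝ => rd u q.1 q.2) (Om d) ∧
    ContDiffOn ℝ 1 (fun q : V d × ℝ => an u q.1 q.2) (Om d) ∧
    ContDiffOn ℝ 1 (fun q : V d × ℝ => gr u q.1 q.2) (Om d) ∧
    ContDiffOn ℝ 1 (fun q : V d × ℝ => ‖q.1‖) (Om d) ∧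
    ∀ q ∈ Om d, ‖q.1‖ ≠ 0 :=
  ⟨h.mono one_le_two, h.cD, h.crd, h.can, h.cgr, cd_norm, fun _ => Om_ne⟩

lemma CD.cbundle (h : CD 2 u) :
    ContinuousOn (fun q : V d × ℝ => u q.1 q.2) (Om d) ∧
    ContinuousOn (fun q : V d × ℝ => D u q.1 q.2) (Om d) ∧
    ContinuousOn (fun q : V d × ℝ => rd u q.1 q.2) (Om d) ∧
    ContinuousOn (fun q : V d × ℝ => an u q.1 q.2) (Om d) ∧
    ContinuousOn (fun q : V d × ℝ => gr u q.1 q.2) (Om d) ∧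
    ∀ q ∈ Om d, ‖q.1‖ ≠ 0 :=
  ⟨h.contOn, h.cD.contOn, h.crd.contOn, h.can.contOn, h.cgr.contOn, fun _ => Om_ne⟩

lemma CD.ceDen (h : CD 2 u) : CD 1 (eDenFree u) := by
  obtain ⟨h1, h2, h3, h4, h5, h6, h7⟩ := h.bundle
  have h8 : ∀ q ∈ Om d, 2 * ‖q.1‖ ≠ 0 := fun q hq => mul_ne_zero two_ne_zero (h7 q hq)
  refine CD.congr (u := fun x t => (1 / 2) * (rd u x t ^ 2 + an u x t) + (1 / 2) * D u x t ^ 2 +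
    u x t ^ 2 / (2 * ‖x‖)) ?_ fun x t _ => eDen_eq
  unfold CD
  fun_prop (disch := assumption)

lemma CD.cnd (h : CD 2 u) : CD 1 (nd u) :=
  ContDiffOn.add h.ceDen (ContDiffOn.mul h.cD h.crd)

/-! ### Linear combinations and time changes -/

lemma gr_lin (hu : CD 2 u) (hv : CD 2 v) (a b : ℝ) (hx : x ≠ 0) :
    gr (fun x t => a * u x t + b * v x t) x t = a • gr u x t + b • gr v x t := by
  refine ext_inner_right ℝ fun w => ?_
  rw [gr, inner_gradient_left, ((((hu.mono one_le_two).hasFDerivAt_gr hx).const_mul a).fun_add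
    (((hv.mono one_le_two).hasFDerivAt_gr hx).const_mul b)).fderiv]
  simp [inner_add_left, inner_smul_left]

lemma D_lin (hu : CD 1 u) (hv : CD 1 v) (a b : ℝ) (hx : x ≠ 0) :
    D (fun x t => a * u x t + b * v x t) x t = a * D u x t + b * D v x t :=
  (((hu.hasDerivAt hx).const_mul a).fun_add ((hv.hasDerivAt hx).const_mul b)).deriv

lemma CD.lin {n : ℕ} (hu : CD n u) (hv : CD n v) (a b : ℝ) :
    CD n (fun x t => a * u x t + b * v x t) :=
  (contDiffOn_const.mul hu).add (contDiffOn_const.mul hv)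

lemma eDen_lin_le (hu : CD 2 u) (hv : CD 2 v) (a b : ℝ) (hx : x ≠ 0) :
    eDenFree (fun x t => a * u x t + b * v x t) x t ≤
      2 * a ^ 2 * eDenFree u x t + 2 * b ^ 2 * eDenFree v x t := by
  have hx0 : 0 < ‖x‖ := norm_pos_iff.2 hx
  rw [eDen_def, eDen_def, eDen_def, gr_lin hu hv a b hx,
    D_lin (hu.mono one_le_two) (hv.mono one_le_two) a b hx]
  have h1 : ‖a • gr u x t + b • gr v x t‖ ^ 2 ≤
      2 * (a ^ 2 * ‖gr u x t‖ ^ 2) + 2 * (b ^ 2 * ‖gr v x t‖ ^ 2) := by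
    have := norm_add_le (a • gr u x t) (b • gr v x t)
    rw [norm_smul, norm_smul] at this
    calc _ ≤ (‖a‖ * ‖gr u x t‖ + ‖b‖ * ‖gr v x t‖) ^ 2 := by gcongr
      _ ≤ 2 * (‖a‖ * ‖gr u x t‖) ^ 2 + 2 * (‖b‖ * ‖gr v x t‖) ^ 2 := by
        nlinarith [sq_nonneg (‖a‖ * ‖gr u x t‖ - ‖b‖ * ‖gr v x t‖)]
      _ = _ := by simp only [mul_pow, Real.norm_eq_abs, sq_abs]
  have h2 : (a * D u x t + b * D v x t) ^ 2 ≤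
      2 * (a ^ 2 * D u x t ^ 2) + 2 * (b ^ 2 * D v x t ^ 2) := by
    nlinarith [sq_nonneg (a * D u x t - b * D v x t)]
  have h3 : (a * u x t + b * v x t) ^ 2 / (2 * ‖x‖) ≤
      2 * (a ^ 2 * (u x t ^ 2 / (2 * ‖x‖))) + 2 * (b ^ 2 * (v x t ^ 2 / (2 * ‖x‖))) := by
    have : 2 * (a ^ 2 * (u x t ^ 2 / (2 * ‖x‖))) + 2 * (b ^ 2 * (v x t ^ 2 / (2 * ‖x‖))) =
      (2 * (a ^ 2 * u x t ^ 2) + 2 * (b ^ 2 * v x t ^ 2)) / (2 * ‖x‖) := by ring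
    rw [this]
    gcongr
    nlinarith [sq_nonneg (a * u x t - b * v x t)]
  linarith

lemma CD.slice {n : ℕ} (hu : CD n u) (hx : x ≠ 0) : ContDiffAt ℝ n (fun y => u y t) x :=
  (hu.at (t := t) hx).comp (f := fun y => (y, t)) x (by fun_prop)

lemma lap_lin (hu : CD 2 u) (hv : CD 2 v) (a b : ℝ) (hx : x ≠ 0) :
    lap (fun y => a * u y t + b * v y t) x =
      a * lap (fun y => u y t) x + b * lap (fun y => v y t) x := by
  have h1 := hu.slice (t := t) hx
  have h2 := hv.slice (t := t) hx
  have e1 : ∀ (c : ℝ) (w : V d → ℝ → ℝ), (fun y => c * w y t) = c • fun y => w y t := fun c w => rfl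
  have e : (fun y => a * u y t + b * v y t) = (fun y => a * u y t) + fun y => b * v y t := rfl
  simp only [lap]
  rw [e, iteratedFDeriv_add_apply (contDiffAt_const.mul h1) (contDiffAt_const.mul h2), e1, e1,
    iteratedFDeriv_const_smul_apply h1, iteratedFDeriv_const_smul_apply h2]
  simp [Finset.sum_add_distrib, Finset.mul_sum]

variable [Fact (3 ≤ d)]

lemma int_slice {F : V d × ℝ → ℝ} (hF : ContinuousOn F (Om d)) {g : V d → ℝ} (hg : Integrable g)
    (h : ∀ x, x ≠ 0 → |F (x, t)| ≤ g x) : Integrable (fun x => F (x, t)) := by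
  refine hg.mono' (aesm_slice hF t) ?_
  filter_upwards [ae_ne_zero] with x hx using h x hx

lemma int_Q {T₀ T : ℝ} {F : V d × ℝ → ℝ} (hF : ContinuousOn F (Om d)) {g : V d × ℝ → ℝ}
    (hg : Integrable g (Qm d T₀ T)) (h : ∀ z : V d × ℝ, z.1 ≠ 0 → z.2 ∈ Ioc T₀ T → |F z| ≤ g z) :
    Integrable F (Qm d T₀ T) := by
  refine hg.mono' (aesm_Q hF T₀ T) ?_
  filter_upwards [ae_Q_mem T₀ T] with z hz using h z hz.1 hz.2

lemma Wave.lin (hu : Wave u) (hv : Wave v) (a b : ℝ) :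
    Wave (fun x t => a * u x t + b * v x t) := by
  have hcd := hu.cd.lin hv.cd a b
  have hi : ∀ t, Integrable (fun x => 2 * a ^ 2 * eDenFree u x t + 2 * b ^ 2 * eDenFree v x t) :=
    fun t => ((hu.int t).const_mul _).add ((hv.int t).const_mul _)
  have hInt : ∀ t, Integrable (fun x => eDenFree (fun x t => a * u x t + b * v x t) x t) := by
    intro t
    refine int_slice hcd.ceDen.contOn (hi t) fun x hx => ?_
    rw [abs_of_nonneg eDen_nonneg]
    exact eDen_lin_le hu.cd hv.cd a b hx
  refine ⟨(hu.cont.const_mul a).add (hv.cont.const_mul b), hcd, ?_, hInt, ?_⟩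
  · intro x t hx
    have h1 : D (fun x t => a * u x t + b * v x t) x = fun t => a * D u x t + b * D v x t := by
      ext s; exact D_lin (hu.cd.mono one_le_two) (hv.cd.mono one_le_two) a b hx
    rw [D, h1, (((hu.cd.cD.hasDerivAt hx).const_mul a).fun_add
      ((hv.cd.cD.hasDerivAt hx).const_mul b)).deriv, lap_lin hu.cd hv.cd a b hx,
      hu.pde x t hx, hv.pde x t hx]
    ring
  · obtain ⟨B, hB⟩ := hu.bdd
    obtain ⟨B', hB'⟩ := hv.bdd
    refine ⟨2 * a ^ 2 * B + 2 * b ^ 2 * B', fun t => ?_⟩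
    calc _ ≤ ∫ x, (2 * a ^ 2 * eDenFree u x t + 2 * b ^ 2 * eDenFree v x t) := by
          refine integral_mono_ae (hInt t) (hi t) ?_
          filter_upwards [ae_ne_zero] with x hx using eDen_lin_le hu.cd hv.cd a b hx
      _ ≤ _ := by
        rw [integral_add ((hu.int t).const_mul _) ((hv.int t).const_mul _), integral_const_mul,
          integral_const_mul]
        gcongr
        · exact hB t
        · exact hB' t

lemma D_time (σ τ : ℝ) : D (fun x t => u x (σ * t + τ)) = fun x t => σ * D u x (σ * t + τ) := by
  ext x t
  have h1 := deriv_comp_mul_left σ (fun s => u x (s + τ)) t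
  rw [deriv_comp_add_const] at h1
  simpa [D] using h1

lemma eDen_time {σ : ℝ} (hσ : σ ^ 2 = 1) (τ : ℝ) :
    eDenFree (fun x t => u x (σ * t + τ)) x t = eDenFree u x (σ * t + τ) := by
  rw [eDen_def, eDen_def, D_time, mul_pow, hσ, one_mul]; rfl

/-- Time translation and time reversal. -/
lemma Wave.time (hu : Wave u) {σ : ℝ} (hσ : σ ^ 2 = 1) (τ : ℝ) :
    Wave (fun x t => u x (σ * t + τ)) := by
  refine ⟨hu.cont.comp (f := fun q : V d × ℝ => (q.1, σ * q.2 + τ)) (by fun_prop), ?_, ?_, ?_, ?_⟩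
  · exact ContDiffOn.comp (g := fun q : V d × ℝ => u q.1 q.2)
      (f := fun q : V d × ℝ => (q.1, σ * q.2 + τ)) hu.cd (by fun_prop)
      fun q hq => ⟨hq.1, mem_univ _⟩
  · intro x t hx
    have h1 : D (D fun x t => u x (σ * t + τ)) x t = σ ^ 2 * D (D u) x (σ * t + τ) := by
      rw [D_time, D, deriv_const_mul_field]
      have := congrFun (congrFun (D_time (u := D u) σ τ) x) t
      rw [D] at this
      rw [this]; ring
    rw [h1, hσ, one_mul, hu.pde x _ hx]
  · intro t; simpa only [eDen_time hσ] using hu.int (σ * t + τ)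
  · obtain ⟨B, hB⟩ := hu.bdd
    exact ⟨B, fun t => by simpa only [eDen_time hσ] using hB (σ * t + τ)⟩

/-! ### Space-time integrability -/

/-- The energy density is integrable on time slabs. -/
lemma Wave.intQ (hu : Wave u) (T₀ T : ℝ) :
    Integrable (fun z : V d × ℝ => eDenFree u z.1 z.2) (Qm d T₀ T) := by
  have hm := aesm_Q hu.cd.ceDen.contOn T₀ T
  rw [Qm] at hm ⊢
  refine (integrable_prod_iff' hm).2 ⟨Eventually.of_forall fun t => hu.int t, ?_⟩
  obtain ⟨B, hB⟩ := hu.bdd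
  refine Integrable.of_bound (C := B) hm.norm.prod_swap.integral_prod_right'
    (Eventually.of_forall fun t => ?_)
  rw [Real.norm_of_nonneg (by positivity)]
  simpa only [Real.norm_of_nonneg eDen_nonneg] using hB t

/-- The function `1/|x|²` restricted to the unit ball. -/
noncomputable def rho (x : V d) : ℝ := (Metric.ball (0 : V d) 1).indicator (fun x => 1 / ‖x‖ ^ 2) x

lemma rho_nonneg (x : V d) : 0 ≤ rho x := indicator_nonneg (fun _ _ => by positivity) _

lemma integrable_rho : Integrable (rho : V d → ℝ) := by
  have hd : 3 ≤ d := Fact.out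
  refine (integrable_indicator_iff measurableSet_ball).2 ?_
  refine integrableOn_ball_of_norm_le_rpow (C := 1) (α := 2) (by simp; omega)
    (by simp; exact_mod_cast (by omega : 2 < d)) (Eventually.of_forall fun x => ?_)
    ((measurable_const.div (measurable_norm.pow_const 2)).aestronglyMeasurable)
  rw [Real.norm_of_nonneg (by positivity), Real.rpow_neg (norm_nonneg _)]
  simp

lemma integrable_rhoQ (T₀ T : ℝ) : Integrable (fun z : V d × ℝ => rho z.1) (Qm d T₀ T) :=
  integrable_rho.comp_fst _

lemma rho_of_lt (hx : ‖x‖ < 1) : rho x = 1 / ‖x‖ ^ 2 := by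
  rw [rho, indicator_of_mem (by simpa using hx)]

/-- A continuous function is bounded on the unit ball, uniformly on compact time intervals. -/
lemma exists_bound_near (h : Continuous (fun q : V d × ℝ => u q.1 q.2)) (T₀ T : ℝ) :
    ∃ K, 0 ≤ K ∧ ∀ x t, ‖x‖ < 1 → t ∈ Icc T₀ T → |u x t| ≤ K := by
  obtain ⟨K, hK⟩ := ((isCompact_closedBall (0 : V d) 1).prod
    (isCompact_Icc (a := T₀) (b := T))).exists_bound_of_continuousOn h.continuousOn
  refine ⟨max K 0, le_max_right _ _, fun x t hx ht => (hK (x, t) ⟨?_, ht⟩).trans (le_max_left _ _)⟩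
  simpa using hx.le

/-- The Hardy weight of a wave is controlled by its energy and its values near the origin. -/
lemma exists_hardy_bound (h : Continuous (fun q : V d × ℝ => u q.1 q.2)) (T₀ T : ℝ) :
    ∃ K, 0 ≤ K ∧ ∀ x t, t ∈ Icc T₀ T → u x t ^ 2 / ‖x‖ ^ 2 ≤ 2 * eDenFree u x t + K * rho x := by
  obtain ⟨K, hK0, hK⟩ := exists_bound_near h T₀ T
  refine ⟨K ^ 2, by positivity, fun x t ht => ?_⟩
  by_cases hx : ‖x‖ < 1
  · rw [rho_of_lt hx, mul_one_div]
    have : u x t ^ 2 ≤ K ^ 2 := sq_le_sq.2 (by rw [abs_of_nonneg hK0]; exact hK x t hx ht)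
    have h2 : u x t ^ 2 / ‖x‖ ^ 2 ≤ K ^ 2 / ‖x‖ ^ 2 := by gcongr
    linarith [eDen_nonneg (u := u) (x := x) (t := t)]
  · have hx1 : 1 ≤ ‖x‖ := not_lt.1 hx
    have : u x t ^ 2 / ‖x‖ ^ 2 ≤ u x t ^ 2 / ‖x‖ := by
      refine div_le_div_of_nonneg_left (sq_nonneg _) (by linarith) ?_
      nlinarith
    have := mul_nonneg (sq_nonneg K) (rho_nonneg x)
    linarith [pot_le (u := u) (x := x) (t := t)]

end waves

section radial

variable {d : ℕ} {u v : V d → ℝ → ℝ} {x : V d} {t : ℝ}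

lemma hasFDerivAt_norm_of_ne (hx : x ≠ 0) :
    HasFDerivAt (fun y : V d => ‖y‖) (innerSL ℝ (‖x‖⁻¹ • x)) x := by
  have h := ((hasStrictFDerivAt_norm_sq x).hasFDerivAt).sqrt (by simpa using hx)
  simp only [Real.sqrt_sq (norm_nonneg _)] at h
  refine h.congr_fderiv ?_
  ext w
  have : ‖x‖ ≠ 0 := norm_ne_zero_iff.2 hx
  simp [inner_smul_left]
  field_simp

lemma dvg_gr (h : CD 2 u) (hx : x ≠ 0) : dvg (fun y => gr u y t) x = lap (fun y => u y t) x :=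
  (h.lap_eq hx).symm

/-- Gradient of a radial weight `φ(t - |x|)`. -/
lemma hasFDerivAt_cone {φ : ℝ → ℝ} (hφ : Differentiable ℝ φ) (hx : x ≠ 0) :
    HasFDerivAt (fun y : V d => φ (t - ‖y‖)) (innerSL ℝ ((-deriv φ (t - ‖x‖) * ‖x‖⁻¹) • x)) x := by
  have h := (hφ (t - ‖x‖)).hasDerivAt.comp_hasFDerivAt x
    ((hasFDerivAt_norm_of_ne hx).const_sub t)
  refine h.congr_fderiv ?_
  ext w
  simp [inner_smul_left]
  ring

lemma hasDerivAt_eDen (h : CD 2 u) (hx : x ≠ 0) :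
    HasDerivAt (eDenFree u x) (⟪gr u x t, gr (D u) x t⟫ + D u x t * D (D u) x t +
      u x t * D u x t / ‖x‖) t := by
  have hx0 : ‖x‖ ≠ 0 := norm_ne_zero_iff.2 hx
  have h1 := (h.hasDerivAt_gr (t := t) hx).norm_sq
  have h2 := (h.cD.hasDerivAt (t := t) hx).fun_pow 2
  have h3 := (((h.mono one_le_two).hasDerivAt (t := t) hx).fun_pow 2).div_const (2 * ‖x‖)
  refine (((h1.const_mul (1 / 2)).fun_add (h2.const_mul (1 / 2))).fun_add h3).congr_deriv ?_
  field_simp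
  simp
  ring

variable [Fact (3 ≤ d)]

lemma mul_norm_gr_le : |D u x t| * ‖gr u x t‖ ≤ eDenFree u x t := by
  rw [eDen_def]
  nlinarith [sq_nonneg (|D u x t| - ‖gr u x t‖), sq_abs (D u x t),
    pot_nonneg (u := u) (x := x) (t := t)]

/-- The flux `|∂ₜu||∇u|/|x|` is controlled by the energy up to an integrable error near `0`. -/
lemma exists_flux_bound (hD : Continuous (fun q : V d × ℝ => D u q.1 q.2)) (T₀ T : ℝ) :
    ∃ K, 0 ≤ K ∧ ∀ x t, t ∈ Icc T₀ T →
      |D u x t| * ‖gr u x t‖ / ‖x‖ ≤ eDenFree u x t + K * rho x := by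
  obtain ⟨K, hK0, hK⟩ := exists_bound_near hD T₀ T
  refine ⟨K ^ 2, by positivity, fun x t ht => ?_⟩
  by_cases hx : ‖x‖ < 1
  · rw [rho_of_lt hx]
    have h1 : |D u x t| * ‖gr u x t‖ / ‖x‖ ≤ ‖gr u x t‖ * (K / ‖x‖) := by
      rw [mul_comm, mul_div_assoc]
      gcongr
      exact hK x t hx ht
    have h2 := gr_sq_le (u := u) (x := x) (t := t)
    have h3 : K ^ 2 * (1 / ‖x‖ ^ 2) = (K / ‖x‖) ^ 2 := by ring
    rw [h3]
    nlinarith [sq_nonneg (‖gr u x t‖ - K / ‖x‖), sq_nonneg (K / ‖x‖)]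
  · have h1 : |D u x t| * ‖gr u x t‖ / ‖x‖ ≤ |D u x t| * ‖gr u x t‖ :=
      div_le_self (by positivity) (not_lt.1 hx)
    linarith [mul_norm_gr_le (u := u) (x := x) (t := t), mul_nonneg (sq_nonneg K) (rho_nonneg x)]

lemma cdOn_cone {n : ℕ∞} {φ : ℝ → ℝ} (hφ : ContDiff ℝ n φ) (hn : n ≤ 1) :
    ContDiffOn ℝ n (fun q : V d × ℝ => φ (q.2 - ‖q.1‖)) (Om d) :=
  hφ.comp_contDiffOn (contDiffOn_snd.sub (cd_norm.of_le (by exact_mod_cast hn)))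

lemma contOn_cone {φ : ℝ → ℝ} (hφ : Continuous φ) :
    ContinuousOn (fun q : V d × ℝ => φ (q.2 - ‖q.1‖)) (Om d) := by fun_prop

/-- Integrability of the energy density against a bounded weight. -/
lemma Wave.int_mul (hu : Wave u) {w : V d → ℝ} (hw : Continuous w) {M : ℝ} (hM : ∀ x, |w x| ≤ M) :
    Integrable (fun x => w x * eDenFree u x t) :=
  (hu.int t).bdd_mul hw.aestronglyMeasurable (Eventually.of_forall hM)

/-- The weighted energy identity on light cones. -/
theorem cone_identity (hu : Wave u) (hD : Continuous (fun q : V d × ℝ => D u q.1 q.2))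
    {φ : ℝ → ℝ} (hφ : ContDiff ℝ 1 φ) {M : ℝ} (hM : ∀ s, |φ s| ≤ M) (hM' : ∀ s, |deriv φ s| ≤ M)
    {T₀ T : ℝ} (hT : T₀ ≤ T) :
    (∫ x, φ (T - ‖x‖) * eDenFree u x T) - ∫ x, φ (T₀ - ‖x‖) * eDenFree u x T₀ =
      ∫ z, deriv φ (z.2 - ‖z.1‖) * nd u z.1 z.2 ∂(Qm d T₀ T) := by
  have hφd : Differentiable ℝ φ := hφ.differentiable one_ne_zero
  have hdc : Continuous (deriv φ) := hφ.continuous_deriv le_rfl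
  have hcone := cdOn_cone (d := d) (n := 1) hφ le_rfl
  obtain ⟨K, hK0, hK⟩ := exists_flux_bound hD T₀ T
  refine spacetime_identity (F := fun x t => φ (t - ‖x‖) * eDenFree u x t)
    (H := fun x t => (φ (t - ‖x‖) * D u x t) • gr u x t)
    (k := fun x t => deriv φ (t - ‖x‖) * nd u x t)
    (ContDiffOn.mul hcone hu.cd.ceDen) (ContDiffOn.smul (hcone.mul hu.cd.cD) hu.cd.cgr) hT ?_
    (hu.int_mul (by fun_prop) fun _ => hM _) (hu.int_mul (by fun_prop) fun _ => hM _) ?_ ?_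
  · intro x t hx
    have hx0 : ‖x‖ ≠ 0 := norm_ne_zero_iff.2 hx
    have hp := (hasFDerivAt_cone (t := t) hφd hx).mul (hu.cd.cD.hasFDerivAt_gr (t := t) hx)
    have h1 := dvg_smul (f := fun y => φ (t - ‖y‖) * D u y t) (X := fun y => gr u y t)
      hp.differentiableAt (hu.cd.hasFDerivAt_hs (t := t) hx).differentiableAt
    rw [h1, dvg_gr hu.cd hx]
    have h2 : HasDerivAt (fun s => φ (s - ‖x‖)) (deriv φ (t - ‖x‖)) t :=
      (hφd (t - ‖x‖)).hasDerivAt.comp_sub_const t ‖x‖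
    have h3 := h2.mul (hasDerivAt_eDen (t := t) hu.cd hx)
    rw [D, HasDerivAt.deriv (f := fun t => φ (t - ‖x‖) * eDenFree u x t) h3]
    have h4 := hp.fderiv
    rw [show fderiv ℝ (fun y => φ (t - ‖y‖) * D u y t) x = _ from h4, nd, rd, hu.pde x t hx]
    simp [inner_smul_left, real_inner_comm]
    ring
  · refine int_Q ((contOn_cone hdc).mul hu.cd.cnd.contOn) ((hu.intQ T₀ T).const_mul (M * 2)) ?_
    intro z hz _
    have h0 := nd_nonneg (u := u) (x := z.1) (t := z.2)
    rw [abs_mul, abs_of_nonneg h0, mul_assoc]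
    exact mul_le_mul (hM' _) nd_le h0 ((abs_nonneg _).trans (hM' 0))
  · have hc := (hcone.mul hu.cd.cD).smul hu.cd.cgr
    refine int_Q (hc.continuousOn.norm.div (by fun_prop) fun q hq => Om_ne hq)
      (((hu.intQ T₀ T).add ((integrable_rhoQ T₀ T).const_mul K)).const_mul M) ?_
    intro z hz ht
    rw [abs_of_nonneg (by positivity), norm_smul, norm_mul]
    have h1 := hK z.1 z.2 (Ioc_subset_Icc_self ht)
    have h2 : ‖φ (z.2 - ‖z.1‖)‖ ≤ M := hM _
    calc _ = ‖φ (z.2 - ‖z.1‖)‖ * (|D u z.1 z.2| * ‖gr u z.1 z.2‖ / ‖z.1‖) := by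
          rw [Real.norm_eq_abs, Real.norm_eq_abs]; ring
      _ ≤ M * _ := mul_le_mul h2 h1 (by positivity) ((abs_nonneg _).trans h2)

/-- Conservation of energy. -/
theorem energy_conservation (hu : Wave u) (hD : Continuous (fun q : V d × ℝ => D u q.1 q.2))
    (s t : ℝ) : ∫ x, eDenFree u x s = ∫ x, eDenFree u x t := by
  wlog h : s ≤ t
  · exact (this hu hD t s (le_of_not_ge h)).symm
  have := cone_identity hu hD (φ := fun _ => 1) contDiff_const (M := 1) (by simp) (by simp) h
  simp only [one_mul, deriv_const, zero_mul, integral_zero] at this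
  linarith

/-- No energy escapes faster than light. -/
theorem outer_energy (hu : Wave u) (hD : Continuous (fun q : V d × ℝ => D u q.1 q.2)) {ε : ℝ}
    (hε : 0 < ε) : ∃ R, ∀ t, 0 ≤ t → ∫ x in {x : V d | t + R < ‖x‖}, eDenFree u x t ≤ ε := by
  have key : ∀ R t : ℝ, 0 ≤ t → ∫ x in {x : V d | t + R < ‖x‖}, eDenFree u x t ≤
      ∫ x, (1 - 2 / Real.pi * Real.arctan (0 - ‖x‖ + R)) * eDenFree u x 0 := by
    intro R t ht
    have hpi := Real.pi_pos
    have hder : ∀ s, HasDerivAt (fun s => 1 - 2 / Real.pi * Real.arctan (s + R))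
        (-(2 / Real.pi * (1 / (1 + (s + R) ^ 2)))) s := fun s => by
      have := (((hasDerivAt_id s).add_const R).arctan.const_mul (2 / Real.pi)).const_sub 1
      simpa using this
    have hde : deriv (fun s => 1 - 2 / Real.pi * Real.arctan (s + R)) =
        fun s => -(2 / Real.pi * (1 / (1 + (s + R) ^ 2))) := funext fun s => (hder s).deriv
    have hb : ∀ s, |2 / Real.pi * Real.arctan s| ≤ 1 := fun s => by
      rw [abs_mul, abs_of_pos (by positivity), div_mul_eq_mul_div, div_le_one hpi]
      have := abs_lt.2 ⟨Real.neg_pi_div_two_lt_arctan s, Real.arctan_lt_pi_div_two s⟩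
      linarith
    have h1 := cone_identity hu hD (φ := fun s => 1 - 2 / Real.pi * Real.arctan (s + R))
      (contDiff_const.sub (contDiff_const.mul (contDiff_id.add contDiff_const).arctan)) (M := 2)
      (fun s => by
        have := abs_le.1 (hb (s + R)); rw [abs_le]; constructor <;> linarith [this.1, this.2]) (fun s => by
        rw [hde]
        simp only [abs_neg]
        rw [abs_of_nonneg (by positivity)]
        have e1 : 2 / Real.pi ≤ 1 := by
          rw [div_le_one hpi]; linarith [Real.pi_gt_three]
        have e2 : 1 / (1 + (s + R) ^ 2) ≤ 1 := by
          rw [div_le_one (by positivity)]; nlinarith [sq_nonneg (s + R)]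
        have e3 : 0 ≤ 1 / (1 + (s + R) ^ 2) := by positivity
        nlinarith [show 0 < 2 / Real.pi by positivity]) ht
    have h2 : ∫ z, deriv (fun s => 1 - 2 / Real.pi * Real.arctan (s + R)) (z.2 - ‖z.1‖) *
        nd u z.1 z.2 ∂(Qm d 0 t) ≤ 0 := by
      refine integral_nonpos fun z => ?_
      rw [hde]
      have : 0 ≤ 2 / Real.pi * (1 / (1 + (z.2 - ‖z.1‖ + R) ^ 2)) := by positivity
      simp only [Pi.zero_apply, neg_mul, Left.neg_nonpos_iff]
      exact mul_nonneg this nd_nonneg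
    have hw : Integrable (fun x => (1 - 2 / Real.pi * Real.arctan (t - ‖x‖ + R)) *
        eDenFree u x t) := hu.int_mul (by fun_prop) (M := 2) fun x => by
        have := abs_le.1 (hb (t - ‖x‖ + R)); rw [abs_le]; constructor <;> linarith [this.1, this.2]
    have hms : MeasurableSet {x : V d | t + R < ‖x‖} := measurableSet_lt measurable_const
      measurable_norm
    have h3 : ∫ x in {x : V d | t + R < ‖x‖}, eDenFree u x t ≤
        ∫ x, (1 - 2 / Real.pi * Real.arctan (t - ‖x‖ + R)) * eDenFree u x t := by
      rw [← integral_indicator hms]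
      refine integral_mono ((hu.int t).indicator hms) hw fun x => ?_
      by_cases hx : t + R < ‖x‖
      · rw [indicator_of_mem (show x ∈ {x : V d | t + R < ‖x‖} from hx)]
        have : Real.arctan (t - ‖x‖ + R) ≤ 0 := by
          rw [← Real.arctan_zero]; exact Real.arctan_mono (by linarith)
        have h5 : 2 / Real.pi * Real.arctan (t - ‖x‖ + R) ≤ 0 :=
          mul_nonpos_of_nonneg_of_nonpos (by positivity) this
        have := eDen_nonneg (u := u) (x := x) (t := t)
        simp only
        nlinarith
      · rw [indicator_of_notMem (show x ∉ {x : V d | t + R < ‖x‖} from hx)]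
        have := (abs_le.1 (hb (t - ‖x‖ + R))).2
        exact mul_nonneg (by linarith) eDen_nonneg
    linarith
  have hlim : Tendsto (fun R : ℝ => ∫ x, (1 - 2 / Real.pi * Real.arctan (0 - ‖x‖ + R)) *
      eDenFree u x 0) atTop (𝓝 (∫ x : V d, (0 : ℝ))) := by
    refine tendsto_integral_filter_of_dominated_convergence (fun x => 2 * eDenFree u x 0)
      (Eventually.of_forall fun R => ?_) (Eventually.of_forall fun R => ?_)
      ((hu.int 0).const_mul 2) ?_
    · exact (by fun_prop : Continuous fun x : V d =>
        (1 - 2 / Real.pi * Real.arctan (0 - ‖x‖ + R))).aestronglyMeasurable.mul (hu.int 0).1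
    · refine Eventually.of_forall fun x => ?_
      rw [norm_mul, Real.norm_of_nonneg eDen_nonneg]
      refine mul_le_mul_of_nonneg_right ?_ eDen_nonneg
      have hpi := Real.pi_pos
      rw [Real.norm_eq_abs, abs_le]
      have e1 := Real.neg_pi_div_two_lt_arctan (0 - ‖x‖ + R)
      have e2 := Real.arctan_lt_pi_div_two (0 - ‖x‖ + R)
      have e3 : 2 / Real.pi * Real.arctan (0 - ‖x‖ + R) ≤ 1 := by
        rw [div_mul_eq_mul_div, div_le_one hpi]; linarith
      have e4 : -1 ≤ 2 / Real.pi * Real.arctan (0 - ‖x‖ + R) := by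
        rw [div_mul_eq_mul_div, le_div_iff₀ hpi]; linarith
      constructor <;> linarith
    · refine Eventually.of_forall fun x => ?_
      have h1 : Tendsto (fun R => Real.arctan (0 - ‖x‖ + R)) atTop (𝓝 (Real.pi / 2)) :=
        (Real.tendsto_arctan_atTop.mono_right nhdsWithin_le_nhds).comp
          (tendsto_atTop_add_const_left _ _ tendsto_id)
      have h2 := ((h1.const_mul (2 / Real.pi)).const_sub 1).mul_const (eDenFree u x 0)
      have h3 : (1 - 2 / Real.pi * (Real.pi / 2)) * eDenFree u x 0 = 0 := by
        have := Real.pi_pos.ne'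
        field_simp
        ring
      rwa [h3] at h2
  simp only [integral_zero] at hlim
  obtain ⟨R, hR⟩ := (hlim.eventually (ge_mem_nhds hε)).exists
  exact ⟨R, fun t ht => (key R t ht).trans hR⟩

end radial

section incoming

variable {d : ℕ} {u v : V d → ℝ → ℝ} {x : V d} {t : ℝ}

lemma dvg_add_smul_clm {f₁ f₂ : V d → ℝ} {X₁ X₂ : V d → V d} {g₁ g₂ : V d →L[ℝ] ℝ}
    {L₁ L₂ : V d →L[ℝ] V d}
    (hf₁ : HasFDerivAt f₁ g₁ x) (hX₁ : HasFDerivAt X₁ L₁ x)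
    (hf₂ : HasFDerivAt f₂ g₂ x) (hX₂ : HasFDerivAt X₂ L₂ x) :
    dvg (fun y => f₁ y • X₁ y + f₂ y • X₂ y) x =
      (g₁ (X₁ x) + f₁ x * ∑ i : Fin d, (L₁ (EuclideanSpace.single i 1)) i) +
      (g₂ (X₂ x) + f₂ x * ∑ i : Fin d, (L₂ (EuclideanSpace.single i 1)) i) := by
  have e : ∀ g : V d →L[ℝ] ℝ, g = innerSL ℝ ((InnerProductSpace.toDual ℝ (V d)).symm g) := by
    intro g; ext w; simp
  rw [dvg_add_smul (hf₁.congr_fderiv (e g₁)) hX₁ (hf₂.congr_fderiv (e g₂)) hX₂]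
  simp

lemma _root_.HasFDerivAt.sq_real {f : V d → ℝ} {f' : V d →L[ℝ] ℝ} (h : HasFDerivAt f f' x) :
    HasFDerivAt (fun y => f y ^ 2) ((2 * f x) • f') x := by
  simp only [pow_two]
  refine (h.fun_mul h).congr_fderiv ?_
  ext w
  simp
  ring

lemma hasFDerivAt_inv_norm (hx : x ≠ 0) :
    HasFDerivAt (fun y : V d => ‖y‖⁻¹) (innerSL ℝ ((-‖x‖⁻¹ ^ 3) • x)) x := by
  have h := (hasDerivAt_inv (norm_ne_zero_iff.2 hx)).comp_hasFDerivAt x (hasFDerivAt_norm_of_ne hx)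
  refine h.congr_fderiv ?_
  ext w
  simp [inner_smul_left]
  ring

/-- The constant `(d-1)/2`. -/
noncomputable def kap (d : ℕ) : ℝ := ((d : ℝ) - 1) / 2

/-- The outgoing derivative `u_t + u_r + (d-1)/2 u/r`. -/
noncomputable def mo (u : V d → ℝ → ℝ) (x : V d) (t : ℝ) : ℝ :=
  D u x t + rd u x t + kap d * (u x t * ‖x‖⁻¹)

/-- The effective radial potential. -/
noncomputable def Wp (x : V d) : ℝ := ‖x‖⁻¹ + kap d * (kap d - 1) * ‖x‖⁻¹ ^ 2

/-- The density associated with the outgoing derivative. -/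
noncomputable def io (u : V d → ℝ → ℝ) (x : V d) (t : ℝ) : ℝ :=
  (1 / 2) * (mo u x t ^ 2 + an u x t + Wp x * u x t ^ 2)

/-- Scalar part of the flux in the outgoing identity. -/
noncomputable def gfl (u : V d → ℝ → ℝ) (x : V d) (t : ℝ) : ℝ :=
  ‖x‖⁻¹ * ((1 / 2) * (mo u x t ^ 2 - an u x t - Wp x * u x t ^ 2) - mo u x t * rd u x t)

lemma rd_hasFDerivAt (h : CD 2 u) (hx : x ≠ 0) :
    HasFDerivAt (fun y => rd u y t) (innerSL ℝ (‖x‖⁻¹ • gr u x t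
      + (-‖x‖⁻¹ ^ 3 * ⟪gr u x t, x⟫) • x) + ‖x‖⁻¹ • (innerSL ℝ x).comp (hs u x t)) x := by
  have h1 := ((h.hasFDerivAt_hs (t := t) hx).inner ℝ (hasFDerivAt_id x)).mul
    (hasFDerivAt_inv_norm hx)
  refine (h1.congr_of_eventuallyEq (Eventually.of_forall fun y => ?_)).congr_fderiv ?_
  · simp [rd, div_eq_mul_inv]
  · ext w
    simp [fderivInnerCLM_apply, inner_smul_left, inner_add_left]
    rw [real_inner_comm x (hs u x t w)]
    ring

lemma an_hasFDerivAt (h : CD 2 u) (hx : x ≠ 0) :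
    HasFDerivAt (fun y => an u y t) ((2 : ℝ) • (innerSL ℝ (gr u x t)).comp (hs u x t) -
      (2 * rd u x t) • (innerSL ℝ (‖x‖⁻¹ • gr u x t
      + (-‖x‖⁻¹ ^ 3 * ⟪gr u x t, x⟫) • x) + ‖x‖⁻¹ • (innerSL ℝ x).comp (hs u x t))) x := by
  have h1 := (h.hasFDerivAt_hs (t := t) hx).norm_sq
  have h2 := HasFDerivAt.sq_real (rd_hasFDerivAt (t := t) h hx)
  refine (h1.fun_sub h2).congr_fderiv ?_
  ext w
  simp

lemma rd_hasDerivAt (h : CD 2 u) (hx : x ≠ 0) : HasDerivAt (rd u x) (rd (D u) x t) t := by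
  have := ((h.hasDerivAt_gr (t := t) hx).inner ℝ (hasDerivAt_const t x)).div_const ‖x‖
  refine this.congr_deriv ?_
  simp [rd]

lemma an_hasDerivAt (h : CD 2 u) (hx : x ≠ 0) : HasDerivAt (an u x)
    (2 * ⟪gr u x t, gr (D u) x t⟫ - 2 * rd u x t * rd (D u) x t) t := by
  have := ((h.hasDerivAt_gr (t := t) hx).norm_sq).fun_sub
    ((rd_hasDerivAt (t := t) h hx).fun_pow 2)
  refine this.congr_deriv ?_
  simp

/-- The pointwise identity for the outgoing density. -/
lemma outgoing_pointwise (hu : Wave u) (hx : x ≠ 0) {a : V d → ℝ → ℝ} {ar at' : ℝ}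
    (ha : HasFDerivAt (fun y => a y t) (innerSL ℝ ((ar * ‖x‖⁻¹) • x)) x)
    (ha' : HasDerivAt (a x) at' t) :
    D (fun x t => a x t * io u x t) x t =
      dvg (fun y => (a y t * mo u y t) • gr u y t + (a y t * gfl u y t) • y) x +
      ((1 / 2) * (at' - ar) * mo u x t ^ 2 + (1 / 2) * (at' + ar) * (an u x t + Wp x * u x t ^ 2) -
        a x t * (an u x t * ‖x‖⁻¹ + (1 / 2) * (‖x‖⁻¹ ^ 2 + 2 * kap d * (kap d - 1) * ‖x‖⁻¹ ^ 3) *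
          u x t ^ 2)) := by
  have hcd := hu.cd
  have h0 := hasFDerivAt_inv_norm hx
  have hU := (hcd.mono one_le_two).hasFDerivAt_gr (t := t) hx
  have hP := hcd.cD.hasFDerivAt_gr (t := t) hx
  have hR := rd_hasFDerivAt (t := t) hcd hx
  have hA := an_hasFDerivAt (t := t) hcd hx
  have hM := (hP.fun_add hR).fun_add ((hU.fun_mul h0).const_mul (kap d))
  have hW := h0.fun_add ((HasFDerivAt.sq_real h0).const_mul (kap d * (kap d - 1)))
  have hG := h0.fun_mul (((((HasFDerivAt.sq_real hM).fun_sub hA).fun_sub (hW.fun_mul (HasFDerivAt.sq_real hU))).const_mul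
    (1 / 2)).fun_sub (hM.fun_mul hR))
  have hdiv := dvg_add_smul_clm (ha.fun_mul hM) (hcd.hasFDerivAt_hs (t := t) hx) (ha.fun_mul hG)
    (hasFDerivAt_id x)
  have hMt := ((hcd.cD.hasDerivAt (t := t) hx).fun_add (rd_hasDerivAt (t := t) hcd hx)).fun_add
    ((((hcd.mono one_le_two).hasDerivAt (t := t) hx).mul_const ‖x‖⁻¹).const_mul (kap d))
  have hIt := (((hMt.fun_pow 2).fun_add (an_hasDerivAt (t := t) hcd hx)).fun_add
    ((((hcd.mono one_le_two).hasDerivAt (t := t) hx).fun_pow 2).const_mul (Wp x))).const_mul (1 / 2)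
  have hF := (ha'.mul hIt).deriv
  have hF' : D (fun x t => a x t * io u x t) x t = _ := hF
  rw [hF']
  have hdiv' : dvg (fun y => (a y t * mo u y t) • gr u y t + (a y t * gfl u y t) • y) x = _ := hdiv
  rw [hdiv', ← hcd.lap_eq hx, sum_single_id]
  have hr : ‖x‖ ≠ 0 := norm_ne_zero_iff.2 hx
  have hs1 : ⟪x, hs u x t (gr u x t)⟫ = ⟪gr u x t, hs u x t x⟫ := by
    rw [real_inner_comm, hcd.hs_symm hx, real_inner_comm]
  have hd : (d : ℝ) = 2 * kap d + 1 := by rw [kap]; ring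
  have han : ⟪gr u x t, gr u x t⟫ = an u x t + rd u x t ^ 2 := by
    rw [real_inner_self_eq_norm_sq, an]; ring
  have hgx : ⟪gr u x t, x⟫ = rd u x t * ‖x‖ := by rw [rd]; field_simp
  have hpx : ⟪gr (D u) x t, x⟫ = rd (D u) x t * ‖x‖ := by rw [rd]; field_simp
  simp only [ContinuousLinearMap.add_apply, ContinuousLinearMap.sub_apply,
    ContinuousLinearMap.smul_apply, innerSL_apply_apply, ContinuousLinearMap.comp_apply,
    inner_smul_left, inner_add_left, smul_eq_mul, real_inner_self_eq_norm_sq, id,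
    real_inner_comm (gr u x t) x, real_inner_comm (gr u x t) (gr (D u) x t), hs1, hcd.hs_symm hx x,
    hu.pde x t hx, conj_trivial, hd, Wp, mo, gfl, io, hgx, hpx]
  rw [show ‖gr u x t‖ ^ 2 = an u x t + rd u x t ^ 2 by rw [an]; ring]
  simp only [Nat.cast_ofNat, Nat.add_one_sub_one, pow_one]
  generalize ‖x‖ = r at hr ⊢
  generalize rd u x t = R, rd (D u) x t = R', D u x t = P, u x t = U, an u x t = A, kap d = κ,
    a x t = a₀, lap (fun y => u y t) x = L, ⟪gr u x t, (hs u x t) x⟫ = h₁,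
    ⟪x, (hs u x t) x⟫ = h₂, ⟪gr u x t, gr (D u) x t⟫ = h₃
  field_simp
  ring

lemma mo_sq_le : mo u x t ^ 2 ≤
    3 * (D u x t ^ 2 + rd u x t ^ 2 + kap d ^ 2 * (u x t ^ 2 / ‖x‖ ^ 2)) := by
  have : u x t ^ 2 / ‖x‖ ^ 2 = (u x t * ‖x‖⁻¹) ^ 2 := by rw [div_eq_mul_inv]; ring
  rw [mo, this]
  nlinarith [sq_nonneg (D u x t - rd u x t), sq_nonneg (D u x t - kap d * (u x t * ‖x‖⁻¹)),
    sq_nonneg (rd u x t - kap d * (u x t * ‖x‖⁻¹))]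

lemma Wp_mul : Wp x * u x t ^ 2 = u x t ^ 2 / ‖x‖ +
    kap d * (kap d - 1) * (u x t ^ 2 / ‖x‖ ^ 2) := by
  rw [Wp]; simp only [div_eq_mul_inv]; ring

lemma eDen_sum : D u x t ^ 2 + rd u x t ^ 2 + an u x t + u x t ^ 2 / ‖x‖ = 2 * eDenFree u x t := by
  rw [eDen_eq, mul_comm 2 ‖x‖, div_mul_eq_div_div]; ring

variable [Fact (3 ≤ d)]

lemma one_le_kap : 1 ≤ kap d := by
  have : (3 : ℝ) ≤ d := by exact_mod_cast (Fact.out : 3 ≤ d)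
  rw [kap]; linarith

lemma Wp_nonneg : 0 ≤ Wp x := by
  have := one_le_kap (d := d)
  have h : 0 ≤ kap d * (kap d - 1) := mul_nonneg (by linarith) (by linarith)
  rw [Wp]; positivity

lemma io_nonneg : 0 ≤ io u x t := by
  have := mul_nonneg (Wp_nonneg (x := x)) (sq_nonneg (u x t))
  rw [io]; linarith [sq_nonneg (mo u x t), an_nonneg (u := u) (x := x) (t := t)]

lemma io_le : io u x t ≤ 3 * eDenFree u x t + 2 * kap d ^ 2 * (u x t ^ 2 / ‖x‖ ^ 2) := by
  have h1 := mo_sq_le (u := u) (x := x) (t := t)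
  have h2 := eDen_sum (u := u) (x := x) (t := t)
  have h3 := one_le_kap (d := d)
  have h4 : 0 ≤ u x t ^ 2 / ‖x‖ ^ 2 := by positivity
  have h5 : 0 ≤ u x t ^ 2 / ‖x‖ := by positivity
  rw [io, Wp_mul]
  nlinarith [an_nonneg (u := u) (x := x) (t := t), mul_nonneg (by linarith : 0 ≤ kap d) h4]

/-- The radial weight `r/(r+M)`. -/
noncomputable def al (M : ℝ) (x : V d) : ℝ := ‖x‖ / (‖x‖ + M)

/-- The coercive bulk density in the outgoing identity. -/
noncomputable def good (M : ℝ) (u : V d → ℝ → ℝ) (x : V d) (t : ℝ) : ℝ :=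
  M / 2 / (‖x‖ + M) ^ 2 * mo u x t ^ 2 + (‖x‖ + M / 2) / (‖x‖ + M) ^ 2 * an u x t +
    1 / 2 / (‖x‖ + M) ^ 2 * u x t ^ 2 +
    kap d * (kap d - 1) * (‖x‖ + M / 2) / (‖x‖ + M) ^ 2 * (u x t ^ 2 / ‖x‖ ^ 2)

variable {M : ℝ}

lemma al_nonneg (hM : 0 < M) : 0 ≤ al M x := by rw [al]; positivity

lemma al_le_one (hM : 0 < M) : al M x ≤ 1 := by
  rw [al, div_le_one (by positivity)]; linarith

lemma al_div_le (hM : 0 < M) : al M x / ‖x‖ ≤ 1 / M := by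
  rw [al, div_right_comm]
  rcases eq_or_ne ‖x‖ 0 with h | h
  · rw [h]; simp; positivity
  · rw [div_self h]
    gcongr
    linarith [norm_nonneg x]

lemma good_nonneg (hM : 0 < M) : 0 ≤ good M u x t := by
  have := one_le_kap (d := d)
  have h : 0 ≤ kap d * (kap d - 1) := mul_nonneg (by linarith) (by linarith)
  have := an_nonneg (u := u) (x := x) (t := t)
  rw [good]; positivity

lemma good_le (hM : 0 < M) (hx : x ≠ 0) : good M u x t ≤
    2 / M * io u x t + 1 / 2 * (u x t ^ 2 / ‖x‖ ^ 2) := by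
  have h1 := one_le_kap (d := d)
  have h : 0 ≤ kap d * (kap d - 1) := mul_nonneg (by linarith) (by linarith)
  have hr : 0 < ‖x‖ := norm_pos_iff.2 hx
  have ha := an_nonneg (u := u) (x := x) (t := t)
  have e1 : M / 2 / (‖x‖ + M) ^ 2 ≤ 1 / M := by
    rw [div_le_div_iff₀ (by positivity) hM]; nlinarith
  have e2 : (‖x‖ + M / 2) / (‖x‖ + M) ^ 2 ≤ 1 / M := by
    rw [div_le_div_iff₀ (by positivity) hM]; nlinarith
  have e3 : 1 / 2 / (‖x‖ + M) ^ 2 * u x t ^ 2 ≤ 1 / 2 * (u x t ^ 2 / ‖x‖ ^ 2) := by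
    rw [div_mul_eq_mul_div, mul_div_assoc']
    gcongr
    linarith
  have e4 : 2 / M * io u x t = 1 / M * mo u x t ^ 2 + 1 / M * an u x t + 1 / M * (u x t ^ 2 / ‖x‖) +
      kap d * (kap d - 1) * (1 / M) * (u x t ^ 2 / ‖x‖ ^ 2) := by rw [io, Wp_mul]; ring
  have e5 : 0 ≤ 1 / M * (u x t ^ 2 / ‖x‖) := by positivity
  rw [good, e4, mul_div_assoc]
  have f1 := mul_le_mul_of_nonneg_right e1 (sq_nonneg (mo u x t))
  have f2 := mul_le_mul_of_nonneg_right e2 ha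
  have f3 := mul_le_mul_of_nonneg_right (mul_le_mul_of_nonneg_left e2 h)
    (show 0 ≤ u x t ^ 2 / ‖x‖ ^ 2 by positivity)
  linarith

lemma CD.cio_bundle (h : CD 2 u) :
    ContDiffOn ℝ 1 (fun q : V d × ℝ => mo u q.1 q.2) (Om d) ∧
    ContDiffOn ℝ 1 (fun q : V d × ℝ => Wp q.1) (Om d) ∧
    ContDiffOn ℝ 1 (fun q : V d × ℝ => io u q.1 q.2) (Om d) ∧
    ContDiffOn ℝ 1 (fun q : V d × ℝ => gfl u q.1 q.2) (Om d) := by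
  obtain ⟨h1, h2, h3, h4, h5, h6, h7⟩ := h.bundle
  have hm : ContDiffOn ℝ 1 (fun q : V d × ℝ => mo u q.1 q.2) (Om d) := by
    unfold mo; fun_prop (disch := assumption)
  have hw : ContDiffOn ℝ 1 (fun q : V d × ℝ => Wp q.1) (Om d) := by
    unfold Wp; fun_prop (disch := assumption)
  refine ⟨hm, hw, ?_, ?_⟩
  · unfold io; fun_prop (disch := assumption)
  · unfold gfl; fun_prop (disch := assumption)

lemma cd_al (hM : 0 < M) : ContDiffOn ℝ 1 (fun q : V d × ℝ => al M q.1) (Om d) :=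
  cd_norm.div (cd_norm.add contDiffOn_const) fun q _ => by positivity

lemma CD.cont_good (h : CD 2 u) (hM : 0 < M) :
    ContinuousOn (fun q : V d × ℝ => good M u q.1 q.2) (Om d) := by
  obtain ⟨h1, h2, h3, h4, h5, h6⟩ := h.cbundle
  have hm := h.cio_bundle.1.continuousOn
  have h7 : ∀ q ∈ Om d, (‖q.1‖ + M) ^ 2 ≠ 0 := fun q _ => by positivity
  have h8 : ∀ q ∈ Om d, ‖q.1‖ ^ 2 ≠ 0 := fun q hq => pow_ne_zero 2 (h6 q hq)
  unfold good
  fun_prop (disch := assumption)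

/-- Integrability of the Hardy density on time slices. -/
lemma Wave.int_hardy (hu : Wave u) (t : ℝ) : Integrable (fun x => u x t ^ 2 / ‖x‖ ^ 2) := by
  obtain ⟨K, hK0, hK⟩ := exists_hardy_bound hu.cont t t
  obtain ⟨h1, h2, h3, h4, h5, h6⟩ := hu.cd.cbundle
  refine int_slice (F := fun q => u q.1 q.2 ^ 2 / ‖q.1‖ ^ 2) (t := t)
    ((h1.pow 2).div (by fun_prop) fun q hq => pow_ne_zero 2 (h6 q hq))
    (((hu.int t).const_mul 2).add (integrable_rho.const_mul K)) fun x _ => ?_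
  rw [abs_of_nonneg (by positivity)]
  exact hK x t ⟨le_rfl, le_rfl⟩

lemma Wave.intQ_hardy (hu : Wave u) (T₀ T : ℝ) :
    Integrable (fun z : V d × ℝ => u z.1 z.2 ^ 2 / ‖z.1‖ ^ 2) (Qm d T₀ T) := by
  obtain ⟨K, hK0, hK⟩ := exists_hardy_bound hu.cont T₀ T
  obtain ⟨h1, h2, h3, h4, h5, h6⟩ := hu.cd.cbundle
  refine int_Q (F := fun q => u q.1 q.2 ^ 2 / ‖q.1‖ ^ 2)
    ((h1.pow 2).div (by fun_prop) fun q hq => pow_ne_zero 2 (h6 q hq))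
    (((hu.intQ T₀ T).const_mul 2).add ((integrable_rhoQ T₀ T).const_mul K)) fun z _ ht => ?_
  rw [abs_of_nonneg (by positivity)]
  exact hK _ _ (Ioc_subset_Icc_self ht)

lemma Wave.int_io (hu : Wave u) (t : ℝ) : Integrable (fun x => io u x t) :=
  int_slice (F := fun q => io u q.1 q.2) (t := t) hu.cd.cio_bundle.2.2.1.continuousOn
    (((hu.int t).const_mul 3).add ((hu.int_hardy t).const_mul (2 * kap d ^ 2))) fun x _ => by
      rw [abs_of_nonneg io_nonneg]; exact io_le

lemma Wave.intQ_io (hu : Wave u) (T₀ T : ℝ) :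
    Integrable (fun z : V d × ℝ => io u z.1 z.2) (Qm d T₀ T) :=
  int_Q hu.cd.cio_bundle.2.2.1.continuousOn
    (((hu.intQ T₀ T).const_mul 3).add ((hu.intQ_hardy T₀ T).const_mul (2 * kap d ^ 2))) fun z _ _ => by
      rw [abs_of_nonneg io_nonneg]; exact io_le

lemma Wave.intQ_good (hu : Wave u) (hM : 0 < M) (T₀ T : ℝ) :
    Integrable (fun z : V d × ℝ => good M u z.1 z.2) (Qm d T₀ T) :=
  int_Q (hu.cd.cont_good hM) (((hu.intQ_io T₀ T).const_mul (2 / M)).add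
    ((hu.intQ_hardy T₀ T).const_mul (1 / 2))) fun z hz _ => by
      rw [abs_of_nonneg (good_nonneg hM)]; exact good_le hM hz

lemma mo_sq_le_io : mo u x t ^ 2 ≤ 2 * io u x t := by
  have := mul_nonneg (Wp_nonneg (x := x)) (sq_nonneg (u x t))
  rw [io]; linarith [sq_nonneg (mo u x t), an_nonneg (u := u) (x := x) (t := t)]

lemma contOn_al (hM : 0 < M) : ContinuousOn (fun q : V d × ℝ => al M q.1) (Om d) :=
  (cd_al hM).continuousOn

lemma cont_al (hM : 0 < M) : Continuous (al M : V d → ℝ) :=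
  continuous_norm.div (by fun_prop) fun x => by positivity

lemma hasFDerivAt_al (hM : 0 < M) (hx : x ≠ 0) :
    HasFDerivAt (al M) (innerSL ℝ ((M / (‖x‖ + M) ^ 2 * ‖x‖⁻¹) • x)) x := by
  have h : ‖x‖ + M ≠ 0 := by positivity
  have h1 : HasDerivAt (fun r : ℝ => r / (r + M)) (M / (‖x‖ + M) ^ 2) ‖x‖ := by
    refine ((hasDerivAt_id ‖x‖).fun_div ((hasDerivAt_id ‖x‖).add_const M) h).congr_deriv ?_
    simp
  have h2 := h1.comp_hasFDerivAt x (hasFDerivAt_norm_of_ne hx)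
  refine h2.congr_fderiv ?_
  ext w
  simp [inner_smul_left]
  ring

lemma Wave.int_aio (hu : Wave u) (hM : 0 < M) {h : ℝ → ℝ} (hh : Continuous h) {K : ℝ}
    (hb : ∀ s, |h s| ≤ K) (t : ℝ) :
    Integrable (fun x => h (t - ‖x‖) * al M x * io u x t) := by
  refine (hu.int_io t).bdd_mul (c := K) ?_ (Eventually.of_forall fun x => ?_)
  · have := cont_al (d := d) hM
    exact (by fun_prop : Continuous fun x : V d => h (t - ‖x‖) * al M x).aestronglyMeasurable
  · rw [norm_mul, Real.norm_of_nonneg (al_nonneg hM)]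
    have := mul_le_mul (hb (t - ‖x‖)) (al_le_one (x := x) hM) (al_nonneg hM)
      ((abs_nonneg _).trans (hb 0))
    simpa using this

/-- The integrated identity for the outgoing density. -/
theorem outgoing_identity (hu : Wave u) (hM : 0 < M) {h : ℝ → ℝ} (hh : ContDiff ℝ 1 h) {K : ℝ}
    (hb : ∀ s, |h s| ≤ K) (hb' : ∀ s, |deriv h s| ≤ K) {T₀ T : ℝ} (hT : T₀ ≤ T) :
    (∫ x, h (T - ‖x‖) * al M x * io u x T) - ∫ x, h (T₀ - ‖x‖) * al M x * io u x T₀ =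
      (∫ z, deriv h (z.2 - ‖z.1‖) * al M z.1 * mo u z.1 z.2 ^ 2 ∂(Qm d T₀ T)) -
        ∫ z, h (z.2 - ‖z.1‖) * good M u z.1 z.2 ∂(Qm d T₀ T) := by
  have hK0 : 0 ≤ K := (abs_nonneg _).trans (hb 0)
  have hhd : Differentiable ℝ h := hh.differentiable one_ne_zero
  have hdc : Continuous (deriv h) := hh.continuous_deriv le_rfl
  have hcone := cdOn_cone (d := d) (n := 1) hh le_rfl
  obtain ⟨cm, cw, ci, cg⟩ := hu.cd.cio_bundle
  have hi1 : Integrable (fun z : V d × ℝ => deriv h (z.2 - ‖z.1‖) * al M z.1 * mo u z.1 z.2 ^ 2)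
      (Qm d T₀ T) := by
    refine int_Q (((contOn_cone hdc).mul (contOn_al hM)).mul (cm.continuousOn.pow 2))
      ((hu.intQ_io T₀ T).const_mul (K * 1 * 2)) fun z _ _ => ?_
    rw [abs_mul, abs_mul, abs_of_nonneg (al_nonneg hM), abs_of_nonneg (sq_nonneg (mo u z.1 z.2))]
    have h1 := mul_le_mul (hb' (z.2 - ‖z.1‖)) (al_le_one (x := z.1) hM) (al_nonneg hM) hK0
    rw [mul_assoc (K * 1)]
    exact mul_le_mul h1 mo_sq_le_io (sq_nonneg _) (by positivity)
  have hi2 : Integrable (fun z : V d × ℝ => h (z.2 - ‖z.1‖) * good M u z.1 z.2) (Qm d T₀ T) := by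
    refine int_Q ((contOn_cone hh.continuous).mul (hu.cd.cont_good hM))
      ((hu.intQ_good hM T₀ T).const_mul K) fun z _ _ => ?_
    rw [abs_mul, abs_of_nonneg (good_nonneg hM)]
    exact mul_le_mul_of_nonneg_right (hb _) (good_nonneg hM)
  rw [← integral_sub hi1 hi2]
  refine spacetime_identity (F := fun x t => h (t - ‖x‖) * al M x * io u x t)
    (H := fun x t => (h (t - ‖x‖) * al M x * mo u x t) • gr u x t +
      (h (t - ‖x‖) * al M x * gfl u x t) • x)
    (k := fun x t => deriv h (t - ‖x‖) * al M x * mo u x t ^ 2 - h (t - ‖x‖) * good M u x t)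
    ((hcone.mul (cd_al hM)).mul ci)
    (((((hcone.mul (cd_al hM)).mul cm)).smul hu.cd.cgr).add
      (((hcone.mul (cd_al hM)).mul cg).smul contDiffOn_fst)) hT ?_
    (hu.int_aio hM hh.continuous hb _) (hu.int_aio hM hh.continuous hb _) (hi1.sub hi2) ?_
  · intro x t hx
    have hr : ‖x‖ ≠ 0 := norm_ne_zero_iff.2 hx
    have hrM : ‖x‖ + M ≠ 0 := by positivity
    have h1 : HasFDerivAt (fun y => h (t - ‖y‖) * al M y) (innerSL ℝ
        (((-deriv h (t - ‖x‖) * al M x + h (t - ‖x‖) * (M / (‖x‖ + M) ^ 2)) * ‖x‖⁻¹) • x)) x := by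
      refine ((hasFDerivAt_cone (t := t) hhd hx).fun_mul (hasFDerivAt_al hM hx)).congr_fderiv ?_
      ext w
      simp [inner_smul_left]
      ring
    have h2 : HasDerivAt (fun s => h (s - ‖x‖) * al M x) (deriv h (t - ‖x‖) * al M x) t :=
      ((hhd (t - ‖x‖)).hasDerivAt.comp_sub_const t ‖x‖).mul_const _
    rw [outgoing_pointwise (a := fun x t => h (t - ‖x‖) * al M x) hu hx h1 h2]
    congr 1
    rw [good, al, Wp]
    generalize ‖x‖ = r at hr hrM ⊢
    field_simp
    ring
  · have hc := ((((hcone.mul (cd_al hM)).mul cm)).smul hu.cd.cgr).add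
      (((hcone.mul (cd_al hM)).mul cg).smul contDiffOn_fst)
    refine int_Q (hc.continuousOn.norm.div (by fun_prop) fun q hq => Om_ne hq)
      ((((hu.intQ T₀ T).const_mul 2).add ((hu.intQ_io T₀ T).const_mul 4)).const_mul (K * (1 / M)))
      fun z hz _ => ?_
    rw [abs_of_nonneg (by positivity)]
    have hr : 0 < ‖z.1‖ := norm_pos_iff.2 hz
    set x := z.1
    set t := z.2
    have e1 : ‖(h (t - ‖x‖) * al M x * mo u x t) • gr u x t + (h (t - ‖x‖) * al M x * gfl u x t) • x‖
        ≤ |h (t - ‖x‖)| * al M x * (|mo u x t| * ‖gr u x t‖ + |gfl u x t| * ‖x‖) := by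
      refine (norm_add_le _ _).trans (le_of_eq ?_)
      simp only [norm_smul, norm_mul, Real.norm_eq_abs, abs_of_nonneg (al_nonneg (x := x) hM)]
      ring
    have e2 : |gfl u x t| * ‖x‖ ≤ io u x t + |mo u x t| * ‖gr u x t‖ := by
      rw [gfl, abs_mul, abs_inv, abs_norm, mul_comm, mul_inv_cancel_left₀ hr.ne']
      refine (abs_sub _ _).trans (add_le_add ?_ ?_)
      · rw [io, abs_le]
        have := mul_nonneg (Wp_nonneg (x := x)) (sq_nonneg (u x t))
        constructor <;>
          linarith [sq_nonneg (mo u x t), an_nonneg (u := u) (x := x) (t := t)]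
      · rw [abs_mul]
        exact mul_le_mul_of_nonneg_left rd_abs_le (abs_nonneg _)
    have e3 : |mo u x t| * ‖gr u x t‖ ≤ io u x t + eDenFree u x t := by
      have := mo_sq_le_io (u := u) (x := x) (t := t)
      have h2 := gr_sq_le (u := u) (x := x) (t := t)
      rw [← sq_abs] at this
      nlinarith [sq_nonneg (|mo u x t| - ‖gr u x t‖)]
    calc _ ≤ |h (t - ‖x‖)| * al M x * (|mo u x t| * ‖gr u x t‖ + |gfl u x t| * ‖x‖) / ‖x‖ := by
          gcongr
      _ = |h (t - ‖x‖)| * (al M x / ‖x‖) * (|mo u x t| * ‖gr u x t‖ + |gfl u x t| * ‖x‖) := by ring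
      _ ≤ K * (1 / M) * (2 * eDenFree u x t + 4 * io u x t) := by
        have e4 := al_div_le (x := x) hM
        have e5 : 0 ≤ al M x / ‖x‖ := div_nonneg (al_nonneg hM) (norm_nonneg _)
        have e6 := hb (t - ‖x‖)
        have e7 := io_nonneg (u := u) (x := x) (t := t)
        refine mul_le_mul (mul_le_mul e6 e4 e5 hK0) ?_ (by positivity) (by positivity)
        linarith
      _ = _ := rfl

end incoming

section decay

/-- Tails of a convergent integral. -/
lemma exists_tail {f : ℝ → ℝ} (hf : ∀ t, 0 ≤ f t) (hi : ∀ a b, IntervalIntegrable f volume a b)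
    {B : ℝ} (hB : ∀ T, 0 ≤ T → ∫ t in (0 : ℝ)..T, f t ≤ B) {ε : ℝ} (hε : 0 < ε) :
    ∃ T₀, 0 ≤ T₀ ∧ ∀ T₁, T₀ ≤ T₁ → ∀ T, T₁ ≤ T → ∫ t in T₁..T, f t ≤ ε := by
  have hmono : Monotone fun n : ℕ => ∫ t in (0 : ℝ)..n, f t := by
    intro m n hmn
    have h := intervalIntegral.integral_add_adjacent_intervals (hi 0 m) (hi m n)
    have := intervalIntegral.integral_nonneg (μ := volume)
      (show (m : ℝ) ≤ n by exact_mod_cast hmn) fun t _ => hf t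
    simp only
    linarith
  have hbdd : BddAbove (range fun n : ℕ => ∫ t in (0 : ℝ)..n, f t) :=
    ⟨B, by rintro _ ⟨n, rfl⟩; exact hB n n.cast_nonneg⟩
  obtain ⟨n, hn⟩ := exists_lt_of_lt_ciSup
    (show (⨆ n : ℕ, ∫ t in (0 : ℝ)..n, f t) - ε < ⨆ n : ℕ, ∫ t in (0 : ℝ)..n, f t by linarith)
  refine ⟨n, n.cast_nonneg, fun T₁ h1 T h2 => ?_⟩
  obtain ⟨m, hm⟩ := exists_nat_ge T
  have e1 := intervalIntegral.integral_add_adjacent_intervals (hi 0 n) (hi n T₁)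
  have e2 := intervalIntegral.integral_add_adjacent_intervals (hi 0 T₁) (hi T₁ T)
  have e3 := intervalIntegral.integral_add_adjacent_intervals (hi 0 T) (hi T m)
  have p1 := intervalIntegral.integral_nonneg (μ := volume) h1 fun t _ => hf t
  have p3 := intervalIntegral.integral_nonneg (μ := volume) hm fun t _ => hf t
  have := le_ciSup hbdd m
  linarith

/-- A nonnegative Lipschitz function with bounded integrals tends to zero. -/
lemma tendsto_zero_of_lipschitz {f : ℝ → ℝ} (hf : ∀ t, 0 ≤ f t) {L : ℝ}
    (hL : ∀ s t, s ≤ t → |f t - f s| ≤ L * (t - s))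
    {B : ℝ} (hB : ∀ T, 0 ≤ T → ∫ t in (0 : ℝ)..T, f t ≤ B) : Tendsto f atTop (𝓝 0) := by
  have hL0 : 0 ≤ L := by
    have := (abs_nonneg _).trans (hL 0 1 zero_le_one); linarith
  have hc : Continuous f := by
    refine (LipschitzWith.of_dist_le_mul (K := L.toNNReal) fun s t => ?_).continuous
    rw [Real.coe_toNNReal _ hL0, Real.dist_eq, Real.dist_eq]
    rcases le_total s t with h | h
    · rw [abs_sub_comm, abs_sub_comm s, abs_of_nonneg (sub_nonneg.2 h)]; exact hL s t h
    · rw [abs_of_nonneg (sub_nonneg.2 h)]; exact hL t s h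
  have hi : ∀ a b, IntervalIntegrable f volume a b := fun a b => hc.intervalIntegrable a b
  rw [Metric.tendsto_atTop]
  intro ε hε
  set δ := ε / (2 * (L + 1)) with hδ
  have hδ0 : 0 < δ := by positivity
  obtain ⟨T₀, hT₀, hT⟩ := exists_tail hf hi hB (ε := ε / 4 * δ) (by positivity)
  refine ⟨T₀, fun t ht => ?_⟩
  rw [Real.dist_eq, sub_zero, abs_of_nonneg (hf t)]
  by_contra! h
  have h1 := hT t ht (t + δ) (by linarith)
  have h2 : ∫ _ in t..(t + δ), ε / 2 ≤ ∫ s in t..(t + δ), f s := by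
    refine intervalIntegral.integral_mono_on (by linarith) (by simp) (hi _ _) fun s hs => ?_
    have h3 := (abs_le.1 (hL t s hs.1)).1
    have h4 : L * (s - t) ≤ ε / 2 := by
      calc L * (s - t) ≤ (L + 1) * δ := by gcongr <;> linarith [hs.1, hs.2]
        _ = ε / 2 := by rw [hδ]; field_simp
    linarith
  rw [intervalIntegral.integral_const, smul_eq_mul] at h2
  nlinarith

variable {d : ℕ} {u v : V d → ℝ → ℝ} {x : V d} {t : ℝ} [Fact (3 ≤ d)] {M : ℝ}

lemma integral_Q {f : V d × ℝ → ℝ} {T₀ T : ℝ} (hT : T₀ ≤ T) (hf : Integrable f (Qm d T₀ T)) :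
    ∫ z, f z ∂(Qm d T₀ T) = ∫ t in T₀..T, ∫ x, f (x, t) := by
  rw [intervalIntegral.integral_of_le hT]
  rw [Qm] at hf ⊢
  exact integral_prod_symm _ hf

lemma intervalIntegrable_Q {f : V d × ℝ → ℝ} (hf : ∀ T₀ T, Integrable f (Qm d T₀ T)) (a b : ℝ) :
    IntervalIntegrable (fun t => ∫ x, f (x, t)) volume a b := by
  refine ⟨?_, ?_⟩
  · have := hf a b
    rw [Qm] at this
    exact this.integral_prod_right
  · have := hf b a
    rw [Qm] at this
    exact this.integral_prod_right

/-- The outgoing energy. -/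
noncomputable def Iw (M : ℝ) (u : V d → ℝ → ℝ) (t : ℝ) : ℝ := ∫ x, al M x * io u x t

/-- The integral of the flux density. -/
noncomputable def Nf (u : V d → ℝ → ℝ) (t : ℝ) : ℝ := ∫ x, nd u x t

/-- The localized energy. -/
noncomputable def Gf (u : V d → ℝ → ℝ) (t : ℝ) : ℝ := ∫ x, eDenFree u x t / (1 + ‖x‖) ^ 2

/-- A wave whose time derivative is also a wave. -/
structure Reg (u : V d → ℝ → ℝ) : Prop where
  wave : Wave u
  dwave : Wave (D u)

lemma Reg.contD (hu : Reg u) : Continuous (fun q : V d × ℝ => D u q.1 q.2) := hu.dwave.cont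

lemma Wave.int_alio (hu : Wave u) (hM : 0 < M) (t : ℝ) :
    Integrable (fun x => al M x * io u x t) := by
  simpa using hu.int_aio hM (h := fun _ => 1) continuous_const (K := 1) (by simp) t

lemma Wave.Iw_add (hu : Wave u) (hM : 0 < M) {T₀ T : ℝ} (hT : T₀ ≤ T) :
    Iw M u T + ∫ z, good M u z.1 z.2 ∂(Qm d T₀ T) = Iw M u T₀ := by
  have := outgoing_identity hu hM (h := fun _ => 1) contDiff_const (K := 1) (by simp) (by simp) hT
  simp only [one_mul, deriv_const, zero_mul, integral_zero] at this
  rw [Iw, Iw]; linarith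

lemma Iw_nonneg (hM : 0 < M) : 0 ≤ Iw M u t :=
  integral_nonneg fun _ => mul_nonneg (al_nonneg hM) io_nonneg

lemma integral_good_nonneg (hM : 0 < M) (T₀ T : ℝ) :
    0 ≤ ∫ z, good M u z.1 z.2 ∂(Qm d T₀ T) := integral_nonneg fun _ => good_nonneg hM

lemma Wave.Iw_anti (hu : Wave u) (hM : 0 < M) {T₀ T : ℝ} (hT : T₀ ≤ T) : Iw M u T ≤ Iw M u T₀ := by
  linarith [hu.Iw_add hM hT, integral_good_nonneg (u := u) hM T₀ T]

lemma Wave.good_le (hu : Wave u) (hM : 0 < M) {T₀ T : ℝ} (hT : T₀ ≤ T) :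
    ∫ z, good M u z.1 z.2 ∂(Qm d T₀ T) ≤ Iw M u T₀ := by
  linarith [hu.Iw_add hM hT, Iw_nonneg (u := u) (t := T) hM]

/-- Weighted bound for the outgoing derivative. -/
lemma Wave.outgoing_le (hu : Wave u) (hM : 0 < M) {h : ℝ → ℝ} (hh : ContDiff ℝ 1 h) {K Hb : ℝ}
    (h0 : ∀ s, 0 ≤ h s) (hH : ∀ s, h s ≤ Hb) (hb' : ∀ s, |deriv h s| ≤ K) {T₀ T : ℝ}
    (hT : T₀ ≤ T) :
    ∫ z, deriv h (z.2 - ‖z.1‖) * al M z.1 * mo u z.1 z.2 ^ 2 ∂(Qm d T₀ T) ≤ Hb * Iw M u T₀ := by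
  have hb : ∀ s, |h s| ≤ max K Hb := fun s => by
    rw [abs_of_nonneg (h0 s)]; exact (hH s).trans (le_max_right _ _)
  have h1 := outgoing_identity hu hM hh hb (fun s => (hb' s).trans (le_max_left _ _)) hT
  have h2 : ∫ x, h (T - ‖x‖) * al M x * io u x T ≤ Hb * Iw M u T := by
    rw [Iw, ← integral_const_mul]
    refine integral_mono (hu.int_aio hM hh.continuous hb _) ((hu.int_alio hM T).const_mul _)
      fun x => ?_
    simp only [mul_assoc]
    exact mul_le_mul_of_nonneg_right (hH _) (mul_nonneg (al_nonneg hM) io_nonneg)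
  have h3 : 0 ≤ ∫ x, h (T₀ - ‖x‖) * al M x * io u x T₀ :=
    integral_nonneg fun x => mul_nonneg (mul_nonneg (h0 _) (al_nonneg hM)) io_nonneg
  have h4 : ∫ z, h (z.2 - ‖z.1‖) * good M u z.1 z.2 ∂(Qm d T₀ T) ≤
      Hb * ∫ z, good M u z.1 z.2 ∂(Qm d T₀ T) := by
    rw [← integral_const_mul]
    refine integral_mono_of_nonneg (Eventually.of_forall fun z =>
      mul_nonneg (h0 _) (good_nonneg hM)) ((hu.intQ_good hM T₀ T).const_mul _)
      (Eventually.of_forall fun z => mul_le_mul_of_nonneg_right (hH _) (good_nonneg hM))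
  have h5 := hu.Iw_add hM hT
  rw [← h5]
  linarith

/-- Space-time Hardy bound. -/
lemma Wave.hardy_le (hu : Wave u) {T₀ T : ℝ} (hT : T₀ ≤ T) :
    ∫ z, u z.1 z.2 ^ 2 / ‖z.1‖ ^ 2 ∂(Qm d T₀ T) ≤ 2 * ∫ x, io u x T₀ := by
  have hpos : ∀ n : ℕ, (0 : ℝ) < 1 / ((n : ℝ) + 1) := fun n => by positivity
  have key : ∀ n : ℕ, ∫ z, u z.1 z.2 ^ 2 / (‖z.1‖ + 1 / ((n : ℝ) + 1)) ^ 2 ∂(Qm d T₀ T) ≤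
      2 * ∫ x, io u x T₀ := by
    intro n
    have h1 : ∫ z, u z.1 z.2 ^ 2 / (‖z.1‖ + 1 / ((n : ℝ) + 1)) ^ 2 ∂(Qm d T₀ T) ≤
        ∫ z, 2 * good (1 / ((n : ℝ) + 1)) u z.1 z.2 ∂(Qm d T₀ T) := by
      refine integral_mono_of_nonneg (Eventually.of_forall fun z => by positivity)
        ((hu.intQ_good (hpos n) T₀ T).const_mul _) (Eventually.of_forall fun z => ?_)
      have hp := hpos n
      generalize 1 / ((n : ℝ) + 1) = M at hp ⊢
      have := one_le_kap (d := d)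
      have h : 0 ≤ kap d * (kap d - 1) := mul_nonneg (by linarith) (by linarith)
      have ha := an_nonneg (u := u) (x := z.1) (t := z.2)
      have e1 : 0 ≤ M / 2 / (‖z.1‖ + M) ^ 2 * mo u z.1 z.2 ^ 2 := by positivity
      have e2 : 0 ≤ (‖z.1‖ + M / 2) / (‖z.1‖ + M) ^ 2 * an u z.1 z.2 := by positivity
      have e3 : 0 ≤ kap d * (kap d - 1) * (‖z.1‖ + M / 2) / (‖z.1‖ + M) ^ 2 *
        (u z.1 z.2 ^ 2 / ‖z.1‖ ^ 2) := by positivity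
      have e4 : u z.1 z.2 ^ 2 / (‖z.1‖ + M) ^ 2 =
        2 * (1 / 2 / (‖z.1‖ + M) ^ 2 * u z.1 z.2 ^ 2) := by ring
      simp only
      rw [good, e4]
      linarith
    rw [integral_const_mul] at h1
    have h2 : Iw (1 / ((n : ℝ) + 1)) u T₀ ≤ ∫ x, io u x T₀ := by
      refine integral_mono (hu.int_alio (hpos n) _) (hu.int_io _) fun x => ?_
      exact mul_le_of_le_one_left io_nonneg (al_le_one (hpos n))
    linarith [hu.good_le (hpos n) hT]
  have hlim : Tendsto (fun n : ℕ =>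
      ∫ z, u z.1 z.2 ^ 2 / (‖z.1‖ + 1 / ((n : ℝ) + 1)) ^ 2 ∂(Qm d T₀ T)) atTop
      (𝓝 (∫ z, u z.1 z.2 ^ 2 / ‖z.1‖ ^ 2 ∂(Qm d T₀ T))) := by
    refine tendsto_integral_of_dominated_convergence _ (fun n => ?_) (hu.intQ_hardy T₀ T)
      (fun n => ?_) ?_
    · refine aesm_Q (ContinuousOn.div (hu.cd.contOn.pow 2) (by fun_prop) fun q _ => ?_) T₀ T
      have := hpos n
      positivity
    · filter_upwards [ae_Q_ne_zero T₀ T] with z hz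
      have := hpos n
      have hr : 0 < ‖z.1‖ := norm_pos_iff.2 hz
      rw [Real.norm_of_nonneg (by positivity)]
      gcongr
      linarith
    · filter_upwards [ae_Q_ne_zero T₀ T] with z hz
      have hr : ‖z.1‖ ≠ 0 := norm_ne_zero_iff.2 hz
      have h1 : Tendsto (fun n : ℕ => ‖z.1‖ + 1 / ((n : ℝ) + 1)) atTop (𝓝 (‖z.1‖ + 0)) :=
        tendsto_one_div_add_atTop_nhds_zero_nat.const_add _
      rw [add_zero] at h1
      exact tendsto_const_nhds.div (h1.pow 2) (pow_ne_zero 2 hr)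
  exact le_of_tendsto' hlim key

lemma Wave.hardy_tail (hu : Wave u) {ε : ℝ} (hε : 0 < ε) : ∃ T₀, 0 ≤ T₀ ∧ ∀ T₁, T₀ ≤ T₁ →
    ∀ T, T₁ ≤ T → ∫ z, u z.1 z.2 ^ 2 / ‖z.1‖ ^ 2 ∂(Qm d T₁ T) ≤ ε := by
  have hi := intervalIntegrable_Q (f := fun z => u z.1 z.2 ^ 2 / ‖z.1‖ ^ 2) hu.intQ_hardy
  obtain ⟨T₀, h0, h1⟩ := exists_tail (f := fun t => ∫ x, u x t ^ 2 / ‖x‖ ^ 2)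
    (fun t => integral_nonneg fun x => by positivity) hi (B := 2 * ∫ x, io u x 0)
    (fun T hT => by rw [← integral_Q hT (hu.intQ_hardy 0 T)]; exact hu.hardy_le hT) hε
  exact ⟨T₀, h0, fun T₁ h2 T h3 => by rw [integral_Q h3 (hu.intQ_hardy T₁ T)]; exact h1 T₁ h2 T h3⟩

lemma al_one_hardy : al 1 x * (u x t ^ 2 / ‖x‖ ^ 2) ≤ u x t ^ 2 / ‖x‖ := by
  rcases eq_or_ne ‖x‖ 0 with h | h
  · simp [h]
  · have hr : 0 < ‖x‖ := lt_of_le_of_ne (norm_nonneg _) h.symm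
    have : al 1 x * (u x t ^ 2 / ‖x‖ ^ 2) = u x t ^ 2 / ‖x‖ * (1 / (‖x‖ + 1)) := by
      rw [al]; field_simp
    rw [this]
    refine mul_le_of_le_one_right (by positivity) ?_
    rw [div_le_one (by positivity)]; linarith

lemma al_io_le : al 1 x * io u x t ≤ (3 + 3 * kap d ^ 2) * nd u x t := by
  have h1 := one_le_kap (d := d)
  have h2 : mo u x t ^ 2 ≤ 2 * (D u x t + rd u x t) ^ 2 +
      2 * kap d ^ 2 * (u x t ^ 2 / ‖x‖ ^ 2) := by
    have : u x t ^ 2 / ‖x‖ ^ 2 = (u x t * ‖x‖⁻¹) ^ 2 := by rw [div_eq_mul_inv]; ring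
    rw [mo, this]
    nlinarith [sq_nonneg (D u x t + rd u x t - kap d * (u x t * ‖x‖⁻¹))]
  have h3 := al_one_hardy (u := u) (x := x) (t := t)
  have h4 := al_nonneg (x := x) one_pos
  have h5 := al_le_one (x := x) one_pos
  have hA := an_nonneg (u := u) (x := x) (t := t)
  have hp : 0 ≤ u x t ^ 2 / ‖x‖ := by positivity
  have e1 : u x t ^ 2 / (2 * ‖x‖) = u x t ^ 2 / ‖x‖ / 2 := by rw [mul_comm, div_mul_eq_div_div]
  rw [io, Wp_mul, nd_eq, e1]
  have g1 := mul_le_mul_of_nonneg_left h2 h4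
  have g2 := mul_le_of_le_one_left (sq_nonneg (D u x t + rd u x t)) h5
  have g3 := mul_le_of_le_one_left hA h5
  have g4 := mul_le_of_le_one_left hp h5
  have g5 := mul_le_mul_of_nonneg_left h3 (show 0 ≤ kap d ^ 2 by positivity)
  have g6 := mul_le_mul_of_nonneg_left h3 (show 0 ≤ kap d * (kap d - 1) from
    mul_nonneg (by linarith) (by linarith))
  have g7 := mul_nonneg (show 0 ≤ kap d ^ 2 by positivity) (sq_nonneg (D u x t + rd u x t))
  have g8 := mul_nonneg (show 0 ≤ kap d ^ 2 by positivity) hA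
  nlinarith [sq_nonneg (D u x t + rd u x t)]

lemma Wave.int_nd (hu : Wave u) (t : ℝ) : Integrable (fun x => nd u x t) :=
  int_slice (F := fun q => nd u q.1 q.2) hu.cd.cnd.contOn ((hu.int t).const_mul 2) fun x _ => by
    rw [abs_of_nonneg nd_nonneg]; exact nd_le

lemma Wave.Iw_le_Nf (hu : Wave u) (t : ℝ) : Iw 1 u t ≤ (3 + 3 * kap d ^ 2) * Nf u t := by
  rw [Iw, Nf, ← integral_const_mul]
  exact integral_mono (hu.int_alio one_pos t) ((hu.int_nd t).const_mul _) fun x => al_io_le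

lemma Wave.Nf_le (hu : Wave u) (t : ℝ) : Nf u t ≤ 2 * ∫ x, eDenFree u x t := by
  rw [Nf, ← integral_const_mul]
  exact integral_mono (hu.int_nd t) ((hu.int t).const_mul _) fun x => nd_le

lemma Nf_nonneg : 0 ≤ Nf u t := integral_nonneg fun _ => nd_nonneg

end decay

section local_decay

variable {d : ℕ} {u v : V d → ℝ → ℝ} {x : V d} {t : ℝ} [Fact (3 ≤ d)] {M : ℝ}

lemma eDen_weight_le (hx : x ≠ 0) : eDenFree u x t / (1 + ‖x‖) ^ 2 ≤ good 1 u x t +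
    good 1 (fun x t => u x (-1 * t + 0)) x (-t) +
    (kap d ^ 2 + 1) * (u x t ^ 2 / ‖x‖ ^ 2) := by
  have hr : 0 < ‖x‖ := norm_pos_iff.2 hx
  have h1 := one_le_kap (d := d)
  have hk : 0 ≤ kap d * (kap d - 1) := mul_nonneg (by linarith) (by linarith)
  have hA := an_nonneg (u := u) (x := x) (t := t)
  have hA' : an (fun x t => u x (-1 * t + 0)) x (-t) = an u x t := by simp [an, rd, gr]
  have hmo : mo (fun x t => u x (-1 * t + 0)) x (-t) =
      -D u x t + rd u x t + kap d * (u x t * ‖x‖⁻¹) := by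
    rw [mo, D_time]; simp [rd, gr]
  rw [good, good, hmo, hA', eDen_eq, mo]
  simp only [neg_mul_neg, one_mul, add_zero, neg_neg, mul_neg, neg_mul]
  generalize an u x t = A at *
  generalize D u x t = p
  generalize rd u x t = q
  generalize u x t = w
  generalize kap d = κ at *
  generalize ‖x‖ = r at *
  have n1 : 0 ≤ κ * (κ - 1) * (r + 1 / 2) / (r + 1) ^ 2 * (w ^ 2 / r ^ 2) := by positivity
  have n2 : 0 ≤ (r + 1 / 2) / (r + 1) ^ 2 * A := by positivity
  have n3 : 0 ≤ 1 / 2 / (r + 1) ^ 2 * w ^ 2 := by positivity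
  have n4 : 0 ≤ r / (r + 1) ^ 2 * A := by positivity
  have n5 : w ^ 2 / (2 * r) / (r + 1) ^ 2 ≤ w ^ 2 / r ^ 2 := by
    rw [div_div]
    refine div_le_div_of_nonneg_left (sq_nonneg _) (by positivity) ?_
    nlinarith [sq_nonneg (r + 1), mul_pos hr hr]
  have n6 : κ ^ 2 * (w ^ 2 / r ^ 2) / (r + 1) ^ 2 ≤ κ ^ 2 * (w ^ 2 / r ^ 2) :=
    div_le_self (by positivity) (by nlinarith)
  have n7 : (1 / 2 * (q ^ 2 + A) + 1 / 2 * p ^ 2 + w ^ 2 / (2 * r)) / (1 + r) ^ 2 ≤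
      1 / 2 / (r + 1) ^ 2 * (p + q + κ * (w * r⁻¹)) ^ 2 +
      1 / 2 / (r + 1) ^ 2 * (-p + q + κ * (w * r⁻¹)) ^ 2 + 1 / 2 / (r + 1) ^ 2 * A +
      w ^ 2 / (2 * r) / (r + 1) ^ 2 + κ ^ 2 * (w ^ 2 / r ^ 2) / (r + 1) ^ 2 := by
    rw [add_comm 1 r, show w ^ 2 / r ^ 2 = (w * r⁻¹) ^ 2 by rw [mul_pow, inv_pow, div_eq_mul_inv]]
    generalize w ^ 2 / (2 * r) = z
    generalize w * r⁻¹ = y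
    have : (1 / 2 * (q ^ 2 + A) + 1 / 2 * p ^ 2 + z) ≤
      1 / 2 * (p + q + κ * y) ^ 2 + 1 / 2 * (-p + q + κ * y) ^ 2 + 1 / 2 * A + z + κ ^ 2 * y ^ 2 := by
      nlinarith [sq_nonneg (q + 2 * (κ * y)), sq_nonneg p]
    calc _ ≤ _ := div_le_div_of_nonneg_right this (by positivity)
      _ = _ := by ring
  have n8 : (r + 1 / 2) / (r + 1) ^ 2 * A = 1 / 2 / (r + 1) ^ 2 * A + r / (r + 1) ^ 2 * A := by ring
  have n9 : 1 / 2 / (r + 1) ^ 2 * A ≥ 0 := by positivity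
  linarith

lemma Wave.int_G (hu : Wave u) (t : ℝ) : Integrable (fun x => eDenFree u x t / (1 + ‖x‖) ^ 2) := by
  have := hu.int_mul (w := fun x => 1 / (1 + ‖x‖) ^ 2)
    (continuous_const.div (by fun_prop) fun x => by positivity) (M := 1) (fun x => by
      rw [abs_of_nonneg (by positivity), div_le_one (by positivity)]
      nlinarith [norm_nonneg x]) (t := t)
  simpa only [one_div, inv_mul_eq_div] using this

lemma contOn_G (hu : CD 2 u) :
    ContinuousOn (fun q : V d × ℝ => eDenFree u q.1 q.2 / (1 + ‖q.1‖) ^ 2) (Om d) :=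
  hu.ceDen.contOn.div (by fun_prop) fun q _ => by positivity

lemma Wave.intQ_G (hu : Wave u) (T₀ T : ℝ) :
    Integrable (fun z : V d × ℝ => eDenFree u z.1 z.2 / (1 + ‖z.1‖) ^ 2) (Qm d T₀ T) :=
  int_Q (contOn_G hu.cd) (hu.intQ T₀ T) fun z _ _ => by
    rw [abs_of_nonneg (div_nonneg eDen_nonneg (by positivity))]
    exact div_le_self eDen_nonneg (by nlinarith [norm_nonneg z.1])

lemma Gf_nonneg : 0 ≤ Gf u t := integral_nonneg fun _ => div_nonneg eDen_nonneg (by positivity)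

lemma Wave.int_good (hu : Wave u) (hM : 0 < M) (t : ℝ) : Integrable (fun x => good M u x t) := by
  exact int_slice (hu.cd.cont_good hM) (((hu.int_io t).const_mul (2 / M)).add
    ((hu.int_hardy t).const_mul (1 / 2))) fun x hx => by
      rw [abs_of_nonneg (good_nonneg hM)]; exact CoulombWave.good_le hM hx

/-- Integrated local energy decay. -/
lemma Wave.integrated_decay (hu : Wave u) : ∃ C, ∀ T, 0 ≤ T → ∫ t in (0 : ℝ)..T, Gf u t ≤ C := by
  have hv := hu.time (σ := -1) (by norm_num) 0
  set v := fun x t => u x (-1 * t + 0) with hvdef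
  obtain ⟨B, hB⟩ := hv.bdd
  refine ⟨Iw 1 u 0 + (3 + 3 * kap d ^ 2) * (2 * B) +
    (kap d ^ 2 + 1) * (2 * ∫ x, io u x 0), fun T hT => ?_⟩
  have i1 := intervalIntegrable_Q (f := fun z => good 1 u z.1 z.2) (hu.intQ_good one_pos) 0 T
  have i2' := intervalIntegrable_Q (f := fun z => good 1 v z.1 z.2) (hv.intQ_good one_pos)
  have i2 : IntervalIntegrable (fun t => ∫ x, good 1 v x (-t)) volume 0 T := by
    have := ((i2' 0 (-T)).comp_sub_left 0)
    simpa using this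
  have i3 := intervalIntegrable_Q (f := fun z => u z.1 z.2 ^ 2 / ‖z.1‖ ^ 2) hu.intQ_hardy 0 T
  have iG := intervalIntegrable_Q (f := fun z => eDenFree u z.1 z.2 / (1 + ‖z.1‖) ^ 2) hu.intQ_G 0 T
  have key : ∫ t in (0 : ℝ)..T, Gf u t ≤ ∫ t in (0 : ℝ)..T, ((∫ x, good 1 u x t) +
      (∫ x, good 1 v x (-t)) + (kap d ^ 2 + 1) * ∫ x, u x t ^ 2 / ‖x‖ ^ 2) := by
    refine intervalIntegral.integral_mono_on hT iG ((i1.add i2).add (i3.const_mul _)) fun t _ => ?_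
    have hg : Integrable fun x => good 1 u x t + good 1 v x (-t) :=
      (hu.int_good one_pos t).add (hv.int_good one_pos _)
    rw [Gf, ← integral_const_mul, ← integral_add (hu.int_good one_pos t) (hv.int_good one_pos _),
      ← integral_add hg ((hu.int_hardy t).const_mul _)]
    refine integral_mono_ae (hu.int_G t) (((hu.int_good one_pos t).add
      (hv.int_good one_pos _)).add ((hu.int_hardy t).const_mul _)) ?_
    filter_upwards [ae_ne_zero] with x hx using eDen_weight_le hx
  refine key.trans ?_
  rw [intervalIntegral.integral_add (i1.add i2) (i3.const_mul _), intervalIntegral.integral_add i1 i2,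
    intervalIntegral.integral_const_mul]
  have b1 := hu.good_le one_pos hT
  rw [integral_Q hT (hu.intQ_good one_pos 0 T)] at b1
  have b2 := hv.good_le one_pos (show -T ≤ 0 by linarith)
  rw [integral_Q (by linarith) (hv.intQ_good one_pos (-T) 0)] at b2
  have b2' : ∫ t in (0 : ℝ)..T, ∫ x, good 1 v x (-t) = ∫ t in (-T)..0, ∫ x, good 1 v x t := by
    have := intervalIntegral.integral_comp_neg (a := 0) (b := T) fun t => ∫ x, good 1 v x t
    simpa using this
  have b3 := hu.hardy_le hT
  rw [integral_Q hT (hu.intQ_hardy 0 T)] at b3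
  have c1 := hv.Iw_le_Nf (-T)
  have c2 := hv.Nf_le (-T)
  have c3 := hB (-T)
  have c4 : (3 + 3 * kap d ^ 2) * Nf v (-T) ≤ (3 + 3 * kap d ^ 2) * (2 * B) := by
    gcongr; linarith
  have c5 := mul_le_mul_of_nonneg_left b3 (show 0 ≤ kap d ^ 2 + 1 by positivity)
  rw [b2']
  linarith

lemma eDen_deriv_le (hu : CD 2 u) (hv : CD 2 (D u)) (hx : x ≠ 0) :
    |D (eDenFree u) x t| ≤ eDenFree u x t + eDenFree (D u) x t := by
  rw [D, (hasDerivAt_eDen hu hx).deriv, eDen_def, eDen_def]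
  have h1 := abs_real_inner_le_norm (gr u x t) (gr (D u) x t)
  have hr : 0 < ‖x‖ := norm_pos_iff.2 hx
  have h2 : |u x t * D u x t / ‖x‖| ≤ u x t ^ 2 / (2 * ‖x‖) + D u x t ^ 2 / (2 * ‖x‖) := by
    rw [abs_div, abs_of_pos hr, ← add_div, div_le_div_iff₀ hr (by positivity), abs_mul]
    nlinarith [two_mul_le_add_sq |u x t| |D u x t|, sq_abs (u x t), sq_abs (D u x t),
      mul_nonneg (abs_nonneg (u x t)) (abs_nonneg (D u x t))]
  have h3 : |D u x t * D (D u) x t| ≤ 1 / 2 * D u x t ^ 2 + 1 / 2 * D (D u) x t ^ 2 := by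
    rw [abs_mul]
    nlinarith [two_mul_le_add_sq |D u x t| |D (D u) x t|, sq_abs (D u x t), sq_abs (D (D u) x t)]
  have h4 : ‖gr u x t‖ * ‖gr (D u) x t‖ ≤ 1 / 2 * ‖gr u x t‖ ^ 2 + 1 / 2 * ‖gr (D u) x t‖ ^ 2 := by
    nlinarith [two_mul_le_add_sq ‖gr u x t‖ ‖gr (D u) x t‖]
  refine (abs_add_three _ _ _).trans ?_
  linarith

lemma Reg.Gf_lipschitz (hu : Reg u) : ∃ L, ∀ s t, s ≤ t → |Gf u t - Gf u s| ≤ L * (t - s) := by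
  obtain ⟨B, hB⟩ := hu.wave.bdd
  obtain ⟨B', hB'⟩ := hu.dwave.bdd
  refine ⟨B + B', fun s t hst => ?_⟩
  have hF : CD 1 (fun (x : V d) t => eDenFree u x t / (1 + ‖x‖) ^ 2) := by
    have hc : ContDiffOn ℝ 1 (fun q : V d × ℝ => (1 + ‖q.1‖) ^ 2) (Om d) :=
      (contDiffOn_const.add cd_norm).pow 2
    exact ContDiffOn.div hu.wave.cd.ceDen hc fun q _ => by positivity
  have hDF : ∀ x t, D (fun (x : V d) t => eDenFree u x t / (1 + ‖x‖) ^ 2) x t =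
      D (eDenFree u) x t / (1 + ‖x‖) ^ 2 := fun x t => by
    rw [D, D, deriv_div_const]
  have hInt := (hu.wave.intQ s t).add (hu.dwave.intQ s t)
  have hle : ∀ z : V d × ℝ, z.1 ≠ 0 → |D (fun (x : V d) t => eDenFree u x t / (1 + ‖x‖) ^ 2) z.1 z.2| ≤
      eDenFree u z.1 z.2 + eDenFree (D u) z.1 z.2 := fun z hz => by
    rw [hDF, abs_div, abs_of_nonneg (show 0 ≤ (1 + ‖z.1‖) ^ 2 by positivity)]
    exact (div_le_self (abs_nonneg _) (by nlinarith [norm_nonneg z.1])).trans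
      (eDen_deriv_le hu.wave.cd hu.dwave.cd hz)
  have hi := int_Q (F := fun z => D (fun (x : V d) t => eDenFree u x t / (1 + ‖x‖) ^ 2) z.1 z.2)
    hF.cD.contOn hInt fun z hz _ => hle z hz
  have h := spacetime_identity hF (H := fun _ _ => 0) contDiffOn_const hst
    (k := D (fun (x : V d) t => eDenFree u x t / (1 + ‖x‖) ^ 2))
    (fun x t _ => by simp [dvg]) (hu.wave.int_G s) (hu.wave.int_G t) hi (by simp)
  rw [Gf, Gf, h]
  refine (abs_integral_le_integral_abs).trans ?_
  calc _ ≤ ∫ z, (eDenFree u z.1 z.2 + eDenFree (D u) z.1 z.2) ∂(Qm d s t) := by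
        refine integral_mono_ae hi.abs hInt ?_
        filter_upwards [ae_Q_ne_zero s t] with z hz using hle z hz
    _ = ∫ τ in s..t, ∫ x, (eDenFree u x τ + eDenFree (D u) x τ) := integral_Q hst hInt
    _ ≤ ∫ τ in s..t, (B + B') := by
        refine intervalIntegral.integral_mono_on hst (intervalIntegrable_Q
          (f := fun z => eDenFree u z.1 z.2 + eDenFree (D u) z.1 z.2)
          (fun a b => (hu.wave.intQ a b).add (hu.dwave.intQ a b)) s t) (by simp) fun τ _ => ?_
        rw [integral_add (hu.wave.int τ) (hu.dwave.int τ)]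
        exact add_le_add (hB τ) (hB' τ)
    _ = (B + B') * (t - s) := by rw [intervalIntegral.integral_const, smul_eq_mul, mul_comm]

/-- Local energy decay. -/
theorem Reg.Gf_tendsto (hu : Reg u) : Tendsto (Gf u) atTop (𝓝 0) := by
  obtain ⟨L, hL⟩ := hu.Gf_lipschitz
  obtain ⟨C, hC⟩ := hu.wave.integrated_decay
  exact tendsto_zero_of_lipschitz (fun _ => Gf_nonneg) hL hC

lemma Wave.Iw_tendsto_zero (hu : Wave u) (t : ℝ) :
    Tendsto (fun n : ℕ => Iw ((n : ℝ) + 1) u t) atTop (𝓝 0) := by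
  have h : Tendsto (fun n : ℕ => ∫ x, al ((n : ℝ) + 1) x * io u x t) atTop
      (𝓝 (∫ x : V d, (0 : ℝ))) := by
    refine tendsto_integral_of_dominated_convergence _ (fun n => ?_) (hu.int_io t)
      (fun n => Eventually.of_forall fun x => ?_) (Eventually.of_forall fun x => ?_)
    · exact (hu.int_alio (by positivity) t).aestronglyMeasurable
    · rw [Real.norm_of_nonneg (mul_nonneg (al_nonneg (by positivity)) io_nonneg)]
      exact mul_le_of_le_one_left io_nonneg (al_le_one (by positivity))
    · have h1 : Tendsto (fun n : ℕ => al ((n : ℝ) + 1) x) atTop (𝓝 0) := by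
        unfold al
        refine Tendsto.div_atTop tendsto_const_nhds ?_
        exact tendsto_atTop_add_const_left _ _
          (tendsto_atTop_add_const_right _ _ tendsto_natCast_atTop_atTop)
      simpa using h1.mul_const (io u x t)
  rwa [integral_zero] at h

lemma nd_le_split (hM : 1 ≤ M) (hx : x ≠ 0) : nd u x t ≤
    (4 + 4 * kap d ^ 2) * (al M x * io u x t) + 2 * (1 + M) ^ 2 * (eDenFree u x t / (1 + ‖x‖) ^ 2) := by
  have hr : 0 < ‖x‖ := norm_pos_iff.2 hx
  have hM0 : 0 < M := by linarith
  have hk := one_le_kap (d := d)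
  have n1 : 0 ≤ (4 + 4 * kap d ^ 2) * (al M x * io u x t) :=
    mul_nonneg (by positivity) (mul_nonneg (al_nonneg hM0) io_nonneg)
  have n2 : 0 ≤ 2 * (1 + M) ^ 2 * (eDenFree u x t / (1 + ‖x‖) ^ 2) :=
    mul_nonneg (by positivity) (div_nonneg eDen_nonneg (by positivity))
  rcases le_total ‖x‖ M with h | h
  · have : nd u x t ≤ 2 * (1 + M) ^ 2 * (eDenFree u x t / (1 + ‖x‖) ^ 2) := by
      refine nd_le.trans ?_
      have h2 : (1 + ‖x‖) ^ 2 ≤ (1 + M) ^ 2 := by gcongr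
      rw [mul_assoc, mul_div_assoc', mul_comm ((1 + M) ^ 2), mul_div_assoc]
      refine mul_le_mul_of_nonneg_left (le_mul_of_one_le_right eDen_nonneg ?_) zero_le_two
      rwa [one_le_div (by positivity)]
    linarith
  · have ha : 1 / 2 ≤ al M x := by
      rw [al, div_le_div_iff₀ (by positivity) (by positivity)]; linarith
    have h1 : nd u x t ≤ (2 + 2 * kap d ^ 2) * io u x t := by
      rw [nd_eq, io, Wp_mul]
      have e1 : (D u x t + rd u x t) ^ 2 ≤ 2 * mo u x t ^ 2 + 2 * kap d ^ 2 * (u x t ^ 2 / ‖x‖ ^ 2) := by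
        rw [mo, show u x t ^ 2 / ‖x‖ ^ 2 = (u x t * ‖x‖⁻¹) ^ 2 by
          rw [mul_pow, inv_pow, div_eq_mul_inv]]
        nlinarith [sq_nonneg (D u x t + rd u x t + 2 * (kap d * (u x t * ‖x‖⁻¹)))]
      have e2 : u x t ^ 2 / ‖x‖ ^ 2 ≤ u x t ^ 2 / ‖x‖ :=
        div_le_div_of_nonneg_left (sq_nonneg _) hr (by nlinarith)
      have e3 : u x t ^ 2 / (2 * ‖x‖) = u x t ^ 2 / ‖x‖ / 2 := by
        rw [mul_comm, div_mul_eq_div_div]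
      have hA := an_nonneg (u := u) (x := x) (t := t)
      have e4 : 0 ≤ kap d * (kap d - 1) * (u x t ^ 2 / ‖x‖ ^ 2) :=
        mul_nonneg (mul_nonneg (by linarith) (by linarith)) (by positivity)
      have e5 : 0 ≤ u x t ^ 2 / ‖x‖ := by positivity
      have e6 : kap d ^ 2 * (u x t ^ 2 / ‖x‖ ^ 2) ≤ kap d ^ 2 * (u x t ^ 2 / ‖x‖) := by gcongr
      have e7 := mul_nonneg (sq_nonneg (kap d)) hA
      have e8 := mul_nonneg (sq_nonneg (kap d)) (sq_nonneg (mo u x t))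
      have e9 := mul_nonneg (sq_nonneg (kap d)) e4
      rw [e3]
      nlinarith [sq_nonneg (mo u x t)]
    have h2 : io u x t ≤ 2 * (al M x * io u x t) := by
      nlinarith [io_nonneg (u := u) (x := x) (t := t)]
    have h3 := mul_le_mul_of_nonneg_left h2 (show 0 ≤ 2 + 2 * kap d ^ 2 by positivity)
    linarith

/-- The flux density tends to zero in `L¹`. -/
theorem Reg.Nf_tendsto (hu : Reg u) : Tendsto (Nf u) atTop (𝓝 0) := by
  rw [Metric.tendsto_atTop]
  intro ε hε
  have hk : 0 < 4 + 4 * kap d ^ 2 := by positivity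
  have h1 := (hu.wave.Iw_tendsto_zero 0).const_mul (4 + 4 * kap d ^ 2)
  rw [mul_zero] at h1
  obtain ⟨n, hn⟩ := (h1.eventually_lt_const (show 0 < ε / 2 by positivity)).exists
  have hM : (1 : ℝ) ≤ (n : ℝ) + 1 := by simp
  generalize (n : ℝ) + 1 = M at hM hn
  have hM0 : 0 < M := by linarith
  have h2 := hu.Gf_tendsto.const_mul (2 * (1 + M) ^ 2)
  rw [mul_zero] at h2
  obtain ⟨T, hT⟩ := eventually_atTop.1 (h2.eventually_lt_const (show 0 < ε / 2 by positivity))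
  refine ⟨max T 0, fun t ht => ?_⟩
  rw [Real.dist_eq, sub_zero, abs_of_nonneg Nf_nonneg]
  have h3 : Nf u t ≤ (4 + 4 * kap d ^ 2) * Iw M u t + 2 * (1 + M) ^ 2 * Gf u t := by
    rw [Nf, Iw, Gf, ← integral_const_mul, ← integral_const_mul,
      ← integral_add ((hu.wave.int_alio hM0 t).const_mul _) ((hu.wave.int_G t).const_mul _)]
    refine integral_mono_ae (hu.wave.int_nd t) (((hu.wave.int_alio hM0 t).const_mul _).add
      ((hu.wave.int_G t).const_mul _)) ?_
    filter_upwards [ae_ne_zero] with x hx using nd_le_split hM hx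
  have h4 := mul_le_mul_of_nonneg_left (hu.wave.Iw_anti hM0 ((le_max_right T 0).trans ht)) hk.le
  linarith [hT t ((le_max_left _ _).trans ht)]

end local_decay

section weights

/-- A bounded approximation of the identity function at scale `S`. -/
noncomputable def ph (S s : ℝ) : ℝ := S * Real.arctan (s / S)

/-- The derivative of `ph S`. -/
noncomputable def dph (S s : ℝ) : ℝ := 1 / (1 + (s / S) ^ 2)

variable {S s : ℝ}

lemma hasDerivAt_ph (hS : 0 < S) (s : ℝ) : HasDerivAt (ph S) (dph S s) s := by
  have h := (((hasDerivAt_id s).div_const S).arctan).const_mul S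
  refine h.congr_deriv ?_
  simp only [dph, id]
  field_simp

lemma deriv_ph (hS : 0 < S) : deriv (ph S) = dph S := funext fun s => (hasDerivAt_ph hS s).deriv

lemma dph_pos : 0 < dph S s := by rw [dph]; positivity

lemma dph_le_one : dph S s ≤ 1 := by
  rw [dph, div_le_one (by positivity)]; nlinarith [sq_nonneg (s / S)]

lemma contDiff_ph : ContDiff ℝ 1 (ph S) :=
  contDiff_const.mul (Real.contDiff_arctan.comp (contDiff_id.div_const S))

@[fun_prop] lemma continuous_ph : Continuous (ph S) := contDiff_ph.continuous

@[fun_prop] lemma continuous_dph : Continuous (dph S) :=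
  continuous_const.div (by fun_prop) fun s => by positivity

lemma abs_ph_le (hS : 0 < S) : |ph S s| ≤ Real.pi / 2 * S := by
  rw [ph, abs_mul, abs_of_pos hS, mul_comm]
  refine mul_le_mul_of_nonneg_right ?_ hS.le
  rw [abs_le]
  exact ⟨(Real.neg_pi_div_two_lt_arctan _).le, (Real.arctan_lt_pi_div_two _).le⟩

lemma abs_ph_le_two (hS : 0 < S) : |ph S s| ≤ 2 * S :=
  (abs_ph_le hS).trans (by nlinarith [Real.pi_le_four])

lemma abs_arctan_le (y : ℝ) : |Real.arctan y| ≤ |y| := by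
  have h0 : ∀ y : ℝ, 0 ≤ y → Real.arctan y ≤ y := fun y hy => by
    have h1 := Real.le_tan (Real.arctan_nonneg.2 hy) (Real.arctan_lt_pi_div_two y)
    rwa [Real.tan_arctan] at h1
  rcases le_total 0 y with h | h
  · rw [abs_of_nonneg (Real.arctan_nonneg.2 h), abs_of_nonneg h]; exact h0 y h
  · rw [← abs_neg, ← Real.arctan_neg, ← abs_neg y,
      abs_of_nonneg (Real.arctan_nonneg.2 (neg_nonneg.2 h)), abs_of_nonneg (neg_nonneg.2 h)]
    exact h0 _ (neg_nonneg.2 h)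

lemma abs_ph_le_abs (hS : 0 < S) : |ph S s| ≤ |s| := by
  rw [ph, abs_mul, abs_of_pos hS]
  have h := mul_le_mul_of_nonneg_left (abs_arctan_le (s / S)) hS.le
  rwa [abs_div, abs_of_pos hS, mul_div_cancel₀ _ hS.ne'] at h

lemma dph_mul_sq (hS : 0 < S) : dph S s * (S ^ 2 + s ^ 2) = S ^ 2 := by
  rw [dph]; field_simp

lemma dph_mul_abs_le (hS : 0 < S) : dph S s * |s| ≤ S / 2 := by
  have h := dph_mul_sq (s := s) hS
  have h1 := dph_pos (S := S) (s := s)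
  have h2 : 2 * S * |s| ≤ S ^ 2 + s ^ 2 := by nlinarith [sq_nonneg (S - |s|), sq_abs s]
  have h3 := mul_le_mul_of_nonneg_left h2 h1.le
  rw [h] at h3
  nlinarith

lemma one_sub_dph_le (hS : 0 < S) : 1 - dph S s ≤ ph S s ^ 2 / S ^ 2 := by
  have h : ph S s ^ 2 / S ^ 2 = Real.arctan (s / S) ^ 2 := by rw [ph]; field_simp
  rw [h, dph]
  generalize s / S = y
  have h1 : Real.sin (Real.arctan y) ^ 2 ≤ Real.arctan y ^ 2 := by
    rw [← sq_abs, ← sq_abs (Real.arctan y)]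
    exact pow_le_pow_left₀ (abs_nonneg _) Real.abs_sin_le_abs 2
  have h2 := Real.sin_sq_add_cos_sq (Real.arctan y)
  rw [Real.cos_sq_arctan] at h2
  linarith

lemma ph_nonneg (hS : 0 < S) (hs : 0 ≤ s) : 0 ≤ ph S s :=
  mul_nonneg hS.le (Real.arctan_nonneg.2 (by positivity))

end weights

section errors

variable {d : ℕ} {u v f : V d → ℝ → ℝ} {x : V d} {t : ℝ} [Fact (3 ≤ d)] {M S : ℝ}

/-- Multiplying by a bounded function of `t - r`. -/
lemma int_coneQ {T₀ T : ℝ} {φ : ℝ → ℝ} (hφ : Continuous φ) {K : ℝ} (hK : ∀ s, |φ s| ≤ K)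
    {F : V d × ℝ → ℝ} (hF : Integrable F (Qm d T₀ T)) :
    Integrable (fun z => φ (z.2 - ‖z.1‖) * F z) (Qm d T₀ T) :=
  hF.bdd_mul (c := K) (Continuous.aestronglyMeasurable (by fun_prop))
    (Eventually.of_forall fun z => by rw [Real.norm_eq_abs]; exact hK _)

lemma int_cone {φ : ℝ → ℝ} (hφ : Continuous φ) {K : ℝ} (hK : ∀ s, |φ s| ≤ K)
    {F : V d → ℝ} (hF : Integrable F) (t : ℝ) : Integrable (fun x => φ (t - ‖x‖) * F x) :=
  hF.bdd_mul (c := K) (Continuous.aestronglyMeasurable (by fun_prop))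
    (Eventually.of_forall fun z => by rw [Real.norm_eq_abs]; exact hK _)

lemma Wave.intQ_nd (hu : Wave u) (T₀ T : ℝ) :
    Integrable (fun z : V d × ℝ => nd u z.1 z.2) (Qm d T₀ T) :=
  int_Q hu.cd.cnd.contOn ((hu.intQ T₀ T).const_mul 2) fun z _ _ => by
    rw [abs_of_nonneg nd_nonneg]; exact nd_le

lemma CD.contOn_out (h : CD 2 u) :
    ContinuousOn (fun q : V d × ℝ => (D u q.1 q.2 + rd u q.1 q.2) ^ 2) (Om d) :=
  (h.cD.contOn.add h.crd.contOn).pow 2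

lemma out_sq_le : (D u x t + rd u x t) ^ 2 ≤ 2 * nd u x t := by
  rw [nd_eq]
  linarith [an_nonneg (u := u) (x := x) (t := t), pot_nonneg (u := u) (x := x) (t := t)]

lemma an_le_nd : an u x t ≤ 2 * nd u x t := by
  rw [nd_eq]
  linarith [sq_nonneg (D u x t + rd u x t), pot_nonneg (u := u) (x := x) (t := t)]

lemma pot_le_nd : u x t ^ 2 / ‖x‖ ≤ 2 * nd u x t := by
  rw [nd_eq, mul_comm 2 ‖x‖, ← div_div]
  linarith [sq_nonneg (D u x t + rd u x t), an_nonneg (u := u) (x := x) (t := t)]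

lemma Wave.intQ_out (hu : Wave u) (T₀ T : ℝ) :
    Integrable (fun z : V d × ℝ => (D u z.1 z.2 + rd u z.1 z.2) ^ 2) (Qm d T₀ T) :=
  int_Q hu.cd.contOn_out ((hu.intQ_nd T₀ T).const_mul 2) fun z _ _ => by
    rw [abs_of_nonneg (sq_nonneg _)]; exact out_sq_le

lemma mo_sq_le_good : mo u x t ^ 2 ≤ 2 * (1 + ‖x‖) ^ 2 * good 1 u x t := by
  have h1 := one_le_kap (d := d)
  have hk : 0 ≤ kap d * (kap d - 1) := mul_nonneg (by linarith) (by linarith)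
  have hA := an_nonneg (u := u) (x := x) (t := t)
  have h : 1 / 2 / (‖x‖ + 1) ^ 2 * mo u x t ^ 2 ≤ good 1 u x t := by
    have e1 : 0 ≤ (‖x‖ + 1 / 2) / (‖x‖ + 1) ^ 2 * an u x t := by positivity
    have e2 : 0 ≤ 1 / 2 / (‖x‖ + 1) ^ 2 * u x t ^ 2 := by positivity
    have e3 : 0 ≤ kap d * (kap d - 1) * (‖x‖ + 1 / 2) / (‖x‖ + 1) ^ 2 *
      (u x t ^ 2 / ‖x‖ ^ 2) := by positivity
    rw [good]; linarith
  calc mo u x t ^ 2 = 2 * (1 + ‖x‖) ^ 2 * (1 / 2 / (‖x‖ + 1) ^ 2 * mo u x t ^ 2) := by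
        field_simp; ring
    _ ≤ _ := mul_le_mul_of_nonneg_left h (by positivity)

lemma out_sq_le_split {w : ℝ} (hw : 0 ≤ w) (hw1 : w ≤ 1) : w * (D u x t + rd u x t) ^ 2 ≤
    4 * (w * al 1 x * mo u x t ^ 2) + 16 * good 1 u x t +
      2 * kap d ^ 2 * (u x t ^ 2 / ‖x‖ ^ 2) := by
  have e1 : (D u x t + rd u x t) ^ 2 ≤ 2 * mo u x t ^ 2 + 2 * kap d ^ 2 * (u x t ^ 2 / ‖x‖ ^ 2) := by
    rw [mo, show u x t ^ 2 / ‖x‖ ^ 2 = (u x t * ‖x‖⁻¹) ^ 2 by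
      rw [mul_pow, inv_pow, div_eq_mul_inv]]
    nlinarith [sq_nonneg (D u x t + rd u x t + 2 * (kap d * (u x t * ‖x‖⁻¹)))]
  have e2 : 0 ≤ 2 * kap d ^ 2 * (u x t ^ 2 / ‖x‖ ^ 2) := by positivity
  have e3 := mul_le_of_le_one_left e2 hw1
  have e4 := mul_le_mul_of_nonneg_left e1 hw
  have e5 := good_nonneg (u := u) (x := x) (t := t) one_pos
  have e6 : 0 ≤ w * mo u x t ^ 2 := by positivity
  have e7 : 0 ≤ w * al 1 x * mo u x t ^ 2 := mul_nonneg (mul_nonneg hw (al_nonneg one_pos)) (sq_nonneg _)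
  suffices h : w * mo u x t ^ 2 ≤ 2 * (w * al 1 x * mo u x t ^ 2) + 8 * good 1 u x t by linarith
  rcases le_total 1 ‖x‖ with h | h
  · have ha : 1 / 2 ≤ al 1 x := by
      rw [al, div_le_div_iff₀ (by positivity) (by positivity)]; linarith
    nlinarith
  · have h1 := mo_sq_le_good (u := u) (x := x) (t := t)
    have h2 : (1 + ‖x‖) ^ 2 ≤ 4 := by nlinarith [norm_nonneg x]
    have h3 := mul_le_of_le_one_left (sq_nonneg (mo u x t)) hw1
    nlinarith

lemma Reg.Iw_tendsto (hu : Reg u) : Tendsto (Iw 1 u) atTop (𝓝 0) := by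
  have h := hu.Nf_tendsto.const_mul (3 + 3 * kap d ^ 2)
  rw [mul_zero] at h
  exact squeeze_zero (fun t => Iw_nonneg one_pos) (fun t => hu.wave.Iw_le_Nf t) h

/-- Space-time smallness of the outgoing derivative near the light cone. -/
lemma Reg.outgoing_small (hu : Reg u) {ε : ℝ} (hε : 0 < ε) : ∃ T₁, 0 ≤ T₁ ∧ ∀ T₀, T₁ ≤ T₀ → ∀ T,
    T₀ ≤ T → ∀ S, 1 ≤ S →
    ∫ z, dph S (z.2 - ‖z.1‖) * (D u z.1 z.2 + rd u z.1 z.2) ^ 2 ∂(Qm d T₀ T) ≤ ε * S := by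
  have hk := one_le_kap (d := d)
  obtain ⟨T₁, h1, hT1⟩ := hu.wave.hardy_tail (ε := ε / (6 * kap d ^ 2)) (by positivity)
  obtain ⟨T₂, hT2⟩ := eventually_atTop.1 (hu.Iw_tendsto.eventually_lt_const
    (show 0 < ε / 96 by positivity))
  refine ⟨max T₁ T₂, h1.trans (le_max_left _ _), fun T₀ hT₀ T hT S hS => ?_⟩
  have hS0 : 0 < S := by linarith
  set h : ℝ → ℝ := fun s => ph S s + 2 * S with hh
  have hd : deriv h = dph S := by
    funext s; exact ((hasDerivAt_ph hS0 s).add_const _).deriv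
  have ho := hu.wave.outgoing_le (M := 1) one_pos (h := h) (contDiff_ph.add contDiff_const)
    (K := 1) (Hb := 4 * S)
    (fun s => by have := (abs_le.1 (abs_ph_le_two (s := s) hS0)).1; simp only [hh]; linarith)
    (fun s => by have := (abs_le.1 (abs_ph_le_two (s := s) hS0)).2; simp only [hh]; linarith)
    (fun s => by rw [hd, abs_of_pos dph_pos]; exact dph_le_one) hT
  rw [hd] at ho
  have hg := hu.wave.good_le one_pos hT
  have hH := hT1 T₀ ((le_max_left _ _).trans hT₀) T hT
  have hI := hT2 T₀ ((le_max_right _ _).trans hT₀)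
  have i1 : Integrable (fun z : V d × ℝ => dph S (z.2 - ‖z.1‖) * al 1 z.1 * mo u z.1 z.2 ^ 2)
      (Qm d T₀ T) := by
    refine ((hu.wave.intQ_io T₀ T).const_mul 2).mono' (aesm_Q (F := ℝ) ?_ T₀ T)
      (Eventually.of_forall fun z => ?_)
    · refine ContinuousOn.mul (ContinuousOn.mul (Continuous.continuousOn (by fun_prop))
        (contOn_al one_pos)) (ContinuousOn.pow ?_ 2)
      have hr : ContinuousOn (fun q : V d × ℝ => ‖q.1‖⁻¹) (Om d) :=
        (Continuous.continuousOn (by fun_prop)).inv₀ fun q hq => Om_ne hq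
      exact (hu.wave.cd.cD.contOn.add hu.wave.cd.crd.contOn).add
        (continuousOn_const.mul (hu.wave.cd.contOn.mul hr))
    · rw [Real.norm_of_nonneg (mul_nonneg (mul_nonneg dph_pos.le (al_nonneg one_pos)) (sq_nonneg _))]
      refine le_trans ?_ mo_sq_le_io
      exact mul_le_of_le_one_left (sq_nonneg _)
        (mul_le_one₀ dph_le_one (al_nonneg one_pos) (al_le_one one_pos))
  have i2 := (hu.wave.intQ_good one_pos T₀ T)
  have i3 := (hu.wave.intQ_hardy T₀ T)
  have key : ∫ z, dph S (z.2 - ‖z.1‖) * (D u z.1 z.2 + rd u z.1 z.2) ^ 2 ∂(Qm d T₀ T) ≤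
      ∫ z, (4 * (dph S (z.2 - ‖z.1‖) * al 1 z.1 * mo u z.1 z.2 ^ 2) + 16 * good 1 u z.1 z.2 +
      2 * kap d ^ 2 * (u z.1 z.2 ^ 2 / ‖z.1‖ ^ 2)) ∂(Qm d T₀ T) :=
    integral_mono_of_nonneg (Eventually.of_forall fun z => mul_nonneg dph_pos.le (sq_nonneg _))
      (((i1.const_mul _).add (i2.const_mul _)).add (i3.const_mul _))
      (Eventually.of_forall fun z => out_sq_le_split dph_pos.le dph_le_one)
  have i12 : Integrable (fun z : V d × ℝ => 4 * (dph S (z.2 - ‖z.1‖) * al 1 z.1 * mo u z.1 z.2 ^ 2) +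
    16 * good 1 u z.1 z.2) (Qm d T₀ T) := (i1.const_mul _).add (i2.const_mul _)
  rw [integral_add i12 (i3.const_mul _), integral_add (i1.const_mul _) (i2.const_mul _),
    integral_const_mul, integral_const_mul, integral_const_mul] at key
  have c1 : 2 * kap d ^ 2 * ∫ z, u z.1 z.2 ^ 2 / ‖z.1‖ ^ 2 ∂(Qm d T₀ T) ≤ ε / 3 := by
    calc _ ≤ 2 * kap d ^ 2 * (ε / (6 * kap d ^ 2)) := by gcongr
      _ = ε / 3 := by field_simp; norm_num
  have c2 : Iw 1 u T₀ * S ≤ ε / 96 * S := by gcongr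
  have c3 : ε ≤ ε * S := le_mul_of_one_le_right hε.le hS
  nlinarith

/-- Bulk integrals with a factor `1/t²`. -/
lemma integral_div_sq_le {g : V d × ℝ → ℝ} (hg : ∀ T₀ T, Integrable g (Qm d T₀ T)) {K : ℝ} {T : ℝ}
    (hS : 0 < S) (hT : S ≤ T) (hK0 : 0 ≤ K) (hK : ∀ t, S ≤ t → ∫ x, g (x, t) ≤ K) :
    Integrable (fun z => g z / z.2 ^ 2) (Qm d S T) ∧ ∫ z, g z / z.2 ^ 2 ∂(Qm d S T) ≤ K / S := by
  have hInt : Integrable (fun z => g z / z.2 ^ 2) (Qm d S T) := by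
    have : Integrable (fun z => 1 / z.2 ^ 2 * g z) (Qm d S T) := by
      refine (hg S T).bdd_mul (c := 1 / S ^ 2) (Measurable.aestronglyMeasurable (by fun_prop)) ?_
      filter_upwards [ae_Q_mem S T] with z hz
      rw [Real.norm_of_nonneg (by positivity)]
      have := hz.2.1
      gcongr
    refine this.congr (Eventually.of_forall fun z => ?_)
    simp only; ring
  refine ⟨hInt, ?_⟩
  rw [integral_Q hT hInt]
  have hne : ∀ t ∈ uIcc S T, t ≠ 0 := fun t ht => by
    rw [uIcc_of_le hT] at ht; linarith [ht.1]
  have hd : ∀ t ∈ uIcc S T, HasDerivAt (fun t => -K * t⁻¹) (K / t ^ 2) t := fun t ht => by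
    refine ((hasDerivAt_inv (hne t ht)).const_mul (-K)).congr_deriv ?_
    ring
  have hc : ContinuousOn (fun t : ℝ => K / t ^ 2) (uIcc S T) :=
    continuousOn_const.div (by fun_prop) fun t ht => pow_ne_zero 2 (hne t ht)
  calc _ ≤ ∫ t in S..T, K / t ^ 2 := by
        refine intervalIntegral.integral_mono_on hT ?_ hc.intervalIntegrable fun t ht => ?_
        · refine ⟨?_, ?_⟩
          · have := hInt
            rw [Qm] at this
            exact this.integral_prod_right
          · rw [Ioc_eq_empty (not_lt.2 hT)]; exact integrableOn_empty
        · simp only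
          rw [integral_div]
          exact div_le_div_of_nonneg_right (hK t ht.1) (sq_nonneg t)
    _ = -K * T⁻¹ - -K * S⁻¹ := intervalIntegral.integral_eq_sub_of_hasDerivAt hd hc.intervalIntegrable
    _ ≤ K / S := by
        have : 0 ≤ K * T⁻¹ := mul_nonneg hK0 (inv_nonneg.2 (by linarith))
        rw [div_eq_mul_inv]; linarith

end errors

section errors

variable {d : ℕ} {u v f : V d → ℝ → ℝ} {x : V d} {t : ℝ} [Fact (3 ≤ d)] {M S : ℝ}

lemma intQ_of_bdd {F : V d × ℝ → ℝ} (hF : ContinuousOn F (Om d)) (h0 : ∀ z, 0 ≤ F z)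
    (hi : ∀ t, Integrable fun x => F (x, t)) {B : ℝ} (hB : ∀ t, ∫ x, F (x, t) ≤ B) (T₀ T : ℝ) :
    Integrable F (Qm d T₀ T) := by
  have hm := aesm_Q hF T₀ T
  rw [Qm] at hm ⊢
  refine (integrable_prod_iff' hm).2 ⟨Eventually.of_forall hi, ?_⟩
  refine Integrable.of_bound (C := B) hm.norm.prod_swap.integral_prod_right'
    (Eventually.of_forall fun t => ?_)
  rw [Real.norm_of_nonneg (by positivity)]
  simpa only [Real.norm_of_nonneg (h0 _)] using hB t

/-- Waves with bounded mass and bounded angular momentum. -/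
structure Tame (f : V d → ℝ → ℝ) : Prop where
  reg : Reg f
  int_sq : ∀ t, Integrable (fun x => f x t ^ 2)
  sq_le : ∃ B, ∀ t, ∫ x, f x t ^ 2 ≤ B
  int_ang : ∀ t, Integrable (fun x => ‖x‖ ^ 2 * an f x t)
  ang_le : ∃ B, ∀ t, ∫ x, ‖x‖ ^ 2 * an f x t ≤ B

lemma Tame.intQ_sq (hf : Tame f) (T₀ T : ℝ) :
    Integrable (fun z : V d × ℝ => f z.1 z.2 ^ 2) (Qm d T₀ T) := by
  obtain ⟨B, hB⟩ := hf.sq_le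
  exact intQ_of_bdd (hf.reg.wave.cd.contOn.pow 2) (fun z => sq_nonneg _) hf.int_sq hB T₀ T

lemma Tame.intQ_ang (hf : Tame f) (T₀ T : ℝ) :
    Integrable (fun z : V d × ℝ => ‖z.1‖ ^ 2 * an f z.1 z.2) (Qm d T₀ T) := by
  obtain ⟨B, hB⟩ := hf.ang_le
  exact intQ_of_bdd (ContinuousOn.mul (Continuous.continuousOn (by fun_prop))
    hf.reg.wave.cd.can.contOn) (fun z => mul_nonneg (sq_nonneg _) an_nonneg) hf.int_ang hB T₀ T

lemma dph_far (hS : 0 < S) (ht : 0 < t) {r : ℝ} (h : r ≤ t / 2) :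
    dph S (t - r) ≤ 4 * S ^ 2 / t ^ 2 := by
  have h1 := dph_mul_sq (S := S) (s := t - r) hS
  have h2 : t ^ 2 ≤ 4 * (S ^ 2 + (t - r) ^ 2) := by nlinarith [sq_nonneg S]
  have h3 := mul_le_mul_of_nonneg_left h2 (dph_pos (S := S) (s := t - r)).le
  rw [le_div_iff₀ (by positivity)]
  nlinarith

lemma dph_mul_sub_le (hS : 0 < S) (ht : S ≤ t) (hx : x ≠ 0) :
    dph S (t - ‖x‖) * |nd f x t - f x t ^ 2 / (2 * t)| ≤
      1 / 2 * (dph S (t - ‖x‖) * (D f x t + rd f x t) ^ 2) +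
      (2 * (‖x‖ ^ 2 * an f x t) + 8 * S ^ 2 * nd f x t + 2 * S * f x t ^ 2) / t ^ 2 := by
  have hr : 0 < ‖x‖ := norm_pos_iff.2 hx
  have ht0 : 0 < t := by linarith
  have hA := an_nonneg (u := f) (x := x) (t := t)
  have hA2 := an_le_nd (u := f) (x := x) (t := t)
  have hp2 := pot_le_nd (u := f) (x := x) (t := t)
  have hn := nd_nonneg (u := f) (x := x) (t := t)
  have hw := dph_pos (S := S) (s := t - ‖x‖)
  have e0 : nd f x t - f x t ^ 2 / (2 * t) = 1 / 2 * (D f x t + rd f x t) ^ 2 +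
      1 / 2 * an f x t + 1 / 2 * (f x t ^ 2 / ‖x‖ - f x t ^ 2 / t) := by
    rw [nd_eq, mul_comm 2 ‖x‖, mul_comm 2 t, ← div_div, ← div_div]; ring
  have e1 : |nd f x t - f x t ^ 2 / (2 * t)| ≤ 1 / 2 * (D f x t + rd f x t) ^ 2 +
      1 / 2 * an f x t + 1 / 2 * |f x t ^ 2 / ‖x‖ - f x t ^ 2 / t| := by
    rw [e0]
    refine (abs_add_three _ _ _).trans (le_of_eq ?_)
    rw [abs_of_nonneg (by positivity), abs_of_nonneg (by positivity), abs_mul,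
      abs_of_nonneg (show (0 : ℝ) ≤ 1 / 2 by norm_num)]
  have e2 := mul_le_mul_of_nonneg_left e1 hw.le
  suffices h : dph S (t - ‖x‖) * (1 / 2 * an f x t + 1 / 2 * |f x t ^ 2 / ‖x‖ - f x t ^ 2 / t|) ≤
      (2 * (‖x‖ ^ 2 * an f x t) + 8 * S ^ 2 * nd f x t + 2 * S * f x t ^ 2) / t ^ 2 by
    linarith
  rcases le_total (t / 2) ‖x‖ with h | h
  · have h1 : |f x t ^ 2 / ‖x‖ - f x t ^ 2 / t| ≤ 2 * f x t ^ 2 / t ^ 2 * |t - ‖x‖| := by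
      have : f x t ^ 2 / ‖x‖ - f x t ^ 2 / t = f x t ^ 2 / (‖x‖ * t) * (t - ‖x‖) := by field_simp
      rw [this, abs_mul, abs_of_nonneg (by positivity)]
      refine mul_le_mul_of_nonneg_right ?_ (abs_nonneg _)
      rw [div_le_div_iff₀ (by positivity) (by positivity)]
      nlinarith [mul_nonneg (sq_nonneg (f x t)) ht0.le]
    have h2 := dph_mul_abs_le (s := t - ‖x‖) hS
    have h3 : an f x t ≤ 4 * (‖x‖ ^ 2 * an f x t) / t ^ 2 := by
      rw [le_div_iff₀ (by positivity)]
      have : t ^ 2 ≤ 4 * ‖x‖ ^ 2 := by nlinarith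
      nlinarith
    have h4 := mul_le_of_le_one_left hA (dph_le_one (S := S) (s := t - ‖x‖))
    have h5 := mul_le_mul_of_nonneg_left h1 hw.le
    have h6 := mul_le_mul_of_nonneg_left h2 (show 0 ≤ 2 * f x t ^ 2 / t ^ 2 by positivity)
    have h7 : 0 ≤ 8 * S ^ 2 * nd f x t / t ^ 2 := by positivity
    have h8 : 0 ≤ S * f x t ^ 2 / t ^ 2 := by positivity
    have h9 : (2 * (‖x‖ ^ 2 * an f x t) + 8 * S ^ 2 * nd f x t + 2 * S * f x t ^ 2) / t ^ 2 =
      1 / 2 * (4 * (‖x‖ ^ 2 * an f x t) / t ^ 2) + 8 * S ^ 2 * nd f x t / t ^ 2 +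
      2 * (S * f x t ^ 2 / t ^ 2) := by ring
    have h10 : 2 * f x t ^ 2 / t ^ 2 * (S / 2) = S * f x t ^ 2 / t ^ 2 := by ring
    rw [h10] at h6
    rw [h9]
    linarith
  · have h1 := dph_far (t := t) hS ht0 h
    have h2 : |f x t ^ 2 / ‖x‖ - f x t ^ 2 / t| ≤ 2 * nd f x t + f x t ^ 2 / t := by
      have a1 : 0 ≤ f x t ^ 2 / ‖x‖ := by positivity
      have a2 : 0 ≤ f x t ^ 2 / t := by positivity
      rw [abs_le]; constructor <;> linarith
    have h3 : f x t ^ 2 / t ≤ f x t ^ 2 / S := by gcongr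
    have h4 : 1 / 2 * an f x t + 1 / 2 * |f x t ^ 2 / ‖x‖ - f x t ^ 2 / t| ≤
        2 * nd f x t + 1 / 2 * (f x t ^ 2 / S) := by linarith
    calc _ ≤ 4 * S ^ 2 / t ^ 2 * (2 * nd f x t + 1 / 2 * (f x t ^ 2 / S)) := by gcongr
      _ = (8 * S ^ 2 * nd f x t + 2 * S * f x t ^ 2) / t ^ 2 := by field_simp; ring
      _ ≤ _ := by gcongr; linarith [mul_nonneg (sq_nonneg ‖x‖) hA]

lemma Tame.intQ_sq_div (hf : Tame f) (hS : 0 < S) (T : ℝ) :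
    Integrable (fun z : V d × ℝ => f z.1 z.2 ^ 2 / (2 * z.2)) (Qm d S T) := by
  have : Integrable (fun z : V d × ℝ => 1 / (2 * z.2) * f z.1 z.2 ^ 2) (Qm d S T) := by
    refine (hf.intQ_sq S T).bdd_mul (c := 1 / (2 * S)) (Measurable.aestronglyMeasurable (by fun_prop)) ?_
    filter_upwards [ae_Q_mem S T] with z hz
    have := hz.2.1
    rw [Real.norm_of_nonneg (by have := hS.trans this; positivity)]
    gcongr
  exact this.congr (Eventually.of_forall fun z => by simp only; ring)

/-- Near the light cone the flux density agrees with `f² / (2t)`. -/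
theorem Tame.flux_error (hf : Tame f) {ε : ℝ} (hε : 0 < ε) : ∃ S₀, 1 ≤ S₀ ∧ ∀ S, S₀ ≤ S → ∀ T, S ≤ T →
    ∀ w : ℝ → ℝ, Continuous w → ∀ K, (∀ s, |w s| ≤ K) →
    |∫ z, w (z.2 - ‖z.1‖) * (dph S (z.2 - ‖z.1‖) * nd f z.1 z.2) ∂(Qm d S T) -
      ∫ z, w (z.2 - ‖z.1‖) * (dph S (z.2 - ‖z.1‖) * (f z.1 z.2 ^ 2 / (2 * z.2))) ∂(Qm d S T)| ≤
      K * (ε * S) := by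
  obtain ⟨B, hB⟩ := hf.sq_le
  obtain ⟨A, hA⟩ := hf.ang_le
  have hB0 : 0 ≤ B := (integral_nonneg fun x => sq_nonneg _).trans (hB 0)
  have hA0 : 0 ≤ A := (integral_nonneg fun x => mul_nonneg (sq_nonneg _) an_nonneg).trans (hA 0)
  obtain ⟨T₁, hT1, h1⟩ := hf.reg.outgoing_small (ε := ε) hε
  obtain ⟨T₂, hT2⟩ := eventually_atTop.1 (hf.reg.Nf_tendsto.eventually_lt_const
    (show 0 < ε / 32 by positivity))
  refine ⟨max (max 1 T₁) (max T₂ ((2 * A + 2 * B) * 4 / ε)),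
    (le_max_left _ _).trans (le_max_left _ _), fun S hS T hT w hw K hK => ?_⟩
  simp only [max_le_iff] at hS
  obtain ⟨⟨hS1, hST1⟩, hST2, hSA⟩ := hS
  have hS0 : 0 < S := by linarith
  have hK0 : 0 ≤ K := (abs_nonneg _).trans (hK 0)
  have hdp : ∀ s, |dph S s| ≤ 1 := fun s => by rw [abs_of_pos dph_pos]; exact dph_le_one
  have i1 := int_coneQ hw hK (int_coneQ continuous_dph hdp (hf.reg.wave.intQ_nd S T))
  have i2 := int_coneQ hw hK (int_coneQ continuous_dph hdp (hf.intQ_sq_div hS0 T))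
  rw [← integral_sub i1 i2]
  have i3 := int_coneQ continuous_dph hdp (hf.reg.wave.intQ_out S T)
  have hgi : ∀ T₀ T, Integrable (fun z : V d × ℝ => 2 * (‖z.1‖ ^ 2 * an f z.1 z.2) +
      8 * S ^ 2 * nd f z.1 z.2 + 2 * S * f z.1 z.2 ^ 2) (Qm d T₀ T) := fun T₀ T =>
    (((hf.intQ_ang T₀ T).const_mul _).add ((hf.reg.wave.intQ_nd T₀ T).const_mul _)).add
      ((hf.intQ_sq T₀ T).const_mul _)
  have h2 := integral_div_sq_le hgi (K := 2 * A + 8 * S ^ 2 * (ε / 32) + 2 * S * B) hS0 hT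
    (by positivity) fun t ht => by
      have j : Integrable fun x : V d => 2 * (‖x‖ ^ 2 * an f x t) + 8 * S ^ 2 * nd f x t :=
        ((hf.int_ang t).const_mul _).add ((hf.reg.wave.int_nd t).const_mul _)
      simp only
      rw [integral_add j ((hf.int_sq t).const_mul _), integral_add ((hf.int_ang t).const_mul _)
        ((hf.reg.wave.int_nd t).const_mul _), integral_const_mul, integral_const_mul,
        integral_const_mul]
      have := hT2 t (hST2.trans ht)
      rw [Nf] at this
      have a1 := hA t
      have a2 := hB t
      gcongr
  have h3 := h1 S hST1 T hT S hS1
  calc _ ≤ ∫ z, K * (1 / 2 * (dph S (z.2 - ‖z.1‖) * (D f z.1 z.2 + rd f z.1 z.2) ^ 2) +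
        (2 * (‖z.1‖ ^ 2 * an f z.1 z.2) + 8 * S ^ 2 * nd f z.1 z.2 + 2 * S * f z.1 z.2 ^ 2) /
          z.2 ^ 2) ∂(Qm d S T) := by
        refine abs_integral_le_integral_abs.trans ?_
        refine integral_mono_ae (i1.sub i2).abs (((i3.const_mul _).add h2.1).const_mul K) ?_
        filter_upwards [ae_Q_mem S T] with z hz
        have := dph_mul_sub_le (f := f) hS0 hz.2.1.le hz.1
        have hw' := hK (z.2 - ‖z.1‖)
        rw [← mul_sub, ← mul_sub, abs_mul, abs_mul, abs_of_pos dph_pos]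
        exact mul_le_mul hw' this (mul_nonneg dph_pos.le (abs_nonneg _)) hK0
    _ = K * (1 / 2 * (∫ z, dph S (z.2 - ‖z.1‖) * (D f z.1 z.2 + rd f z.1 z.2) ^ 2 ∂(Qm d S T)) +
        ∫ z, (2 * (‖z.1‖ ^ 2 * an f z.1 z.2) + 8 * S ^ 2 * nd f z.1 z.2 + 2 * S * f z.1 z.2 ^ 2) /
          z.2 ^ 2 ∂(Qm d S T)) := by
        rw [integral_const_mul, integral_add (i3.const_mul _) h2.1, integral_const_mul]
    _ ≤ K * (ε * S) := by
        refine mul_le_mul_of_nonneg_left ?_ hK0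
        have e : (2 * A + 8 * S ^ 2 * (ε / 32) + 2 * S * B) / S = 2 * A / S + ε / 4 * S + 2 * B := by
          field_simp; ring
        have e2 : 2 * A / S ≤ 2 * A := div_le_self (by positivity) hS1
        have e3 : 2 * A + 2 * B ≤ ε / 4 * S := by
          rw [div_le_iff₀ hε] at hSA; linarith
        have h4 := h2.2
        rw [e] at h4
        linarith

lemma mul_out_le {η : ℝ} (hη : 0 < η) :
    |D u x t * (D u x t + rd u x t)| ≤ η * eDenFree u x t + nd u x t / η := by
  have h1 : D u x t ^ 2 ≤ 2 * eDenFree u x t := D_sq_le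
  have h2 := out_sq_le (u := u) (x := x) (t := t)
  generalize eDenFree u x t = e at *
  generalize nd u x t = n at *
  generalize D u x t = p at *
  generalize p + rd u x t = q at *
  have h3 : 2 * (η * |p|) * |q| ≤ (η * |p|) ^ 2 + |q| ^ 2 := two_mul_le_add_sq _ _
  have h4 : |p * q| * η ≤ η ^ 2 * e + n := by
    rw [mul_pow, sq_abs, sq_abs] at h3
    rw [abs_mul]
    nlinarith [mul_le_mul_of_nonneg_left h1 (sq_nonneg η)]
  have h5 : η * e + n / η = (η ^ 2 * e + n) / η := by field_simp
  rw [h5, le_div_iff₀ hη]; exact h4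

lemma equip_le {η : ℝ} (hη : 0 < η) :
    |eDenFree u x t - D u x t ^ 2| ≤ η * eDenFree u x t + (1 + 1 / η) * nd u x t := by
  have h := mul_out_le (u := u) (x := x) (t := t) hη
  have e : eDenFree u x t - D u x t ^ 2 = nd u x t - D u x t * (D u x t + rd u x t) := by
    rw [nd, ]; ring
  rw [e, add_mul, one_mul, one_div_mul_eq_div]
  refine (abs_sub _ _).trans ?_
  rw [abs_of_nonneg nd_nonneg]
  linarith

lemma Wave.int_D_sq (hu : Wave u) (t : ℝ) : Integrable (fun x => D u x t ^ 2) :=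
  int_slice (F := fun q => D u q.1 q.2 ^ 2) (hu.cd.cD.contOn.pow 2) ((hu.int t).const_mul 2)
    fun x _ => by rw [abs_of_nonneg (sq_nonneg _)]; exact D_sq_le

lemma Wave.int_gr_sq (hu : Wave u) (t : ℝ) : Integrable (fun x => ‖gr u x t‖ ^ 2) :=
  int_slice (F := fun q => ‖gr u q.1 q.2‖ ^ 2) (hu.cd.cgr.contOn.norm.pow 2)
    ((hu.int t).const_mul 2) fun x _ => by rw [abs_of_nonneg (sq_nonneg _)]; exact gr_sq_le

lemma Wave.int_pot (hu : Wave u) (t : ℝ) : Integrable (fun x => u x t ^ 2 / ‖x‖) :=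
  int_slice (F := fun q => u q.1 q.2 ^ 2 / ‖q.1‖) ((hu.cd.contOn.pow 2).div (by fun_prop)
    fun q hq => Om_ne hq) ((hu.int t).const_mul 2)
    fun x _ => by rw [abs_of_nonneg (by positivity)]; exact pot_le

/-- Asymptotic equipartition of energy. -/
theorem Reg.equipartition (hu : Reg u) :
    Tendsto (fun t => ∫ x, |eDenFree u x t - D u x t ^ 2|) atTop (𝓝 0) := by
  obtain ⟨B, hB⟩ := hu.wave.bdd
  have hB0 : 0 ≤ B := (integral_nonneg fun x => eDen_nonneg).trans (hB 0)
  rw [Metric.tendsto_atTop]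
  intro ε hε
  set η := ε / (2 * (B + 1)) with hη
  have hη0 : 0 < η := by positivity
  have h2 := hu.Nf_tendsto.const_mul (1 + 1 / η)
  rw [mul_zero] at h2
  obtain ⟨T, hT⟩ := eventually_atTop.1 (h2.eventually_lt_const (show 0 < ε / 2 by positivity))
  refine ⟨T, fun t ht => ?_⟩
  rw [Real.dist_eq, sub_zero, abs_of_nonneg (by positivity)]
  have h3 : ∫ x, |eDenFree u x t - D u x t ^ 2| ≤ η * (∫ x, eDenFree u x t) + (1 + 1 / η) * Nf u t := by
    rw [Nf, ← integral_const_mul, ← integral_const_mul, ← integral_add ((hu.wave.int t).const_mul _)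
      ((hu.wave.int_nd t).const_mul _)]
    exact integral_mono ((hu.wave.int t).sub (hu.wave.int_D_sq t)).abs
      (((hu.wave.int t).const_mul _).add ((hu.wave.int_nd t).const_mul _)) fun x => equip_le hη0
  have h4 : η * (∫ x, eDenFree u x t) ≤ ε / 2 := by
    calc _ ≤ η * (B + 1) := by gcongr; linarith [hB t]
      _ = ε / 2 := by rw [hη]; field_simp
  linarith [hT t ht]

lemma equip_gr_le : |‖gr u x t‖ ^ 2 - D u x t ^ 2| ≤
    2 * |eDenFree u x t - D u x t ^ 2| + 2 * nd u x t := by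
  have e : ‖gr u x t‖ ^ 2 - D u x t ^ 2 = 2 * (eDenFree u x t - D u x t ^ 2) - u x t ^ 2 / ‖x‖ := by
    rw [eDen_def, mul_comm 2 ‖x‖, ← div_div]; ring
  rw [e]
  refine (abs_sub _ _).trans ?_
  rw [abs_mul, abs_two, abs_of_nonneg (show 0 ≤ u x t ^ 2 / ‖x‖ by positivity)]
  linarith [pot_le_nd (u := u) (x := x) (t := t)]

end errors

section equipartition
variable {d : ℕ} {u v f : V d → ℝ → ℝ} {x : V d} {t : ℝ} [Fact (3 ≤ d)] {M S : ℝ}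

lemma ph_sq_le (hS : 0 < S) (s : ℝ) : ph S s ^ 2 ≤ 4 * S ^ 2 := by
  have := abs_ph_le_two (s := s) hS
  rw [← sq_abs]
  nlinarith [abs_nonneg (ph S s)]

lemma abs_ph_mul_dph_le (hS : 0 < S) (s : ℝ) : |2 * ph S s * dph S s| ≤ 4 * S := by
  rw [abs_mul, abs_mul, abs_of_pos dph_pos, abs_of_pos (zero_lt_two' ℝ)]
  have := abs_ph_le_two (s := s) hS
  have h1 := dph_le_one (S := S) (s := s)
  have h2 := dph_pos (S := S) (s := s)
  nlinarith [abs_nonneg (ph S s)]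

lemma deriv_ph_sq (hS : 0 < S) (s : ℝ) :
    HasDerivAt (fun s => ph S s ^ 2) (2 * ph S s * dph S s) s := by
  simpa using (hasDerivAt_ph hS s).fun_pow 2

/-- The cone identity for the weight `ph ^ 2`. -/
lemma Reg.cone_sq (hu : Reg u) (hS : 1 ≤ S) {T₀ T : ℝ} (hT : T₀ ≤ T) :
    (∫ x, ph S (T - ‖x‖) ^ 2 * eDenFree u x T) - ∫ x, ph S (T₀ - ‖x‖) ^ 2 * eDenFree u x T₀ =
      ∫ z, 2 * ph S (z.2 - ‖z.1‖) * dph S (z.2 - ‖z.1‖) * nd u z.1 z.2 ∂(Qm d T₀ T) := by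
  have hS0 : 0 < S := by linarith
  have hd : deriv (fun s => ph S s ^ 2) = fun s => 2 * ph S s * dph S s :=
    funext fun s => (deriv_ph_sq hS0 s).deriv
  have := cone_identity hu.wave hu.contD (φ := fun s => ph S s ^ 2) (contDiff_ph.pow 2)
    (M := 4 * S ^ 2) (fun s => by rw [abs_of_nonneg (sq_nonneg _)]; exact ph_sq_le hS0 s)
    (fun s => by rw [hd]; exact (abs_ph_mul_dph_le hS0 s).trans (by nlinarith)) hT
  rwa [hd] at this

/-- The cone identity for the weight `ph`. -/
lemma Reg.cone_ph (hu : Reg u) (hS : 1 ≤ S) {T₀ T : ℝ} (hT : T₀ ≤ T) :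
    (∫ x, ph S (T - ‖x‖) * eDenFree u x T) - ∫ x, ph S (T₀ - ‖x‖) * eDenFree u x T₀ =
      ∫ z, dph S (z.2 - ‖z.1‖) * nd u z.1 z.2 ∂(Qm d T₀ T) := by
  have hS0 : 0 < S := by linarith
  have := cone_identity hu.wave hu.contD (φ := ph S) contDiff_ph
    (M := 2 * S) (fun s => abs_ph_le_two hS0)
    (fun s => by rw [deriv_ph hS0, abs_of_pos dph_pos]; linarith [dph_le_one (S := S) (s := s)]) hT
  rwa [deriv_ph hS0] at this

lemma Wave.tendsto_ph_sq (hu : Wave u) (t : ℝ) :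
    Tendsto (fun S => ∫ x, (ph S (t - ‖x‖) / S) ^ 2 * eDenFree u x t) atTop (𝓝 0) := by
  have := tendsto_integral_filter_of_dominated_convergence (μ := (volume : Measure (V d)))
    (l := atTop) (F := fun (S : ℝ) x => (ph S (t - ‖x‖) / S) ^ 2 * eDenFree u x t) (f := fun _ => 0)
    (fun x => 4 * eDenFree u x t) ?_ ?_ ((hu.int t).const_mul 4) ?_
  · simpa using this
  · filter_upwards with S
    refine AEStronglyMeasurable.mul ?_ (hu.int t).aestronglyMeasurable
    have : Continuous (ph S) := by fun_prop
    exact (by fun_prop : Continuous fun x : V d => (ph S (t - ‖x‖) / S) ^ 2).aestronglyMeasurable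
  · filter_upwards [eventually_gt_atTop 0] with S hS
    filter_upwards with x
    rw [Real.norm_eq_abs, abs_of_nonneg (mul_nonneg (sq_nonneg _) eDen_nonneg), div_pow]
    refine mul_le_mul_of_nonneg_right ?_ eDen_nonneg
    rw [div_le_iff₀ (by positivity)]
    exact ph_sq_le hS _
  · filter_upwards with x
    rw [show (0 : ℝ) = (0 : ℝ) ^ 2 * eDenFree u x t by ring]
    refine Tendsto.mul (Tendsto.pow ?_ 2) tendsto_const_nhds
    have h1 : Tendsto (fun S : ℝ => Real.arctan ((t - ‖x‖) / S)) atTop (𝓝 0) := by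
      have := (Real.continuous_arctan.tendsto 0).comp
        ((tendsto_const_nhds (x := t - ‖x‖)).div_atTop tendsto_id)
      simpa [Function.comp_def] using this
    refine h1.congr' ?_
    filter_upwards [eventually_gt_atTop 0] with S hS
    rw [ph]; field_simp

lemma Reg.init_sq (hu : Reg u) {ε : ℝ} (hε : 0 < ε) : ∃ S₀, 1 ≤ S₀ ∧ ∀ S, S₀ ≤ S →
    ∫ x, ph S (S - ‖x‖) ^ 2 * eDenFree u x S ≤ ε * S ^ 2 := by
  obtain ⟨T₁, hT1⟩ := eventually_atTop.1 (hu.Nf_tendsto.eventually_lt_const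
    (show 0 < ε / 8 by positivity))
  obtain ⟨S₁, hS1⟩ := eventually_atTop.1 ((hu.wave.tendsto_ph_sq (max T₁ 0)).eventually_lt_const
    (show 0 < ε / 2 by positivity))
  refine ⟨max 1 (max (max T₁ 0) S₁), le_max_left _ _, fun S hS => ?_⟩
  simp only [max_le_iff] at hS
  obtain ⟨hSo, ⟨hST, hSp⟩, hSS⟩ := hS
  have hS0 : 0 < S := by linarith
  set T₀ := max T₁ 0 with hT0
  have hTS : T₀ ≤ S := max_le hST hSp
  have h1 := hu.cone_sq hSo hTS
  have h2 := hS1 S hSS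
  have h3 : ∫ x, ph S (T₀ - ‖x‖) ^ 2 * eDenFree u x T₀ ≤ ε / 2 * S ^ 2 := by
    have e : ∀ x : V d, ph S (T₀ - ‖x‖) ^ 2 * eDenFree u x T₀ =
        S ^ 2 * ((ph S (T₀ - ‖x‖) / S) ^ 2 * eDenFree u x T₀) := fun x => by field_simp
    simp_rw [e]
    rw [integral_const_mul, mul_comm]
    exact mul_le_mul_of_nonneg_right h2.le (sq_nonneg _)
  have h4 : ∫ z, 2 * ph S (z.2 - ‖z.1‖) * dph S (z.2 - ‖z.1‖) * nd u z.1 z.2 ∂(Qm d T₀ S) ≤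
      ε / 2 * S ^ 2 := by
    calc _ ≤ ∫ z, 4 * S * nd u z.1 z.2 ∂(Qm d T₀ S) := by
          refine integral_mono (int_coneQ (φ := fun s => 2 * ph S s * dph S s) (by fun_prop)
            (abs_ph_mul_dph_le hS0) (hu.wave.intQ_nd _ _)) ((hu.wave.intQ_nd _ _).const_mul _)
            fun z => mul_le_mul_of_nonneg_right ((le_abs_self _).trans (abs_ph_mul_dph_le hS0 _))
              nd_nonneg
      _ = 4 * S * ∫ t in T₀..S, Nf u t := by
          rw [integral_const_mul, integral_Q hTS (hu.wave.intQ_nd _ _)]; rfl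
      _ ≤ 4 * S * ∫ t in T₀..S, ε / 8 := by
          refine mul_le_mul_of_nonneg_left ?_ (by positivity)
          refine intervalIntegral.integral_mono_on hTS
            (intervalIntegrable_Q (f := fun z => nd u z.1 z.2) hu.wave.intQ_nd T₀ S)
            intervalIntegrable_const fun t ht => (hT1 t ((le_max_left _ _).trans ht.1)).le
      _ ≤ ε / 2 * S ^ 2 := by
          rw [intervalIntegral.integral_const, smul_eq_mul]
          have : 0 ≤ T₀ := le_max_right _ _
          nlinarith [mul_pos hS0 hε, mul_nonneg this (mul_pos hS0 hε).le]
  linarith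

lemma Reg.init_abs (hu : Reg u) {ε : ℝ} (hε : 0 < ε) : ∃ S₀, 1 ≤ S₀ ∧ ∀ S, S₀ ≤ S →
    |∫ x, ph S (S - ‖x‖) * eDenFree u x S| ≤ ε * S := by
  obtain ⟨B, hB⟩ := hu.wave.bdd
  have hB0 : 0 ≤ B := (integral_nonneg fun x => eDen_nonneg).trans (hB 0)
  set δ := ε / (2 * (B + 1)) with hδ
  have hδ0 : 0 < δ := by positivity
  have hδB : δ * B ≤ ε / 2 := by
    rw [hδ, div_mul_eq_mul_div, div_le_div_iff₀ (by positivity) (by positivity)]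
    nlinarith
  obtain ⟨S₀, hS0, h⟩ := hu.init_sq (ε := ε / 2 * δ) (by positivity)
  refine ⟨S₀, hS0, fun S hS => ?_⟩
  have hSp : 0 < S := by linarith
  have i1 := int_cone (φ := ph S) (by fun_prop) (fun s => abs_ph_le_two hSp) (hu.wave.int S) S
  have i2 := int_cone (φ := fun s => ph S s ^ 2) (by fun_prop)
    (fun s => by rw [abs_of_nonneg (sq_nonneg _)]; exact ph_sq_le hSp s) (hu.wave.int S) S
  calc _ ≤ ∫ x, (δ * S * eDenFree u x S + 1 / (δ * S) * (ph S (S - ‖x‖) ^ 2 * eDenFree u x S)) := by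
        refine abs_integral_le_integral_abs.trans (integral_mono i1.abs
          (((hu.wave.int S).const_mul _).add (i2.const_mul _)) fun x => ?_)
        simp only [abs_mul, abs_of_nonneg (eDen_nonneg (u := u) (x := x) (t := S)), ← mul_assoc,
          ← add_mul]
        refine mul_le_mul_of_nonneg_right ?_ eDen_nonneg
        rw [← sq_abs (ph S _)]
        generalize |ph S (S - ‖x‖)| = a
        have : 0 < δ * S := by positivity
        rw [one_div, inv_mul_eq_div, ← sub_nonneg]
        have e : δ * S + a ^ 2 / (δ * S) - a = ((δ * S - a) ^ 2 + δ * S * a) / (δ * S) := by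
          field_simp; ring
        have e' : (δ * S - a) ^ 2 + δ * S * a = (δ * S - a / 2) ^ 2 + 3 / 4 * a ^ 2 := by ring
        rw [e, e']; positivity
    _ = δ * S * (∫ x, eDenFree u x S) + 1 / (δ * S) * ∫ x, ph S (S - ‖x‖) ^ 2 * eDenFree u x S := by
        rw [integral_add ((hu.wave.int S).const_mul _) (i2.const_mul _), integral_const_mul,
          integral_const_mul]
    _ ≤ δ * S * B + 1 / (δ * S) * (ε / 2 * δ * S ^ 2) := by
        gcongr
        · exact hB S
        · exact h S hS
    _ ≤ ε * S := by
        have : 1 / (δ * S) * (ε / 2 * δ * S ^ 2) = ε / 2 * S := by field_simp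
        rw [this]; nlinarith

/-- Weighted error in the equipartition of energy. -/
lemma Reg.equip_weight (hu : Reg u) {ε : ℝ} (hε : 0 < ε) : ∃ T₀, ∀ t, T₀ ≤ t → ∀ w : ℝ → ℝ,
    Continuous w → ∀ K, (∀ s, |w s| ≤ K) →
    |(∫ x, w (t - ‖x‖) * eDenFree u x t) - ∫ x, w (t - ‖x‖) * D u x t ^ 2| ≤ K * ε := by
  obtain ⟨T₀, hT⟩ := eventually_atTop.1 (hu.equipartition.eventually_lt_const hε)
  refine ⟨T₀, fun t ht w hw K hK => ?_⟩
  have hK0 : 0 ≤ K := (abs_nonneg _).trans (hK 0)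
  have i := (hu.wave.int t).sub (hu.wave.int_D_sq t)
  rw [← integral_sub (int_cone hw hK (hu.wave.int t) t) (int_cone hw hK (hu.wave.int_D_sq t) t)]
  calc _ ≤ ∫ x, K * |eDenFree u x t - D u x t ^ 2| := by
        refine abs_integral_le_integral_abs.trans (integral_mono
          ((int_cone hw hK (hu.wave.int t) t).sub (int_cone hw hK (hu.wave.int_D_sq t) t)).abs
          (i.abs.const_mul K) fun x => ?_)
        simp only [← mul_sub, abs_mul]
        exact mul_le_mul_of_nonneg_right (hK _) (abs_nonneg _)
    _ ≤ _ := by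
        rw [integral_const_mul]
        exact mul_le_mul_of_nonneg_left (hT t ht).le hK0

lemma Tame.first_moment (hf : Tame f) {ε : ℝ} (hε : 0 < ε) : ∃ S₀, 1 ≤ S₀ ∧ ∀ S, S₀ ≤ S → ∀ T, S ≤ T →
    |(∫ x, ph S (T - ‖x‖) * D f x T ^ 2) -
      ∫ z, dph S (z.2 - ‖z.1‖) * (f z.1 z.2 ^ 2 / (2 * z.2)) ∂(Qm d S T)| ≤ ε * S := by
  obtain ⟨S₁, h1, H1⟩ := hf.flux_error (ε := ε / 4) (by positivity)
  obtain ⟨S₂, h2, H2⟩ := hf.reg.init_abs (ε := ε / 4) (by positivity)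
  obtain ⟨S₃, H3⟩ := hf.reg.equip_weight (ε := ε / 4) (by positivity)
  refine ⟨max S₁ (max S₂ S₃), h1.trans (le_max_left _ _), fun S hS T hT => ?_⟩
  simp only [max_le_iff] at hS
  have hSo : 1 ≤ S := by linarith
  have hSp : 0 < S := by linarith
  have a1 := H1 S hS.1 T hT (fun _ => 1) continuous_const 1 (by simp)
  simp only [one_mul] at a1
  have a2 := H2 S hS.2.1
  have a3 := H3 T (hS.2.2.trans hT) (ph S) (by fun_prop) (2 * S) fun s => abs_ph_le_two hSp
  have a4 := hf.reg.cone_ph hSo hT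
  rw [abs_le] at *
  constructor <;> linarith [a1.1, a1.2, a2.1, a2.2, a3.1, a3.2]

lemma Tame.second_moment (hf : Tame f) {ε : ℝ} (hε : 0 < ε) :
    ∃ S₀, 1 ≤ S₀ ∧ ∀ S, S₀ ≤ S → ∀ T, S ≤ T →
    |(∫ x, ph S (T - ‖x‖) ^ 2 * D f x T ^ 2) -
      ∫ z, 2 * ph S (z.2 - ‖z.1‖) * (dph S (z.2 - ‖z.1‖) * (f z.1 z.2 ^ 2 / (2 * z.2))) ∂(Qm d S T)| ≤
      ε * S ^ 2 := by
  obtain ⟨S₁, h1, H1⟩ := hf.flux_error (ε := ε / 16) (by positivity)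
  obtain ⟨S₂, h2, H2⟩ := hf.reg.init_sq (ε := ε / 4) (by positivity)
  obtain ⟨S₃, H3⟩ := hf.reg.equip_weight (ε := ε / 16) (by positivity)
  refine ⟨max S₁ (max S₂ S₃), h1.trans (le_max_left _ _), fun S hS T hT => ?_⟩
  simp only [max_le_iff] at hS
  have hSo : 1 ≤ S := by linarith
  have hSp : 0 < S := by linarith
  have a1 := H1 S hS.1 T hT (fun s => 2 * ph S s) (by fun_prop) (4 * S) (fun s => by
    rw [abs_mul, abs_two]; linarith [abs_ph_le_two (s := s) hSp])
  have a2 := H2 S hS.2.1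
  have a2' : 0 ≤ ∫ x, ph S (S - ‖x‖) ^ 2 * eDenFree f x S :=
    integral_nonneg fun x => mul_nonneg (sq_nonneg _) eDen_nonneg
  have a3 := H3 T (hS.2.2.trans hT) (fun s => ph S s ^ 2) (by fun_prop) (4 * S ^ 2) fun s => by
    rw [abs_of_nonneg (sq_nonneg _)]; exact ph_sq_le hSp s
  have a4 := hf.reg.cone_sq hSo hT
  simp only [← mul_assoc] at *
  have hp : 0 < ε * S ^ 2 := by positivity
  rw [abs_le] at *
  constructor <;> linarith [a1.1, a1.2, a3.1, a3.2]

lemma Reg.kinetic_tendsto (hu : Reg u) :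
    Tendsto (fun t => ∫ x, D u x t ^ 2) atTop (𝓝 (∫ x, eDenFree u x 0)) := by
  rw [Metric.tendsto_atTop]
  intro ε hε
  obtain ⟨T₀, h⟩ := hu.equip_weight (ε := ε / 2) (by positivity)
  refine ⟨T₀, fun t ht => ?_⟩
  have := h t ht (fun _ => 1) continuous_const 1 (by simp)
  simp only [one_mul] at this
  rw [energy_conservation hu.wave hu.contD t 0] at this
  rw [dist_comm, Real.dist_eq]; linarith

end equipartition

section moments
variable {d : ℕ} {u v f : V d → ℝ → ℝ} {x : V d} {t : ℝ} [Fact (3 ≤ d)] {M S : ℝ}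

lemma integral_Q_log_le {g : V d × ℝ → ℝ} (hS : 0 < S) {T : ℝ} (hT : S ≤ T)
    (hg : Integrable (fun z => g z / z.2) (Qm d S T)) {A B : ℝ}
    (h : ∀ τ, S ≤ τ → τ ≤ T → ∫ x, g (x, τ) ≤ A + B * Real.log (τ / S)) :
    ∫ z, g z / z.2 ∂(Qm d S T) ≤ A * Real.log (T / S) + B * (Real.log (T / S) ^ 2 / 2) := by
  have hc : ContinuousOn (fun τ : ℝ => (A + B * Real.log (τ / S)) / τ) (Icc S T) := by
    refine ContinuousOn.div (continuousOn_const.add (continuousOn_const.mul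
      (ContinuousOn.log (by fun_prop) fun τ hτ => ?_))) continuousOn_id fun τ hτ => ?_
    · have := hS.trans_le hτ.1; positivity
    · exact (hS.trans_le hτ.1).ne'
  rw [integral_Q hT hg]
  calc _ ≤ ∫ τ in S..T, (A + B * Real.log (τ / S)) / τ := by
        refine intervalIntegral.integral_mono_on hT ?_ ?_ fun τ hτ => ?_
        · rw [intervalIntegrable_iff_integrableOn_Ioc_of_le hT]
          exact hg.integral_prod_right
        · exact (by rwa [uIcc_of_le hT] : ContinuousOn _ (uIcc S T)).intervalIntegrable
        · simp only [integral_div]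
          exact div_le_div_of_nonneg_right (h τ hτ.1 hτ.2) (hS.le.trans hτ.1)
    _ = _ := by
        have := intervalIntegral.integral_eq_sub_of_hasDerivAt
          (f := fun τ => A * Real.log (τ / S) + B * (Real.log (τ / S) ^ 2 / 2))
          (f' := fun τ => (A + B * Real.log (τ / S)) / τ) (a := S) (b := T) (fun τ hτ => ?_) ?_
        · rw [this]; simp [hS.ne']
        · rw [uIcc_of_le hT] at hτ
          have hp := hS.trans_le hτ.1
          have h1 : HasDerivAt (fun τ => Real.log (τ / S)) (1 / τ) τ := by
            refine (((hasDerivAt_id τ).div_const S).log (by simp; exact ⟨hp.ne', hS.ne'⟩)).congr_deriv ?_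
            simp only [id]; field_simp
          refine ((h1.const_mul A).fun_add (((h1.fun_pow 2).div_const 2).const_mul B)).congr_deriv ?_
          simp only [Nat.cast_ofNat, Nat.add_one_sub_one, pow_one]
          field_simp
        · exact (by rwa [uIcc_of_le hT] : ContinuousOn _ (uIcc S T)).intervalIntegrable

lemma Tame.intQ_div (hf : Tame f) (hS : 0 < S) (T : ℝ) :
    Integrable (fun z : V d × ℝ => f z.1 z.2 ^ 2 / z.2) (Qm d S T) := by
  refine ((hf.intQ_sq_div hS T).const_mul 2).congr ?_
  filter_upwards [ae_Q_mem S T] with z hz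
  have := (hS.trans hz.2.1).ne'
  field_simp

/-- Most of the `L²` mass of `D f` lies where `dph S` is close to one. -/
lemma Tame.tail (hf : Tame f) : ∃ B, 0 ≤ B ∧ ∀ ε, 0 < ε → ∃ S₀, 1 ≤ S₀ ∧ ∀ S, S₀ ≤ S → ∀ T, S ≤ T →
    ∫ x, (1 - dph S (T - ‖x‖)) * D f x T ^ 2 ≤ ε + B * (Real.log (T / S) / S) := by
  obtain ⟨B, hB⟩ := hf.sq_le
  have hB0 : 0 ≤ B := (integral_nonneg fun x => sq_nonneg _).trans (hB 0)
  refine ⟨2 * B, by positivity, fun ε hε => ?_⟩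
  obtain ⟨S₀, h0, h⟩ := hf.second_moment hε
  refine ⟨S₀, h0, fun S hS T hT => ?_⟩
  have hS0 : 0 < S := by linarith
  have a1 := (abs_le.1 (h S hS T hT)).2
  have hb : ∀ s, |dph S s * ph S s| ≤ 2 * S := fun s => by
    have := abs_ph_mul_dph_le hS0 s
    rw [mul_assoc, abs_mul, abs_two, mul_comm (ph S s)] at this; linarith
  have hi := int_coneQ (φ := fun s => dph S s * ph S s) (by fun_prop) hb (hf.intQ_div hS0 T)
  have a2 : ∫ z, 2 * ph S (z.2 - ‖z.1‖) * (dph S (z.2 - ‖z.1‖) * (f z.1 z.2 ^ 2 / (2 * z.2)))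
      ∂(Qm d S T) ≤ 2 * S * B * Real.log (T / S) := by
    have e : ∀ z : V d × ℝ, 2 * ph S (z.2 - ‖z.1‖) *
        (dph S (z.2 - ‖z.1‖) * (f z.1 z.2 ^ 2 / (2 * z.2))) =
        (dph S (z.2 - ‖z.1‖) * ph S (z.2 - ‖z.1‖) * f z.1 z.2 ^ 2) / z.2 := fun z => by
      by_cases hz : z.2 = 0
      · simp [hz]
      · field_simp
    simp_rw [e]
    have := integral_Q_log_le (g := fun z : V d × ℝ => dph S (z.2 - ‖z.1‖) * ph S (z.2 - ‖z.1‖) *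
      f z.1 z.2 ^ 2) hS0 hT (by simpa only [mul_div_assoc] using hi) (A := 2 * S * B) (B := 0)
      fun τ h1 h2 => by
        have i := int_cone (φ := fun s => dph S s * ph S s) (by fun_prop) hb (hf.int_sq τ) τ
        calc _ ≤ ∫ x, 2 * S * f x τ ^ 2 := integral_mono i ((hf.int_sq τ).const_mul _) fun x =>
              mul_le_mul_of_nonneg_right ((le_abs_self _).trans (hb _)) (sq_nonneg _)
          _ ≤ _ := by
              rw [integral_const_mul, zero_mul, add_zero]
              exact mul_le_mul_of_nonneg_left (hB τ) (by positivity)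
    linarith
  have i2 := int_cone (φ := fun s => ph S s ^ 2) (by fun_prop)
    (fun s => by rw [abs_of_nonneg (sq_nonneg _)]; exact ph_sq_le hS0 s)
    (hf.reg.wave.int_D_sq T) T
  have i1 := int_cone (φ := fun s => 1 - dph S s) (K := 1) (by fun_prop)
    (fun s => by
      have h1 := dph_le_one (S := S) (s := s)
      have h2 := dph_pos (S := S) (s := s)
      rw [abs_le]; constructor <;> linarith) (hf.reg.wave.int_D_sq T) T
  calc _ ≤ ∫ x, 1 / S ^ 2 * (ph S (T - ‖x‖) ^ 2 * D f x T ^ 2) := by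
        refine integral_mono i1 (i2.const_mul _) fun x => ?_
        have := one_sub_dph_le (s := T - ‖x‖) hS0
        calc _ ≤ ph S (T - ‖x‖) ^ 2 / S ^ 2 * D f x T ^ 2 :=
              mul_le_mul_of_nonneg_right this (sq_nonneg _)
          _ = _ := by ring
    _ ≤ 1 / S ^ 2 * (ε * S ^ 2 + 2 * S * B * Real.log (T / S)) := by
        rw [integral_const_mul]
        refine mul_le_mul_of_nonneg_left ?_ (by positivity)
        linarith
    _ = _ := by field_simp

/-- Upper and lower bounds for the first moment of `D f` when `f` is a time derivative. -/
lemma first_moment_bounds (hf : Tame f) (hg : Tame (D f)) : ∃ B, 0 ≤ B ∧ ∀ ε, 0 < ε →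
    ∃ S₀, 1 ≤ S₀ ∧ ∀ S, S₀ ≤ S → ∀ T, S ≤ T →
    ∫ x, ph S (T - ‖x‖) * D (D f) x T ^ 2 ≤
      1 / 2 * ((∫ x, eDenFree f x 0) + ε) * Real.log (T / S) + ε * S ∧
    1 / 2 * ((∫ x, eDenFree f x 0) - ε - B * (Real.log (T / S) / S)) * Real.log (T / S) - ε * S ≤
      ∫ x, ph S (T - ‖x‖) * D (D f) x T ^ 2 := by
  obtain ⟨B, hB0, hB⟩ := hf.tail
  refine ⟨B, hB0, fun ε hε => ?_⟩
  obtain ⟨S₁, h1, H1⟩ := hB (ε / 2) (by positivity)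
  obtain ⟨S₂, h2, H2⟩ := hg.first_moment hε
  obtain ⟨S₃, H3⟩ := Metric.tendsto_atTop.1 hf.reg.kinetic_tendsto (ε / 2) (by positivity)
  refine ⟨max S₁ (max S₂ S₃), h1.trans (le_max_left _ _), fun S hS T hT => ?_⟩
  simp only [max_le_iff] at hS
  have hS0 : 0 < S := by linarith
  have hl : ∀ τ, S ≤ τ → 0 ≤ Real.log (τ / S) := fun τ hτ =>
    Real.log_nonneg ((one_le_div hS0).2 hτ)
  have hdp : ∀ s, |dph S s| ≤ 1 := fun s => by rw [abs_of_pos dph_pos]; exact dph_le_one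
  have hi := int_coneQ continuous_dph hdp (hg.intQ_div hS0 T)
  have e : ∫ z, dph S (z.2 - ‖z.1‖) * (D f z.1 z.2 ^ 2 / (2 * z.2)) ∂(Qm d S T) =
      1 / 2 * ∫ z, dph S (z.2 - ‖z.1‖) * D f z.1 z.2 ^ 2 / z.2 ∂(Qm d S T) := by
    rw [← integral_const_mul]
    congr 1; ext z
    by_cases hz : z.2 = 0
    · simp [hz]
    · field_simp
  have a1 := abs_le.1 (H2 S hS.2.1 T hT)
  rw [e] at a1
  have hi' : Integrable (fun z : V d × ℝ => dph S (z.2 - ‖z.1‖) * D f z.1 z.2 ^ 2 / z.2)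
    (Qm d S T) := by simpa only [mul_div_assoc] using hi
  have i1 : ∀ τ, Integrable fun x => dph S (τ - ‖x‖) * D f x τ ^ 2 := fun τ =>
    int_cone continuous_dph hdp (hg.int_sq τ) τ
  have b1 := integral_Q_log_le (g := fun z : V d × ℝ => dph S (z.2 - ‖z.1‖) * D f z.1 z.2 ^ 2)
    hS0 hT hi' (A := (∫ x, eDenFree f x 0) + ε) (B := 0) fun τ h1 h2 => by
      have := H3 τ (hS.2.2.trans h1)
      rw [Real.dist_eq, abs_lt] at this
      have h3 : ∫ x, dph S (τ - ‖x‖) * D f x τ ^ 2 ≤ ∫ x, D f x τ ^ 2 :=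
        integral_mono (i1 τ) (hg.int_sq τ) fun x =>
          mul_le_of_le_one_left (sq_nonneg _) dph_le_one
      simp only
      linarith [this.2]
  have b2 := integral_Q_log_le
    (g := fun z : V d × ℝ => -(dph S (z.2 - ‖z.1‖) * D f z.1 z.2 ^ 2)) hS0 hT
    (by simp only [neg_div]; exact hi'.neg)
    (A := -((∫ x, eDenFree f x 0) - ε - B * (Real.log (T / S) / S))) (B := 0) fun τ h1 h2 => by
      have := H3 τ (hS.2.2.trans h1)
      rw [Real.dist_eq, abs_lt] at this
      have h3 := H1 S hS.1 τ h1
      have h4 : ∫ x, (1 - dph S (τ - ‖x‖)) * D f x τ ^ 2 = (∫ x, D f x τ ^ 2) -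
          ∫ x, dph S (τ - ‖x‖) * D f x τ ^ 2 := by
        rw [← integral_sub (hg.int_sq τ) (i1 τ)]
        congr 1; ext x; ring
      have h5 : B * (Real.log (τ / S) / S) ≤ B * (Real.log (T / S) / S) := by
        have : 0 < τ / S := div_pos (by linarith) hS0
        gcongr
      simp only [integral_neg]
      linarith [this.1]
  simp only [neg_div, integral_neg] at b2
  constructor <;> linarith [a1.1, a1.2]

end moments

section cross_terms
variable {d : ℕ} {u v f : V d → ℝ → ℝ} {x : V d} {t : ℝ} [Fact (3 ≤ d)] {M S : ℝ}

lemma CD.freeze {F : Type*} [NormedAddCommGroup F] [NormedSpace ℝ F] {n : ℕ} {u : V d → ℝ → F}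
    (h : CD n u) (T : ℝ) : CD n (fun x _ => u x T) :=
  ContDiffOn.comp (g := fun q : V d × ℝ => u q.1 q.2) (f := fun q : V d × ℝ => (q.1, T)) h
    (contDiffOn_fst.prodMk contDiffOn_const) fun _ hq => ⟨hq.1, mem_univ _⟩

lemma mul_rd_le : |f x t * rd f x t| ≤ f x t ^ 2 + ‖gr f x t‖ ^ 2 := by
  have := two_mul_le_add_sq |f x t| |rd f x t|
  have h3 := rd_abs_le (u := f) (x := x) (t := t)
  rw [sq_abs] at this
  have h4 : |rd f x t| ^ 2 ≤ ‖gr f x t‖ ^ 2 := by gcongr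
  rw [abs_mul]
  nlinarith [mul_nonneg (abs_nonneg (f x t)) (abs_nonneg (rd f x t))]

lemma Tame.int_mul_rd (hf : Tame f) (T : ℝ) : Integrable fun x => f x T * rd f x T := by
  have hw := hf.reg.wave
  have hwc := hw.cd.cbundle
  exact int_slice (t := T) (F := fun q => f q.1 q.2 * rd f q.1 q.2)
    (hwc.1.mul hwc.2.2.1)
    ((hf.int_sq T).add (hw.int_gr_sq T)) fun x hx => mul_rd_le

/-- Integration by parts for the elliptic part of the equation at a fixed time. -/
lemma Tame.static_identity (hf : Tame f) (hS : 0 < S) (T : ℝ) :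
    ∫ x, ph S (T - ‖x‖) * (f x T * D (D f) x T) =
      (∫ x, dph S (T - ‖x‖) * (f x T * rd f x T)) - (∫ x, ph S (T - ‖x‖) * ‖gr f x T‖ ^ 2) -
        ∫ x, ph S (T - ‖x‖) * (f x T ^ 2 / ‖x‖) := by
  have hw := hf.reg.wave
  have hwc := hw.cd.cbundle
  have h2 := hf.reg.dwave
  have hpc : Continuous (ph S) := by fun_prop
  have hp2 : ∀ s, |ph S s| ≤ 2 * S := fun s => abs_ph_le_two hS
  have hdp : ∀ s, |dph S s| ≤ 1 := fun s => by rw [abs_of_pos dph_pos]; exact dph_le_one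
  have hci : Continuous (fun x : V d => (x, T)) := by fun_prop
  have hfp : Integrable fun x => f x T * D (D f) x T := by
    refine int_slice (t := T) (F := fun q => f q.1 q.2 * D (D f) q.1 q.2)
      (hw.cd.contOn.mul (h2.cd.cD (n := 1)).contOn)
      ((hf.int_sq T).add (h2.int_D_sq T)) fun x hx => ?_
    simp only [abs_mul, Pi.add_apply]
    have := two_mul_le_add_sq |f x T| |D (D f) x T|
    rw [sq_abs, sq_abs] at this
    nlinarith [mul_nonneg (abs_nonneg (f x T)) (abs_nonneg (D (D f) x T))]
  have hfr := hf.int_mul_rd T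
  have i1 := int_cone hpc hp2 hfp T
  have i2 := int_cone continuous_dph hdp hfr T
  have i3 := int_cone hpc hp2 (hw.int_gr_sq T) T
  have i4 := int_cone hpc hp2 (hw.int_pot T) T
  obtain ⟨K, hK0, hK⟩ := exists_hardy_bound hw.cont T T
  have key := spacetime_identity (d := d) (F := fun _ _ => 0)
    (H := fun x _ => (ph S (T - ‖x‖) * f x T) • gr f x T)
    (k := fun x _ => dph S (T - ‖x‖) * (f x T * rd f x T) - ph S (T - ‖x‖) * ‖gr f x T‖ ^ 2 -
      ph S (T - ‖x‖) * (f x T ^ 2 / ‖x‖) - ph S (T - ‖x‖) * (f x T * D (D f) x T))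
    contDiffOn_const ?_ (zero_le_one (α := ℝ)) ?_ (by simp) (by simp) ?_ ?_
  · rw [sub_self] at key
    have hk : Integrable (fun z : V d × ℝ => dph S (T - ‖z.1‖) * (f z.1 T * rd f z.1 T) -
        ph S (T - ‖z.1‖) * ‖gr f z.1 T‖ ^ 2 - ph S (T - ‖z.1‖) * (f z.1 T ^ 2 / ‖z.1‖) -
        ph S (T - ‖z.1‖) * (f z.1 T * D (D f) z.1 T)) (Qm d 0 1) :=
      (((i2.sub i3).sub i4).sub i1).comp_fst _
    rw [integral_Q zero_le_one hk] at key
    simp only [intervalIntegral.integral_const, sub_zero, one_smul] at key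
    have j1 : Integrable fun x => dph S (T - ‖x‖) * (f x T * rd f x T) -
      ph S (T - ‖x‖) * ‖gr f x T‖ ^ 2 := i2.sub i3
    have j2 : Integrable fun x => dph S (T - ‖x‖) * (f x T * rd f x T) -
      ph S (T - ‖x‖) * ‖gr f x T‖ ^ 2 - ph S (T - ‖x‖) * (f x T ^ 2 / ‖x‖) := j1.sub i4
    rw [integral_sub j2 i1, integral_sub j1 i4, integral_sub i2 i3] at key
    linarith
  · refine CD.freeze (u := fun x t => (ph S (t - ‖x‖) * f x t) • gr f x t) ?_ T
    exact ContDiffOn.smul ((cdOn_cone (n := 1) contDiff_ph le_rfl).mul (hw.cd.mono one_le_two))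
      hw.cd.cgr
  · intro x _ hx
    have hx0 : ‖x‖ ≠ 0 := norm_ne_zero_iff.2 hx
    have hp := (hasFDerivAt_cone (t := T) (contDiff_ph (S := S).differentiable one_ne_zero) hx).mul
      ((hw.cd.mono one_le_two).hasFDerivAt_gr (t := T) hx)
    have h1 := dvg_smul (f := fun y => ph S (T - ‖y‖) * f y T) (X := fun y => gr f y T)
      hp.differentiableAt (hw.cd.hasFDerivAt_hs (t := T) hx).differentiableAt
    have h4 := hp.fderiv
    rw [h1, dvg_gr hw.cd hx, show fderiv ℝ (fun y => ph S (T - ‖y‖) * f y T) x = _ from h4,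
      hw.pde x T hx, deriv_ph hS, rd]
    simp only [D, deriv_const]
    simp [inner_smul_left, real_inner_comm]
    ring
  · exact (((i2.sub i3).sub i4).sub i1).comp_fst _
  · have hg : Integrable fun x : V d => 2 * S * (2 * eDenFree f x T + K * rho x) :=
      (((hw.int T).const_mul 2).add (integrable_rho.const_mul K)).const_mul _
    have hc : ContinuousOn (fun q : V d × ℝ => ‖(ph S (q.2 - ‖q.1‖) * f q.1 q.2) • gr f q.1 q.2‖ /
        ‖q.1‖) (Om d) := by
      obtain ⟨c1, c2, c3, c4, c5, c6⟩ := hwc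
      exact ((((contOn_cone hpc).mul c1).smul c5).norm).div (by fun_prop) c6
    refine (int_slice (t := T) hc (hg.add ((hw.int_gr_sq T).const_mul (2 * S))) fun x hx => ?_).comp_fst _
    have h1 := hK x T ⟨le_rfl, le_rfl⟩
    rw [abs_of_nonneg (by positivity), norm_smul, norm_mul, Real.norm_eq_abs, Real.norm_eq_abs]
    simp only [Pi.add_apply]
    have h3 : |f x T| / ‖x‖ * ‖gr f x T‖ ≤ f x T ^ 2 / ‖x‖ ^ 2 + ‖gr f x T‖ ^ 2 := by
      have := two_mul_le_add_sq (|f x T| / ‖x‖) ‖gr f x T‖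
      rw [div_pow, sq_abs] at this
      have : 0 ≤ |f x T| / ‖x‖ * ‖gr f x T‖ := by positivity
      linarith
    calc _ = |ph S (T - ‖x‖)| * (|f x T| / ‖x‖ * ‖gr f x T‖) := by ring
      _ ≤ 2 * S * (2 * eDenFree f x T + K * rho x + ‖gr f x T‖ ^ 2) :=
        mul_le_mul (hp2 _) (by linarith) (by positivity) (by positivity)
      _ = _ := by ring

/-- The negative part of the weight `ph S` only contributes near the light cone. -/
lemma Reg.neg_part (hu : Reg u) {ε : ℝ} (hε : 0 < ε) : ∃ S₀, 1 ≤ S₀ ∧ ∀ S, S₀ ≤ S → ∀ T, S ≤ T →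
    ∫ x, (|ph S (T - ‖x‖)| - ph S (T - ‖x‖)) * D u x T ^ 2 ≤ ε * S := by
  obtain ⟨B, hB⟩ := hu.wave.bdd
  have hB0 : 0 ≤ B := (integral_nonneg fun x => eDen_nonneg).trans (hB 0)
  obtain ⟨R', hR'⟩ := outer_energy hu.wave hu.contD (ε := ε / 16) (by positivity)
  set R := max R' 0 with hRd
  have hR0 : 0 ≤ R := le_max_right _ _
  refine ⟨max 1 (8 * R * B / ε), le_max_left _ _, fun S hS T hT => ?_⟩
  simp only [max_le_iff] at hS
  have hS0 : 0 < S := by linarith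
  have hR : ∫ x in {x : V d | T + R < ‖x‖}, eDenFree u x T ≤ ε / 16 := by
    refine (setIntegral_mono_set (hu.wave.int T).integrableOn
      (Eventually.of_forall fun x => eDen_nonneg) ?_).trans (hR' T (by linarith))
    refine (HasSubset.Subset.eventuallyLE fun x hx => ?_)
    have : R' ≤ R := le_max_left _ _
    simp only [mem_setOf_eq] at hx ⊢
    linarith
  have hm : MeasurableSet {x : V d | T + R < ‖x‖} :=
    (isOpen_lt continuous_const continuous_norm).measurableSet
  have hi := (hu.wave.int T).indicator hm
  have i1 := int_cone (φ := fun s => |ph S s| - ph S s) (K := 4 * S) (by fun_prop) (fun s => by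
    have h1 := abs_ph_le_two (s := s) hS0
    have h2 := le_abs_self (ph S s)
    have h3 := neg_abs_le (ph S s)
    rw [abs_of_nonneg (by linarith)]; linarith) (hu.wave.int_D_sq T) T
  calc _ ≤ ∫ x, (4 * R * eDenFree u x T +
        8 * S * {x : V d | T + R < ‖x‖}.indicator (fun x => eDenFree u x T) x) := by
        refine integral_mono i1 (((hu.wave.int T).const_mul _).add (hi.const_mul _)) fun x => ?_
        simp only
        have he := eDen_nonneg (u := u) (x := x) (t := T)
        have hD := D_sq_le (u := u) (x := x) (t := T)
        have h3 := neg_abs_le (ph S (T - ‖x‖))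
        have h4 := le_abs_self (ph S (T - ‖x‖))
        by_cases hx : T + R < ‖x‖
        · rw [indicator_of_mem (by exact hx)]
          have h1 := abs_ph_le_two (s := T - ‖x‖) hS0
          calc _ ≤ 4 * S * (2 * eDenFree u x T) :=
                mul_le_mul (by linarith) hD (sq_nonneg _) (by positivity)
            _ ≤ _ := by nlinarith [mul_nonneg hR0 he]
        · rw [indicator_of_notMem (by exact hx), mul_zero, add_zero]
          have h1 : |ph S (T - ‖x‖)| - ph S (T - ‖x‖) ≤ 2 * R := by
            by_cases h0 : 0 ≤ T - ‖x‖
            · rw [abs_of_nonneg (ph_nonneg hS0 h0)]; linarith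
            · have h5 := abs_ph_le_abs (s := T - ‖x‖) hS0
              rw [abs_of_neg (a := T - ‖x‖) (by linarith)] at h5
              linarith
          calc _ ≤ 2 * R * (2 * eDenFree u x T) :=
                mul_le_mul h1 hD (sq_nonneg _) (by positivity)
            _ = _ := by ring
    _ = 4 * R * (∫ x, eDenFree u x T) + 8 * S * ∫ x in {x : V d | T + R < ‖x‖}, eDenFree u x T := by
        rw [integral_add ((hu.wave.int T).const_mul _) (hi.const_mul _), integral_const_mul,
          integral_const_mul, integral_indicator hm]
    _ ≤ 4 * R * B + 8 * S * (ε / 16) := by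
        gcongr
        exact hB T
    _ ≤ _ := by
        have := hS.2
        rw [div_le_iff₀ hε] at this
        linarith

lemma second_moment_bound (h1 : Tame f) (h2 : Tame (D f)) (h3 : Tame (D (D f))) {ε : ℝ}
    (hε : 0 < ε) : ∃ S₀, 1 ≤ S₀ ∧ ∀ S, S₀ ≤ S → ∀ T, S ≤ T →
    ∫ x, ph S (T - ‖x‖) ^ 2 * D (D (D f)) x T ^ 2 ≤
      1 / 4 * ((∫ x, eDenFree f x 0) + ε) * Real.log (T / S) ^ 2 + 2 * ε * S * Real.log (T / S) +
        ε * S ^ 2 := by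
  obtain ⟨B, hB0, hB⟩ := first_moment_bounds h1 h2
  obtain ⟨S₁, hS1, H1⟩ := hB ε hε
  obtain ⟨S₂, hS2, H2⟩ := h3.second_moment hε
  obtain ⟨S₃, hS3, H3⟩ := h2.reg.neg_part hε
  refine ⟨max S₁ (max S₂ S₃), hS1.trans (le_max_left _ _), fun S hS T hT => ?_⟩
  simp only [max_le_iff] at hS
  have hS0 : 0 < S := by linarith
  have a1 := (abs_le.1 (H2 S hS.2.1 T hT)).2
  have hb : ∀ s, |dph S s * ph S s| ≤ 2 * S := fun s => by
    have := abs_ph_mul_dph_le hS0 s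
    rw [mul_assoc, abs_mul, abs_two, mul_comm (ph S s)] at this; linarith
  have hi := int_coneQ (φ := fun s => dph S s * ph S s) (by fun_prop) hb (h3.intQ_div hS0 T)
  have e : ∀ z : V d × ℝ, 2 * ph S (z.2 - ‖z.1‖) *
      (dph S (z.2 - ‖z.1‖) * (D (D f) z.1 z.2 ^ 2 / (2 * z.2))) =
      (dph S (z.2 - ‖z.1‖) * ph S (z.2 - ‖z.1‖) * D (D f) z.1 z.2 ^ 2) / z.2 := fun z => by
    by_cases hz : z.2 = 0
    · simp [hz]
    · field_simp
  simp_rw [e] at a1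
  have := integral_Q_log_le (g := fun z : V d × ℝ => dph S (z.2 - ‖z.1‖) * ph S (z.2 - ‖z.1‖) *
    D (D f) z.1 z.2 ^ 2) hS0 hT (by simpa only [mul_div_assoc] using hi) (A := 2 * ε * S)
    (B := 1 / 2 * ((∫ x, eDenFree f x 0) + ε)) fun τ g1 g2 => by
      have i := int_cone (φ := fun s => dph S s * ph S s) (by fun_prop) hb (h3.int_sq τ) τ
      have i1 := int_cone (φ := ph S) (by fun_prop) (fun s => abs_ph_le_two hS0) (h3.int_sq τ) τ
      have i2 := int_cone (φ := fun s => |ph S s|) (K := 2 * S) (by fun_prop)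
        (fun s => by rw [abs_abs]; exact abs_ph_le_two hS0) (h3.int_sq τ) τ
      have b1 := (H1 S hS.1 τ g1).1
      have b2 := H3 S hS.2.2 τ g1
      have e2 : ∫ x, (|ph S (τ - ‖x‖)| - ph S (τ - ‖x‖)) * D (D f) x τ ^ 2 =
          (∫ x, |ph S (τ - ‖x‖)| * D (D f) x τ ^ 2) - ∫ x, ph S (τ - ‖x‖) * D (D f) x τ ^ 2 := by
        rw [← integral_sub i2 i1]; congr 1; ext x; ring
      have b3 : ∫ x, dph S (τ - ‖x‖) * ph S (τ - ‖x‖) * D (D f) x τ ^ 2 ≤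
          ∫ x, |ph S (τ - ‖x‖)| * D (D f) x τ ^ 2 := by
        refine integral_mono i i2 fun x => mul_le_mul_of_nonneg_right ?_ (sq_nonneg _)
        refine (le_abs_self _).trans ?_
        rw [abs_mul, abs_of_pos dph_pos]
        exact mul_le_of_le_one_left (abs_nonneg _) dph_le_one
      linarith
  linarith

lemma cross_bound (h1 : Tame f) (h2 : Tame (D f)) {ε : ℝ}
    (hε : 0 < ε) : ∃ S₀, 1 ≤ S₀ ∧ ∀ S, S₀ ≤ S → ∀ T, S ≤ T →
    ∫ x, ph S (T - ‖x‖) * (f x T * D (D f) x T) ≤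
      ε * S - ∫ x, ph S (T - ‖x‖) * D f x T ^ 2 := by
  obtain ⟨B, hB⟩ := h1.sq_le
  obtain ⟨B', hB'⟩ := h1.reg.wave.bdd
  obtain ⟨S₁, H1⟩ := eventually_atTop.1
    (h1.reg.equipartition.eventually_lt_const (show 0 < ε / 16 by positivity))
  obtain ⟨S₂, H2⟩ := eventually_atTop.1 (h1.reg.Nf_tendsto.eventually_lt_const
    (show 0 < ε / 64 by positivity))
  refine ⟨max 1 (max ((B + 2 * B') * 2 / ε) (max S₁ S₂)), le_max_left _ _, fun S hS T hT => ?_⟩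
  simp only [max_le_iff] at hS
  obtain ⟨hS1, hSB, hSS1, hSS2⟩ := hS
  have hS0 : 0 < S := by linarith
  have hw := h1.reg.wave
  have hpc : Continuous (ph S) := by fun_prop
  have hp2 : ∀ s, |ph S s| ≤ 2 * S := fun s => abs_ph_le_two hS0
  have i1 := int_cone hpc hp2 (hw.int_gr_sq T) T
  have i2 := int_cone hpc hp2 (hw.int_D_sq T) T
  have i3 := int_cone hpc hp2 (hw.int_pot T) T
  have hdp : ∀ s, |dph S s| ≤ 1 := fun s => by rw [abs_of_pos dph_pos]; exact dph_le_one
  have iE : Integrable fun x => |eDenFree f x T - D f x T ^ 2| :=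
    ((hw.int T).sub (hw.int_D_sq T)).abs
  have iN := hw.int_nd T
  have hE := H1 T (hSS1.trans hT)
  have hN := H2 T (hSS2.trans hT)
  rw [Nf] at hN
  rw [h1.static_identity hS0 T]
  have c1 : ∫ x, dph S (T - ‖x‖) * (f x T * rd f x T) ≤ B + 2 * B' := by
    calc _ ≤ ∫ x, (f x T ^ 2 + 2 * eDenFree f x T) := by
          refine integral_mono (int_cone continuous_dph hdp (h1.int_mul_rd T) T)
            ((h1.int_sq T).add ((hw.int T).const_mul 2)) fun x => ?_
          simp only [Pi.add_apply]
          have e1 := mul_rd_le (f := f) (x := x) (t := T)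
          have e2 := gr_sq_le (u := f) (x := x) (t := T)
          refine (le_abs_self _).trans ?_
          rw [abs_mul, abs_of_pos dph_pos]
          exact (mul_le_of_le_one_left (abs_nonneg _) dph_le_one).trans (by linarith)
      _ = (∫ x, f x T ^ 2) + 2 * ∫ x, eDenFree f x T := by
          rw [integral_add (h1.int_sq T) ((hw.int T).const_mul 2), integral_const_mul]
      _ ≤ _ := by linarith [hB T, hB' T]
  have c2 : (∫ x, ph S (T - ‖x‖) * D f x T ^ 2) - (∫ x, ph S (T - ‖x‖) * ‖gr f x T‖ ^ 2) -
      (∫ x, ph S (T - ‖x‖) * (f x T ^ 2 / ‖x‖)) ≤ 2 * S * (2 * (ε / 16) + 4 * (ε / 64)) := by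
    have j : Integrable fun x => ph S (T - ‖x‖) * D f x T ^ 2 -
      ph S (T - ‖x‖) * ‖gr f x T‖ ^ 2 := i2.sub i1
    rw [← integral_sub i2 i1, ← integral_sub j i3]
    calc _ ≤ ∫ x, 2 * S * (2 * |eDenFree f x T - D f x T ^ 2| + 4 * nd f x T) := by
          refine integral_mono (j.sub i3)
            (((iE.const_mul 2).add (iN.const_mul 4)).const_mul (2 * S)) fun x => ?_
          simp only
          have e1 := equip_gr_le (u := f) (x := x) (t := T)
          have e2 := pot_le_nd (u := f) (x := x) (t := T)
          have e3 : 0 ≤ f x T ^ 2 / ‖x‖ := by positivity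
          rw [← mul_sub, ← mul_sub]
          refine (le_abs_self _).trans ?_
          rw [abs_mul]
          refine mul_le_mul (hp2 _) ?_ (abs_nonneg _) (by positivity)
          rw [abs_le] at e1 ⊢
          have e4 : 0 ≤ nd f x T := nd_nonneg
          constructor <;> linarith [e1.1, e1.2]
      _ = 2 * S * (2 * (∫ x, |eDenFree f x T - D f x T ^ 2|) + 4 * ∫ x, nd f x T) := by
          rw [integral_const_mul, integral_add (iE.const_mul 2) (iN.const_mul 4),
            integral_const_mul, integral_const_mul]
      _ ≤ _ := by gcongr
  rw [div_le_iff₀ hε] at hSB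
  have := mul_pos hε hS0
  linarith

end cross_terms

section quantitative_core
variable {d : ℕ} {u v f : V d → ℝ → ℝ} {x : V d} {t : ℝ} [Fact (3 ≤ d)] {M S : ℝ}

lemma core_arith {M₀ δ C L l B P X m S : ℝ} (hM : 0 ≤ M₀) (hB : 0 ≤ B) (hC : 1 ≤ C) (hL : 0 < L)
    (hl0 : 0 ≤ l) (hlL : l ≤ L) (hl : (1 - δ) * L ≤ l) (hδ : 0 < δ) (hS : S = C * L)
    (hP : P ≤ 1 / 4 * (M₀ + δ) * l ^ 2 + 2 * δ * S * l + δ * S ^ 2)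
    (hX : X ≤ δ * S - (1 / 2 * (M₀ - δ - B * (l / S)) * l - δ * S)) (hm : m ≤ M₀ + δ) :
    4 / L ^ 2 * P + 4 / L * X + m ≤ 2 * B / C + δ * (24 * C ^ 2 + 2 * M₀) := by
  have hC0 : 0 < C := by linarith
  have hS0 : 0 < S := by rw [hS]; positivity
  have hP' : P ≤ L ^ 2 / 4 * (M₀ + δ + 8 * δ * C + 4 * δ * C ^ 2) := by
    have h1 : 1 / 4 * (M₀ + δ) * l ^ 2 ≤ 1 / 4 * (M₀ + δ) * L ^ 2 := by gcongr
    have h2 : 2 * δ * S * l ≤ 2 * δ * S * L := by gcongr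
    rw [hS] at *
    nlinarith
  have hX' : X ≤ L / 4 * (8 * δ * C - 2 * M₀ * (1 - δ) + 2 * δ + 2 * B / C) := by
    have h1 : B * (l / S) ≤ B / C := by
      rw [div_eq_mul_one_div B C]
      refine mul_le_mul_of_nonneg_left ?_ hB
      rw [div_le_div_iff₀ hS0 hC0, hS]; nlinarith
    have h2 : B * (l / S) * l ≤ B / C * L := mul_le_mul h1 hlL hl0 (by positivity)
    have h3 : M₀ * ((1 - δ) * L) ≤ M₀ * l := mul_le_mul_of_nonneg_left hl hM
    have h4 : δ * l ≤ δ * L := mul_le_mul_of_nonneg_left hlL hδ.le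
    have h5 : 2 * B / C = 2 * (B / C) := by ring
    rw [h5]
    have h6 : δ * S = δ * (C * L) := by rw [hS]
    generalize B / C = q at *
    nlinarith
  have e1 : 4 / L ^ 2 * P ≤ M₀ + δ + 8 * δ * C + 4 * δ * C ^ 2 := by
    rw [div_mul_eq_mul_div, div_le_iff₀ (by positivity)]; linarith
  have e2 : 4 / L * X ≤ 8 * δ * C - 2 * M₀ * (1 - δ) + 2 * δ + 2 * B / C := by
    rw [div_mul_eq_mul_div, div_le_iff₀ (by positivity)]; linarith
  have e3 : δ * C ≤ δ * C ^ 2 := mul_le_mul_of_nonneg_left (by nlinarith) hδ.le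
  have e4 : δ ≤ δ * C ^ 2 := le_mul_of_one_le_right hδ.le (by nlinarith)
  nlinarith

/-- In logarithmic variables, `2 φ ∂ₜ³f / log T + ∂ₜf` is asymptotically small. -/
theorem core (h1 : Tame f) (h2 : Tame (D f)) (h3 : Tame (D (D f))) : ∃ κ, 0 ≤ κ ∧ ∀ C, 1 ≤ C →
    ∀ ε, 0 < ε → ∀ᶠ T in atTop,
    Integrable (fun x => (2 / Real.log T * ph (C * Real.log T) (T - ‖x‖) * D (D (D f)) x T +
      D f x T) ^ 2) ∧
    ∫ x, (2 / Real.log T * ph (C * Real.log T) (T - ‖x‖) * D (D (D f)) x T + D f x T) ^ 2 ≤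
      κ / C + ε := by
  obtain ⟨B, hB0, hB⟩ := first_moment_bounds h1 h2
  set M₀ := ∫ x, eDenFree f x 0 with hM
  have hM0 : 0 ≤ M₀ := integral_nonneg fun x => eDen_nonneg
  refine ⟨2 * B, by positivity, fun C hC ε hε => ?_⟩
  have hC0 : 0 < C := by linarith
  set δ := ε / (24 * C ^ 2 + 2 * M₀ + 1) with hδ
  have hδ0 : 0 < δ := by positivity
  have hδε : δ * (24 * C ^ 2 + 2 * M₀) ≤ ε := by
    rw [hδ, div_mul_eq_mul_div, div_le_iff₀ (by positivity)]; nlinarith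
  obtain ⟨S₁, hS1, H1⟩ := hB δ hδ0
  obtain ⟨S₂, hS2, H2⟩ := second_moment_bound h1 h2 h3 hδ0
  obtain ⟨S₃, hS3, H3⟩ := cross_bound h2 h3 hδ0
  obtain ⟨T₄, H4⟩ := Metric.tendsto_atTop.1 h1.reg.kinetic_tendsto δ hδ0
  have hlog : Tendsto (fun T => C * Real.log T) atTop atTop :=
    Real.tendsto_log_atTop.const_mul_atTop hC0
  have hsmall : Tendsto (fun T => Real.log (C * Real.log T) / (C * Real.log T)) atTop (𝓝 0) :=
    (Real.isLittleO_log_id_atTop.tendsto_div_nhds_zero).comp hlog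
  have hle : ∀ᶠ T in atTop, C * Real.log T ≤ T := by
    have := (Real.isLittleO_log_id_atTop.bound (show 0 < 1 / C by positivity))
    filter_upwards [this, eventually_ge_atTop 1] with T hT hT1
    rw [Real.norm_of_nonneg (Real.log_nonneg hT1), id, Real.norm_of_nonneg (by linarith)] at hT
    rw [one_div, inv_mul_eq_div, le_div_iff₀ hC0] at hT
    linarith
  filter_upwards [hlog.eventually_ge_atTop S₁, hlog.eventually_ge_atTop S₂,
    hlog.eventually_ge_atTop S₃, hle, eventually_ge_atTop T₄, eventually_gt_atTop 1,
    hsmall.eventually_lt_const (show 0 < δ / C by positivity)] with T g1 g2 g3 g4 g5 g6 g7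
  set L := Real.log T with hL
  have hL0 : 0 < L := Real.log_pos g6
  set S := C * L with hS
  have hS0 : 0 < S := by positivity
  have hS1' : 1 ≤ S := hS1.trans g1
  obtain ⟨-, b1⟩ := H1 S g1 T g4
  have b2 := H2 S g2 T g4
  have b3 := H3 S g3 T g4
  have b4 := H4 T g5
  rw [Real.dist_eq, abs_lt, ← hM] at b4
  have hll : Real.log (T / S) = L - Real.log S := Real.log_div (by linarith) hS0.ne'
  have hl1 : 0 ≤ Real.log (T / S) := Real.log_nonneg ((one_le_div hS0).2 g4)
  have hl2 : Real.log (T / S) ≤ L := by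
    rw [hll]; linarith [Real.log_nonneg hS1']
  have hl3 : (1 - δ) * L ≤ Real.log (T / S) := by
    rw [div_lt_div_iff₀ hS0 hC0] at g7
    have : Real.log S * C < δ * L * C := by rw [hS] at g7 ⊢; linarith
    have := lt_of_mul_lt_mul_right this hC0.le
    rw [hll]; linarith
  have hpc : Continuous (ph S) := by fun_prop
  have hp2 : ∀ s, |ph S s| ≤ 2 * S := fun s => abs_ph_le_two hS0
  have i1 := int_cone (φ := fun s => ph S s ^ 2) (by fun_prop)
    (fun s => by rw [abs_of_nonneg (sq_nonneg _)]; exact ph_sq_le hS0 s)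
    (h3.reg.wave.int_D_sq T) T
  have hfp : Integrable fun x => D f x T * D (D (D f)) x T := by
    refine int_slice (t := T) (F := fun q => D f q.1 q.2 * D (D (D f)) q.1 q.2)
      (h2.reg.wave.cd.contOn.mul (h3.reg.wave.cd.cD (n := 1)).contOn)
      ((h2.int_sq T).add (h3.reg.wave.int_D_sq T)) fun x hx => ?_
    simp only [abs_mul, Pi.add_apply]
    have := two_mul_le_add_sq |D f x T| |D (D (D f)) x T|
    rw [sq_abs, sq_abs] at this
    nlinarith [mul_nonneg (abs_nonneg (D f x T)) (abs_nonneg (D (D (D f)) x T))]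
  have i2 := int_cone hpc hp2 hfp T
  have i3 := h2.int_sq T
  have e : ∀ x, (2 / L * ph S (T - ‖x‖) * D (D (D f)) x T + D f x T) ^ 2 =
      4 / L ^ 2 * (ph S (T - ‖x‖) ^ 2 * D (D (D f)) x T ^ 2) +
      4 / L * (ph S (T - ‖x‖) * (D f x T * D (D (D f)) x T)) + D f x T ^ 2 := fun x => by
    field_simp; ring
  simp_rw [e]
  have j1 : Integrable fun x => 4 / L ^ 2 * (ph S (T - ‖x‖) ^ 2 * D (D (D f)) x T ^ 2) +
      4 / L * (ph S (T - ‖x‖) * (D f x T * D (D (D f)) x T)) := (i1.const_mul _).add (i2.const_mul _)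
  refine ⟨j1.add i3, ?_⟩
  rw [integral_add j1 i3, integral_add (i1.const_mul _) (i2.const_mul _), integral_const_mul,
    integral_const_mul]
  have := core_arith (P := ∫ x, ph S (T - ‖x‖) ^ 2 * D (D (D f)) x T ^ 2)
    (X := ∫ x, ph S (T - ‖x‖) * (D f x T * D (D (D f)) x T)) (m := ∫ x, D f x T ^ 2)
    hM0 hB0 hC hL0 hl1 hl2 hl3 hδ0 hS b2 (by linarith) (by linarith)
  linarith

end quantitative_core

section parametric

variable {Y : Type*} [TopologicalSpace Y] [MeasurableSpace Y] [BorelSpace Y]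
  [SecondCountableTopology Y] {μ : Measure Y} [IsFiniteMeasureOnCompacts μ]
  {E F : Type*} [NormedAddCommGroup E] [NormedSpace ℝ E] [LocallyCompactSpace E]
  [NormedAddCommGroup F] [NormedSpace ℝ F] [CompleteSpace F]
  {U : Set E} {ψ : Y → ℝ} {Φ : E → Y → F} {Φ' : E → Y → E →L[ℝ] F}

omit [MeasurableSpace Y] [BorelSpace Y] [SecondCountableTopology Y] [NormedSpace ℝ E]
  [LocallyCompactSpace E] in
lemma ContinuousOn.section_right {G : Type*} [TopologicalSpace G] {Φ : E → Y → G}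
    (h : ContinuousOn (fun z : E × Y => Φ z.1 z.2) (U ×ˢ univ)) {q : E} (hq : q ∈ U) :
    Continuous (Φ q) :=
  continuousOn_univ.1 (h.comp (f := fun y : Y => (q, y)) (by fun_prop) fun y _ => ⟨hq, mem_univ _⟩)

omit [LocallyCompactSpace E] [CompleteSpace F] in
lemma integrable_weight (hψ : Continuous ψ) (hc : HasCompactSupport ψ)
    (h : ContinuousOn (fun z : E × Y => Φ z.1 z.2) (U ×ˢ univ)) {q : E} (hq : q ∈ U) :
    Integrable (fun y => ψ y • Φ q y) μ :=
  (hψ.smul (ContinuousOn.section_right h hq)).integrable_of_hasCompactSupport hc.smul_right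

omit [LocallyCompactSpace E] [CompleteSpace F] [SecondCountableTopology Y] in
lemma continuousOn_average (hψ : Continuous ψ) (hc : HasCompactSupport ψ)
    (h : ContinuousOn (fun z : E × Y => Φ z.1 z.2) (U ×ˢ univ)) :
    ContinuousOn (fun q => ∫ y, ψ y • Φ q y ∂μ) U := by
  refine continuousOn_integral_of_compact_support (k := tsupport ψ) hc ?_ ?_
  · exact (hψ.comp continuous_snd).continuousOn.smul h
  · intro p x _ hx
    simp [image_eq_zero_of_notMem_tsupport hx]

/-- Differentiation of a weighted average. -/
lemma hasFDerivAt_average (hU : IsOpen U) (hψ : Continuous ψ) (hc : HasCompactSupport ψ)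
    (h : ContinuousOn (fun z : E × Y => Φ z.1 z.2) (U ×ˢ univ))
    (h' : ContinuousOn (fun z : E × Y => Φ' z.1 z.2) (U ×ˢ univ))
    (hd : ∀ q ∈ U, ∀ y, HasFDerivAt (fun q => Φ q y) (Φ' q y) q) {q : E} (hq : q ∈ U) :
    HasFDerivAt (fun q => ∫ y, ψ y • Φ q y ∂μ) (∫ y, ψ y • Φ' q y ∂μ) q := by
  obtain ⟨K, hK, hKU, hKc⟩ := local_compact_nhds (hU.mem_nhds hq)
  obtain ⟨C, hC⟩ := (hKc.prod hc.isCompact).exists_bound_of_continuousOn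
    (h'.mono (prod_mono hKU (subset_univ _)))
  refine hasFDerivAt_integral_of_dominated_of_fderiv_le (F := fun q y => ψ y • Φ q y)
    (F' := fun q y => ψ y • Φ' q y) (bound := fun y => |ψ y| * C) hK ?_
    (integrable_weight hψ hc h hq) (integrable_weight hψ hc h' hq).aestronglyMeasurable ?_ ?_ ?_
  · filter_upwards [hK] with p hp
    exact (integrable_weight hψ hc h (hKU hp)).aestronglyMeasurable
  · refine Eventually.of_forall fun y p hp => ?_
    rw [norm_smul, Real.norm_eq_abs]
    by_cases hy : y ∈ tsupport ψ
    · exact mul_le_mul_of_nonneg_left (hC (p, y) ⟨hp, hy⟩) (abs_nonneg _)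
    · simp [image_eq_zero_of_notMem_tsupport hy]
  · exact (hψ.abs.integrable_of_hasCompactSupport hc.abs).mul_const C
  · exact Eventually.of_forall fun y p hp => (hd p (hKU hp) y).const_smul (ψ y)

lemma contDiffOn_one_average (hU : IsOpen U) (hψ : Continuous ψ) (hc : HasCompactSupport ψ)
    (h : ContinuousOn (fun z : E × Y => Φ z.1 z.2) (U ×ˢ univ))
    (h' : ContinuousOn (fun z : E × Y => Φ' z.1 z.2) (U ×ˢ univ))
    (hd : ∀ q ∈ U, ∀ y, HasFDerivAt (fun q => Φ q y) (Φ' q y) q) :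
    ContDiffOn ℝ 1 (fun q => ∫ y, ψ y • Φ q y ∂μ) U := by
  have := (contDiffOn_succ_iff_fderiv_of_isOpen (𝕜 := ℝ) (n := 0)
    (f := fun q => ∫ y, ψ y • Φ q y ∂μ) hU).2
    ⟨fun q hq => (hasFDerivAt_average hU hψ hc h h' hd hq).differentiableAt.differentiableWithinAt,
      by simp, ?_⟩
  · simpa using this
  · rw [contDiffOn_zero]
    exact (continuousOn_average hψ hc h').congr fun q hq =>
      (hasFDerivAt_average hU hψ hc h h' hd hq).fderiv

lemma contDiffOn_two_average {Φ'' : E → Y → E →L[ℝ] E →L[ℝ] F}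
    (hU : IsOpen U) (hψ : Continuous ψ) (hc : HasCompactSupport ψ)
    (h : ContinuousOn (fun z : E × Y => Φ z.1 z.2) (U ×ˢ univ))
    (h' : ContinuousOn (fun z : E × Y => Φ' z.1 z.2) (U ×ˢ univ))
    (h'' : ContinuousOn (fun z : E × Y => Φ'' z.1 z.2) (U ×ˢ univ))
    (hd : ∀ q ∈ U, ∀ y, HasFDerivAt (fun q => Φ q y) (Φ' q y) q)
    (hd' : ∀ q ∈ U, ∀ y, HasFDerivAt (fun q => Φ' q y) (Φ'' q y) q) :
    ContDiffOn ℝ 2 (fun q => ∫ y, ψ y • Φ q y ∂μ) U := by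
  have := (contDiffOn_succ_iff_fderiv_of_isOpen (𝕜 := ℝ) (n := 1)
    (f := fun q => ∫ y, ψ y • Φ q y ∂μ) hU).2
    ⟨fun q hq => (hasFDerivAt_average hU hψ hc h h' hd hq).differentiableAt.differentiableWithinAt,
      by simp, ?_⟩
  · simpa [one_add_one_eq_two] using this
  · exact (contDiffOn_one_average hU hψ hc h' h'' hd').congr fun q hq =>
      (hasFDerivAt_average hU hψ hc h h' hd hq).fderiv

lemma fderiv_fderiv_average {Φ'' : E → Y → E →L[ℝ] E →L[ℝ] F}
    (hU : IsOpen U) (hψ : Continuous ψ) (hc : HasCompactSupport ψ)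
    (h : ContinuousOn (fun z : E × Y => Φ z.1 z.2) (U ×ˢ univ))
    (h' : ContinuousOn (fun z : E × Y => Φ' z.1 z.2) (U ×ˢ univ))
    (h'' : ContinuousOn (fun z : E × Y => Φ'' z.1 z.2) (U ×ˢ univ))
    (hd : ∀ q ∈ U, ∀ y, HasFDerivAt (fun q => Φ q y) (Φ' q y) q)
    (hd' : ∀ q ∈ U, ∀ y, HasFDerivAt (fun q => Φ' q y) (Φ'' q y) q) {q : E} (hq : q ∈ U)
    (v w : E) :
    fderiv ℝ (fderiv ℝ (fun q => ∫ y, ψ y • Φ q y ∂μ)) q v w = ∫ y, ψ y • Φ'' q y v w ∂μ := by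
  have h1 : fderiv ℝ (fun q => ∫ y, ψ y • Φ q y ∂μ) =ᶠ[𝓝 q] fun q => ∫ y, ψ y • Φ' q y ∂μ := by
    filter_upwards [hU.mem_nhds hq] with p hp
    exact (hasFDerivAt_average hU hψ hc h h' hd hp).fderiv
  rw [h1.fderiv_eq, (hasFDerivAt_average hU hψ hc h' h'' hd' hq).fderiv]
  have hi := integrable_weight (μ := μ) (F := E →L[ℝ] E →L[ℝ] F) hψ hc h'' hq
  rw [ContinuousLinearMap.integral_apply hi v, ContinuousLinearMap.integral_apply]
  · simp
  · exact hi.apply_continuousLinearMap v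

end parametric

/-- The orthogonal group of `ℝ^d`. -/
noncomputable abbrev G (d : ℕ) := unitary (V d →L[ℝ] V d)

instance (d : ℕ) : ContinuousStar (V d →L[ℝ] V d) :=
  ⟨(ContinuousLinearMap.adjoint (𝕜 := ℝ) (E := V d) (F := V d)).continuous⟩

instance (d : ℕ) : IsTopologicalGroup (G d) where

lemma norm_unitary_le {d : ℕ} (g : G d) : ‖(g : V d →L[ℝ] V d)‖ ≤ 1 :=
  ContinuousLinearMap.opNorm_le_bound _ zero_le_one fun x => by
    rw [one_mul, ← Unitary.coe_linearIsometryEquiv_apply]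
    exact ((Unitary.linearIsometryEquiv g).norm_map x).le

instance (d : ℕ) : CompactSpace (G d) := by
  have h : IsCompact (unitary (V d →L[ℝ] V d) : Set (V d →L[ℝ] V d)) :=
    Metric.isCompact_of_isClosed_isBounded isClosed_unitary
      (isBounded_iff_forall_norm_le.2 ⟨1, fun g hg => norm_unitary_le ⟨g, hg⟩⟩)
  exact isCompact_iff_compactSpace.1 h

/-- The space of rotations and time shifts. -/
noncomputable abbrev Sy (d : ℕ) := G d × ℝ

/-- The invariant measure on rotations and time shifts. -/
noncomputable abbrev mu (d : ℕ) : Measure (Sy d) := (Measure.haar : Measure (G d)).prod volume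

/-- The rotation applied to the space variable. -/
noncomputable def Rt {d : ℕ} (y : Sy d) : V d ≃ₗᵢ[ℝ] V d := Unitary.linearIsometryEquiv y.1⁻¹

/-- The transform of a function on space-time by a rotation and a time shift. -/
noncomputable def tr {d : ℕ} (u : V d → ℝ → ℝ) (y : Sy d) : V d → ℝ → ℝ :=
  fun x t => u (Rt y x) (t - y.2)

section rot
variable {d : ℕ} {u v f : V d → ℝ → ℝ} {x : V d} {t : ℝ} [Fact (3 ≤ d)]

lemma Rt_coe (y : Sy d) (x : V d) : Rt y x = ((y.1⁻¹ : G d) : V d →L[ℝ] V d) x := by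
  rw [Rt, ← Unitary.coe_linearIsometryEquiv_apply]; rfl

lemma continuous_Rt : Continuous fun z : V d × Sy d => Rt z.2 z.1 := by
  simp_rw [Rt_coe]
  have h : Continuous fun z : V d × Sy d => ((z.2.1⁻¹ : G d) : V d →L[ℝ] V d) :=
    continuous_subtype_val.comp (continuous_fst.comp continuous_snd).inv
  exact h.clm_apply continuous_fst

/-- The linear part of the space-time transform. -/
noncomputable def Mt (y : Sy d) : V d × ℝ →L[ℝ] V d × ℝ :=
  ((y.1⁻¹ : G d) : V d →L[ℝ] V d).prodMap (.id ℝ ℝ)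

lemma continuous_Mt : Continuous (Mt (d := d)) := by
  have h : Continuous fun y : Sy d => ((y.1⁻¹ : G d) : V d →L[ℝ] V d) :=
    continuous_subtype_val.comp continuous_fst.inv
  have := (ContinuousLinearMap.prodMapL ℝ (V d) (V d) ℝ ℝ).continuous.comp
    (h.prodMk (continuous_const (y := ContinuousLinearMap.id ℝ ℝ)))
  exact this

lemma Mt_apply (y : Sy d) (v : V d) (s : ℝ) : Mt y (v, s) = (Rt y v, s) := by
  rw [Mt, Rt_coe]; rfl

/-- The space-time transform. -/
noncomputable def At (y : Sy d) (q : V d × ℝ) : V d × ℝ := (Rt y q.1, q.2 - y.2)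

lemma At_eq (y : Sy d) (q : V d × ℝ) : At y q = Mt y q - (0, y.2) := by
  rcases q with ⟨x, t⟩
  rw [Mt_apply, At]; simp

lemma hasFDerivAt_At (y : Sy d) (q : V d × ℝ) : HasFDerivAt (At y) (Mt y) q := by
  have : At y = fun q => Mt y q - (0, y.2) := funext (At_eq y)
  rw [this]
  exact (Mt y).hasFDerivAt.sub_const _

lemma continuous_At : Continuous fun z : (V d × ℝ) × Sy d => At z.2 z.1 := by
  have h : Continuous fun z : (V d × ℝ) × Sy d => Rt z.2 z.1.1 :=
    continuous_Rt.comp (f := fun z : (V d × ℝ) × Sy d => (z.1.1, z.2)) (by fun_prop)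
  exact h.prodMk (by fun_prop)

lemma Rt_ne {y : Sy d} (hx : x ≠ 0) : Rt y x ≠ 0 := by simpa using hx

lemma At_mem {y : Sy d} {q : V d × ℝ} (hq : q ∈ Om d) : At y q ∈ Om d :=
  mem_Om (Rt_ne hq.1)

lemma mapsTo_At : MapsTo (fun z : (V d × ℝ) × Sy d => At z.2 z.1) (Om d ×ˢ univ) (Om d) :=
  fun _ hz => At_mem hz.1

/-- First derivative of the transformed function. -/
noncomputable def F1 (u : V d → ℝ → ℝ) (q : V d × ℝ) (y : Sy d) : V d × ℝ →L[ℝ] ℝ :=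
  (fderiv ℝ (fun q : V d × ℝ => u q.1 q.2) (At y q)).comp (Mt y)

/-- Second derivative of the transformed function. -/
noncomputable def F2 (u : V d → ℝ → ℝ) (q : V d × ℝ) (y : Sy d) :
    V d × ℝ →L[ℝ] V d × ℝ →L[ℝ] ℝ :=
  ((ContinuousLinearMap.compL ℝ (V d × ℝ) (V d × ℝ) ℝ).flip (Mt y)).comp
    ((fderiv ℝ (fderiv ℝ (fun q : V d × ℝ => u q.1 q.2)) (At y q)).comp (Mt y))

lemma F2_apply (q v w : V d × ℝ) (y : Sy d) : F2 u q y v w =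
    fderiv ℝ (fderiv ℝ (fun q : V d × ℝ => u q.1 q.2)) (At y q) (Mt y v) (Mt y w) := rfl

lemma hasFDerivAt_tr (h : CD 1 u) {q : V d × ℝ} (hq : q ∈ Om d) (y : Sy d) :
    HasFDerivAt (fun q : V d × ℝ => tr u y q.1 q.2) (F1 u q y) q :=
  (h.hasFDerivAt (x := (At y q).1) (t := (At y q).2) le_rfl (At_mem (y := y) hq).1).comp
    (g := fun q : V d × ℝ => u q.1 q.2) q (hasFDerivAt_At y q)

lemma hasFDerivAt_F1 (h : CD 2 u) {q : V d × ℝ} (hq : q ∈ Om d) (y : Sy d) :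
    HasFDerivAt (fun q => F1 u q y) (F2 u q y) q := by
  have h1 := (h.cfderiv.hasFDerivAt le_rfl (At_mem (y := y) hq).1).comp q (hasFDerivAt_At y q)
  exact (((ContinuousLinearMap.compL ℝ (V d × ℝ) (V d × ℝ) ℝ).flip (Mt y)).hasFDerivAt).comp q h1

lemma contOn_F0 (h : CD 2 u) :
    ContinuousOn (fun z : (V d × ℝ) × Sy d => tr u z.2 z.1.1 z.1.2) (Om d ×ˢ univ) :=
  h.contOn.comp continuous_At.continuousOn mapsTo_At

lemma contOn_F1 (h : CD 2 u) :
    ContinuousOn (fun z : (V d × ℝ) × Sy d => F1 u z.1 z.2) (Om d ×ˢ univ) :=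
  (h.cfderiv.contOn.comp continuous_At.continuousOn mapsTo_At).clm_comp
    (continuous_Mt.comp continuous_snd).continuousOn

lemma contOn_F2 (h : CD 2 u) :
    ContinuousOn (fun z : (V d × ℝ) × Sy d => F2 u z.1 z.2) (Om d ×ˢ univ) := by
  have h2 := (h.cfderiv.cfderiv (n := 0)).contOn.comp continuous_At.continuousOn mapsTo_At
  have hM : Continuous fun z : (V d × ℝ) × Sy d => Mt z.2 := continuous_Mt.comp continuous_snd
  exact ((((ContinuousLinearMap.compL ℝ (V d × ℝ) (V d × ℝ) ℝ).flip).continuous.comp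
    hM).continuousOn).clm_comp (h2.clm_comp hM.continuousOn)

lemma CD.hess_time (h : CD 2 u) (hx : x ≠ 0) : D (D u) x t =
    fderiv ℝ (fderiv ℝ (fun q : V d × ℝ => u q.1 q.2)) (x, t) (0, 1) (0, 1) := by
  rw [(h.cD).D_eq hx]
  have h1 : (fun q : V d × ℝ => D u q.1 q.2) =ᶠ[𝓝 (x, t)]
      fun q => fderiv ℝ (fun q : V d × ℝ => u q.1 q.2) q (0, 1) := by
    filter_upwards [Om_mem_nhds hx] with q hq
    exact (h.mono one_le_two).D_eq hq.1
  rw [h1.fderiv_eq]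
  have h2 := (h.cfderiv.hasFDerivAt (t := t) le_rfl hx).clm_apply
    (hasFDerivAt_const ((0, 1) : V d × ℝ) (x, t))
  rw [h2.fderiv]; simp

lemma CD.hess_lap (h : CD 2 u) (hx : x ≠ 0) : lap (fun y => u y t) x =
    ∑ i : Fin d, fderiv ℝ (fderiv ℝ (fun q : V d × ℝ => u q.1 q.2)) (x, t)
      (EuclideanSpace.single i 1, 0) (EuclideanSpace.single i 1, 0) := by
  rw [h.lap_eq hx]
  refine Finset.sum_congr rfl fun i _ => ?_
  rw [← h.inner_hs hx]
  simp [EuclideanSpace.inner_single_right]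

lemma CD.hess_lap_rot (h : CD 2 u) (hx : x ≠ 0) (R : V d ≃ₗᵢ[ℝ] V d) : lap (fun y => u y t) x =
    ∑ i : Fin d, fderiv ℝ (fderiv ℝ (fun q : V d × ℝ => u q.1 q.2)) (x, t)
      (R (EuclideanSpace.single i 1), 0) (R (EuclideanSpace.single i 1), 0) := by
  have h1 := LinearMap.trace_eq_sum_inner (hs u x t : V d →ₗ[ℝ] V d)
    (EuclideanSpace.basisFun (Fin d) ℝ)
  have h2 := LinearMap.trace_eq_sum_inner (hs u x t : V d →ₗ[ℝ] V d)
    ((EuclideanSpace.basisFun (Fin d) ℝ).map R)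
  rw [h.lap_eq hx]
  simp_rw [← h.inner_hs hx]
  rw [h1] at h2
  simpa [real_inner_comm, EuclideanSpace.inner_single_left] using h2

lemma tr_hess (h : CD 2 u) (hx : x ≠ 0) (y : Sy d) (v w : V d × ℝ) :
    fderiv ℝ (fderiv ℝ (fun q : V d × ℝ => tr u y q.1 q.2)) (x, t) v w = F2 u (x, t) y v w := by
  have h1 : fderiv ℝ (fun q : V d × ℝ => tr u y q.1 q.2) =ᶠ[𝓝 (x, t)] fun q => F1 u q y := by
    filter_upwards [Om_mem_nhds hx] with q hq
    exact (hasFDerivAt_tr (h.mono one_le_two) hq y).fderiv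
  rw [h1.fderiv_eq, (hasFDerivAt_F1 h (mem_Om hx) y).fderiv]

lemma CD.tr (h : CD 2 u) (y : Sy d) : CD 2 (tr u y) := by
  have hA : ContDiff ℝ 2 (At y) := by
    have : At y = fun q => Mt y q - (0, y.2) := funext (At_eq y)
    rw [this]; exact (Mt y).contDiff.sub contDiff_const
  exact ContDiffOn.comp h hA.contDiffOn fun q hq => At_mem hq

lemma tr_D (h : CD 1 u) (y : Sy d) (hx : x ≠ 0) : D (tr u y) x t = D u (Rt y x) (t - y.2) := by
  have := (h.hasDerivAt (t := t - y.2) (Rt_ne (y := y) hx)).comp t ((hasDerivAt_id t).sub_const y.2)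
  exact (this.congr_deriv (by simp)).deriv

lemma tr_gr (h : CD 2 u) (y : Sy d) (hx : x ≠ 0) :
    gr (tr u y) x t = (Rt y).symm (gr u (Rt y x) (t - y.2)) := by
  refine ext_inner_right ℝ fun v => ?_
  rw [((h.tr y).mono one_le_two).inner_gr hx, (hasFDerivAt_tr (h.mono one_le_two) (mem_Om hx) y).fderiv,
    F1, ContinuousLinearMap.comp_apply, Mt_apply, LinearIsometryEquiv.inner_map_eq_flip,
    LinearIsometryEquiv.symm_symm, (h.mono one_le_two).inner_gr (Rt_ne hx)]
  rfl

lemma tr_eDen (h : CD 2 u) (y : Sy d) (hx : x ≠ 0) :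
    eDenFree (tr u y) x t = eDenFree u (Rt y x) (t - y.2) := by
  rw [eDen_def, eDen_def, tr_gr h y hx, tr_D (h.mono one_le_two) y hx]
  simp [tr]

lemma Wave.tr_pde (h : Wave u) (y : Sy d) (hx : x ≠ 0) :
    D (D (tr u y)) x t = lap (fun z => tr u y z t) x - tr u y x t / ‖x‖ := by
  have h1 := h.pde (Rt y x) (t - y.2) (Rt_ne hx)
  rw [h.cd.hess_time (Rt_ne hx), h.cd.hess_lap_rot (Rt_ne hx) (Rt y)] at h1
  rw [(h.cd.tr y).hess_time hx, (h.cd.tr y).hess_lap hx, tr_hess h.cd hx, F2_apply, Mt_apply]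
  simp_rw [tr_hess h.cd hx, F2_apply, Mt_apply]
  simpa [At, CoulombWave.tr] using h1

lemma Wave.tr_int (h : Wave u) (y : Sy d) (t : ℝ) :
    Integrable (fun x => eDenFree (CoulombWave.tr u y) x t) := by
  have := ((Rt y).measurePreserving.integrable_comp_emb
    (Rt y).toHomeomorph.measurableEmbedding).2 (h.int (t - y.2))
  exact this.congr (ae_ne_zero.mono fun x hx => (tr_eDen h.cd y hx).symm)

lemma Wave.tr_integral (h : Wave u) (y : Sy d) (t : ℝ) :
    ∫ x, eDenFree (CoulombWave.tr u y) x t = ∫ x, eDenFree u x (t - y.2) := by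
  rw [← (Rt y).measurePreserving.integral_comp (Rt y).toHomeomorph.measurableEmbedding
    (fun x => eDenFree u x (t - y.2))]
  exact integral_congr_ae (ae_ne_zero.mono fun x hx => tr_eDen h.cd y hx)

lemma Wave.tr (h : Wave u) (y : Sy d) : Wave (CoulombWave.tr u y) := by
  obtain ⟨B, hB⟩ := h.bdd
  refine ⟨?_, h.cd.tr y, fun x t hx => h.tr_pde y hx, h.tr_int y, B, fun t => ?_⟩
  · exact h.cont.comp ((continuous_At).comp (f := fun q : V d × ℝ => (q, y)) (by fun_prop))
  · rw [h.tr_integral]; exact hB _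

end rot

/-- Continuous compactly supported weights. -/
def Wt {Y : Type*} [TopologicalSpace Y] (Ψ : Y → ℝ) : Prop := Continuous Ψ ∧ HasCompactSupport Ψ

section jensen

variable {Y : Type*} [TopologicalSpace Y] [MeasurableSpace Y] [BorelSpace Y]
  [SecondCountableTopology Y] {μ : Measure Y} [IsFiniteMeasureOnCompacts μ]
  {F : Type*} [NormedAddCommGroup F] [NormedSpace ℝ F] {Ψ : Y → ℝ} {g : Y → F}

lemma Wt.integrable_smul (h : Wt Ψ) (hg : Continuous g) : Integrable (fun y => Ψ y • g y) μ :=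
  (h.1.smul hg).integrable_of_hasCompactSupport h.2.smul_right

lemma Wt.abs (h : Wt Ψ) : Wt (fun y => |Ψ y|) := ⟨h.1.abs, h.2.abs⟩

lemma Wt.integrable (h : Wt Ψ) : Integrable Ψ μ := h.1.integrable_of_hasCompactSupport h.2

lemma Wt.integrable_mul {g : Y → ℝ} (h : Wt Ψ) (hg : Continuous g) :
    Integrable (fun y => Ψ y * g y) μ := h.integrable_smul hg

/-- Jensen's inequality for squared norms of weighted averages. -/
lemma Wt.jensen (h : Wt Ψ) (hg : Continuous g) :
    ‖∫ y, Ψ y • g y ∂μ‖ ^ 2 ≤ (∫ y, |Ψ y| ∂μ) * ∫ y, |Ψ y| * ‖g y‖ ^ 2 ∂μ := by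
  have h0 : ‖∫ y, Ψ y • g y ∂μ‖ ≤ ∫ y, |Ψ y| * ‖g y‖ ∂μ := by
    refine (norm_integral_le_integral_norm _).trans_eq ?_
    simp [norm_smul]
  have hA : 0 ≤ ∫ y, |Ψ y| ∂μ := integral_nonneg fun y => abs_nonneg _
  have hB : 0 ≤ ∫ y, |Ψ y| * ‖g y‖ ∂μ := integral_nonneg fun y => by positivity
  have h1 : ∀ l : ℝ, 0 ≤ (∫ y, |Ψ y| ∂μ) * (l * l) + (-(2 * ∫ y, |Ψ y| * ‖g y‖ ∂μ)) * l +
      ∫ y, |Ψ y| * ‖g y‖ ^ 2 ∂μ := by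
    intro l
    have e : ∫ y, |Ψ y| * (l - ‖g y‖) ^ 2 ∂μ = (∫ y, |Ψ y| ∂μ) * (l * l) +
        (-(2 * ∫ y, |Ψ y| * ‖g y‖ ∂μ)) * l + ∫ y, |Ψ y| * ‖g y‖ ^ 2 ∂μ := by
      have i1 : Integrable (fun y => |Ψ y| * (l * l)) μ := h.abs.integrable.mul_const _
      have i2 : Integrable (fun y => (-(2 * l)) * (|Ψ y| * ‖g y‖)) μ :=
        (h.abs.integrable_mul hg.norm).const_mul _
      have i3 : Integrable (fun y => |Ψ y| * ‖g y‖ ^ 2) μ := h.abs.integrable_mul (hg.norm.pow 2)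
      have i4 : Integrable (fun y => |Ψ y| * (l * l) + (-(2 * l)) * (|Ψ y| * ‖g y‖)) μ := i1.add i2
      rw [← integral_mul_const, show (-(2 * ∫ y, |Ψ y| * ‖g y‖ ∂μ)) * l =
        (-(2 * l)) * ∫ y, |Ψ y| * ‖g y‖ ∂μ by ring, ← integral_const_mul, ← integral_add i1 i2,
        ← integral_add i4 i3]
      exact integral_congr_ae (Eventually.of_forall fun y => by ring)
    rw [← e]
    exact integral_nonneg fun y => by positivity
  have h2 := discrim_le_zero h1
  rw [discrim] at h2
  nlinarith [pow_le_pow_left₀ (norm_nonneg _) h0 2]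

end jensen

/-- The average of the transforms of `u` with weight `Ψ`. -/
noncomputable def av {d : ℕ} (u : V d → ℝ → ℝ) (Ψ : Sy d → ℝ) : V d → ℝ → ℝ :=
  fun x t => ∫ y, Ψ y • tr u y x t ∂(mu d)

section average
variable {d : ℕ} {u v f : V d → ℝ → ℝ} {x : V d} {t : ℝ} [Fact (3 ≤ d)] {Ψ : Sy d → ℝ}

lemma hasFDerivAt_av (hu : CD 2 u) (h : Wt Ψ) {q : V d × ℝ} (hq : q ∈ Om d) :
    HasFDerivAt (fun q : V d × ℝ => av u Ψ q.1 q.2) (∫ y, Ψ y • F1 u q y ∂(mu d)) q := by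
  have := hasFDerivAt_average (μ := mu d) (Φ := fun (q : V d × ℝ) y => tr u y q.1 q.2)
    (Φ' := F1 u) isOpen_Om h.1 h.2
    (contOn_F0 hu) (contOn_F1 hu) (fun _ hq y => hasFDerivAt_tr (hu.mono one_le_two) hq y) hq
  exact this

lemma CD.av (hu : CD 2 u) (h : Wt Ψ) : CD 2 (CoulombWave.av u Ψ) := by
  have := contDiffOn_two_average (μ := mu d)
    (Φ := fun (q : V d × ℝ) y => CoulombWave.tr u y q.1 q.2) (Φ' := F1 u) (Φ'' := F2 u)
    isOpen_Om h.1 h.2 (contOn_F0 hu) (contOn_F1 hu) (contOn_F2 hu)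
    (fun _ hq y => hasFDerivAt_tr (hu.mono one_le_two) hq y) (fun _ hq y => hasFDerivAt_F1 hu hq y)
  exact this

lemma av_hess (hu : CD 2 u) (h : Wt Ψ) (hx : x ≠ 0) (v w : V d × ℝ) :
    fderiv ℝ (fderiv ℝ (fun q : V d × ℝ => av u Ψ q.1 q.2)) (x, t) v w =
      ∫ y, Ψ y • F2 u (x, t) y v w ∂(mu d) := by
  have := fderiv_fderiv_average (μ := mu d) (Φ := fun (q : V d × ℝ) y => tr u y q.1 q.2)
    (Φ' := F1 u) (Φ'' := F2 u)
    isOpen_Om h.1 h.2 (contOn_F0 hu) (contOn_F1 hu) (contOn_F2 hu)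
    (fun _ hq y => hasFDerivAt_tr (hu.mono one_le_two) hq y) (fun _ hq y => hasFDerivAt_F1 hu hq y)
    (mem_Om (t := t) hx) v w
  exact this

lemma contOn_tr_gr (hu : CD 2 u) :
    ContinuousOn (fun z : (V d × ℝ) × Sy d => gr (tr u z.2) z.1.1 z.1.2) (Om d ×ˢ univ) := by
  have h1 := (contOn_F1 hu).clm_comp
    (continuous_const (y := ContinuousLinearMap.inl ℝ (V d) ℝ)).continuousOn
  refine ((InnerProductSpace.toDual ℝ (V d)).symm.continuous.comp_continuousOn h1).congr ?_
  intro z hz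
  have hz1 : z.1 ∈ Om d := hz.1
  show gr (tr u z.2) z.1.1 z.1.2 = _
  rw [gr_eq_toDual ((hu.tr z.2).mono one_le_two) hz1.1]
  have := (hasFDerivAt_tr (hu.mono one_le_two) hz1 z.2).fderiv
  rw [Prod.mk.eta, this]; rfl

lemma contOn_tr_D (hu : CD 2 u) :
    ContinuousOn (fun z : (V d × ℝ) × Sy d => D (tr u z.2) z.1.1 z.1.2) (Om d ×ˢ univ) := by
  refine ((contOn_F1 hu).clm_apply (g := fun _ => ((0, 1) : V d × ℝ)) continuousOn_const).congr ?_
  intro z hz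
  have hz1 : z.1 ∈ Om d := hz.1
  show D (tr u z.2) z.1.1 z.1.2 = _
  rw [((hu.tr z.2).mono one_le_two).D_eq hz1.1]
  have := (hasFDerivAt_tr (hu.mono one_le_two) hz1 z.2).fderiv
  rw [Prod.mk.eta, this]

lemma cont_F1 (hu : CD 2 u) (hx : x ≠ 0) : Continuous fun y => F1 u (x, t) y := by
  have := ContinuousOn.section_right (Φ := F1 u) (q := (x, t)) (contOn_F1 hu) (mem_Om hx)
  exact this

lemma cont_F2 (hu : CD 2 u) (hx : x ≠ 0) : Continuous fun y => F2 u (x, t) y := by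
  have := ContinuousOn.section_right (Φ := F2 u) (q := (x, t)) (contOn_F2 hu) (mem_Om hx)
  exact this

lemma cont_tr (hu : CD 2 u) (hx : x ≠ 0) : Continuous fun y => tr u y x t := by
  have := ContinuousOn.section_right (Φ := fun (q : V d × ℝ) y => tr u y q.1 q.2) (q := (x, t))
    (contOn_F0 hu) (mem_Om hx)
  exact this

lemma cont_tr_gr (hu : CD 2 u) (hx : x ≠ 0) : Continuous fun y => gr (tr u y) x t := by
  have := ContinuousOn.section_right (Φ := fun (q : V d × ℝ) y => gr (tr u y) q.1 q.2)
    (q := (x, t)) (contOn_tr_gr hu) (mem_Om hx)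
  exact this

lemma cont_tr_D (hu : CD 2 u) (hx : x ≠ 0) : Continuous fun y => D (tr u y) x t := by
  have := ContinuousOn.section_right (Φ := fun (q : V d × ℝ) y => D (tr u y) q.1 q.2)
    (q := (x, t)) (contOn_tr_D hu) (mem_Om hx)
  exact this

lemma av_D (hu : CD 2 u) (h : Wt Ψ) (hx : x ≠ 0) :
    D (av u Ψ) x t = ∫ y, Ψ y • D (tr u y) x t ∂(mu d) := by
  rw [((hu.av h).mono one_le_two).D_eq hx, (hasFDerivAt_av hu h (mem_Om hx)).fderiv,
    ContinuousLinearMap.integral_apply (h.integrable_smul (cont_F1 hu hx))]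
  refine integral_congr_ae (Eventually.of_forall fun y => ?_)
  simp only [ContinuousLinearMap.smul_apply]
  rw [((hu.tr y).mono one_le_two).D_eq hx, (hasFDerivAt_tr (hu.mono one_le_two) (mem_Om hx) y).fderiv]

lemma av_gr (hu : CD 2 u) (h : Wt Ψ) (hx : x ≠ 0) :
    gr (av u Ψ) x t = ∫ y, Ψ y • gr (tr u y) x t ∂(mu d) := by
  refine ext_inner_left ℝ fun w => ?_
  rw [← integral_inner (h.integrable_smul (cont_tr_gr hu hx)), real_inner_comm,
    ((hu.av h).mono one_le_two).inner_gr hx, (hasFDerivAt_av hu h (mem_Om hx)).fderiv,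
    ContinuousLinearMap.integral_apply (h.integrable_smul (cont_F1 hu hx))]
  refine integral_congr_ae (Eventually.of_forall fun y => ?_)
  simp only [ContinuousLinearMap.smul_apply, real_inner_smul_right]
  rw [real_inner_comm, ((hu.tr y).mono one_le_two).inner_gr hx,
    (hasFDerivAt_tr (hu.mono one_le_two) (mem_Om hx) y).fderiv, smul_eq_mul]

lemma Wave.av_pde (hu : Wave u) (h : Wt Ψ) (hx : x ≠ 0) :
    D (D (CoulombWave.av u Ψ)) x t = lap (fun z => CoulombWave.av u Ψ z t) x -
      CoulombWave.av u Ψ x t / ‖x‖ := by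
  have hc : ∀ v w, Continuous fun y => F2 u (x, t) y v w := fun v w =>
    ((cont_F2 hu.cd hx).clm_apply continuous_const).clm_apply continuous_const
  rw [(hu.cd.av h).hess_time hx, (hu.cd.av h).hess_lap hx, av_hess hu.cd h hx]
  simp_rw [av_hess hu.cd h hx]
  rw [← integral_finsetSum _ fun i _ => h.integrable_smul (hc _ _), CoulombWave.av,
    ← integral_div, ← integral_sub
      (integrable_finsetSum _ fun i _ => h.integrable_smul (hc _ _))
      ((h.integrable_smul (cont_tr hu.cd hx)).div_const _)]
  refine integral_congr_ae (Eventually.of_forall fun y => ?_)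
  have := hu.tr_pde y hx (t := t)
  rw [(hu.cd.tr y).hess_time hx, (hu.cd.tr y).hess_lap hx, tr_hess hu.cd hx] at this
  simp_rw [tr_hess hu.cd hx] at this
  simp only [smul_eq_mul, ← Finset.mul_sum]
  rw [this]; ring

lemma av_cont (hu : Continuous (fun q : V d × ℝ => u q.1 q.2)) (h : Wt Ψ) :
    Continuous (fun q : V d × ℝ => av u Ψ q.1 q.2) := by
  rw [← continuousOn_univ]
  refine continuousOn_average (Φ := fun (q : V d × ℝ) y => tr u y q.1 q.2) h.1 h.2 ?_
  exact (hu.comp continuous_At).continuousOn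

/-- The difference between a transformed wave and a multiple of the wave. -/
noncomputable def dif (u : V d → ℝ → ℝ) (c : ℝ) (y : Sy d) : V d → ℝ → ℝ :=
  fun x t => 1 * tr u y x t + c * u x t

lemma Wave.dif (hu : Wave u) (c : ℝ) (y : Sy d) : Wave (CoulombWave.dif u c y) :=
  (hu.tr y).lin hu 1 c

lemma contOn_dif_eDen (hu : Wave u) (c : ℝ) : ContinuousOn
    (fun z : (V d × ℝ) × Sy d => eDenFree (dif u c z.2) z.1.1 z.1.2) (Om d ×ˢ univ) := by
  have hp : MapsTo (Prod.fst : (V d × ℝ) × Sy d → V d × ℝ) (Om d ×ˢ univ) (Om d) := fun z hz => hz.1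
  have g := hu.cd.cgr.contOn.comp continuous_fst.continuousOn hp
  have p := hu.cd.cD.contOn.comp continuous_fst.continuousOn hp
  have m := hu.cd.contOn.comp continuous_fst.continuousOn hp
  have hn : ContinuousOn (fun z : (V d × ℝ) × Sy d => 2 * ‖z.1.1‖) (Om d ×ˢ univ) := by fun_prop
  have key : ContinuousOn (fun z : (V d × ℝ) × Sy d =>
      (1 / 2) * ‖(1 : ℝ) • gr (tr u z.2) z.1.1 z.1.2 + c • gr u z.1.1 z.1.2‖ ^ 2 +
      (1 / 2) * (1 * D (tr u z.2) z.1.1 z.1.2 + c * D u z.1.1 z.1.2) ^ 2 +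
      (1 * tr u z.2 z.1.1 z.1.2 + c * u z.1.1 z.1.2) ^ 2 / (2 * ‖z.1.1‖)) (Om d ×ˢ univ) := by
    refine ((continuousOn_const.mul ((((contOn_tr_gr hu.cd).const_smul (1 : ℝ)).add
      (g.const_smul c)).norm.pow 2)).add (continuousOn_const.mul
      (((continuousOn_const.mul (contOn_tr_D hu.cd)).add (continuousOn_const.mul p)).pow 2))).add
      ((((continuousOn_const.mul (contOn_F0 hu.cd)).add (continuousOn_const.mul m)).pow 2).div hn ?_)
    intro z hz
    have : z.1 ∈ Om d := hz.1
    have : z.1.1 ≠ 0 := this.1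
    positivity
  refine key.congr fun z hz => ?_
  have hz1 : z.1 ∈ Om d := hz.1
  show eDenFree (fun x t => 1 * tr u z.2 x t + c * u x t) z.1.1 z.1.2 = _
  rw [eDen_def, gr_lin (hu.cd.tr _) hu.cd 1 c hz1.1, D_lin ((hu.cd.tr _).mono one_le_two)
    (hu.cd.mono one_le_two) 1 c hz1.1]

lemma av_eDen_le (hu : Wave u) (h : Wt Ψ) (c : ℝ) (hx : x ≠ 0) :
    eDenFree (fun x t => 1 * av u Ψ x t + (c * ∫ y, Ψ y ∂(mu d)) * u x t) x t ≤
      (∫ y, |Ψ y| ∂(mu d)) * ∫ y, |Ψ y| * eDenFree (dif u c y) x t ∂(mu d) := by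
  have hx0 : 0 < ‖x‖ := norm_pos_iff.2 hx
  have hu1 := hu.cd.mono one_le_two
  set A := ∫ y, Ψ y ∂(mu d) with hA
  have cg : Continuous fun y => (1 : ℝ) • gr (tr u y) x t + c • gr u x t :=
    ((cont_tr_gr hu.cd hx).const_smul (1 : ℝ)).add (continuous_const (y := c • gr u x t))
  have cD : Continuous fun y => 1 * D (tr u y) x t + c * D u x t :=
    (continuous_const.mul (cont_tr_D hu.cd hx)).add continuous_const
  have c0 : Continuous fun y => 1 * tr u y x t + c * u x t :=
    (continuous_const.mul (cont_tr hu.cd hx)).add continuous_const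
  have e1 : (1 : ℝ) • gr (av u Ψ) x t + (c * A) • gr u x t =
      ∫ y, Ψ y • ((1 : ℝ) • gr (tr u y) x t + c • gr u x t) ∂(mu d) := by
    simp only [one_smul, smul_add]
    rw [integral_add (h.integrable_smul (cont_tr_gr hu.cd hx))
      (h.integrable_smul continuous_const), av_gr hu.cd h hx, integral_smul_const, hA, smul_smul,
      mul_comm]
  have e2 : 1 * D (av u Ψ) x t + (c * A) * D u x t =
      ∫ y, Ψ y • (1 * D (tr u y) x t + c * D u x t) ∂(mu d) := by
    simp only [one_mul, smul_add]
    rw [integral_add (h.integrable_smul (cont_tr_D hu.cd hx))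
      (h.integrable_smul continuous_const), av_D hu.cd h hx, integral_smul_const, hA, smul_eq_mul]
    ring
  have e3 : 1 * av u Ψ x t + (c * A) * u x t =
      ∫ y, Ψ y • (1 * tr u y x t + c * u x t) ∂(mu d) := by
    simp only [one_mul, smul_add]
    rw [integral_add (h.integrable_smul (cont_tr hu.cd hx))
      (h.integrable_smul continuous_const), av, integral_smul_const, hA, smul_eq_mul]
    ring
  have j1 := h.jensen (μ := mu d) cg
  have j2 := h.jensen (μ := mu d) cD
  have j3 := h.jensen (μ := mu d) c0
  have hW : ∀ y, eDenFree (dif u c y) x t =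
      (1 / 2) * ‖(1 : ℝ) • gr (tr u y) x t + c • gr u x t‖ ^ 2 +
      (1 / 2) * ‖1 * D (tr u y) x t + c * D u x t‖ ^ 2 +
      1 / (2 * ‖x‖) * ‖1 * tr u y x t + c * u x t‖ ^ 2 := by
    intro y
    show eDenFree (fun x t => 1 * tr u y x t + c * u x t) x t = _
    rw [eDen_def, gr_lin (hu.cd.tr _) hu.cd 1 c hx, D_lin ((hu.cd.tr _).mono one_le_two)
      hu1 1 c hx, Real.norm_eq_abs, sq_abs, Real.norm_eq_abs, sq_abs]
    ring
  have i1 : Integrable (fun y => (1 / 2) *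
      (|Ψ y| * ‖(1 : ℝ) • gr (tr u y) x t + c • gr u x t‖ ^ 2)) (mu d) :=
    (h.abs.integrable_mul (cg.norm.pow 2)).const_mul _
  have i2 : Integrable (fun y => (1 / 2) *
      (|Ψ y| * ‖1 * D (tr u y) x t + c * D u x t‖ ^ 2)) (mu d) :=
    (h.abs.integrable_mul (cD.norm.pow 2)).const_mul _
  have i3 : Integrable (fun y => 1 / (2 * ‖x‖) *
      (|Ψ y| * ‖1 * tr u y x t + c * u x t‖ ^ 2)) (mu d) :=
    (h.abs.integrable_mul (c0.norm.pow 2)).const_mul _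
  have i12 : Integrable (fun y => (1 / 2) *
      (|Ψ y| * ‖(1 : ℝ) • gr (tr u y) x t + c • gr u x t‖ ^ 2) + (1 / 2) *
      (|Ψ y| * ‖1 * D (tr u y) x t + c * D u x t‖ ^ 2)) (mu d) := i1.add i2
  have eI : ∫ y, |Ψ y| * eDenFree (dif u c y) x t ∂(mu d) =
      (1 / 2) * ∫ y, |Ψ y| * ‖(1 : ℝ) • gr (tr u y) x t + c • gr u x t‖ ^ 2 ∂(mu d) +
      (1 / 2) * ∫ y, |Ψ y| * ‖1 * D (tr u y) x t + c * D u x t‖ ^ 2 ∂(mu d) +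
      1 / (2 * ‖x‖) * ∫ y, |Ψ y| * ‖1 * tr u y x t + c * u x t‖ ^ 2 ∂(mu d) := by
    rw [← integral_const_mul, ← integral_const_mul, ← integral_const_mul,
      ← integral_add i1 i2, ← integral_add i12 i3]
    refine integral_congr_ae (Eventually.of_forall fun y => ?_)
    simp only [hW]; ring
  rw [eDen_def, gr_lin (hu.cd.av h) hu.cd 1 (c * A) hx, D_lin ((hu.cd.av h).mono one_le_two)
    hu1 1 (c * A) hx, e1, e2, e3, eI]
  rw [Real.norm_eq_abs, sq_abs] at j2 j3
  have j3' := mul_le_mul_of_nonneg_left j3 (by positivity : 0 ≤ 1 / (2 * ‖x‖))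
  have e4 : ∀ a : ℝ, a ^ 2 / (2 * ‖x‖) = 1 / (2 * ‖x‖) * a ^ 2 := fun a => by ring
  rw [e4]
  linarith

end average

section avEnergy
variable {d : ℕ} {u v f : V d → ℝ → ℝ} {x : V d} {t : ℝ} [Fact (3 ≤ d)] {Ψ : Sy d → ℝ}

lemma aesm_dif (hu : Wave u) (h : Wt Ψ) (c : ℝ) (t : ℝ) :
    AEStronglyMeasurable (fun z : V d × Sy d => |Ψ z.2| * eDenFree (dif u c z.2) z.1 t)
      (volume.prod (mu d)) := by
  have hc : ContinuousOn (fun z : V d × Sy d => |Ψ z.2| * eDenFree (dif u c z.2) z.1 t)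
      ({0}ᶜ ×ˢ univ) := by
    refine ((h.1.comp continuous_snd).abs.continuousOn).mul ?_
    exact (contOn_dif_eDen hu c).comp (f := fun z : V d × Sy d => ((z.1, t), z.2)) (by fun_prop)
      fun z hz => ⟨⟨hz.1, mem_univ _⟩, mem_univ _⟩
  have hm : MeasurableSet (({0}ᶜ : Set (V d)) ×ˢ (univ : Set (Sy d))) :=
    (measurableSet_singleton 0).compl.prod MeasurableSet.univ
  have h1 := hc.aestronglyMeasurable (μ := volume.prod (mu d)) hm
  rwa [← Measure.prod_restrict, Measure.restrict_univ,
    Measure.restrict_eq_self_of_ae_mem (s := ({0}ᶜ : Set (V d))) ae_ne_zero] at h1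

lemma int_dif (hu : Wave u) (h : Wt Ψ) (c : ℝ) (t : ℝ) :
    Integrable (fun z : V d × Sy d => |Ψ z.2| * eDenFree (dif u c z.2) z.1 t)
      (volume.prod (mu d)) := by
  obtain ⟨B, hB⟩ := hu.bdd
  refine (integrable_prod_iff' (aesm_dif hu h c t)).2 ⟨Eventually.of_forall fun y => by
    have := ((hu.dif c y).int t).const_mul |Ψ y|
    exact this, ?_⟩
  have hm := (aesm_dif hu h c t).norm.prod_swap.integral_prod_right'
  refine Integrable.mono' (h.abs.integrable.mul_const (2 * 1 ^ 2 * B + 2 * c ^ 2 * B)) hm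
    (Eventually.of_forall fun y => ?_)
  have e1 : ∀ x, ‖|Ψ y| * eDenFree (dif u c y) x t‖ = |Ψ y| * eDenFree (dif u c y) x t := fun x =>
    Real.norm_of_nonneg (mul_nonneg (abs_nonneg _) eDen_nonneg)
  simp only [e1]
  rw [integral_const_mul, Real.norm_of_nonneg (mul_nonneg (abs_nonneg _)
    (integral_nonneg fun _ => eDen_nonneg))]
  refine mul_le_mul_of_nonneg_left ?_ (abs_nonneg _)
  have i1 := ((hu.tr y).int t).const_mul (2 * 1 ^ 2)
  have i2 := (hu.int t).const_mul (2 * c ^ 2)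
  calc ∫ x, eDenFree (dif u c y) x t ≤ ∫ x, (2 * 1 ^ 2 * eDenFree (tr u y) x t +
        2 * c ^ 2 * eDenFree u x t) := by
        refine integral_mono_ae ((hu.dif c y).int t) (i1.add i2) ?_
        filter_upwards [ae_ne_zero] with x hx
        exact eDen_lin_le (hu.cd.tr y) hu.cd 1 c hx
    _ = 2 * 1 ^ 2 * (∫ x, eDenFree u x (t - y.2)) + 2 * c ^ 2 * (∫ x, eDenFree u x t) := by
        rw [integral_add i1 i2, integral_const_mul, integral_const_mul, hu.tr_integral]
    _ ≤ _ := by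
        have h1 := hB (t - y.2)
        have h2 := hB t
        gcongr

/-- Minkowski-type energy bound for weighted averages. -/
lemma av_energy_le (hu : Wave u) (h : Wt Ψ) (c t : ℝ) {m : ℝ}
    (hm : ∀ y, Ψ y ≠ 0 → ∫ x, eDenFree (dif u c y) x t ≤ m) :
    Integrable (fun x => eDenFree
      (fun x t => 1 * av u Ψ x t + (c * ∫ y, Ψ y ∂(mu d)) * u x t) x t) ∧
    ∫ x, eDenFree (fun x t => 1 * av u Ψ x t + (c * ∫ y, Ψ y ∂(mu d)) * u x t) x t ≤
      (∫ y, |Ψ y| ∂(mu d)) ^ 2 * m := by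
  have hi := int_dif hu h c t
  have hA : 0 ≤ ∫ y, |Ψ y| ∂(mu d) := integral_nonneg fun y => abs_nonneg _
  have j1 : Integrable (fun x => (∫ y, |Ψ y| ∂(mu d)) *
      ∫ y, |Ψ y| * eDenFree (dif u c y) x t ∂(mu d)) := hi.integral_prod_left.const_mul _
  have j2 : Integrable (fun x => eDenFree
      (fun x t => 1 * av u Ψ x t + (c * ∫ y, Ψ y ∂(mu d)) * u x t) x t) := by
    refine int_slice ((hu.cd.av h).lin hu.cd 1 (c * ∫ y, Ψ y ∂(mu d))).ceDen.contOn j1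
      fun x hx => ?_
    rw [abs_of_nonneg eDen_nonneg]
    exact av_eDen_le hu h c hx
  refine ⟨j2, (integral_mono_ae j2 j1 (ae_ne_zero.mono fun x hx => av_eDen_le hu h c hx)).trans ?_⟩
  rw [integral_const_mul, pow_two, mul_assoc]
  refine mul_le_mul_of_nonneg_left ?_ hA
  rw [integral_integral_swap hi, ← integral_mul_const]
  refine integral_mono hi.integral_prod_right (h.abs.integrable.mul_const _) fun y => ?_
  simp only
  rw [integral_const_mul]
  by_cases hy : Ψ y = 0
  · simp [hy]
  · exact mul_le_mul_of_nonneg_left (hm y hy) (abs_nonneg _)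

lemma dif_zero (y : Sy d) : dif u 0 y = tr u y := by
  ext x t; simp [dif]

lemma Wave.av_energy (hu : Wave u) (h : Wt Ψ) (t : ℝ) {B : ℝ}
    (hB : ∀ t, ∫ x, eDenFree u x t ≤ B) :
    Integrable (fun x => eDenFree (CoulombWave.av u Ψ) x t) ∧
    ∫ x, eDenFree (CoulombWave.av u Ψ) x t ≤ (∫ y, |Ψ y| ∂(mu d)) ^ 2 * B := by
  have := av_energy_le hu h 0 t (m := B) fun y _ => by
    rw [dif_zero, hu.tr_integral]; exact hB _
  simpa only [zero_mul, add_zero, one_mul] using this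

lemma Wave.av (hu : Wave u) (h : Wt Ψ) : Wave (CoulombWave.av u Ψ) := by
  obtain ⟨B, hB⟩ := hu.bdd
  exact ⟨av_cont hu.cont h, hu.cd.av h, fun x t hx => hu.av_pde h hx,
    fun t => (hu.av_energy h t hB).1, _, fun t => (hu.av_energy h t hB).2⟩

lemma integrable_av (hu : Continuous (fun q : V d × ℝ => u q.1 q.2)) (h : Wt Ψ) (x : V d) (t : ℝ) :
    Integrable (fun y => Ψ y • tr u y x t) (mu d) := by
  refine h.integrable_smul (g := fun y => tr u y x t) ?_
  exact (hu.comp continuous_At).comp (f := fun y : Sy d => ((x, t), y)) (by fun_prop)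

lemma av_lin (hu : Continuous (fun q : V d × ℝ => u q.1 q.2)) {Ψ₁ Ψ₂ : Sy d → ℝ}
    (h₁ : Wt Ψ₁) (h₂ : Wt Ψ₂) (a b : ℝ) :
    av u (fun y => a * Ψ₁ y + b * Ψ₂ y) = fun x t => a * av u Ψ₁ x t + b * av u Ψ₂ x t := by
  ext x t
  simp only [av]
  rw [← integral_const_mul, ← integral_const_mul, ← integral_add
    ((integrable_av hu h₁ x t).const_mul _) ((integrable_av hu h₂ x t).const_mul _)]
  refine integral_congr_ae (Eventually.of_forall fun y => ?_)
  simp only [smul_eq_mul]; ring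

end avEnergy

open scoped ContDiff

/-- Smooth compactly supported kernels in time. -/
structure Kn (k : ℝ → ℝ) : Prop where
  smooth : ContDiff ℝ ∞ k
  supp : HasCompactSupport k

lemma Kn.deriv {k : ℝ → ℝ} (h : Kn k) : Kn (deriv k) :=
  ⟨(contDiff_infty_iff_deriv.1 h.smooth).2, h.supp.deriv⟩

lemma Kn.cont {k : ℝ → ℝ} (h : Kn k) : Continuous k := h.smooth.continuous

lemma Kn.shift {k : ℝ → ℝ} (h : Kn k) (a : ℝ) : Kn (fun s => k (s + a)) :=
  ⟨h.smooth.comp (contDiff_id.add contDiff_const),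
    h.supp.comp_homeomorph (Homeomorph.addRight a)⟩

lemma Kn.lin {k l : ℝ → ℝ} (h : Kn k) (h' : Kn l) (a b : ℝ) : Kn (fun s => a * k s + b * l s) :=
  ⟨(contDiff_const.mul h.smooth).add (contDiff_const.mul h'.smooth),
    (h.supp.mul_left (f := fun _ => a)).add (h'.supp.mul_left (f := fun _ => b))⟩

/-- Product weights. -/
noncomputable def sp {d : ℕ} (ψ : G d → ℝ) (k : ℝ → ℝ) : Sy d → ℝ := fun y => ψ y.1 * k y.2

/-- Averages with product weights. -/
noncomputable def Fa {d : ℕ} (u : V d → ℝ → ℝ) (ψ : G d → ℝ) (k : ℝ → ℝ) : V d → ℝ → ℝ :=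
  av u (sp ψ k)

/-- The average over rotations only. -/
noncomputable def Ra {d : ℕ} (u : V d → ℝ → ℝ) (ψ : G d → ℝ) (x : V d) (s : ℝ) : ℝ :=
  ∫ g, ψ g * u (Rt ((g, 0) : Sy d) x) s ∂(Measure.haar : Measure (G d))

section cls
variable {d : ℕ} {u v f : V d → ℝ → ℝ} {x : V d} {t : ℝ} [Fact (3 ≤ d)] {ψ : G d → ℝ} {k l : ℝ → ℝ}

lemma Wt.sp (hψ : Continuous ψ) (hk : Continuous k) (hc : HasCompactSupport k) :
    Wt (CoulombWave.sp ψ k) := by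
  refine ⟨(hψ.comp continuous_fst).mul (hk.comp continuous_snd), ?_⟩
  refine HasCompactSupport.intro (K := univ ×ˢ tsupport k) (isCompact_univ.prod hc) fun y hy => ?_
  have : y.2 ∉ tsupport k := fun h => hy ⟨mem_univ _, h⟩
  simp [CoulombWave.sp, image_eq_zero_of_notMem_tsupport this]

lemma Kn.wt (hk : Kn k) (hψ : Continuous ψ) : Wt (CoulombWave.sp ψ k) :=
  Wt.sp hψ hk.cont hk.supp

lemma continuous_Ra (hu : Continuous (fun q : V d × ℝ => u q.1 q.2)) (hψ : Continuous ψ) (x : V d) :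
    Continuous (Ra u ψ x) := by
  have h : Continuous (Function.uncurry fun (s : ℝ) (g : G d) =>
      ψ g * u (Rt ((g, 0) : Sy d) x) s) := by
    refine (hψ.comp continuous_snd).mul (hu.comp (f := fun z : ℝ × G d =>
      (Rt ((z.2, 0) : Sy d) x, z.1)) ?_)
    exact (continuous_Rt.comp (f := fun z : ℝ × G d => (x, ((z.2, 0) : Sy d)))
      (by fun_prop)).prodMk continuous_fst
  have := continuous_parametric_integral_of_continuous (μ := (Measure.haar : Measure (G d)))
    h (s := univ) isCompact_univ
  rw [Measure.restrict_univ] at this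
  exact this

lemma Fa_eq (hu : Continuous (fun q : V d × ℝ => u q.1 q.2)) (hψ : Continuous ψ)
    (hk : Kn k) (x : V d) (t : ℝ) : Fa u ψ k x t = ∫ s, k s * Ra u ψ x (t - s) := by
  have h := integrable_av hu (hk.wt hψ) x t
  rw [Fa, av, mu, integral_prod_symm _ h]
  refine integral_congr_ae (Eventually.of_forall fun s => ?_)
  simp only [Ra, CoulombWave.sp, smul_eq_mul, CoulombWave.tr]
  rw [← integral_const_mul]
  refine integral_congr_ae (Eventually.of_forall fun g => ?_)
  simp only [Rt]; ring

lemma hasDerivAt_Fa (hu : Continuous (fun q : V d × ℝ => u q.1 q.2)) (hψ : Continuous ψ)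
    (hk : Kn k) (x : V d) (t : ℝ) : HasDerivAt (Fa u ψ k x) (Fa u ψ (deriv k) x t) t := by
  have h1 : Fa u ψ k x = convolution k (Ra u ψ x) (ContinuousLinearMap.mul ℝ ℝ) volume := by
    ext s; rw [Fa_eq hu hψ hk]; rfl
  have h2 := hk.supp.hasDerivAt_convolution_left (ContinuousLinearMap.mul ℝ ℝ) (μ := volume)
    (hk.smooth.of_le (by norm_cast)) (continuous_Ra hu hψ x).locallyIntegrable t
  rw [h1, Fa_eq hu hψ hk.deriv]; exact h2

lemma D_Fa (hu : Continuous (fun q : V d × ℝ => u q.1 q.2)) (hψ : Continuous ψ)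
    (hk : Kn k) : D (Fa u ψ k) = Fa u ψ (deriv k) := by
  ext x t
  exact (hasDerivAt_Fa hu hψ hk x t).deriv

lemma Fa_shift (hu : Continuous (fun q : V d × ℝ => u q.1 q.2)) (hψ : Continuous ψ)
    (hk : Kn k) (x : V d) (t a : ℝ) : Fa u ψ k x (t + a) = Fa u ψ (fun s => k (s + a)) x t := by
  rw [Fa_eq hu hψ hk, Fa_eq hu hψ (hk.shift a),
    ← integral_add_right_eq_self (fun s => k s * Ra u ψ x (t + a - s)) a]
  simp only [add_sub_add_right_eq_sub]

lemma Fa_rot (hu : Continuous (fun q : V d × ℝ => u q.1 q.2)) (hψ : Continuous ψ)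
    (hk : Kn k) (h : G d) (x : V d) (t : ℝ) :
    Fa u ψ k ((h : V d →L[ℝ] V d) x) t = Fa u (fun g => ψ (h * g)) k x t := by
  have hψ' : Continuous fun g => ψ (h * g) := hψ.comp (continuous_const_mul h)
  rw [Fa_eq hu hψ hk, Fa_eq hu hψ' hk]
  have : ∀ s, Ra u ψ ((h : V d →L[ℝ] V d) x) s = Ra u (fun g => ψ (h * g)) x s := by
    intro s
    rw [Ra, Ra, ← integral_mul_left_eq_self _ h]
    refine integral_congr_ae (Eventually.of_forall fun g => ?_)
    simp only [Rt_coe]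
    congr 2
    rw [← ContinuousLinearMap.mul_apply, ← Submonoid.coe_mul]
    simp
  simp only [this]

lemma Fa_lin (hu : Continuous (fun q : V d × ℝ => u q.1 q.2)) (hψ : Continuous ψ)
    (hk : Kn k) (hl : Kn l) (a b : ℝ) : Fa u ψ (fun s => a * k s + b * l s) =
      fun x t => a * Fa u ψ k x t + b * Fa u ψ l x t := by
  rw [Fa, Fa, Fa, ← av_lin hu (hk.wt hψ) (hl.wt hψ)]
  congr 1; ext y; simp only [CoulombWave.sp]; ring

lemma Fa_sub_left (hu : Continuous (fun q : V d × ℝ => u q.1 q.2)) {ψ' : G d → ℝ}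
    (hψ : Continuous ψ) (hψ' : Continuous ψ') (hk : Kn k) :
    Fa u (fun g => ψ g - ψ' g) k = fun x t => Fa u ψ k x t - Fa u ψ' k x t := by
  have := av_lin hu (hk.wt hψ) (hk.wt hψ') 1 (-1)
  simp only [one_mul, neg_mul, ← sub_eq_add_neg] at this
  rw [Fa, Fa, Fa, ← this]
  congr 1; ext y; simp only [CoulombWave.sp]; ring

lemma Wave.Fa_reg (hu : Wave u) (hψ : Continuous ψ) (hk : Kn k) : Reg (Fa u ψ k) := by
  refine ⟨hu.av (hk.wt hψ), ?_⟩
  rw [D_Fa hu.cont hψ hk]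
  exact hu.av (hk.deriv.wt hψ)

lemma integral_abs_sp (ψ : G d → ℝ) (k : ℝ → ℝ) : ∫ y, |sp ψ k y| ∂(mu d) =
    (∫ g, |ψ g| ∂(Measure.haar : Measure (G d))) * ∫ s, |k s| := by
  rw [← integral_prod_mul]
  simp only [sp, abs_mul]

/-- The time derivative of an average is square integrable. -/
lemma Wave.Fa_deriv_sq (hu : Wave u) (hψ : Continuous ψ) (hk : Kn k) {B : ℝ}
    (hB : ∀ t, ∫ x, eDenFree u x t ≤ B) (t : ℝ) :
    Integrable (fun x => Fa u ψ (deriv k) x t ^ 2) ∧ ∫ x, Fa u ψ (deriv k) x t ^ 2 ≤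
      2 * (((∫ g, |ψ g| ∂(Measure.haar : Measure (G d))) * ∫ s, |k s|) ^ 2 * B) := by
  have hw : Wave (Fa u ψ k) := hu.av (hk.wt hψ)
  have h1 := hw.int_D_sq t
  have h2 := (hu.av_energy (hk.wt hψ) t hB).2
  rw [integral_abs_sp] at h2
  rw [← D_Fa hu.cont hψ hk]
  refine ⟨h1, ?_⟩
  calc ∫ x, D (Fa u ψ k) x t ^ 2 ≤ ∫ x, 2 * eDenFree (Fa u ψ k) x t :=
        integral_mono h1 ((hw.int t).const_mul 2) fun x => D_sq_le
    _ ≤ _ := by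
        rw [integral_const_mul]
        exact mul_le_mul_of_nonneg_left h2 zero_le_two

end cls

lemma integrable_of_fatou {α : Type*} [MeasurableSpace α] {μ : Measure α} {f : ℕ → α → ℝ} {g : α → ℝ}
    {C : ℝ} (hf : ∀ n, Integrable (f n) μ) (h0 : ∀ n, 0 ≤ᵐ[μ] f n) (hC : ∀ n, ∫ x, f n x ∂μ ≤ C)
    (hlim : ∀ᵐ x ∂μ, Tendsto (fun n => f n x) atTop (𝓝 (g x))) :
    Integrable g μ ∧ ∫ x, g x ∂μ ≤ C := by
  have hg : AEStronglyMeasurable g μ :=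
    aestronglyMeasurable_of_tendsto_ae atTop (fun n => (hf n).aestronglyMeasurable) hlim
  have hg0 : 0 ≤ᵐ[μ] g := by
    filter_upwards [hlim, ae_all_iff.2 h0] with x hx h using ge_of_tendsto' hx h
  have hC0 : 0 ≤ C := (integral_nonneg_of_ae (h0 0)).trans (hC 0)
  have key : ∫⁻ x, ENNReal.ofReal (g x) ∂μ ≤ ENNReal.ofReal C := by
    calc ∫⁻ x, ENNReal.ofReal (g x) ∂μ
        = ∫⁻ x, liminf (fun n => ENNReal.ofReal (f n x)) atTop ∂μ := by
          refine lintegral_congr_ae ?_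
          filter_upwards [hlim] with x hx
          exact ((ENNReal.continuous_ofReal.tendsto _).comp hx).liminf_eq.symm
      _ ≤ liminf (fun n => ∫⁻ x, ENNReal.ofReal (f n x) ∂μ) atTop :=
          lintegral_liminf_le' fun n => (hf n).aestronglyMeasurable.aemeasurable.ennreal_ofReal
      _ ≤ ENNReal.ofReal C := by
          refine liminf_le_of_le (by isBoundedDefault) fun b hb => ?_
          obtain ⟨n, hn⟩ := hb.exists
          refine hn.trans ?_
          rw [← ofReal_integral_eq_lintegral_ofReal (hf n) (h0 n)]
          exact ENNReal.ofReal_le_ofReal (hC n)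
  refine ⟨⟨hg, (hasFiniteIntegral_iff_ofReal hg0).2 (key.trans_lt ENNReal.ofReal_lt_top)⟩, ?_⟩
  rw [integral_eq_lintegral_of_nonneg_ae hg0 hg]
  exact ENNReal.toReal_le_of_le_ofReal hC0 key

/-- The infinitesimal rotation in the plane spanned by two vectors. -/
noncomputable def Jm {d : ℕ} (a b : V d) : V d →L[ℝ] V d :=
  (innerSL ℝ a).smulRight b - (innerSL ℝ b).smulRight a

section ang
variable {d : ℕ} {u v f : V d → ℝ → ℝ} {x : V d} {t : ℝ} [Fact (3 ≤ d)] {ψ : G d → ℝ} {k l : ℝ → ℝ}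

lemma Jm_apply (a b x : V d) : Jm a b x = ⟪a, x⟫ • b - ⟪b, x⟫ • a := by
  simp [Jm]

lemma Jm_skew (a b : V d) : Jm a b ∈ skewAdjoint (V d →L[ℝ] V d) := by
  rw [skewAdjoint.mem_iff, ContinuousLinearMap.star_eq_adjoint, eq_comm,
    ContinuousLinearMap.eq_adjoint_iff]
  intro x y
  simp only [ContinuousLinearMap.neg_apply, Jm_apply, inner_neg_left, inner_sub_left,
    inner_sub_right, real_inner_smul_left, real_inner_smul_right]
  rw [real_inner_comm x a, real_inner_comm x b]; ring

/-- Rotations generated by `Jm`. -/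
noncomputable def rotG (a b : V d) (θ : ℝ) : G d :=
  ⟨NormedSpace.exp (θ • Jm a b), by
    letI : NormedAlgebra ℚ (V d →L[ℝ] V d) := NormedAlgebra.restrictScalars ℚ ℝ _
    exact NormedSpace.exp_mem_unitary_of_mem_skewAdjoint
      ((skewAdjoint.submodule ℝ (V d →L[ℝ] V d)).smul_mem θ (Jm_skew a b))⟩

lemma exp_zero_smul (J : V d →L[ℝ] V d) : NormedSpace.exp ((0 : ℝ) • J) = 1 := by
  have h0 : (0 : ℝ) • J = 0 := zero_smul ℝ J
  exact (congrArg NormedSpace.exp h0).trans NormedSpace.exp_zero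

lemma hasDerivAt_rotG (a b : V d) :
    HasDerivAt (fun θ => (rotG a b θ : V d →L[ℝ] V d)) (Jm a b) 0 := by
  have := hasDerivAt_exp_smul_const (𝕂 := ℝ) (Jm a b) 0
  exact this.congr_deriv ((congrArg (· * Jm a b) (exp_zero_smul _)).trans (one_mul _))

lemma rotG_zero (a b : V d) : (rotG a b 0 : V d →L[ℝ] V d) = 1 := exp_zero_smul _

lemma exists_rotG_bound (a b : V d) : ∃ C, 0 ≤ C ∧ ∀ n : ℕ,
    ‖(rotG a b (1 / (n + 1)) : V d →L[ℝ] V d) - 1‖ ≤ C * (1 / (n + 1)) := by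
  have h := hasDerivAt_iff_tendsto_slope_zero.1 (hasDerivAt_rotG a b)
  have h1 : Tendsto (fun n : ℕ => (1 / ((n : ℝ) + 1))) atTop (𝓝[≠] 0) :=
    tendsto_nhdsWithin_iff.2 ⟨tendsto_one_div_add_atTop_nhds_zero_nat,
      Eventually.of_forall fun n => by simp only [mem_compl_iff, mem_singleton_iff]; positivity⟩
  obtain ⟨C, hC⟩ := (h.comp h1).norm.bddAbove_range
  refine ⟨C, (norm_nonneg _).trans (hC ⟨0, rfl⟩), fun n => ?_⟩
  have h2 := hC ⟨n, rfl⟩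
  have hp : (0 : ℝ) < 1 / (n + 1) := by positivity
  simp only [Function.comp_apply, zero_add, rotG_zero, norm_smul, norm_inv,
    Real.norm_of_nonneg hp.le] at h2
  rwa [inv_mul_le_iff₀ hp, mul_comm] at h2

lemma tendsto_rotG (hf : CD 1 f) (a b : V d) (hx : x ≠ 0) :
    Tendsto (fun n : ℕ => ((1 / ((n : ℝ) + 1))⁻¹ *
      (f ((rotG a b (1 / (n + 1)) : V d →L[ℝ] V d) x) t - f x t))) atTop
      (𝓝 ⟪gr f x t, Jm a b x⟫) := by
  have h0 : (rotG a b 0 : V d →L[ℝ] V d) x = x := by simp [rotG_zero]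
  have hd : HasDerivAt (fun θ => f ((rotG a b θ : V d →L[ℝ] V d) x) t) ⟪gr f x t, Jm a b x⟫ 0 := by
    have h1 := (hasDerivAt_rotG a b).clm_apply (hasDerivAt_const (0 : ℝ) x)
    have h2 : HasFDerivAt (fun y => f y t) (innerSL ℝ (gr f x t))
        ((rotG a b 0 : V d →L[ℝ] V d) x) := by rw [h0]; exact hf.hasFDerivAt_gr hx
    have h3 := h2.comp_hasDerivAt (0 : ℝ) h1
    exact h3.congr_deriv (by simp)
  have h := hasDerivAt_iff_tendsto_slope_zero.1 hd
  have h1 : Tendsto (fun n : ℕ => (1 / ((n : ℝ) + 1))) atTop (𝓝[≠] 0) :=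
    tendsto_nhdsWithin_iff.2 ⟨tendsto_one_div_add_atTop_nhds_zero_nat,
      Eventually.of_forall fun n => by simp only [mem_compl_iff, mem_singleton_iff]; positivity⟩
  have h2 := h.comp h1
  simpa only [Function.comp_def, zero_add, h0, smul_eq_mul] using h2

/-- Lagrange's identity for the angular part of the gradient. -/
lemma sum_Jm_sq (g x : V d) : ∑ i, ∑ j,
    ⟪g, Jm (EuclideanSpace.single i (1 : ℝ)) (EuclideanSpace.single j (1 : ℝ)) x⟫ ^ 2 =
      2 * (‖x‖ ^ 2 * ‖g‖ ^ 2 - ⟪g, x⟫ ^ 2) := by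
  have h1 : ∀ i j, ⟪g, Jm (EuclideanSpace.single i (1 : ℝ)) (EuclideanSpace.single j (1 : ℝ)) x⟫ ^ 2
      = x i ^ 2 * g j ^ 2 + x j ^ 2 * g i ^ 2 - 2 * ((g i * x i) * (g j * x j)) := by
    intro i j
    rw [Jm_apply, inner_sub_right, real_inner_smul_right, real_inner_smul_right,
      EuclideanSpace.inner_single_left, EuclideanSpace.inner_single_left,
      EuclideanSpace.inner_single_right, EuclideanSpace.inner_single_right]
    simp; ring
  have h2 : ⟪g, x⟫ = ∑ i, g i * x i := by
    rw [PiLp.inner_apply]; simp [mul_comm]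
  simp_rw [h1, Finset.sum_sub_distrib, Finset.sum_add_distrib, ← Finset.mul_sum, ← Finset.sum_mul,
    h2, EuclideanSpace.real_norm_sq_eq, ← Finset.mul_sum]
  ring

lemma mul_an_eq (hx : x ≠ 0) : ‖x‖ ^ 2 * an f x t = (1 / 2) * ∑ i, ∑ j,
    ⟪gr f x t, Jm (EuclideanSpace.single i (1 : ℝ)) (EuclideanSpace.single j (1 : ℝ)) x⟫ ^ 2 := by
  have : ‖x‖ ≠ 0 := norm_ne_zero_iff.2 hx
  rw [sum_Jm_sq, an, rd]
  field_simp

/-- Lipschitz weights on the orthogonal group. -/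
def Lp (ψ : G d → ℝ) : Prop := Continuous ψ ∧ ∃ L, 0 ≤ L ∧ ∀ h g : G d,
  |ψ (h * g) - ψ g| ≤ L * ‖(h : V d →L[ℝ] V d) - 1‖

lemma Wave.Fa_rot_sq (hu : Wave u) (hψ : Lp ψ) (hk : Kn k) : ∃ C, 0 ≤ C ∧ ∀ (h : G d) (t : ℝ),
    Integrable (fun x => (Fa u ψ (deriv k) ((h : V d →L[ℝ] V d) x) t - Fa u ψ (deriv k) x t) ^ 2) ∧
    ∫ x, (Fa u ψ (deriv k) ((h : V d →L[ℝ] V d) x) t - Fa u ψ (deriv k) x t) ^ 2 ≤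
      C * ‖(h : V d →L[ℝ] V d) - 1‖ ^ 2 := by
  obtain ⟨hψc, L, hL, hLip⟩ := hψ
  obtain ⟨B, hB⟩ := hu.bdd
  have hB0 : 0 ≤ B := (integral_nonneg fun x => eDen_nonneg).trans (hB 0)
  have hk0 : 0 ≤ ∫ s, |k s| := integral_nonneg fun s => abs_nonneg _
  set M := (Measure.haar : Measure (G d)).real univ with hM
  refine ⟨2 * ((M * L * ∫ s, |k s|) ^ 2 * B), by positivity, fun h t => ?_⟩
  have hc : Continuous fun g => ψ (h * g) := hψc.comp (continuous_const_mul h)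
  have hs : Continuous fun g => ψ (h * g) - ψ g := hc.sub hψc
  have e : ∀ x, Fa u ψ (deriv k) ((h : V d →L[ℝ] V d) x) t - Fa u ψ (deriv k) x t =
      Fa u (fun g => ψ (h * g) - ψ g) (deriv k) x t := by
    intro x
    rw [Fa_rot hu.cont hψc hk.deriv, Fa_sub_left hu.cont hc hψc hk.deriv]
  simp only [e]
  obtain ⟨h1, h2⟩ := hu.Fa_deriv_sq hs hk hB t
  refine ⟨h1, h2.trans ?_⟩
  have h3 : ∫ g, |ψ (h * g) - ψ g| ∂(Measure.haar : Measure (G d)) ≤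
      M * (L * ‖(h : V d →L[ℝ] V d) - 1‖) := by
    calc _ ≤ ∫ _g, L * ‖(h : V d →L[ℝ] V d) - 1‖ ∂(Measure.haar : Measure (G d)) := by
          refine integral_mono ?_ (integrable_const _) fun g => hLip h g
          exact hs.abs.integrable_of_hasCompactSupport (HasCompactSupport.of_compactSpace _)
      _ = _ := by rw [integral_const, smul_eq_mul]
  have h4 : 0 ≤ ∫ g, |ψ (h * g) - ψ g| ∂(Measure.haar : Measure (G d)) :=
    integral_nonneg fun g => abs_nonneg _
  calc _ ≤ 2 * ((M * (L * ‖(h : V d →L[ℝ] V d) - 1‖) * ∫ s, |k s|) ^ 2 * B) := by gcongr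
    _ = _ := by ring

lemma Wave.Fa_ang (hu : Wave u) (hψ : Lp ψ) (hk : Kn k) (a b : V d) : ∃ C, ∀ t : ℝ,
    Integrable (fun x => ⟪gr (Fa u ψ (deriv k)) x t, Jm a b x⟫ ^ 2) ∧
    ∫ x, ⟪gr (Fa u ψ (deriv k)) x t, Jm a b x⟫ ^ 2 ≤ C := by
  obtain ⟨C, hC, h⟩ := hu.Fa_rot_sq hψ hk
  obtain ⟨C', hC', h'⟩ := exists_rotG_bound a b
  refine ⟨C * C' ^ 2, fun t => ?_⟩
  have hcd : CD 1 (Fa u ψ (deriv k)) := (hu.cd.av (hk.deriv.wt hψ.1)).mono one_le_two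
  refine integrable_of_fatou (f := fun (n : ℕ) x => ((1 / ((n : ℝ) + 1))⁻¹ *
      (Fa u ψ (deriv k) ((rotG a b (1 / (n + 1)) : V d →L[ℝ] V d) x) t -
        Fa u ψ (deriv k) x t)) ^ 2) (fun n => ?_)
    (fun n => Eventually.of_forall fun x => sq_nonneg _) (fun n => ?_)
    (ae_ne_zero.mono fun x hx => (tendsto_rotG hcd a b hx).pow 2)
  · simp only [mul_pow]
    exact (h _ t).1.const_mul _
  · simp only [mul_pow]
    rw [integral_const_mul]
    have hp : (0 : ℝ) < 1 / (n + 1) := by positivity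
    have h1 := (h (rotG a b (1 / (n + 1))) t).2
    have h2 := pow_le_pow_left₀ (norm_nonneg _) (h' n) 2
    rw [inv_pow, inv_mul_le_iff₀ (by positivity)]
    calc _ ≤ _ := h1
      _ ≤ C * (C' * (1 / (n + 1))) ^ 2 := by gcongr
      _ = _ := by ring

theorem Wave.Fa_tame (hu : Wave u) (hψ : Lp ψ) (hk : Kn k) : Tame (Fa u ψ (deriv k)) := by
  obtain ⟨B, hB⟩ := hu.bdd
  choose C hC using fun i j : Fin d => hu.Fa_ang hψ hk (EuclideanSpace.single i (1 : ℝ))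
    (EuclideanSpace.single j (1 : ℝ))
  have hi : ∀ t, Integrable (fun x => (1 / 2) * ∑ i, ∑ j, ⟪gr (Fa u ψ (deriv k)) x t,
      Jm (EuclideanSpace.single i (1 : ℝ)) (EuclideanSpace.single j (1 : ℝ)) x⟫ ^ 2) := fun t =>
    (integrable_finsetSum _ fun i _ => integrable_finsetSum _ fun j _ => (hC i j t).1).const_mul _
  refine ⟨hu.Fa_reg hψ.1 hk.deriv, fun t => (hu.Fa_deriv_sq hψ.1 hk hB t).1,
    ⟨_, fun t => (hu.Fa_deriv_sq hψ.1 hk hB t).2⟩, fun t => (hi t).congr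
      (ae_ne_zero.mono fun x hx => (mul_an_eq hx).symm), (1 / 2) * ∑ i, ∑ j, C i j, fun t => ?_⟩
  rw [integral_congr_ae (ae_ne_zero.mono fun x hx => mul_an_eq hx), integral_const_mul,
    integral_finsetSum _ fun i _ => integrable_finsetSum _ fun j _ => (hC i j t).1]
  refine mul_le_mul_of_nonneg_left (Finset.sum_le_sum fun i _ => ?_) (by norm_num)
  rw [integral_finsetSum _ fun j _ => (hC i j t).1]
  exact Finset.sum_le_sum fun j _ => (hC i j t).2

end ang

section approx
variable {d : ℕ} {u v f : V d → ℝ → ℝ} {x : V d} {t : ℝ} [Fact (3 ≤ d)] {ψ : G d → ℝ} {k l : ℝ → ℝ}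

lemma energy_lin_le (hu : Wave u) (hv : Wave v) (a b t : ℝ) :
    ∫ x, eDenFree (fun x t => a * u x t + b * v x t) x t ≤
      2 * a ^ 2 * (∫ x, eDenFree u x t) + 2 * b ^ 2 * (∫ x, eDenFree v x t) := by
  have i1 := (hu.int t).const_mul (2 * a ^ 2)
  have i2 := (hv.int t).const_mul (2 * b ^ 2)
  rw [← integral_const_mul, ← integral_const_mul, ← integral_add i1 i2]
  refine integral_mono_ae ((hu.lin hv a b).int t) (i1.add i2) ?_
  filter_upwards [ae_ne_zero] with x hx using eDen_lin_le hu.cd hv.cd a b hx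

/-- Lipschitz bumps near the identity of the orthogonal group. -/
lemma exists_group_bump {δ : ℝ} (hδ : 0 < δ) : ∃ ψ : G d → ℝ, Lp ψ ∧ (∀ g, 0 ≤ ψ g) ∧
    ∫ g, ψ g ∂(Measure.haar : Measure (G d)) = 1 ∧ ∀ g, ψ g ≠ 0 → dist g 1 < δ := by
  set ψ : G d → ℝ := fun g => max 0 (δ - dist g 1) with hψ
  have hc : Continuous ψ := by fun_prop
  have h0 : ∀ g, 0 ≤ ψ g := fun g => le_max_left _ _
  have hI : 0 < ∫ g, ψ g ∂(Measure.haar : Measure (G d)) := by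
    refine hc.integral_pos_of_hasCompactSupport_nonneg_nonzero
      (HasCompactSupport.of_compactSpace _) h0 (x := 1) ?_
    simp [hψ, hδ.ne', hδ.le]
  set I := ∫ g, ψ g ∂(Measure.haar : Measure (G d)) with hI'
  refine ⟨fun g => I⁻¹ * ψ g, ⟨hc.const_mul _, I⁻¹, by positivity, fun h g => ?_⟩, fun g =>
    mul_nonneg (by positivity) (h0 g), ?_, fun g hg => ?_⟩
  · rw [← mul_sub, abs_mul, abs_of_pos (inv_pos.2 hI)]
    refine mul_le_mul_of_nonneg_left ?_ (by positivity)
    have h1 : |ψ (h * g) - ψ g| ≤ |dist (h * g) 1 - dist g 1| := by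
      simp only [hψ]
      refine (abs_max_sub_max_le_max _ _ _ _).trans ?_
      rw [sub_self, abs_zero, max_eq_right (abs_nonneg _), sub_sub_sub_cancel_left, abs_sub_comm]
    refine h1.trans ((abs_dist_sub_le _ _ _).trans ?_)
    rw [Subtype.dist_eq, dist_eq_norm, Submonoid.coe_mul]
    calc ‖(h : V d →L[ℝ] V d) * g - g‖ = ‖((h : V d →L[ℝ] V d) - 1) * g‖ := by
          rw [sub_mul, one_mul]
      _ ≤ ‖(h : V d →L[ℝ] V d) - 1‖ * ‖(g : V d →L[ℝ] V d)‖ := norm_mul_le _ _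
      _ ≤ ‖(h : V d →L[ℝ] V d) - 1‖ * 1 :=
          mul_le_mul_of_nonneg_left (norm_unitary_le g) (norm_nonneg _)
      _ = _ := mul_one _
  · rw [integral_const_mul, inv_mul_cancel₀ hI.ne']
  · by_contra hcon
    exact hg (by simp [hψ, not_lt.1 hcon])

/-- Smooth bumps in time near the origin. -/
lemma exists_time_bump {δ : ℝ} (hδ : 0 < δ) : ∃ k : ℝ → ℝ, Kn k ∧ (∀ s, 0 ≤ k s) ∧
    ∫ s, k s = 1 ∧ ∀ s, k s ≠ 0 → dist s 0 < δ := by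
  let b : ContDiffBump (0 : ℝ) := ⟨δ / 2, δ, by positivity, by linarith⟩
  refine ⟨b.normed volume, ⟨b.contDiff_normed, b.hasCompactSupport_normed⟩, b.nonneg_normed,
    b.integral_normed, fun s hs => ?_⟩
  have : s ∈ Function.support (b.normed volume) := hs
  rwa [b.support_normed_eq] at this


/-- Product weights concentrated near the identity. -/
lemma exists_weight {N : Set (Sy d)} (hN : N ∈ 𝓝 ((1 : G d), (0 : ℝ))) :
    ∃ (ψ : G d → ℝ) (k : ℝ → ℝ), Lp ψ ∧ Kn k ∧ ∫ y, sp ψ k y ∂(mu d) = 1 ∧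
      ∫ y, |sp ψ k y| ∂(mu d) = 1 ∧ ∀ y, sp ψ k y ≠ 0 → y ∈ N := by
  obtain ⟨δ, hδ, hball⟩ := Metric.mem_nhds_iff.1 hN
  obtain ⟨ψ, h1, h2, h3, h4⟩ := exists_group_bump (d := d) hδ
  obtain ⟨k, j1, j2, j3, j4⟩ := exists_time_bump hδ
  have hI : ∫ y, sp ψ k y ∂(mu d) = 1 := by
    have := integral_prod_mul (μ := (Measure.haar : Measure (G d))) (ν := (volume : Measure ℝ)) ψ k
    rw [h3, j3, one_mul] at this
    exact this
  refine ⟨ψ, k, h1, j1, hI, ?_, fun y hy => hball ?_⟩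
  · rw [← hI]
    exact integral_congr_ae (Eventually.of_forall fun y => abs_of_nonneg (mul_nonneg (h2 _) (j2 _)))
  · rw [Metric.mem_ball, Prod.dist_eq]
    exact max_lt (h4 _ (left_ne_zero_of_mul hy)) (j4 _ (right_ne_zero_of_mul hy))

lemma Rt_one (x : V d) : Rt ((1 : G d), (0 : ℝ)) x = x := by
  rw [Rt_coe]; simp

lemma tr_one (u : V d → ℝ → ℝ) : tr u ((1 : G d), (0 : ℝ)) = u := by
  ext x t; simp [tr, Rt_one]

/-- Continuity of the symmetry action in energy. -/
lemma eventually_energy_dif (hu : Wave u) (hE : ∀ s t, ∫ x, eDenFree u x s = ∫ x, eDenFree u x t)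
    (t : ℝ) {ε : ℝ} (hε : 0 < ε) :
    ∀ᶠ y in 𝓝 ((1 : G d), (0 : ℝ)), ∫ x, eDenFree (dif u (-1) y) x t ≤ ε := by
  by_contra hcon
  obtain ⟨ys, hy, hn⟩ := exists_seq_forall_of_frequently (not_eventually.1 hcon)
  set E := ∫ x, eDenFree u x t with hEd
  have i1 : ∀ n, Integrable (fun x => 2 * eDenFree (tr u (ys n)) x t + 2 * eDenFree u x t) :=
    fun n => (((hu.tr (ys n)).int t).const_mul 2).add ((hu.int t).const_mul 2)
  have hc : ∀ c : ℝ, ∀ x : V d, x ≠ 0 → Tendsto (fun n => eDenFree (dif u c (ys n)) x t) atTop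
      (𝓝 (eDenFree (dif u c ((1 : G d), (0 : ℝ))) x t)) := by
    intro c x hx
    have h1 := ContinuousOn.section_right
      (Φ := fun (q : V d × ℝ) y => eDenFree (dif u c y) q.1 q.2) (q := (x, t))
      (contOn_dif_eDen hu c) (mem_Om hx)
    exact (h1.tendsto _).comp hy
  have hz : eDenFree (dif u (-1) ((1 : G d), (0 : ℝ))) = fun _ _ => 0 := by
    have : dif u (-1) ((1 : G d), (0 : ℝ)) = fun _ _ => 0 := by
      ext x t; simp [dif, tr_one]
    ext x t
    rw [this]
    simp [eDenFree, gradient_const]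
  have key := integrable_of_fatou (μ := (volume : Measure (V d)))
    (f := fun n x => 2 * eDenFree (tr u (ys n)) x t + 2 * eDenFree u x t -
      eDenFree (dif u (-1) (ys n)) x t) (g := fun x => 2 * eDenFree u x t + 2 * eDenFree u x t - 0)
    (C := 4 * E - ε) (fun n => (i1 n).sub ((hu.dif (-1) (ys n)).int t)) (fun n => ?_) (fun n => ?_) ?_
  · have h2 := key.2
    have e : ∀ x : V d, 2 * eDenFree u x t + 2 * eDenFree u x t - 0 = 4 * eDenFree u x t :=
      fun x => by ring
    simp only [e] at h2
    rw [integral_const_mul] at h2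
    linarith
  · filter_upwards [ae_ne_zero] with x hx
    have := eDen_lin_le (hu.cd.tr (ys n)) hu.cd 1 (-1) hx (t := t)
    simp only [Pi.zero_apply]
    have e : eDenFree (fun x t => 1 * tr u (ys n) x t + -1 * u x t) x t =
      eDenFree (dif u (-1) (ys n)) x t := rfl
    rw [e] at this
    linarith
  · have h3 := not_le.1 (hn n)
    rw [integral_sub (i1 n) ((hu.dif (-1) (ys n)).int t),
      integral_add (((hu.tr (ys n)).int t).const_mul 2) ((hu.int t).const_mul 2),
      integral_const_mul, integral_const_mul, hu.tr_integral, hE (t - (ys n).2) t]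
    linarith
  · filter_upwards [ae_ne_zero] with x hx
    have h1 := hc 0 x hx
    have h2 := hc (-1) x hx
    simp only [dif_zero, tr_one, hz] at h1 h2
    exact ((h1.const_mul 2).add tendsto_const_nhds).sub h2

lemma Fa_energy_conservation (hu : Wave u) {ψ₁ ψ₂ : G d → ℝ} (h₁ : Continuous ψ₁)
    (h₂ : Continuous ψ₂) (hk : Kn k) (hl : Kn l) (a b s t : ℝ) :
    ∫ x, eDenFree (fun x t => a * Fa u ψ₁ k x t + b * Fa u ψ₂ l x t) x s =
      ∫ x, eDenFree (fun x t => a * Fa u ψ₁ k x t + b * Fa u ψ₂ l x t) x t := by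
  refine energy_conservation ((hu.av (hk.wt h₁)).lin (hu.av (hl.wt h₂)) a b) ?_ s t
  have : D (fun x t => a * Fa u ψ₁ k x t + b * Fa u ψ₂ l x t) =
      fun x t => a * Fa u ψ₁ (deriv k) x t + b * Fa u ψ₂ (deriv l) x t := by
    ext x t
    exact (((hasDerivAt_Fa hu.cont h₁ hk x t).const_mul a).fun_add
      ((hasDerivAt_Fa hu.cont h₂ hl x t).const_mul b)).deriv
  show Continuous fun q : V d × ℝ => D (fun x t => a * Fa u ψ₁ k x t + b * Fa u ψ₂ l x t) q.1 q.2
  rw [this]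
  exact ((av_cont hu.cont (hk.deriv.wt h₁)).const_mul a).add
    ((av_cont hu.cont (hl.deriv.wt h₂)).const_mul b)

/-- Averages approximate the wave in energy, uniformly in time. -/
theorem exists_approx (hu : Wave u) (hE : ∀ s t, ∫ x, eDenFree u x s = ∫ x, eDenFree u x t)
    {ε : ℝ} (hε : 0 < ε) : ∃ (ψ : G d → ℝ) (k : ℝ → ℝ), Lp ψ ∧ Kn k ∧
      ∀ t, ∫ x, eDenFree (fun x t => 1 * Fa u ψ k x t + (-1) * u x t) x t ≤ ε := by
  have hsmall : ∀ (ψ : G d → ℝ) (k : ℝ → ℝ) (t m : ℝ), Lp ψ → Kn k →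
      ∫ y, sp ψ k y ∂(mu d) = 1 → ∫ y, |sp ψ k y| ∂(mu d) = 1 →
      (∀ y, sp ψ k y ≠ 0 → ∫ x, eDenFree (dif u (-1) y) x t ≤ m) →
      ∫ x, eDenFree (fun x t => 1 * Fa u ψ k x t + (-1) * u x t) x t ≤ m := by
    intro ψ k t m h1 h2 h3 h4 h5
    have := (av_energy_le hu (h2.wt h1.1) (-1) t h5).2
    rwa [h3, h4, mul_one, one_pow, one_mul] at this
  obtain ⟨ψ₁, k₁, a1, a2, a3, a4, a5⟩ :=
    exists_weight (eventually_energy_dif hu hE 0 (ε := ε / 16) (by positivity))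
  refine ⟨ψ₁, k₁, a1, a2, fun t => ?_⟩
  obtain ⟨ψ₂, k₂, b1, b2, b3, b4, b5⟩ :=
    exists_weight ((eventually_energy_dif hu hE 0 (ε := ε / 16) (by positivity)).and
      (eventually_energy_dif hu hE t (ε := ε / 16) (by positivity)))
  have c1 := hsmall ψ₁ k₁ 0 _ a1 a2 a3 a4 a5
  have c2 := hsmall ψ₂ k₂ 0 _ b1 b2 b3 b4 fun y hy => (b5 y hy).1
  have c3 := hsmall ψ₂ k₂ t _ b1 b2 b3 b4 fun y hy => (b5 y hy).2
  have w1 : Wave (Fa u ψ₁ k₁) := hu.av (a2.wt a1.1)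
  have w2 : Wave (Fa u ψ₂ k₂) := hu.av (b2.wt b1.1)
  have c4 := energy_lin_le (w1.lin hu 1 (-1)) (w2.lin hu 1 (-1)) 1 (-1) 0
  have c5 := energy_lin_le (w1.lin w2 1 (-1)) (w2.lin hu 1 (-1)) 1 1 t
  have e1 : (fun (x : V d) (t : ℝ) => 1 * (1 * Fa u ψ₁ k₁ x t + -1 * u x t) +
      -1 * (1 * Fa u ψ₂ k₂ x t + -1 * u x t)) =
      fun x t => 1 * Fa u ψ₁ k₁ x t + -1 * Fa u ψ₂ k₂ x t := by
    ext x t; ring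
  have e2 : (fun (x : V d) (t : ℝ) => 1 * (1 * Fa u ψ₁ k₁ x t + -1 * Fa u ψ₂ k₂ x t) +
      1 * (1 * Fa u ψ₂ k₂ x t + -1 * u x t)) =
      fun x t => 1 * Fa u ψ₁ k₁ x t + -1 * u x t := by
    ext x t; ring
  rw [e1, Fa_energy_conservation hu a1.1 b1.1 a2 b2 1 (-1) 0 t] at c4
  rw [e2] at c5
  linarith

end approx

section kernels
variable {k g : ℝ → ℝ} {p : ℝ}

/-- Weighted moving integrals of a kernel. -/
noncomputable def mv (g : ℝ → ℝ) (p : ℝ) (k : ℝ → ℝ) (s : ℝ) : ℝ := ∫ r in 0..p, g r * k (s + r)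

lemma mv_eq_convolution (hp : 0 ≤ p) (g k : ℝ → ℝ) : mv g p k =
    convolution (fun r => (Ioc 0 p).indicator g (-r)) k (ContinuousLinearMap.mul ℝ ℝ) volume := by
  ext s
  rw [mv, intervalIntegral.integral_of_le hp, ← integral_indicator measurableSet_Ioc, convolution,
    ← integral_neg_eq_self]
  refine integral_congr_ae (Eventually.of_forall fun r => ?_)
  simp only [ContinuousLinearMap.mul_apply']
  by_cases h : -r ∈ Ioc 0 p
  · simp [indicator_of_mem h, ← sub_eq_add_neg]
  · simp [indicator_of_notMem h]

lemma integrable_mv_weight (hg : Continuous g) :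
    Integrable fun r => (Ioc 0 p).indicator g (-r) :=
  ((hg.integrableOn_Icc.mono_set Ioc_subset_Icc_self).integrable_indicator
    measurableSet_Ioc).comp_neg

lemma Kn.mv (hk : Kn k) (hp : 0 ≤ p) (hg : Continuous g) : Kn (CoulombWave.mv g p k) := by
  rw [mv_eq_convolution hp]
  refine ⟨hk.supp.contDiff_convolution_right _ (integrable_mv_weight hg).locallyIntegrable
    hk.smooth, HasCompactSupport.convolution _ ?_ hk.supp⟩
  refine HasCompactSupport.intro (K := Icc (-p) 0) isCompact_Icc fun r hr => ?_
  refine indicator_of_notMem (fun h => hr ?_) _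
  exact ⟨by linarith [h.2], by linarith [h.1]⟩

lemma deriv_mv (hk : Kn k) (hp : 0 ≤ p) (hg : Continuous g) :
    deriv (mv g p k) = mv g p (deriv k) := by
  ext s
  rw [mv_eq_convolution hp, mv_eq_convolution hp]
  exact (hk.supp.hasDerivAt_convolution_right (ContinuousLinearMap.mul ℝ ℝ)
    (integrable_mv_weight hg).locallyIntegrable (hk.smooth.of_le (by norm_cast)) s).deriv

lemma mv_deriv (hk : Kn k) {g' : ℝ → ℝ} (hg : ∀ r, HasDerivAt g (g' r) r) (hg' : Continuous g')
    (s : ℝ) : mv g p (deriv k) s = g p * k (s + p) - g 0 * k s - mv g' p k s := by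
  have h1 : ∀ r, HasDerivAt (fun r => k (s + r)) (deriv k (s + r)) r := fun r =>
    ((hk.smooth.differentiable (by norm_cast)) (s + r)).hasDerivAt.comp_const_add s r
  have := intervalIntegral.integral_mul_deriv_eq_deriv_mul (a := 0) (b := p) (u := g) (u' := g')
    (v := fun r => k (s + r)) (v' := fun r => deriv k (s + r)) (fun r _ => hg r) (fun r _ => h1 r)
    (hg'.intervalIntegrable _ _)
    ((hk.deriv.cont.comp (continuous_const.add continuous_id)).intervalIntegrable _ _)
  rw [mv, this, mv, add_zero]

/-- The increments of a kernel are derivatives of kernels. -/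
lemma exists_primitive (hk : Kn k) : ∃ κ, Kn κ ∧ deriv κ = fun s => 1 * k (s + 1) + (-1) * k s := by
  refine ⟨mv (fun _ => 1) 1 k, hk.mv zero_le_one continuous_const, ?_⟩
  rw [deriv_mv hk zero_le_one continuous_const]
  ext s
  rw [mv_deriv hk (fun r => hasDerivAt_const r 1) continuous_const]
  simp [mv, sub_eq_add_neg]

/-- Solvability of the oscillator equation over a full period. -/
lemma exists_oscillator {σ : ℝ} (hσ : 0 < σ) : ∃ p, 0 < p ∧ ∀ k, Kn k → ∃ κ, Kn κ ∧
    (fun s => 2 * σ * deriv (deriv (deriv κ)) s + 1 * deriv κ s) =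
      fun s => 1 * k (s + p) + (-1) * k s := by
  set w := 1 / Real.sqrt (2 * σ) with hw
  have hw0 : 0 < w := by positivity
  have hwσ : w ^ 2 * (2 * σ) = 1 := by
    rw [hw, div_pow, Real.sq_sqrt (by positivity)]; field_simp
  set p := 2 * Real.pi / w with hp
  have hp0 : 0 < p := by positivity
  have hwp : w * p = 2 * Real.pi := by rw [hp]; field_simp
  refine ⟨p, hp0, fun k hk => ⟨mv (fun r => 1 - Real.cos (w * r)) p k,
    hk.mv hp0.le (by fun_prop), ?_⟩⟩
  have hlin : ∀ r : ℝ, HasDerivAt (fun r => w * r) w r := fun r => by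
    simpa using (hasDerivAt_id r).const_mul w
  have d1 : deriv (mv (fun r => 1 - Real.cos (w * r)) p k) =
      mv (fun r => -(w * Real.sin (w * r))) p k := by
    rw [deriv_mv hk hp0.le (by fun_prop)]
    ext s
    rw [mv_deriv hk (g' := fun r => w * Real.sin (w * r)) (fun r => ?_) (by fun_prop)]
    · simp [mv, hwp, Real.cos_two_pi, intervalIntegral.integral_neg]
    · exact (((hlin r).cos).const_sub 1).congr_deriv (by ring)
  have d2 : deriv (mv (fun r => -(w * Real.sin (w * r))) p k) =
      mv (fun r => w ^ 2 * Real.cos (w * r)) p k := by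
    rw [deriv_mv hk hp0.le (by fun_prop)]
    ext s
    rw [mv_deriv hk (g' := fun r => -(w ^ 2 * Real.cos (w * r))) (fun r => ?_) (by fun_prop)]
    · simp [mv, hwp, Real.sin_two_pi, intervalIntegral.integral_neg]
    · exact (((hlin r).sin.const_mul w).neg).congr_deriv (by ring)
  have d3 : ∀ s, deriv (mv (fun r => w ^ 2 * Real.cos (w * r)) p k) s =
      w ^ 2 * (k (s + p) - k s) - w ^ 2 * mv (fun r => -(w * Real.sin (w * r))) p k s := by
    intro s
    rw [deriv_mv hk hp0.le (by fun_prop),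
      mv_deriv hk (g' := fun r => w ^ 2 * (-(w * Real.sin (w * r)))) (fun r => ?_) (by fun_prop)]
    · simp only [hwp, Real.cos_two_pi, mul_zero, Real.cos_zero, mul_one, mv, mul_assoc]
      rw [intervalIntegral.integral_const_mul]; ring
    · exact ((hlin r).cos.const_mul _).congr_deriv (by ring)
  ext s
  rw [d1, d2, d3]
  linear_combination (k (s + p) - k s - mv (fun r => -(w * Real.sin (w * r))) p k s) * hwσ

end kernels

section small
variable {d : ℕ} {u v f : V d → ℝ → ℝ} {x : V d} {t : ℝ} [Fact (3 ≤ d)] {ψ : G d → ℝ} {k l : ℝ → ℝ}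
  {A : ℕ → Set (V d)} {T : ℕ → ℝ}

/-- The energy of `u` in the sets `A n` at the times `T n` tends to zero. -/
def Small (A : ℕ → Set (V d)) (T : ℕ → ℝ) (u : V d → ℝ → ℝ) : Prop :=
  Tendsto (fun n => ∫ x in A n, eDenFree u x (T n)) atTop (𝓝 0)

lemma small_of_le {F : ℕ → ℝ} (hF : Tendsto F atTop (𝓝 0))
    (h : ∀ᶠ n in atTop, ∫ x in A n, eDenFree u x (T n) ≤ F n) : Small A T u :=
  squeeze_zero' (Eventually.of_forall fun _ => integral_nonneg fun _ => eDen_nonneg) h hF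

lemma setIntegral_energy_lin_le (hu : Wave u) (hv : Wave v) (a b t : ℝ) (s : Set (V d)) :
    ∫ x in s, eDenFree (fun x t => a * u x t + b * v x t) x t ≤
      2 * a ^ 2 * (∫ x in s, eDenFree u x t) + 2 * b ^ 2 * (∫ x in s, eDenFree v x t) := by
  have i1 := ((hu.int t).const_mul (2 * a ^ 2)).integrableOn (s := s)
  have i2 := ((hv.int t).const_mul (2 * b ^ 2)).integrableOn (s := s)
  rw [← integral_const_mul, ← integral_const_mul, ← integral_add i1 i2]
  refine integral_mono_ae ((hu.lin hv a b).int t).integrableOn (i1.add i2)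
    (ae_restrict_of_ae ?_)
  filter_upwards [ae_ne_zero] with x hx using eDen_lin_le hu.cd hv.cd a b hx

lemma Small.lin (hu : Wave u) (hv : Wave v) (su : Small A T u) (sv : Small A T v) (a b : ℝ) :
    Small A T (fun x t => a * u x t + b * v x t) := by
  have := (su.const_mul (2 * a ^ 2)).add (sv.const_mul (2 * b ^ 2))
  rw [mul_zero, mul_zero, add_zero] at this
  exact small_of_le this (Eventually.of_forall fun n => setIntegral_energy_lin_le hu hv a b _ _)

lemma small_of_forall (h : ∀ ε, 0 < ε → ∀ᶠ n in atTop, ∫ x in A n, eDenFree u x (T n) ≤ ε) :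
    Small A T u := by
  refine tendsto_order.2 ⟨fun a ha => Eventually.of_forall fun n =>
    ha.trans_le (integral_nonneg fun _ => eDen_nonneg), fun a ha => ?_⟩
  filter_upwards [h (a / 2) (half_pos ha)] with n hn using hn.trans_lt (half_lt_self ha)

lemma small_of_approx (hu : Wave u) (h : ∀ ε, 0 < ε → ∃ v, Wave v ∧ Small A T v ∧
    ∀ t, ∫ x, eDenFree (fun x t => 1 * v x t + (-1) * u x t) x t ≤ ε) : Small A T u := by
  refine small_of_forall fun ε hε => ?_
  obtain ⟨v, hv, sv, hvu⟩ := h (ε / 4) (by positivity)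
  filter_upwards [sv.eventually_lt_const (show 0 < ε / 4 by positivity)] with n hn
  have h1 := setIntegral_energy_lin_le hv (hv.lin hu 1 (-1)) 1 (-1) (T n) (A n)
  have e : (fun (x : V d) (t : ℝ) => 1 * v x t + -1 * (1 * v x t + -1 * u x t)) = u := by
    ext x t; ring
  rw [e] at h1
  have h2 : ∫ x in A n, eDenFree (fun x t => 1 * v x t + (-1) * u x t) x (T n) ≤ ε / 4 :=
    (setIntegral_le_integral ((hv.lin hu 1 (-1)).int _)
      (Eventually.of_forall fun _ => eDen_nonneg)).trans (hvu _)
  linarith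

lemma Reg.small_of_kinetic (hu : Reg u) (hT : Tendsto T atTop atTop)
    (h : ∀ ε, 0 < ε → ∀ᶠ n in atTop, ∫ x in A n, D u x (T n) ^ 2 ≤ ε) : Small A T u := by
  refine small_of_forall fun ε hε => ?_
  filter_upwards [h (ε / 2) (half_pos hε),
    (hu.equipartition.comp hT).eventually_lt_const (half_pos hε)] with n h1 h2
  have i1 := hu.wave.int (T n)
  have i2 := hu.wave.int_D_sq (T n)
  have i3 : Integrable fun x => |eDenFree u x (T n) - D u x (T n) ^ 2| := (i1.sub i2).abs
  have h3 : ∫ x in A n, |eDenFree u x (T n) - D u x (T n) ^ 2| ≤ ε / 2 :=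
    (setIntegral_le_integral i3 (Eventually.of_forall fun _ => abs_nonneg _)).trans h2.le
  have h4 : ∫ x in A n, eDenFree u x (T n) ≤
      ∫ x in A n, (|eDenFree u x (T n) - D u x (T n) ^ 2| + D u x (T n) ^ 2) :=
    integral_mono i1.integrableOn (i3.integrableOn.add i2.integrableOn) fun x => by
      have := le_abs_self (eDenFree u x (T n) - D u x (T n) ^ 2)
      dsimp only; linarith
  rw [integral_add i3.integrableOn i2.integrableOn] at h4
  linarith

lemma eDen_lin_le_unequal (hu : CD 2 u) (hv : CD 2 v) (hx : x ≠ 0) :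
    eDenFree (fun x t => 1 / 2 * u x t + 1 / 2 * v x t) x t ≤
      5 / 16 * eDenFree u x t + 5 / 4 * eDenFree v x t := by
  have hx0 : 0 < ‖x‖ := norm_pos_iff.2 hx
  rw [eDen_def, eDen_def, eDen_def, gr_lin hu hv _ _ hx,
    D_lin (hu.mono one_le_two) (hv.mono one_le_two) _ _ hx]
  have h1 : ‖(1 / 2 : ℝ) • gr u x t + (1 / 2 : ℝ) • gr v x t‖ ^ 2 ≤
      5 / 16 * ‖gr u x t‖ ^ 2 + 5 / 4 * ‖gr v x t‖ ^ 2 := by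
    have := norm_add_le ((1 / 2 : ℝ) • gr u x t) ((1 / 2 : ℝ) • gr v x t)
    rw [norm_smul, norm_smul, Real.norm_of_nonneg (by norm_num : (0 : ℝ) ≤ 1 / 2)] at this
    calc _ ≤ (1 / 2 * ‖gr u x t‖ + 1 / 2 * ‖gr v x t‖) ^ 2 := by gcongr
      _ ≤ _ := by nlinarith [sq_nonneg (‖gr u x t‖ - 4 * ‖gr v x t‖)]
  have h2 : ∀ a b : ℝ, (1 / 2 * a + 1 / 2 * b) ^ 2 ≤ 5 / 16 * a ^ 2 + 5 / 4 * b ^ 2 := fun a b => by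
    nlinarith [sq_nonneg (a - 4 * b)]
  have h3 := div_le_div_of_nonneg_right (h2 (u x t) (v x t)) (show 0 ≤ 2 * ‖x‖ by positivity)
  rw [add_div, mul_div_assoc, mul_div_assoc] at h3
  linarith [h2 (D u x t) (D v x t)]

/-- Averaging with a far time translate almost halves the energy. -/
lemma Reg.average_translate (hu : Reg u) (hE : ∀ s t, ∫ x, eDenFree u x s = ∫ x, eDenFree u x t)
    {ε : ℝ} (hε : 0 < ε) : ∀ᶠ a in atTop,
    ∫ x, eDenFree (fun x t => 1 / 2 * u x t + 1 / 2 * u x (t + a)) x 0 ≤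
      5 / 8 * (∫ x, eDenFree u x 0) + ε := by
  obtain ⟨R, hR⟩ := outer_energy hu.wave hu.contD (ε := ε / 4) (by positivity)
  specialize hR 0 le_rfl
  rw [zero_add] at hR
  have hG := hu.Gf_tendsto.const_mul ((1 + |R|) ^ 2)
  rw [mul_zero] at hG
  filter_upwards [hG.eventually_lt_const (show 0 < ε / 4 by positivity)] with a ha
  have wv : Wave (fun x t => u x (t + a)) := by
    simpa only [one_mul] using hu.wave.time (σ := 1) (by norm_num) a
  have ev : ∀ x, eDenFree (fun x t => u x (t + a)) x 0 = eDenFree u x a := fun x => by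
    simpa only [one_mul, zero_add] using
      eDen_time (u := u) (x := x) (t := 0) (σ := 1) (by norm_num) a
  set S : Set (V d) := {x | R < ‖x‖} with hS
  have mS : MeasurableSet S := measurableSet_lt measurable_const measurable_norm
  have i0 := hu.wave.int 0
  have i1 := hu.wave.int a
  have i2 : Integrable (fun x : V d => eDenFree u x a / (1 + ‖x‖) ^ 2) := by
    refine i1.mono' ((i1.aestronglyMeasurable.aemeasurable.div
      (by fun_prop)).aestronglyMeasurable) (Eventually.of_forall fun x => ?_)
    rw [Real.norm_of_nonneg (div_nonneg eDen_nonneg (by positivity))]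
    exact div_le_self eDen_nonneg (one_le_pow₀ (by linarith [norm_nonneg x]))
  have i3 := i0.indicator mS
  have j1 : Integrable fun x => 5 / 16 * eDenFree u x 0 + 5 / 16 * eDenFree u x a :=
    (i0.const_mul _).add (i1.const_mul _)
  have j2 : Integrable fun x => 5 / 4 * S.indicator (fun x => eDenFree u x 0) x +
      5 / 4 * ((1 + |R|) ^ 2 * (eDenFree u x a / (1 + ‖x‖) ^ 2)) :=
    (i3.const_mul _).add ((i2.const_mul _).const_mul _)
  have key : ∫ x, eDenFree (fun x t => 1 / 2 * u x t + 1 / 2 * u x (t + a)) x 0 ≤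
      ∫ x, ((5 / 16 * eDenFree u x 0 + 5 / 16 * eDenFree u x a) +
        (5 / 4 * S.indicator (fun x => eDenFree u x 0) x +
          5 / 4 * ((1 + |R|) ^ 2 * (eDenFree u x a / (1 + ‖x‖) ^ 2)))) := by
    refine integral_mono_ae ((hu.wave.lin wv _ _).int 0) (j1.add j2) ?_
    filter_upwards [ae_ne_zero] with x hx
    have p0 : 0 ≤ eDenFree u x 0 := eDen_nonneg
    have p1 : 0 ≤ eDenFree u x a := eDen_nonneg
    by_cases hxS : x ∈ S
    · rw [indicator_of_mem hxS]
      have h1 := eDen_lin_le_unequal wv.cd hu.wave.cd hx (t := 0)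
      rw [ev] at h1
      have e : (fun (x : V d) (t : ℝ) => 1 / 2 * u x (t + a) + 1 / 2 * u x t) =
        fun x t => 1 / 2 * u x t + 1 / 2 * u x (t + a) := by ext x t; ring
      rw [e] at h1
      have : 0 ≤ (1 + |R|) ^ 2 * (eDenFree u x a / (1 + ‖x‖) ^ 2) := by positivity
      linarith
    · rw [indicator_of_notMem hxS]
      have h1 := eDen_lin_le_unequal hu.wave.cd wv.cd hx (t := 0)
      rw [ev] at h1
      have hxR : ‖x‖ ≤ |R| := (not_lt.1 hxS).trans (le_abs_self R)
      have : eDenFree u x a ≤ (1 + |R|) ^ 2 * (eDenFree u x a / (1 + ‖x‖) ^ 2) := by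
        rw [mul_div_assoc', le_div_iff₀ (by positivity), mul_comm]
        gcongr
      linarith
  rw [integral_add j1 j2, integral_add (i0.const_mul _) (i1.const_mul _),
    integral_add (i3.const_mul _) ((i2.const_mul _).const_mul _), integral_const_mul,
    integral_const_mul, integral_const_mul, integral_const_mul, integral_const_mul,
    integral_indicator mS, hE a 0] at key
  have hG' : (1 + |R|) ^ 2 * (∫ x : V d, eDenFree u x a / (1 + ‖x‖) ^ 2) < ε / 4 := ha
  linarith

/-- If all averages are asymptotically invariant under a time translation on the sets `A n`, then
their energy in these sets tends to zero. -/
theorem small_of_translate (hu : Wave u) (hψ : Continuous ψ) {p : ℝ} (hp : 0 < p)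
    (h : ∀ k, Kn k → Small A T (Fa u ψ (fun s => 1 * k (s + p) + (-1) * k s))) (hk : Kn k) :
    Small A T (Fa u ψ k) := by
  have hw : ∀ {k}, Kn k → Wave (Fa u ψ k) := fun hk => hu.av (hk.wt hψ)
  set K : Set (ℝ → ℝ) := {l | Kn l ∧ Small A T (Fa u ψ (fun s => 1 * l s + (-1) * k s))} with hK
  have hadd : ∀ {l m n : ℝ → ℝ} (a b : ℝ), Kn l → Kn m → Small A T (Fa u ψ l) →
      Small A T (Fa u ψ m) → (n = fun s => a * l s + b * m s) → Small A T (Fa u ψ n) := by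
    intro l m n a b hl hm sl sm hn
    rw [hn, Fa_lin hu.cont hψ hl hm]
    exact sl.lin (hw hl) (hw hm) sm a b
  have kK : k ∈ K := by
    refine ⟨hk, ?_⟩
    have h0 := h k hk
    exact hadd 0 0 ((hk.shift p).lin hk 1 (-1)) ((hk.shift p).lin hk 1 (-1)) h0 h0
      (by ext s; ring)
  have shiftK : ∀ n : ℕ, ∀ l ∈ K, (fun s => l (s + n * p)) ∈ K := by
    intro n
    induction n with
    | zero => intro l hl; simpa using hl
    | succ n ih =>
      intro l hl
      obtain ⟨h1, h2⟩ := ih l hl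
      have e : (fun s => 1 * l (s + (n + 1 : ℕ) * p) + (-1) * k s) = fun s =>
          1 * (1 * l (s + p + n * p) + (-1) * l (s + n * p)) +
            1 * (1 * l (s + n * p) + (-1) * k s) := by
        ext s; push_cast
        rw [show s + p + n * p = s + (n + 1) * p by ring]; ring
      have h3 : Kn fun s => 1 * l (s + p + n * p) + (-1) * l (s + n * p) :=
        (h1.shift p).lin h1 1 (-1)
      have h4 := h _ h1
      exact ⟨hl.1.shift _, hadd 1 1 h3 (h1.lin hk 1 (-1)) h4 h2 e⟩
  have meanK : ∀ l ∈ K, ∀ m ∈ K, (fun s => 1 / 2 * l s + 1 / 2 * m s) ∈ K := by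
    intro l hl m hm
    obtain ⟨l1, l2⟩ := hl
    obtain ⟨m1, m2⟩ := hm
    have e : (fun s => 1 * (1 / 2 * l s + 1 / 2 * m s) + (-1) * k s) =
        fun s => 1 / 2 * (1 * l s + (-1) * k s) + 1 / 2 * (1 * m s + (-1) * k s) := by
      ext s; ring
    exact ⟨l1.lin m1 (1 / 2) (1 / 2),
      hadd (1 / 2) (1 / 2) (l1.lin hk 1 (-1)) (m1.lin hk 1 (-1)) l2 m2 e⟩
  have hcons : ∀ {l}, Kn l → ∀ s t, ∫ x, eDenFree (Fa u ψ l) x s = ∫ x, eDenFree (Fa u ψ l) x t :=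
    fun hl s t => energy_conservation (hw hl) (hu.Fa_reg hψ hl).contD s t
  set E : (ℝ → ℝ) → ℝ := fun l => ∫ x, eDenFree (Fa u ψ l) x 0 with hEdef
  have hE0 : ∀ l, 0 ≤ E l := fun l => integral_nonneg fun _ => eDen_nonneg
  have hbdd : BddBelow (E '' K) := ⟨0, by rintro _ ⟨l, -, rfl⟩; exact hE0 l⟩
  have step : ∀ l ∈ K, ∀ ε, 0 < ε → ∃ m ∈ K, E m ≤ 5 / 8 * E l + ε := by
    intro l hl ε hε
    have hn : Tendsto (fun n : ℕ => (n : ℝ) * p) atTop atTop :=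
      tendsto_natCast_atTop_atTop.atTop_mul_const hp
    obtain ⟨n, hn⟩ := (hn.eventually
      ((hu.Fa_reg hψ hl.1).average_translate (hcons hl.1) hε)).exists
    refine ⟨_, meanK l hl _ (shiftK n l hl), ?_⟩
    simp only [hEdef]
    rw [Fa_lin hu.cont hψ hl.1 (hl.1.shift _)]
    simpa only [Fa_shift hu.cont hψ hl.1] using hn
  have hinf : sInf (E '' K) ≤ 0 := by
    by_contra hpos
    rw [not_le] at hpos
    obtain ⟨_, ⟨l, hl, rfl⟩, hl'⟩ := exists_lt_of_csInf_lt (Set.Nonempty.image E ⟨k, kK⟩)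
      (show sInf (E '' K) < 9 / 8 * sInf (E '' K) by linarith)
    obtain ⟨m, hm, hm'⟩ := step l hl (sInf (E '' K) / 8) (by positivity)
    have := csInf_le hbdd ⟨m, hm, rfl⟩
    linarith
  refine small_of_approx (hw hk) fun ε hε => ?_
  obtain ⟨_, ⟨l, hl, rfl⟩, hl'⟩ := exists_lt_of_csInf_lt (Set.Nonempty.image E ⟨k, kK⟩)
    (hinf.trans_lt (show 0 < ε / 2 by positivity))
  refine ⟨_, hw (hk.lin hl.1 1 (-1)), ?_, fun t => ?_⟩
  · refine hadd (-1) 0 (hl.1.lin hk 1 (-1)) (hl.1.lin hk 1 (-1)) hl.2 hl.2 ?_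
    ext s; ring
  · rw [Fa_lin hu.cont hψ hk hl.1]
    have e : (fun (x : V d) (t : ℝ) => 1 * (1 * Fa u ψ k x t + -1 * Fa u ψ l x t) +
        -1 * Fa u ψ k x t) = fun x t => (-1) * Fa u ψ l x t + 0 * Fa u ψ l x t := by
      ext x t; ring
    rw [e]
    have := energy_lin_le (hw hl.1) (hw hl.1) (-1) 0 t
    rw [hcons hl.1 t 0] at this
    have hl'' : (∫ x, eDenFree (Fa u ψ l) x 0) < ε / 2 := hl'
    linarith

end small

section annuli
variable {d : ℕ} {u v f : V d → ℝ → ℝ} {x : V d} {t : ℝ} [Fact (3 ≤ d)] {ψ : G d → ℝ} {k l : ℝ → ℝ}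
  {r w T : ℕ → ℝ}

/-- An open annulus. -/
def ann (d : ℕ) (r w : ℝ) : Set (V d) := {x | r < ‖x‖ ∧ ‖x‖ < r + w}

lemma measurableSet_ann {r w : ℝ} : MeasurableSet (ann d r w) :=
  (measurableSet_lt measurable_const measurable_norm).inter
    (measurableSet_lt measurable_norm measurable_const)

lemma abs_arctan_sub_le (a b : ℝ) : |Real.arctan a - Real.arctan b| ≤ |a - b| := by
  have := Convex.norm_image_sub_le_of_norm_deriv_le (f := Real.arctan) (s := univ) (C := 1)
    (x := b) (y := a) (fun x _ => Real.differentiable_arctan x) (fun x _ => ?_) convex_univ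
    (mem_univ _) (mem_univ _)
  · simpa using this
  · rw [Real.deriv_arctan, Real.norm_of_nonneg (by positivity)]
    exact div_le_one_of_le₀ (by nlinarith [sq_nonneg x]) (by positivity)

lemma tendsto_ph_atTop (s : ℝ) : Tendsto (fun C => ph C s) atTop (𝓝 s) := by
  have h : HasDerivAt (fun h : ℝ => Real.arctan (s * h)) s 0 := by
    have h1 : HasDerivAt (fun h : ℝ => s * h) s 0 := by
      simpa using (hasDerivAt_id (0 : ℝ)).const_mul s
    exact h1.arctan.congr_deriv (by simp)
  have h2 := h.tendsto_slope_zero.comp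
    (tendsto_inv_atTop_nhdsGT_zero.mono_right (nhdsWithin_mono _ fun x (hx : 0 < x) => hx.ne'))
  refine h2.congr fun C => ?_
  simp [ph, div_eq_mul_inv]

lemma Reg.small_outside (hf : Reg f) (hT : Tendsto T atTop atTop) {δ : ℝ} (hδ : 0 < δ)
    (h : ∀ᶠ n in atTop, (T n - r n) / Real.log (T n) < -δ) :
    Small (fun n => ann d (r n) (w n)) T f := by
  refine small_of_forall fun ε hε => ?_
  obtain ⟨R, hR⟩ := outer_energy hf.wave hf.contD hε
  have hlog := (Real.tendsto_log_atTop.comp hT).const_mul_atTop hδ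
  filter_upwards [h, hlog.eventually_gt_atTop R, hT.eventually_gt_atTop 1] with n h1 h2 h3
  have hL : 0 < Real.log (T n) := Real.log_pos h3
  refine (setIntegral_mono_set (hf.wave.int (T n)).integrableOn
    (Eventually.of_forall fun _ => eDen_nonneg) (HasSubset.Subset.eventuallyLE ?_)).trans
    (hR (T n) (by linarith))
  rintro x ⟨hx, -⟩
  rw [div_lt_iff₀ hL] at h1
  have h2' : R < δ * Real.log (T n) := h2
  simp only [mem_setOf_eq]
  linarith

lemma Tame.small_inside (hf : Tame f) (hT : Tendsto T atTop atTop)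
    (hw : Tendsto (fun n => w n / Real.log (T n)) atTop (𝓝 0))
    (h : Tendsto (fun n => (T n - r n) / Real.log (T n)) atTop atTop) :
    Small (fun n => ann d (r n) (w n)) T f := by
  refine hf.reg.small_of_kinetic hT fun ε hε => ?_
  obtain ⟨B, hB0, hB⟩ := hf.tail
  obtain ⟨S₀, hS₀, hS⟩ := hB (ε / 4) (by positivity)
  set C := max 1 (4 * B / ε) with hC
  have hC1 : 1 ≤ C := le_max_left _ _
  have hCB : B / C ≤ ε / 4 := by
    rw [div_le_iff₀ (by positivity)]
    have := (div_le_iff₀ hε).1 (le_max_right 1 (4 * B / ε))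
    linarith
  have hlog : Tendsto (fun n => C * Real.log (T n)) atTop atTop :=
    (Real.tendsto_log_atTop.comp hT).const_mul_atTop (by positivity)
  have hlT : Tendsto (fun n => C * (Real.log (T n) / T n)) atTop (𝓝 (C * 0)) :=
    ((Real.isLittleO_log_id_atTop.tendsto_div_nhds_zero).comp hT).const_mul C
  rw [mul_zero] at hlT
  filter_upwards [hw.eventually_lt_const one_pos, h.eventually_gt_atTop (C + 1),
    hlog.eventually_ge_atTop S₀, hlT.eventually_lt_const one_pos, hT.eventually_gt_atTop 1]
    with n h1 h2 h3 h4 h5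
  have hL : 0 < Real.log (T n) := Real.log_pos h5
  have hT0 : 0 < T n := by linarith
  rw [← mul_div_assoc, div_lt_one hT0] at h4
  rw [div_lt_iff₀ hL] at h1
  rw [lt_div_iff₀ hL] at h2
  set S := C * Real.log (T n) with hSdef
  have hS1 : 1 ≤ S := hS₀.trans h3
  have key := hS S h3 (T n) h4.le
  have hl : Real.log (T n / S) / S ≤ 1 / C := by
    have : Real.log (T n / S) ≤ Real.log (T n) :=
      Real.log_le_log (by positivity) (div_le_self hT0.le hS1)
    rw [div_le_div_iff₀ (by positivity) (by positivity), hSdef]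
    nlinarith
  have hl' : B * (Real.log (T n / S) / S) ≤ ε / 4 := by
    calc _ ≤ B * (1 / C) := by gcongr
      _ = B / C := by ring
      _ ≤ _ := hCB
  have i1 := hf.reg.wave.int_D_sq (T n)
  have i2 : Integrable fun x : V d => (1 - dph S (T n - ‖x‖)) * D f x (T n) ^ 2 := by
    refine i1.bdd_mul (c := 1) ?_ (Eventually.of_forall fun x => ?_)
    · exact (Continuous.aestronglyMeasurable (by
        simp only [dph]
        exact continuous_const.sub (continuous_const.div (by fun_prop) fun x => by positivity)))
    · rw [Real.norm_eq_abs, abs_le]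
      constructor <;> linarith [dph_le_one (S := S) (s := T n - ‖x‖),
        dph_pos (S := S) (s := T n - ‖x‖)]
  calc ∫ x in ann d (r n) (w n), D f x (T n) ^ 2
      ≤ ∫ x in ann d (r n) (w n), 2 * ((1 - dph S (T n - ‖x‖)) * D f x (T n) ^ 2) := by
        refine setIntegral_mono_on i1.integrableOn (i2.const_mul 2).integrableOn
          measurableSet_ann fun x hx => ?_
        have hs : S ≤ T n - ‖x‖ := by linarith [hx.2]
        have h6 : 1 ≤ ((T n - ‖x‖) / S) ^ 2 := one_le_pow₀ ((one_le_div (by linarith)).2 hs)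
        have h7 : dph S (T n - ‖x‖) ≤ 1 / 2 := by
          rw [dph]
          exact one_div_le_one_div_of_le (by norm_num) (by linarith)
        nlinarith [sq_nonneg (D f x (T n))]
    _ ≤ ∫ x, 2 * ((1 - dph S (T n - ‖x‖)) * D f x (T n) ^ 2) :=
        setIntegral_le_integral (i2.const_mul 2) (Eventually.of_forall fun x => by
          have := dph_le_one (S := S) (s := T n - ‖x‖)
          exact mul_nonneg zero_le_two (mul_nonneg (by linarith) (sq_nonneg _)))
    _ ≤ ε := by
        rw [integral_const_mul]; linarith

lemma small_near_cone (hu : Wave u) (hψ : Lp ψ) (hk : Kn k) (hT : Tendsto T atTop atTop)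
    (hw : Tendsto (fun n => w n / Real.log (T n)) atTop (𝓝 0)) {σ : ℝ}
    (h : Tendsto (fun n => (T n - r n) / Real.log (T n)) atTop (𝓝 σ)) :
    Small (fun n => ann d (r n) (w n)) T
      (Fa u ψ (fun s => 2 * σ * deriv (deriv (deriv k)) s + 1 * deriv k s)) := by
  have e1 : D (Fa u ψ (deriv k)) = Fa u ψ (deriv (deriv k)) := D_Fa hu.cont hψ.1 hk.deriv
  have e2 := D_Fa hu.cont hψ.1 hk.deriv.deriv
  have e3 := D_Fa hu.cont hψ.1 hk.deriv.deriv.deriv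
  have h1 := hu.Fa_tame hψ hk
  have h2 := hu.Fa_tame hψ hk.deriv
  have h3 := hu.Fa_tame hψ hk.deriv.deriv
  rw [← e1] at h2
  rw [← e2, ← e1] at h3
  obtain ⟨κ, hκ0, hκ⟩ := core h1 h2 h3
  rw [e1, e2, e3] at hκ
  refine (hu.Fa_reg hψ.1 (hk.deriv.deriv.deriv.lin hk.deriv (2 * σ) 1)).small_of_kinetic hT
    fun ε hε => ?_
  set y := Fa u ψ (deriv (deriv k)) with hy
  set z := Fa u ψ (deriv (deriv (deriv (deriv k)))) with hz
  have eD : ∀ x t, D (Fa u ψ (fun s => 2 * σ * deriv (deriv (deriv k)) s + 1 * deriv k s)) x t =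
      2 * σ * z x t + 1 * y x t := by
    intro x t
    rw [Fa_lin hu.cont hψ.1 hk.deriv.deriv.deriv hk.deriv]
    exact (((hasDerivAt_Fa hu.cont hψ.1 hk.deriv.deriv.deriv x t).const_mul (2 * σ)).fun_add
      ((hasDerivAt_Fa hu.cont hψ.1 hk.deriv x t).const_mul 1)).deriv
  have hz2 : Tame z := hu.Fa_tame hψ hk.deriv.deriv.deriv
  obtain ⟨B, hB⟩ := hz2.sq_le
  have hB0 : 0 ≤ B := (integral_nonneg fun x => sq_nonneg _).trans (hB 0)
  set η := min 1 (ε / (32 * (B + 1))) with hη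
  have hη0 : 0 < η := lt_min one_pos (by positivity)
  have hηB : 8 * η ^ 2 * B ≤ ε / 4 := by
    have h4 : η * (32 * (B + 1)) ≤ ε := (le_div_iff₀ (by positivity)).1 (min_le_right _ _)
    have h5 : η ^ 2 ≤ η := by nlinarith [min_le_left 1 (ε / (32 * (B + 1)))]
    nlinarith
  obtain ⟨C, hC1, hCκ, hCσ⟩ : ∃ C, 1 ≤ C ∧ κ / C < ε / 8 ∧ |ph C σ - σ| < η / 3 := by
    have t1 : Tendsto (fun C : ℝ => κ / C) atTop (𝓝 0) := tendsto_const_nhds.div_atTop tendsto_id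
    have t2 := (tendsto_ph_atTop σ).eventually (Metric.ball_mem_nhds σ (show 0 < η / 3 by positivity))
    exact ((eventually_ge_atTop 1).and ((t1.eventually_lt_const (show 0 < ε / 8 by positivity)).and
      t2)).exists
  filter_upwards [hT.eventually (hκ C hC1 (ε / 8) (by positivity)), hT.eventually_gt_atTop 1,
    h.eventually (Metric.ball_mem_nhds σ (show 0 < η / 3 by positivity)),
    hw.eventually_lt_const (show 0 < η / 3 by positivity)] with n hn n1 n2 n3
  obtain ⟨i1, n4⟩ := hn
  have hL : 0 < Real.log (T n) := Real.log_pos n1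
  set L := Real.log (T n) with hLdef
  have i2 := hz2.int_sq (T n)
  set q : V d → ℝ := fun x => (2 / L * ph (C * L) (T n - ‖x‖) * z x (T n) + y x (T n)) ^ 2 with hq
  have i3 : Integrable fun x => 2 * q x + 8 * η ^ 2 * z x (T n) ^ 2 :=
    (i1.const_mul 2).add (i2.const_mul _)
  have i4 : Integrable fun x => (2 * σ * z x (T n) + 1 * y x (T n)) ^ 2 := by
    have := (hu.Fa_reg hψ.1
      (hk.deriv.deriv.deriv.lin hk.deriv (2 * σ) 1)).wave.int_D_sq (T n)
    simpa only [eD] using this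
  simp only [eD]
  calc ∫ x in ann d (r n) (w n), (2 * σ * z x (T n) + 1 * y x (T n)) ^ 2
      ≤ ∫ x in ann d (r n) (w n), (2 * q x + 8 * η ^ 2 * z x (T n) ^ 2) := by
        refine setIntegral_mono_on i4.integrableOn i3.integrableOn measurableSet_ann fun x hx => ?_
        have hp : |σ - ph (C * L) (T n - ‖x‖) / L| ≤ η := by
          have p1 : ph (C * L) (T n - ‖x‖) / L = C * Real.arctan ((T n - ‖x‖) / L / C) := by
            rw [ph, mul_comm C L, mul_assoc, mul_div_cancel_left₀ _ hL.ne', div_div]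
          have p2 : |ph C σ - C * Real.arctan ((T n - ‖x‖) / L / C)| ≤ |σ - (T n - ‖x‖) / L| := by
            rw [ph, ← mul_sub, abs_mul, abs_of_pos (show 0 < C by linarith)]
            calc _ ≤ C * |σ / C - (T n - ‖x‖) / L / C| := by
                  exact mul_le_mul_of_nonneg_left (abs_arctan_sub_le _ _) (by linarith)
              _ = _ := by
                  rw [← sub_div, abs_div, abs_of_pos (show 0 < C by linarith)]
                  field_simp
          have p3 : |σ - (T n - ‖x‖) / L| ≤ 2 * (η / 3) := by
            have q1 : |(T n - r n) / L - σ| < η / 3 := n2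
            rw [abs_lt] at q1
            have q2 : (T n - ‖x‖) / L = (T n - r n) / L - (‖x‖ - r n) / L := by ring
            have q3 : (‖x‖ - r n) / L ≤ w n / L := by gcongr; linarith [hx.2]
            have q4 : 0 ≤ (‖x‖ - r n) / L := div_nonneg (by linarith [hx.1]) hL.le
            rw [q2, abs_le]
            constructor <;> linarith
          rw [p1]
          have p4 := abs_sub_le σ (ph C σ) (C * Real.arctan ((T n - ‖x‖) / L / C))
          rw [abs_sub_comm σ (ph C σ)] at p4
          linarith
        have hp2 : (σ - ph (C * L) (T n - ‖x‖) / L) ^ 2 ≤ η ^ 2 := by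
          rw [← sq_abs]; gcongr
        have e : 2 * σ * z x (T n) + 1 * y x (T n) =
            (2 / L * ph (C * L) (T n - ‖x‖) * z x (T n) + y x (T n)) +
              2 * (σ - ph (C * L) (T n - ‖x‖) / L) * z x (T n) := by ring
        have e' := add_sq_le (a := 2 / L * ph (C * L) (T n - ‖x‖) * z x (T n) + y x (T n))
          (b := 2 * (σ - ph (C * L) (T n - ‖x‖) / L) * z x (T n))
        rw [← e] at e'
        have e'' := mul_le_mul_of_nonneg_right hp2 (sq_nonneg (z x (T n)))
        simp only [hq]
        nlinarith
    _ ≤ ∫ x, (2 * q x + 8 * η ^ 2 * z x (T n) ^ 2) :=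
        setIntegral_le_integral i3 (Eventually.of_forall fun x => by
          simp only [hq, Pi.zero_apply]; positivity)
    _ ≤ ε := by
        rw [integral_add (i1.const_mul 2) (i2.const_mul _), integral_const_mul, integral_const_mul]
        have h6 : 8 * η ^ 2 * (∫ x, z x (T n) ^ 2) ≤ 8 * η ^ 2 * B := by
          gcongr; exact hB _
        linarith

end annuli

section main
variable {d : ℕ} {u v f : V d → ℝ → ℝ} {x : V d} {t : ℝ} [Fact (3 ≤ d)] {ψ : G d → ℝ} {k l : ℝ → ℝ}
  {r w T : ℕ → ℝ}

/-- Averages are asymptotically invariant under some time translation on thin annuli. -/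
lemma exists_period (hu : Wave u) (hψ : Lp ψ) (hT : Tendsto T atTop atTop)
    (hw : Tendsto (fun n => w n / Real.log (T n)) atTop (𝓝 0)) {σ : EReal}
    (h : Tendsto (fun n => (((T n - r n) / Real.log (T n) : ℝ) : EReal)) atTop (𝓝 σ)) :
    ∃ p, 0 < p ∧ ∀ k, Kn k → Small (fun n => ann d (r n) (w n)) T
      (Fa u ψ (fun s => 1 * k (s + p) + (-1) * k s)) := by
  have hout : ∀ δ, 0 < δ → (∀ᶠ n in atTop, (T n - r n) / Real.log (T n) < -δ) →
      ∃ p, 0 < p ∧ ∀ k, Kn k → Small (fun n => ann d (r n) (w n)) T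
        (Fa u ψ (fun s => 1 * k (s + p) + (-1) * k s)) := fun δ hδ hs =>
    ⟨1, one_pos, fun k hk =>
      (hu.Fa_reg hψ.1 ((hk.shift 1).lin hk 1 (-1))).small_outside hT hδ hs⟩
  induction σ with
  | bot =>
    exact hout 1 one_pos ((EReal.tendsto_coe_nhds_bot_iff.1 h).eventually_lt_atBot (-1))
  | top =>
    refine ⟨1, one_pos, fun k hk => ?_⟩
    obtain ⟨κ, hκ, hκ'⟩ := exists_primitive hk
    rw [← hκ']
    exact (hu.Fa_tame hψ hκ).small_inside hT hw (EReal.tendsto_coe_nhds_top_iff.1 h)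
  | coe a =>
    have ha := EReal.tendsto_coe.1 h
    rcases lt_trichotomy a 0 with h0 | h0 | h0
    · exact hout (-a / 2) (by linarith) (ha.eventually_lt_const (by linarith))
    · refine ⟨1, one_pos, fun k hk => ?_⟩
      obtain ⟨κ, hκ, hκ'⟩ := exists_primitive hk
      have := small_near_cone hu hψ hκ hT hw ha
      simpa only [h0, mul_zero, zero_mul, zero_add, one_mul, hκ'] using this
    · obtain ⟨p, hp, H⟩ := exists_oscillator h0
      refine ⟨p, hp, fun k hk => ?_⟩
      obtain ⟨κ, hκ, hκ'⟩ := H k hk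
      rw [← hκ']
      exact small_near_cone hu hψ hκ hT hw ha

theorem small_annuli (hu : Wave u) (hE : ∀ s t, ∫ x, eDenFree u x s = ∫ x, eDenFree u x t)
    (hT : Tendsto T atTop atTop) (hw : Tendsto (fun n => w n / Real.log (T n)) atTop (𝓝 0))
    {σ : EReal}
    (h : Tendsto (fun n => (((T n - r n) / Real.log (T n) : ℝ) : EReal)) atTop (𝓝 σ)) :
    Small (fun n => ann d (r n) (w n)) T u := by
  refine small_of_approx hu fun ε hε => ?_
  obtain ⟨ψ, k, hψ, hk, hle⟩ := exists_approx hu hE hε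
  obtain ⟨p, hp, H⟩ := exists_period hu hψ hT hw h
  exact ⟨Fa u ψ k, hu.av (hk.wt hψ.1), small_of_translate hu hψ.1 hp H hk, hle⟩

theorem tendsto_iSup_annuli (hu : Wave u)
    (hE : ∀ s t, ∫ x, eDenFree u x s = ∫ x, eDenFree u x t) {ℓ : ℝ → ℝ}
    (hℓ : Tendsto (fun t => ℓ t / Real.log t) atTop (𝓝 0)) :
    Tendsto (fun t => ⨆ r : Ici (0 : ℝ), ∫ x in ann d r (ℓ t), eDenFree u x t) atTop (𝓝 0) := by
  refine tendsto_order.2 ⟨fun a ha => Eventually.of_forall fun t =>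
    ha.trans_le (Real.iSup_nonneg fun r => integral_nonneg fun _ => eDen_nonneg), fun ε hε => ?_⟩
  by_contra hcon
  obtain ⟨T, hT, hTε⟩ := exists_seq_forall_of_frequently (not_eventually.1 hcon)
  have hr : ∀ n, ∃ r : Ici (0 : ℝ), ε / 2 < ∫ x in ann d r (ℓ (T n)), eDenFree u x (T n) :=
    fun n => exists_lt_of_lt_ciSup ((half_lt_self hε).trans_le (not_lt.1 (hTε n)))
  choose r hr using hr
  obtain ⟨σ, φ, hφ, hσ⟩ := CompactSpace.tendsto_subseq
    (fun n => (((T n - r n) / Real.log (T n) : ℝ) : EReal))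
  have hTφ := hT.comp hφ.tendsto_atTop
  have := small_annuli (T := T ∘ φ) (r := fun n => r (φ n)) (w := fun n => ℓ (T (φ n))) hu hE hTφ
    (hℓ.comp hTφ) hσ
  obtain ⟨n, hn⟩ := (Tendsto.eventually_lt_const (half_pos hε) this).exists
  exact absurd hn (hr (φ n)).not_gt

end main

end CoulombWave

/-- No energy concentration in thin annuli: for a
finite-energy free Coulomb wave and any `ℓ` with `ℓ(t)/ln t → 0`,
`sup_{r ≥ 0} ∫_{r < |x| < r + ℓ(t)} e(x,t) dx → 0` as `t → +∞`. -/
theorem stmt19 (d : ℕ) (hd : 3 ≤ d)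
    (u : EuclideanSpace ℝ (Fin d) → ℝ → ℝ) (E : ℝ)
    (hu : IsFreeCoulombWave u E)
    (ℓ : ℝ → ℝ) (hℓpos : ∀ t : ℝ, 0 < t → 0 < ℓ t)
    (hℓ : Tendsto (fun t => ℓ t / Real.log t) atTop (nhds 0)) :
    Tendsto (fun t : ℝ =>
        ⨆ r : Set.Ici (0 : ℝ),
          ∫ x in {x : EuclideanSpace ℝ (Fin d) |
              (r : ℝ) < ‖x‖ ∧ ‖x‖ < (r : ℝ) + ℓ t},
            eDenFree u x t)
      atTop (nhds 0) := by
  have : Fact (3 ≤ d) := ⟨hd⟩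
  exact CoulombWave.tendsto_iSup_annuli (CoulombWave.Wave.of_isFree hu)
    (fun s t => (hu.2.2.2.2 s).trans (hu.2.2.2.2 t).symm) hℓ
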